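/- For every real ε ≠ 0 there exists a constant C_ε > 0 such that for every measurable function u : ℝ → ℝ and every Schwartz function f : ℝ² → ℂ, the Hilbert transform along the variable odd curves, H_ε^u f(x₁, x₂) := p.v. ∫_ℝ f(x₁ − t, x₂ − u(x₁)·sgn(t)·|t|^ε) dt/t, satisfies ‖H_ε^u f‖_{L²(ℝ²)} ≤ C_ε ‖f‖_{L²(ℝ²)}. In particular the constant is independent of u. -/

import Mathlib

section
open MeasureTheory Filter Set
open scoped ENNReal Topology

/-! ### Grid -/
noncomputable def sc (k : ℤ) : ℝ := (64:ℝ) ^ k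
noncomputable def idx (k : ℤ) (x : ℝ) : ℤ := ⌊x / sc k⌋
noncomputable def nix (k : ℤ) (ξ : ℝ) : ℤ := ⌊ξ * sc k⌋
def iv (k m : ℤ) : Set ℝ := {x | idx k x = m}

lemma sc_pos (k : ℤ) : 0 < sc k := by unfold sc; positivity
lemma sc_succ (k : ℤ) : sc (k+1) = 64 * sc k := by
  unfold sc; rw [zpow_add_one₀ (by norm_num)]; ring
lemma sc_pred (k : ℤ) : sc k = 64 * sc (k-1) := by
  rw [← sc_succ]; simp
lemma sc_mono {j k : ℤ} (h : j ≤ k) : sc j ≤ sc k := by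
  unfold sc; exact zpow_le_zpow_right₀ (by norm_num) h
lemma sc_lt {j k : ℤ} (h : j < k) : 64 * sc j ≤ sc k := by
  rw [← sc_succ]; exact sc_mono h
lemma sc_eq_mul {j k : ℤ} (h : j ≤ k) : sc k = (64:ℝ)^(k-j).toNat * sc j := by
  unfold sc
  rw [← zpow_natCast, ← zpow_add₀ (by norm_num)]
  congr 1; omega

lemma idx_iff {k : ℤ} {x : ℝ} {m : ℤ} : idx k x = m ↔ m * sc k ≤ x ∧ x < (m+1) * sc k := by
  have := sc_pos k
  unfold idx
  rw [Int.floor_eq_iff, le_div_iff₀ this, div_lt_iff₀ this]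
lemma nix_iff {k : ℤ} {x : ℝ} {m : ℤ} : nix k x = m ↔ m / sc k ≤ x ∧ x < (m+1) / sc k := by
  have := sc_pos k
  unfold nix
  rw [Int.floor_eq_iff, lt_div_iff₀ this, div_le_iff₀ this]

lemma idx_eq_div {j k : ℤ} (h : j ≤ k) (x : ℝ) : idx k x = idx j x / (64:ℤ)^(k-j).toNat := by
  unfold idx
  have := sc_pos j
  rw [sc_eq_mul h]
  have h1 : x / ((64:ℝ)^(k-j).toNat * sc j) = (x / sc j) / ((64^(k-j).toNat : ℕ) : ℝ) := by
    push_cast; field_simp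
  rw [h1, Int.floor_div_natCast]; norm_cast
lemma nix_eq_div {j k : ℤ} (h : j ≤ k) (x : ℝ) : nix j x = nix k x / (64:ℤ)^(k-j).toNat := by
  unfold nix
  have := sc_pos j
  rw [sc_eq_mul h]
  have h1 : x * sc j = (x * ((64:ℝ)^(k-j).toNat * sc j)) / ((64^(k-j).toNat : ℕ) : ℝ) := by
    push_cast; field_simp
  rw [h1, Int.floor_div_natCast]; norm_cast
lemma idx_up {j k : ℤ} (h : j ≤ k) {x y : ℝ} (e : idx j x = idx j y) : idx k x = idx k y := by
  rw [idx_eq_div h, idx_eq_div h, e]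
lemma nix_down {j k : ℤ} (h : j ≤ k) {x y : ℝ} (e : nix k x = nix k y) : nix j x = nix j y := by
  rw [nix_eq_div h, nix_eq_div h, e]
lemma iv_eq (k m : ℤ) : iv k m = Ico (m * sc k) ((m+1) * sc k) := by
  ext x; simp [iv, idx_iff]
lemma mem_iv {k m : ℤ} {x : ℝ} : x ∈ iv k m ↔ idx k x = m := Iff.rfl
lemma measurableSet_iv (k m : ℤ) : MeasurableSet (iv k m) := by
  rw [iv_eq]; exact measurableSet_Ico
lemma volume_iv (k m : ℤ) : volume (iv k m) = ENNReal.ofReal (sc k) := by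
  rw [iv_eq, Real.volume_Ico]; congr 1; ring
lemma measurable_idx (k : ℤ) : Measurable (idx k) := by
  unfold idx; exact Int.measurable_floor.comp (measurable_id.div_const _)
lemma measurable_nix (k : ℤ) : Measurable (nix k) := by
  unfold nix; exact Int.measurable_floor.comp (measurable_id.mul_const _)
lemma left_mem_iv (k m : ℤ) : (m * sc k) ∈ iv k m := by
  rw [mem_iv, idx_iff]; have := sc_pos k; constructor <;> nlinarith
lemma nonempty_iv (k m : ℤ) : (iv k m).Nonempty := ⟨_, left_mem_iv k m⟩
lemma iv_subset_iff_of {j k m n : ℤ} (h : j ≤ k) {x : ℝ} (hx : x ∈ iv j m) :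
    iv j m ⊆ iv k n ↔ idx k x = n := by
  constructor
  · intro hs; exact hs hx
  · rintro rfl y hy
    exact idx_up h ((mem_iv.1 hy).trans (mem_iv.1 hx).symm)
lemma iv_idx_subset {j k : ℤ} (h : j ≤ k) (x : ℝ) : iv j (idx j x) ⊆ iv k (idx k x) :=
  (iv_subset_iff_of h (x := x) rfl).2 rfl
lemma le_of_iv_subset {j k m n : ℤ} (h : iv j m ⊆ iv k n) : j ≤ k := by
  have := measure_mono (μ := volume) h
  rw [volume_iv, volume_iv, ENNReal.ofReal_le_ofReal_iff (sc_pos k).le] at this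
  by_contra hc
  have := sc_lt (not_le.1 hc)
  have := sc_pos k
  linarith
lemma sum_geom_sc (a k : ℤ) : ∑ j ∈ Finset.Ico a k, sc j ≤ sc k / 63 := by
  rcases le_or_gt a k with h | h
  · induction k, h using Int.leInduction with
    | base => have := (sc_pos a).le; simp; positivity
    | succ n hn ih =>
      have : Finset.Ico a (n+1) = insert n (Finset.Ico a n) := by
        ext j; simp only [Finset.mem_Ico, Finset.mem_insert]; omega
      rw [this, Finset.sum_insert (by simp), sc_succ]; linarith
  · rw [Finset.Ico_eq_empty (by omega)]; simp; have := sc_pos k; positivity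
lemma sum_geom_inv (k b : ℤ) : ∑ j ∈ Finset.Icc k b, (sc j)⁻¹ ≤ (64/63) * (sc k)⁻¹ - (1/63) * (sc b)⁻¹ ∨ b < k := by
  rcases le_or_gt k b with h | h
  · left
    induction b, h using Int.leInduction with
    | base => simp; linarith
    | succ n hn ih =>
      have : Finset.Icc k (n+1) = insert (n+1) (Finset.Icc k n) := by
        ext j; simp only [Finset.mem_Icc, Finset.mem_insert]; omega
      rw [this, Finset.sum_insert (by simp), sc_succ, mul_inv]
      linarith
  · exact Or.inr h
lemma sum_geom_inv' (k b : ℤ) : ∑ j ∈ Finset.Icc k b, (sc j)⁻¹ ≤ 2 * (sc k)⁻¹ := by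
  have h1 := inv_pos.2 (sc_pos k)
  have h2 := inv_pos.2 (sc_pos b)
  rcases sum_geom_inv k b with h | h
  · linarith
  · rw [Finset.Icc_eq_empty (by omega)]; simp only [Finset.sum_empty]; positivity
end

section
open MeasureTheory Filter Set
open scoped ENNReal Topology

structure Stop (I : Finset (ℤ × ℤ)) (γ g g' : ℤ → ℝ → ℂ) (F : ℤ × ℤ → ℝ) (E : ℝ) (a K0 M0 : ℤ) : Prop where
  mem : ∀ s ∈ I, a ≤ s.1 ∧ iv s.1 s.2 ⊆ iv K0 M0
  up : ∀ x j k, (j, idx j x) ∈ I → j ≤ k → k ≤ K0 → (k, idx k x) ∈ I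
  dγ : ∀ k x, HasDerivAt (γ k) (g k x) x
  dg : ∀ k x, HasDerivAt (g k) (g' k x) x
  cg' : ∀ k, Continuous (g' k)
  bd : ∀ s ∈ I, ∀ x ∈ Icc (s.2 * sc s.1) ((s.2+1) * sc s.1),
    ‖g s.1 x‖ ≤ F s ∧ ‖g' s.1 x‖ ≤ F s / sc s.1 ∧ ‖γ s.1 x‖ ≤ F s * sc s.1
  F0 : ∀ s ∈ I, 0 ≤ F s
  FE : ∀ s ∈ I, F s ≤ E
  car : ∑ s ∈ I, sc s.1 * F s ^ 2 ≤ E ^ 2 * sc K0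

noncomputable def GS (g : ℤ → ℝ → ℂ) (K0 k : ℤ) (x : ℝ) : ℂ := ∑ j ∈ Finset.Icc k K0, g j x

lemma GS_succ (g : ℤ → ℝ → ℂ) {K0 k : ℤ} (h : k ≤ K0) (x : ℝ) :
    GS g K0 k x = GS g K0 (k+1) x + g k x := by
  unfold GS
  have : Finset.Icc k K0 = insert k (Finset.Icc (k+1) K0) := by
    ext j; simp only [Finset.mem_Icc, Finset.mem_insert]; omega
  rw [this, Finset.sum_insert (by simp), add_comm]

lemma iv_bounds {k m K0 M0 : ℤ} (h : iv k m ⊆ iv K0 M0) :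
    M0 * sc K0 ≤ m * sc k ∧ (m+1) * sc k ≤ (M0+1) * sc K0 ∧ sc k ≤ sc K0 := by
  have hk := sc_pos k
  rw [iv_eq, iv_eq] at h
  have h2 := (Ico_subset_Ico_iff (by nlinarith)).1 h
  refine ⟨h2.1, h2.2, ?_⟩
  nlinarith

lemma pairwise_vol {S : Finset (ℤ × ℤ)} {R : ℤ × ℤ → Set ℝ} {K0 M0 : ℤ}
    (hm : ∀ s, MeasurableSet (R s))
    (hd : (S : Set (ℤ × ℤ)).PairwiseDisjoint R)
    (hsub : ∀ s ∈ S, R s ⊆ Ico ((M0-1) * sc K0) ((M0+2) * sc K0))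
    (hv : ∀ s, volume (R s) = ENNReal.ofReal (63/64 * sc s.1)) :
    ∑ s ∈ S, sc s.1 ≤ 4 * sc K0 := by
  have h1 : volume (⋃ s ∈ S, R s) = ∑ s ∈ S, volume (R s) :=
    measure_biUnion_finset hd (fun s _ => hm s)
  have h2 : volume (⋃ s ∈ S, R s) ≤ volume (Ico ((M0-1) * sc K0) ((M0+2) * sc K0)) :=
    measure_mono (iUnion₂_subset hsub)
  rw [h1, Real.volume_Ico, Finset.sum_congr rfl (fun s _ => hv s),
    ← ENNReal.ofReal_sum_of_nonneg (fun s _ => by have := sc_pos s.1; positivity),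
    ENNReal.ofReal_le_ofReal_iff (by have := sc_pos K0; nlinarith), ← Finset.mul_sum] at h2
  have := sc_pos K0
  linarith

variable {I : Finset (ℤ × ℤ)} {γ g g' : ℤ → ℝ → ℂ} {F : ℤ × ℤ → ℝ} {E : ℝ} {a K0 M0 : ℤ}

lemma bdry_plus (hmem : ∀ s ∈ I, iv s.1 s.2 ⊆ iv K0 M0)
    (hup : ∀ x j k, (j, idx j x) ∈ I → j ≤ k → k ≤ K0 → (k, idx k x) ∈ I) :
    ∑ s ∈ I.filter (fun s => (s.1, s.2+1) ∉ I), sc s.1 ≤ 4 * sc K0 := by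
  refine pairwise_vol (M0 := M0)
    (R := fun s => Ico ((s.2+1) * sc s.1 + sc (s.1-1)) ((s.2+2) * sc s.1))
    (fun _ => measurableSet_Ico) ?_ ?_ ?_
  · have key : ∀ s ∈ I.filter (fun s => (s.1, s.2+1) ∉ I), ∀ s' ∈ I.filter (fun s => (s.1, s.2+1) ∉ I),
        s'.1 < s.1 → ∀ x, x ∈ Ico ((s.2+1) * sc s.1 + sc (s.1-1)) ((s.2+2) * sc s.1) →
        x ∈ Ico ((s'.2+1) * sc s'.1 + sc (s'.1-1)) ((s'.2+2) * sc s'.1) → False := by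
      rintro ⟨k, m⟩ hs ⟨k', m'⟩ hs' hlt x ⟨h1, h2⟩ ⟨h3, h4⟩
      simp only [Finset.mem_filter] at hs hs' hlt h1 h2 h3 h4
      have hp := sc_pos (k'-1)
      have hp' := sc_pos k'
      have e1 : idx k' (x - sc k') = m' := by rw [idx_iff]; constructor <;> linarith
      have e2 : idx k (x - sc k') = m+1 := by
        have := sc_mono (show k' ≤ k-1 by omega)
        rw [idx_iff]; push_cast; constructor <;> linarith
      have := hup (x - sc k') k' k (by rw [e1]; exact hs'.1) hlt.le (le_of_iv_subset (hmem _ hs.1))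
      rw [e2] at this
      exact hs.2 this
    intro s hs s' hs' hne
    rw [Function.onFun, Set.disjoint_left]
    intro x hx hx'
    rcases lt_trichotomy s.1 s'.1 with h | h | h
    · exact key s' hs' s hs h x hx' hx
    · obtain ⟨k, m⟩ := s
      obtain ⟨k', m'⟩ := s'
      simp only at h; subst h
      have hp := sc_pos (k-1)
      apply hne
      have e1 : idx k x = m+1 := by
        rw [idx_iff]; push_cast; simp only [mem_Ico] at hx; constructor <;> linarith [hx.1, hx.2]
      have e2 : idx k x = m'+1 := by
        rw [idx_iff]; push_cast; simp only [mem_Ico] at hx'; constructor <;> linarith [hx'.1, hx'.2]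
      have : m = m' := by omega
      rw [this]
    · exact key s hs s' hs' h x hx hx'
  · rintro ⟨k, m⟩ hs x ⟨h1, h2⟩
    have := iv_bounds (hmem _ (Finset.mem_filter.1 hs).1)
    simp only at this h1 h2
    have hp := sc_pos (k-1)
    have := sc_pos k
    constructor <;> linarith
  · intro s
    rw [Real.volume_Ico]; congr 1; rw [sc_pred s.1]; ring

lemma bdry_minus (hmem : ∀ s ∈ I, iv s.1 s.2 ⊆ iv K0 M0)
    (hup : ∀ x j k, (j, idx j x) ∈ I → j ≤ k → k ≤ K0 → (k, idx k x) ∈ I) :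
    ∑ s ∈ I.filter (fun s => (s.1, s.2-1) ∉ I), sc s.1 ≤ 4 * sc K0 := by
  refine pairwise_vol (M0 := M0)
    (R := fun s => Ico ((s.2-1) * sc s.1) (s.2 * sc s.1 - sc (s.1-1)))
    (fun _ => measurableSet_Ico) ?_ ?_ ?_
  · have key : ∀ s ∈ I.filter (fun s => (s.1, s.2-1) ∉ I), ∀ s' ∈ I.filter (fun s => (s.1, s.2-1) ∉ I),
        s'.1 < s.1 → ∀ x, x ∈ Ico ((s.2-1) * sc s.1) (s.2 * sc s.1 - sc (s.1-1)) →
        x ∈ Ico ((s'.2-1) * sc s'.1) (s'.2 * sc s'.1 - sc (s'.1-1)) → False := by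
      rintro ⟨k, m⟩ hs ⟨k', m'⟩ hs' hlt x ⟨h1, h2⟩ ⟨h3, h4⟩
      simp only [Finset.mem_filter] at hs hs' hlt h1 h2 h3 h4
      have hp := sc_pos (k'-1)
      have hp' := sc_pos k'
      have e1 : idx k' (x + sc k') = m' := by rw [idx_iff]; constructor <;> linarith
      have e2 : idx k (x + sc k') = m-1 := by
        have := sc_mono (show k' ≤ k-1 by omega)
        rw [idx_iff]; push_cast; constructor <;> linarith
      have := hup (x + sc k') k' k (by rw [e1]; exact hs'.1) hlt.le (le_of_iv_subset (hmem _ hs.1))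
      rw [e2] at this
      exact hs.2 this
    intro s hs s' hs' hne
    rw [Function.onFun, Set.disjoint_left]
    intro x hx hx'
    rcases lt_trichotomy s.1 s'.1 with h | h | h
    · exact key s' hs' s hs h x hx' hx
    · obtain ⟨k, m⟩ := s
      obtain ⟨k', m'⟩ := s'
      simp only at h; subst h
      have hp := sc_pos (k-1)
      apply hne
      have e1 : idx k x = m-1 := by
        rw [idx_iff]; push_cast; simp only [mem_Ico] at hx; constructor <;> linarith [hx.1, hx.2]
      have e2 : idx k x = m'-1 := by
        rw [idx_iff]; push_cast; simp only [mem_Ico] at hx'; constructor <;> linarith [hx'.1, hx'.2]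
      have : m = m' := by omega
      rw [this]
    · exact key s hs s' hs' h x hx hx'
  · rintro ⟨k, m⟩ hs x ⟨h1, h2⟩
    have := iv_bounds (hmem _ (Finset.mem_filter.1 hs).1)
    simp only at this h1 h2
    have hp := sc_pos (k-1)
    have := sc_pos k
    constructor <;> linarith
  · intro s
    rw [Real.volume_Ico]; congr 1; rw [sc_pred s.1]; ring

/-- discrete summation by parts -/
lemma sum_tele (S : Finset (ℤ × ℤ)) (h : ℤ × ℤ → ℝ) :
    ∑ s ∈ S, (h (s.1, s.2+1) - h s) =
      ∑ s ∈ S.filter (fun s => (s.1, s.2+1) ∉ S), h (s.1, s.2+1)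
        - ∑ s ∈ S.filter (fun s => (s.1, s.2-1) ∉ S), h s := by
  rw [Finset.sum_sub_distrib, ← Finset.sum_filter_add_sum_filter_not S (fun s => (s.1, s.2+1) ∉ S) (fun s => h (s.1, s.2+1)),
    ← Finset.sum_filter_add_sum_filter_not S (fun s => (s.1, s.2-1) ∉ S) h]
  have : ∑ s ∈ S.filter (fun s => ¬ ((s.1, s.2+1) ∉ S)), h (s.1, s.2+1) = ∑ s ∈ S.filter (fun s => ¬ ((s.1, s.2-1) ∉ S)), h s := by
    refine Finset.sum_nbij' (fun s => (s.1, s.2+1)) (fun s => (s.1, s.2-1)) ?_ ?_ ?_ ?_ ?_ <;> simp +contextual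
  rw [this]; ring
end

section
open MeasureTheory Filter Set
open scoped ENNReal Topology

variable {I : Finset (ℤ × ℤ)} {γ g g' : ℤ → ℝ → ℂ} {F : ℤ × ℤ → ℝ} {E : ℝ} {a K0 M0 : ℤ}

lemma integral_level (hmem : ∀ s ∈ I, iv s.1 s.2 ⊆ iv K0 M0) (k : ℤ) {φ : ℝ → ℝ}
    (hφ : ∀ m, (k, m) ∈ I → IntegrableOn φ (iv k m)) :
    IntegrableOn (fun x => if (k, idx k x) ∈ I then φ x else 0) (iv K0 M0) ∧
    ∫ x in iv K0 M0, (if (k, idx k x) ∈ I then φ x else 0) =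
      ∑ s ∈ I.filter (fun s => s.1 = k), ∫ x in iv s.1 s.2, φ x := by
  have h1 : (fun x => if (k, idx k x) ∈ I then φ x else 0) =
      fun x => ∑ s ∈ I.filter (fun s => s.1 = k), (iv s.1 s.2).indicator φ x := by
    ext x
    split_ifs with h
    · rw [Finset.sum_eq_single (k, idx k x)]
      · simp [mem_iv]
      · rintro ⟨j, m⟩ hs hne
        simp only [Finset.mem_filter] at hs
        obtain ⟨_, rfl⟩ := hs
        rw [indicator_of_notMem]
        intro hx
        rw [mem_iv] at hx; simp only at hx
        exact hne (by rw [hx])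
      · simp [h]
    · symm; apply Finset.sum_eq_zero
      rintro ⟨j, m⟩ hs
      simp only [Finset.mem_filter] at hs
      obtain ⟨hs, rfl⟩ := hs
      rw [indicator_of_notMem]
      intro hx
      rw [mem_iv] at hx; simp only at hx
      rw [hx] at h; exact h hs
  have h2 : ∀ s ∈ I.filter (fun s => s.1 = k), IntegrableOn ((iv s.1 s.2).indicator φ) (iv K0 M0) := by
    rintro ⟨j, m⟩ hs
    simp only [Finset.mem_filter] at hs
    obtain ⟨hs, rfl⟩ := hs
    rw [IntegrableOn, integrable_indicator_iff (measurableSet_iv _ _), IntegrableOn,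
      Measure.restrict_restrict (measurableSet_iv _ _), inter_eq_left.2 (hmem _ hs)]
    exact hφ m hs
  rw [h1]
  refine ⟨integrable_finsetSum _ h2, ?_⟩
  rw [integral_finsetSum _ h2]
  apply Finset.sum_congr rfl
  intro s hs
  rw [integral_indicator (measurableSet_iv _ _), Measure.restrict_restrict (measurableSet_iv _ _),
    inter_eq_left.2 (hmem _ (Finset.mem_filter.1 hs).1)]

lemma iv_integral (k m : ℤ) (φ : ℝ → ℝ) :
    ∫ x in iv k m, φ x = ∫ x in (m * sc k)..((m+1) * sc k), φ x := by
  rw [iv_eq, integral_Ico_eq_integral_Ioo, ← integral_Ioc_eq_integral_Ioo,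
    intervalIntegral.integral_of_le (by have := sc_pos k; nlinarith)]

lemma Continuous.intOn_iv {φ : ℝ → ℝ} (h : Continuous φ) (k m : ℤ) : IntegrableOn φ (iv k m) := by
  rw [iv_eq]
  exact (h.continuousOn.integrableOn_Icc).mono_set Ico_subset_Icc_self

lemma iv_mem_Icc {k m : ℤ} {x : ℝ} (h : x ∈ iv k m) : x ∈ Icc (m * sc k) ((m+1) * sc k) := by
  rw [iv_eq] at h; exact Ico_subset_Icc_self h

lemma schur (c : ℤ → ℝ) (a K0 : ℤ) :
    ∑ k ∈ Finset.Icc a K0, (c k ^ 2 + 2 * (∑ j ∈ Finset.Icc (k+1) K0, c j / sc j) * (c k * sc k))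
      ≤ 2 * ∑ k ∈ Finset.Icc a K0, c k ^ 2 := by
  have h1 : ∀ k ∈ Finset.Icc a K0, 2 * (∑ j ∈ Finset.Icc (k+1) K0, c j / sc j) * (c k * sc k) ≤
      c k ^ 2 * (1/8) + ∑ j ∈ Finset.Icc (k+1) K0, c j ^ 2 * (sc k / sc j) := by
    intro k _
    have hk := sc_pos k
    have e : ∑ j ∈ Finset.Icc (k+1) K0, (sc k / sc j) ≤ 1/8 := by
      have := sum_geom_inv' (k+1) K0
      rw [sc_succ, mul_inv] at this
      simp_rw [div_eq_mul_inv]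
      rw [← Finset.mul_sum]
      calc _ ≤ sc k * (2 * (64⁻¹ * (sc k)⁻¹)) := by gcongr
        _ = 2 * 64⁻¹ := by field_simp
        _ ≤ _ := by norm_num
    calc 2 * (∑ j ∈ Finset.Icc (k+1) K0, c j / sc j) * (c k * sc k)
        = ∑ j ∈ Finset.Icc (k+1) K0, (2 * c j * c k) * (sc k / sc j) := by
          rw [Finset.mul_sum, Finset.sum_mul]
          exact Finset.sum_congr rfl fun j _ => by ring
      _ ≤ ∑ j ∈ Finset.Icc (k+1) K0, (c k ^ 2 + c j ^ 2) * (sc k / sc j) := by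
          refine Finset.sum_le_sum fun j _ => ?_
          have := sc_pos j
          gcongr; nlinarith [sq_nonneg (c j - c k)]
      _ = c k ^ 2 * ∑ j ∈ Finset.Icc (k+1) K0, (sc k / sc j) + ∑ j ∈ Finset.Icc (k+1) K0, c j ^ 2 * (sc k / sc j) := by
          rw [Finset.mul_sum, ← Finset.sum_add_distrib]
          exact Finset.sum_congr rfl fun j _ => by ring
      _ ≤ _ := by gcongr
  have h2 : ∑ k ∈ Finset.Icc a K0, ∑ j ∈ Finset.Icc (k+1) K0, c j ^ 2 * (sc k / sc j) ≤
      ∑ j ∈ Finset.Icc a K0, c j ^ 2 * (1/8) := by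
    rw [Finset.sum_comm' (t' := Finset.Icc a K0) (s' := fun j => Finset.Ico a j)]
    · refine Finset.sum_le_sum fun j _ => ?_
      rw [← Finset.mul_sum, ← Finset.sum_div]
      have := sc_pos j
      have e : (∑ k ∈ Finset.Ico a j, sc k) / sc j ≤ 1/8 := by
        rw [div_le_iff₀ this]
        linarith [sum_geom_sc a j]
      gcongr
    · intro k j; simp only [Finset.mem_Icc, Finset.mem_Ico]; omega
  rw [Finset.sum_add_distrib]
  have h3 := Finset.sum_le_sum h1
  rw [Finset.sum_add_distrib, ← Finset.sum_mul] at h3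
  rw [← Finset.sum_mul] at h2
  have : 0 ≤ ∑ k ∈ Finset.Icc a K0, c k ^ 2 := Finset.sum_nonneg fun _ _ => sq_nonneg _
  linarith

namespace Stop
variable (h : Stop I γ g g' F E a K0 M0)
include h

lemma cg (k : ℤ) : Continuous (g k) :=
  continuous_iff_continuousAt.2 fun x => (h.dg k x).continuousAt
lemma cγ (k : ℤ) : Continuous (γ k) :=
  continuous_iff_continuousAt.2 fun x => (h.dγ k x).continuousAt
lemma cG (k : ℤ) : Continuous (GS g K0 k) := by
  unfold GS; exact continuous_finsetSum _ fun j _ => h.cg j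
lemma cG' (k : ℤ) : Continuous (GS g' K0 k) := by
  unfold GS; exact continuous_finsetSum _ fun j _ => h.cg' j
lemma dG (k : ℤ) (x : ℝ) : HasDerivAt (GS g K0 k) (GS g' K0 k x) x := by
  have := HasDerivAt.sum (u := Finset.Icc k K0) (A := g) (A' := fun j => g' j x) (x := x) (fun j _ => h.dg j x)
  have e : GS g K0 k = ∑ j ∈ Finset.Icc k K0, g j := by ext x; simp [GS]
  rw [e]; exact this

/-- energy on one interval -/
lemma one_iv {s : ℤ × ℤ} (hs : s ∈ I) :
    ∫ x in iv s.1 s.2, (‖GS g K0 s.1 x‖^2 - ‖GS g K0 (s.1+1) x‖^2) =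
     2 * inner ℝ (GS g K0 (s.1+1) ((s.2+1) * sc s.1)) (γ s.1 ((s.2+1) * sc s.1))
      - 2 * inner ℝ (GS g K0 (s.1+1) (s.2 * sc s.1)) (γ s.1 (s.2 * sc s.1))
      + ∫ x in iv s.1 s.2, (‖g s.1 x‖^2 - 2 * inner ℝ (GS g' K0 (s.1+1) x) (γ s.1 x)) := by
  have hk : s.1 ≤ K0 := le_of_iv_subset (h.mem s hs).2
  rw [iv_integral, iv_integral]
  have c1 := h.cG (s.1+1)
  have c2 := h.cG' (s.1+1)
  have c3 := h.cγ s.1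
  have c4 := h.cg s.1
  have c5 : Continuous fun x => inner ℝ (GS g K0 (s.1+1) x) (g s.1 x) := c1.inner c4
  have c6 : Continuous fun x => inner ℝ (GS g' K0 (s.1+1) x) (γ s.1 x) := c2.inner c3
  have hd : ∀ x ∈ uIcc (s.2 * sc s.1) ((s.2+1) * sc s.1),
      HasDerivAt (fun x => inner ℝ (GS g K0 (s.1+1) x) (γ s.1 x))
        (inner ℝ (GS g K0 (s.1+1) x) (g s.1 x) + inner ℝ (GS g' K0 (s.1+1) x) (γ s.1 x)) x :=
    fun x _ => (h.dG (s.1+1) x).inner ℝ (h.dγ s.1 x)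
  have := intervalIntegral.integral_eq_sub_of_hasDerivAt hd ((c5.add c6).intervalIntegrable _ _)
  rw [← mul_sub, ← this, ← intervalIntegral.integral_const_mul, ← intervalIntegral.integral_add
    (Continuous.intervalIntegrable (by fun_prop) _ _)
    (Continuous.intervalIntegrable (by fun_prop) _ _)]
  congr 1; ext x
  rw [GS_succ g hk x, @norm_add_sq_real]; ring

lemma FGS' {s : ℤ × ℤ} (hs : s ∈ I) {x : ℝ} (hx : x ∈ iv s.1 s.2) :
    ‖GS g' K0 (s.1+1) x‖ ≤ ∑ j ∈ Finset.Icc (s.1+1) K0, F (j, idx j x) / sc j := by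
  refine (norm_sum_le _ _).trans (Finset.sum_le_sum fun j hj => ?_)
  rw [Finset.mem_Icc] at hj
  have : (j, idx j x) ∈ I := h.up x s.1 j (by rw [mem_iv.1 hx]; exact hs) (by omega) hj.2
  exact (h.bd _ this x (iv_mem_Icc (mem_iv.2 rfl))).2.1


lemma l2 (hE : 0 ≤ E) {lam : ℝ} (hl0 : 0 ≤ lam)
    (hl : ∀ s ∈ I, ∀ x ∈ Icc (s.2 * sc s.1) ((s.2+1) * sc s.1), ‖GS g K0 (s.1+1) x‖ ≤ lam) :
    ∫ x in iv K0 M0, ∑ k ∈ Finset.Icc a K0,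
      (if (k, idx k x) ∈ I then ‖GS g K0 k x‖^2 - ‖GS g K0 (k+1) x‖^2 else 0)
      ≤ (2 * E^2 + 16 * lam * E) * sc K0 := by
  have hmem := fun s hs => (h.mem s hs).2
  have hIcc : ∀ s ∈ I, s.1 ∈ Finset.Icc a K0 := fun s hs =>
    Finset.mem_Icc.2 ⟨(h.mem s hs).1, le_of_iv_subset (hmem s hs)⟩
  have c0 : ∀ k, Continuous fun x => ‖GS g K0 k x‖^2 - ‖GS g K0 (k+1) x‖^2 := fun k => by
    have := h.cG k; have := h.cG (k+1); fun_prop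
  have c1 : ∀ k, Continuous fun x => ‖g k x‖^2 - 2 * inner ℝ (GS g' K0 (k+1) x) (γ k x) := fun k => by
    have h1 := h.cG' (k+1); have h2 := h.cg k; have h3 := h.cγ k
    have := h1.inner (𝕜 := ℝ) h3
    fun_prop
  have i0 := fun k => integral_level hmem k (fun m _ => (c0 k).intOn_iv k m)
  have i1 := fun k => integral_level hmem k (fun m _ => (c1 k).intOn_iv k m)
  have i2 := fun k => integral_level hmem k (φ := fun x => F (k, idx k x) ^ 2) (fun m _ => by
    refine IntegrableOn.congr_fun (f := fun _ => F (k, m)^2) ?_ ?_ (measurableSet_iv _ _)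
    · simp [volume_iv]
    · intro x hx; simp only; rw [mem_iv.1 hx])
  rw [integral_finsetSum _ (fun k _ => (i0 k).1), Finset.sum_congr rfl (fun k _ => (i0 k).2)]
  have e1 : ∀ φ : ℤ × ℤ → ℝ, ∑ k ∈ Finset.Icc a K0, ∑ s ∈ I.filter (fun s => s.1 = k), φ s = ∑ s ∈ I, φ s :=
    fun φ => Finset.sum_fiberwise_of_maps_to hIcc φ
  have e2 : ∑ k ∈ Finset.Icc a K0, ∑ s ∈ I.filter (fun s => s.1 = k),
      ∫ x in iv s.1 s.2, (‖GS g K0 k x‖^2 - ‖GS g K0 (k+1) x‖^2) =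
      ∑ s ∈ I, ∫ x in iv s.1 s.2, (‖GS g K0 s.1 x‖^2 - ‖GS g K0 (s.1+1) x‖^2) := by
    rw [← e1]
    refine Finset.sum_congr rfl fun k _ => Finset.sum_congr rfl fun s hs => ?_
    rw [(Finset.mem_filter.1 hs).2]
  rw [e2, Finset.sum_congr rfl (fun s hs => h.one_iv hs), Finset.sum_add_distrib]
  have p1 : ∑ s ∈ I, ∫ x in iv s.1 s.2, (‖g s.1 x‖^2 - 2 * inner ℝ (GS g' K0 (s.1+1) x) (γ s.1 x))
      ≤ 2 * (E^2 * sc K0) := by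
    have e3 : ∑ s ∈ I, ∫ x in iv s.1 s.2, (‖g s.1 x‖^2 - 2 * inner ℝ (GS g' K0 (s.1+1) x) (γ s.1 x)) =
        ∫ x in iv K0 M0, ∑ k ∈ Finset.Icc a K0,
        (if (k, idx k x) ∈ I then ‖g k x‖^2 - 2 * inner ℝ (GS g' K0 (k+1) x) (γ k x) else 0) := by
      rw [integral_finsetSum _ (fun k _ => (i1 k).1), Finset.sum_congr rfl (fun k _ => (i1 k).2), ← e1]
      refine Finset.sum_congr rfl fun k _ => Finset.sum_congr rfl fun s hs => ?_
      rw [(Finset.mem_filter.1 hs).2]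
    have e4 : ∑ s ∈ I, sc s.1 * F s ^ 2 = ∫ x in iv K0 M0, ∑ k ∈ Finset.Icc a K0,
        (if (k, idx k x) ∈ I then F (k, idx k x) ^ 2 else 0) := by
      rw [integral_finsetSum _ (fun k _ => (i2 k).1), Finset.sum_congr rfl (fun k _ => (i2 k).2), ← e1]
      refine Finset.sum_congr rfl fun k _ => Finset.sum_congr rfl fun s hs => ?_
      rw [setIntegral_congr_fun (g := fun _ => F s ^ 2) (measurableSet_iv _ _)]
      · simp [Measure.real, volume_iv, (sc_pos _).le]
      · intro x hx; simp only
        rw [← (Finset.mem_filter.1 hs).2, mem_iv.1 hx]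
    refine le_trans ?_ (mul_le_mul_of_nonneg_left h.car (by norm_num))
    rw [e3, e4, ← integral_const_mul]
    refine integral_mono (integrable_finsetSum _ (fun k _ => (i1 k).1))
      ((integrable_finsetSum _ (fun k _ => (i2 k).1)).const_mul 2) fun x => ?_
    simp only
    set c : ℤ → ℝ := fun k => if (k, idx k x) ∈ I then F (k, idx k x) else 0 with hc
    have := schur c a K0
    have e5 : ∀ k, (if (k, idx k x) ∈ I then F (k, idx k x) ^ 2 else 0) = c k ^ 2 := by
      intro k; simp only [hc]; split_ifs <;> simp
    simp_rw [e5]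
    refine le_trans (Finset.sum_le_sum fun k hk => ?_) this
    by_cases hk' : (k, idx k x) ∈ I
    · have hck : c k = F (k, idx k x) := by simp [hc, hk']
      have b1 := h.bd _ hk' x (iv_mem_Icc (mem_iv.2 rfl))
      have b2 := h.FGS' hk' (x := x) (mem_iv.2 rfl)
      have b3 : ∑ j ∈ Finset.Icc (k+1) K0, F (j, idx j x) / sc j = ∑ j ∈ Finset.Icc (k+1) K0, c j / sc j := by
        refine Finset.sum_congr rfl fun j hj => ?_
        rw [Finset.mem_Icc] at hj
        simp [hc, h.up x k j hk' (by omega) hj.2]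
      simp only at b1 b2
      rw [b3] at b2
      rw [if_pos hk', hck]
      have b4 := (abs_le.1 (abs_real_inner_le_norm (GS g' K0 (k+1) x) (γ k x))).1
      have b5 : ‖GS g' K0 (k+1) x‖ * ‖γ k x‖ ≤ (∑ j ∈ Finset.Icc (k+1) K0, c j / sc j) * (F (k, idx k x) * sc k) :=
        mul_le_mul b2 b1.2.2 (norm_nonneg _) ((norm_nonneg _).trans b2)
      have b6 : ‖g k x‖^2 ≤ F (k, idx k x)^2 := pow_le_pow_left₀ (norm_nonneg _) b1.1 2
      linarith
    · have hck : c k = 0 := by simp [hc, hk']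
      rw [if_neg hk', hck]; simp
  have p2 : ∑ s ∈ I, (2 * inner ℝ (GS g K0 (s.1+1) ((s.2+1) * sc s.1)) (γ s.1 ((s.2+1) * sc s.1))
      - 2 * inner ℝ (GS g K0 (s.1+1) (s.2 * sc s.1)) (γ s.1 (s.2 * sc s.1))) ≤ 16 * lam * E * sc K0 := by
    have := sum_tele I (fun s => 2 * inner ℝ (GS g K0 (s.1+1) (s.2 * sc s.1)) (γ s.1 (s.2 * sc s.1)))
    push_cast at this
    rw [this]
    have q : ∀ s ∈ I, ∀ x ∈ Icc (s.2 * sc s.1) ((s.2+1) * sc s.1),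
        |2 * inner ℝ (GS g K0 (s.1+1) x) (γ s.1 x)| ≤ 2 * lam * E * sc s.1 := by
      intro s hs x hx
      have q1 := abs_real_inner_le_norm (GS g K0 (s.1+1) x) (γ s.1 x)
      have q2 := hl s hs x hx
      have q3 := (h.bd s hs x hx).2.2
      have q4 : F s * sc s.1 ≤ E * sc s.1 := mul_le_mul_of_nonneg_right (h.FE s hs) (sc_pos _).le
      have q5 := mul_le_mul q2 (q3.trans q4) (norm_nonneg _) hl0
      rw [abs_mul, abs_two]; linarith
    have r1 : ∑ s ∈ I.filter (fun s => (s.1, s.2+1) ∉ I),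
        2 * inner ℝ (GS g K0 (s.1+1) ((s.2+1) * sc s.1)) (γ s.1 ((s.2+1) * sc s.1)) ≤ 2 * lam * E * (4 * sc K0) := by
      refine le_trans (Finset.sum_le_sum (g := fun s => 2 * lam * E * sc s.1) fun s hs => ?_) ?_
      · have := sc_pos s.1
        exact (le_abs_self _).trans (q s (Finset.mem_filter.1 hs).1 _ (by constructor <;> nlinarith))
      · rw [← Finset.mul_sum]
        exact mul_le_mul_of_nonneg_left (bdry_plus hmem h.up) (by positivity)
    have r2 : -∑ s ∈ I.filter (fun s => (s.1, s.2-1) ∉ I),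
        2 * inner ℝ (GS g K0 (s.1+1) (s.2 * sc s.1)) (γ s.1 (s.2 * sc s.1)) ≤ 2 * lam * E * (4 * sc K0) := by
      rw [← Finset.sum_neg_distrib]
      refine le_trans (Finset.sum_le_sum (g := fun s => 2 * lam * E * sc s.1) fun s hs => ?_) ?_
      · have := sc_pos s.1
        exact (neg_le_abs _).trans (q s (Finset.mem_filter.1 hs).1 _ (by constructor <;> nlinarith))
      · rw [← Finset.mul_sum]
        exact mul_le_mul_of_nonneg_left (bdry_minus hmem h.up) (by positivity)
    linarith
  linarith
end Stop
end

section
open MeasureTheory Filter Set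
open scoped ENNReal Topology

variable {I : Finset (ℤ × ℤ)} {γ g g' : ℤ → ℝ → ℂ} {F : ℤ × ℤ → ℝ} {E : ℝ} {a K0 M0 : ℤ}

noncomputable def Zf (I : Finset (ℤ × ℤ)) (g : ℤ → ℝ → ℂ) (a K0 : ℤ) (x : ℝ) : ℝ≥0∞ :=
  (Finset.Icc a K0).sup (fun k => if (k, idx k x) ∈ I then ‖GS g K0 k x‖ₑ else 0)

lemma measurableSet_lvl (I : Finset (ℤ × ℤ)) (k : ℤ) : MeasurableSet {x | (k, idx k x) ∈ I} :=
  (measurable_const.prodMk (measurable_idx k)) (I.measurableSet)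

lemma measurable_Zf (hg : ∀ k, Continuous (g k)) : Measurable (Zf I g a K0) := by
  have key : ∀ k, Measurable fun x => (if (k, idx k x) ∈ I then ‖GS g K0 k x‖ₑ else 0) := by
    intro k
    refine Measurable.ite (measurableSet_lvl I k) ?_ measurable_const
    unfold GS
    exact (continuous_finsetSum _ fun j _ => hg j).measurable.enorm
  have : ∀ S : Finset ℤ, Measurable fun x => S.sup (fun k => if (k, idx k x) ∈ I then ‖GS g K0 k x‖ₑ else 0) := by
    intro S
    induction S using Finset.induction_on with
    | empty => simp
    | insert b S _ ih => simp_rw [Finset.sup_insert]; exact (key b).sup ih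
  exact this _

lemma le_Zf {k : ℤ} {x : ℝ} (hk : k ∈ Finset.Icc a K0) (h : (k, idx k x) ∈ I) : ‖GS g K0 k x‖ₑ ≤ Zf I g a K0 x := by
  unfold Zf
  refine le_trans ?_ (Finset.le_sup hk)
  rw [if_pos h]

lemma Icc_anc {k m j n : ℤ} (h : iv k m ⊆ iv j n) {x : ℝ} (hx : x ∈ Icc (m * sc k) ((m+1) * sc k)) :
    x ∈ Icc (n * sc j) ((n+1) * sc j) := by
  have := iv_bounds h
  exact ⟨this.1.trans hx.1, hx.2.trans this.2.1⟩

lemma tele_up (p : ℤ → Prop) [DecidablePred p] (c : ℤ → ℝ) (a K κ : ℤ) (hκ : a ≤ κ) (hK : κ ≤ K)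
    (hp : ∀ k ∈ Finset.Icc a K, (p k ↔ κ ≤ k)) :
    ∑ k ∈ Finset.Icc a K, (if p k then c k - c (k+1) else 0) = c κ - c (K+1) := by
  rw [← Finset.sum_filter]
  have : (Finset.Icc a K).filter p = Finset.Icc κ K := by
    ext k
    simp only [Finset.mem_filter]
    constructor
    · rintro ⟨h1, h2⟩; have := (hp k h1).1 h2; rw [Finset.mem_Icc] at *; omega
    · intro h1; have h2 : k ∈ Finset.Icc a K := by rw [Finset.mem_Icc] at *; omega
      exact ⟨h2, (hp k h2).2 (Finset.mem_Icc.1 h1).1⟩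
  rw [this]
  clear this hp
  induction K, hK using Int.leInduction with
  | base => simp
  | succ n hn ih =>
    have : Finset.Icc κ (n+1) = insert (n+1) (Finset.Icc κ n) := by
      ext j; simp only [Finset.mem_Icc, Finset.mem_insert]; omega
    rw [this, Finset.sum_insert (by simp), ih]; ring

namespace Stop
variable (h : Stop I γ g g' F E a K0 M0)
include h

lemma anc {s : ℤ × ℤ} (hs : s ∈ I) {j : ℤ} (h1 : s.1 ≤ j) (h2 : j ≤ K0) :
    ∃ n, (j, n) ∈ I ∧ iv s.1 s.2 ⊆ iv j n := by
  have hl := left_mem_iv s.1 s.2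
  refine ⟨idx j (s.2 * sc s.1), h.up _ s.1 j (by rw [mem_iv.1 hl]; exact hs) h1 h2, ?_⟩
  exact (iv_subset_iff_of h1 hl).2 rfl

lemma osc (hE : 0 ≤ E) {s : ℤ × ℤ} (hs : s ∈ I) {k : ℤ} (hk : s.1 ≤ k) {x y : ℝ}
    (hx : x ∈ Icc (s.2 * sc s.1) ((s.2+1) * sc s.1)) (hy : y ∈ Icc (s.2 * sc s.1) ((s.2+1) * sc s.1)) :
    ‖GS g K0 k x - GS g K0 k y‖ ≤ 2 * E := by
  have b : ∀ z ∈ Icc (s.2 * sc s.1) ((s.2+1) * sc s.1), ‖GS g' K0 k z‖ ≤ 2 * E * (sc s.1)⁻¹ := by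
    intro z hz
    calc ‖GS g' K0 k z‖ ≤ ∑ j ∈ Finset.Icc k K0, E * (sc j)⁻¹ := by
          refine (norm_sum_le _ _).trans (Finset.sum_le_sum fun j hj => ?_)
          rw [Finset.mem_Icc] at hj
          obtain ⟨n, hn, hsub⟩ := h.anc hs (hk.trans hj.1) hj.2
          have := (h.bd _ hn z (Icc_anc hsub hz)).2.1
          have h3 := h.FE _ hn
          have := sc_pos j
          calc _ ≤ _ := ‹_›
            _ ≤ E / sc j := by gcongr
            _ = _ := div_eq_mul_inv _ _
      _ = E * ∑ j ∈ Finset.Icc k K0, (sc j)⁻¹ := by rw [Finset.mul_sum]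
      _ ≤ E * (2 * (sc k)⁻¹) := by gcongr; exact sum_geom_inv' k K0
      _ ≤ E * (2 * (sc s.1)⁻¹) := by
          gcongr
          · exact sc_pos _
          · exact sc_mono hk
      _ = _ := by ring
  have := (convex_Icc (s.2 * sc s.1) ((s.2+1) * sc s.1)).norm_image_sub_le_of_norm_hasDerivWithin_le
    (f := GS g K0 k) (f' := GS g' K0 k) (fun z _ => (h.dG k z).hasDerivWithinAt) b hy hx
  have hp := sc_pos s.1
  have h4 : ‖x - y‖ ≤ sc s.1 := by
    rw [Real.norm_eq_abs, abs_le]; constructor <;> linarith [hx.1, hx.2, hy.1, hy.2]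
  calc _ ≤ _ := this
    _ ≤ 2 * E * (sc s.1)⁻¹ * sc s.1 := by gcongr
    _ = 2 * E := by field_simp
end Stop

lemma enorm_le_ofReal {z : ℂ} {r : ℝ} (h : ‖z‖ ≤ r) : ‖z‖ₑ ≤ ENNReal.ofReal r := by
  rw [← ofReal_norm]; exact ENNReal.ofReal_le_ofReal h

set_option maxHeartbeats 2000000 in
open Classical in
theorem stop_main (γ g g' : ℤ → ℝ → ℂ) (F : ℤ × ℤ → ℝ) (E : ℝ) (hE : 0 < E) (a : ℤ) (n : ℕ) :
    ∀ (I : Finset (ℤ × ℤ)) (K0 M0 : ℤ), K0 - a ≤ n → Stop I γ g g' F E a K0 M0 →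
    (∀ K M, iv K M ⊆ iv K0 M0 →
      ∑ s ∈ I.filter (fun s => iv s.1 s.2 ⊆ iv K M), sc s.1 * F s ^ 2 ≤ E ^ 2 * sc K) →
    ∫⁻ x in iv K0 M0, Zf I g a K0 x ≤ ENNReal.ofReal (260 * E * sc K0) := by
  induction n with
  | zero =>
    intro I K0 M0 hn h hcar
    have : ∀ x ∈ iv K0 M0, Zf I g a K0 x ≤ ENNReal.ofReal E := by
      intro x hx
      refine Finset.sup_le fun k hk => ?_
      rw [Finset.mem_Icc] at hk
      have : k = K0 := by push_cast at hn; omega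
      subst this
      split_ifs with hI
      · refine enorm_le_ofReal ?_
        rw [GS_succ g le_rfl]
        have : GS g k (k+1) x = 0 := by simp [GS]
        rw [this, zero_add]
        exact (h.bd _ hI x (iv_mem_Icc (mem_iv.2 rfl))).1.trans (h.FE _ hI)
      · simp
    refine (setLIntegral_mono measurable_const this).trans ?_
    rw [setLIntegral_const, volume_iv, ← ENNReal.ofReal_mul hE.le]
    have := sc_pos K0
    refine ENNReal.ofReal_le_ofReal ?_
    nlinarith [mul_pos hE this]
  | succ n ih =>
    intro I K0 M0 hn h hcar
    set lam := 130 * E with hlam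
    let bad : ℤ × ℤ → Prop := fun s => ∃ x ∈ Icc (s.2 * sc s.1) ((s.2+1) * sc s.1), lam < ‖GS g K0 s.1 x‖
    let J := I.filter (fun s => ∀ t ∈ I, s.1 < t.1 → iv s.1 s.2 ⊆ iv t.1 t.2 → ¬ bad t)
    have hJI : J ⊆ I := Finset.filter_subset _ _
    have hJ : Stop J γ g g' F E a K0 M0 :=
      { mem := fun s hs => h.mem s (hJI hs)
        up := by
          intro x j k hj hjk hk
          have hj' := Finset.mem_filter.1 hj
          refine Finset.mem_filter.2 ⟨h.up x j k hj'.1 hjk hk, fun t ht h1 h2 => ?_⟩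
          exact hj'.2 t ht (by simp only at h1 ⊢; omega) ((iv_idx_subset hjk x).trans h2)
        dγ := h.dγ
        dg := h.dg
        cg' := h.cg'
        bd := fun s hs => h.bd s (hJI hs)
        F0 := fun s hs => h.F0 s (hJI hs)
        FE := fun s hs => h.FE s (hJI hs)
        car := (Finset.sum_le_sum_of_subset_of_nonneg hJI
          (fun s _ _ => by have := sc_pos s.1; positivity)).trans h.car }
    have hK : ∀ s ∈ I, s.1 ≤ K0 := fun s hs => le_of_iv_subset (h.mem s hs).2
    have hGtop : ∀ x, GS g K0 (K0+1) x = 0 := fun x => by simp [GS]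
    have hl : ∀ s ∈ J, ∀ x ∈ Icc (s.2 * sc s.1) ((s.2+1) * sc s.1), ‖GS g K0 (s.1+1) x‖ ≤ lam := by
      intro s hs x hx
      rcases (hK s (hJI hs)).eq_or_lt with e | e
      · rw [e, hGtop]; simp; positivity
      · obtain ⟨m, hm, hsub⟩ := h.anc (hJI hs) (j := s.1+1) (by omega) (by omega)
        have := (Finset.mem_filter.1 hs).2 _ hm (by simp) hsub
        by_contra hc
        exact this ⟨x, Icc_anc hsub hx, not_le.1 hc⟩
    let MB := J.filter bad
    have hMB : ∀ s ∈ MB, s ∈ J ∧ s ∈ I ∧ bad s := fun s hs =>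
      ⟨(Finset.mem_filter.1 hs).1, hJI (Finset.mem_filter.1 hs).1, (Finset.mem_filter.1 hs).2⟩
    have hlt : ∀ s ∈ MB, s.1 < K0 := by
      intro s hs
      obtain ⟨-, h2, x, hx, h3⟩ := hMB s hs
      refine lt_of_le_of_ne (hK s h2) fun e => ?_
      have := (h.bd _ h2 x hx).1.trans (h.FE _ h2)
      rw [e, GS_succ g le_rfl, hGtop, zero_add] at h3
      rw [e] at this
      nlinarith
    have hbig : ∀ s ∈ MB, ∀ x ∈ iv s.1 s.2, lam / 2 ≤ ‖GS g K0 s.1 x‖ := by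
      intro s hs x hx
      obtain ⟨-, h2, y, hy, h3⟩ := hMB s hs
      have := h.osc hE.le h2 le_rfl hy (iv_mem_Icc hx)
      have := norm_sub_norm_le (GS g K0 s.1 y) (GS g K0 s.1 x)
      linarith
    have hκ : ∀ s ∈ MB, ∀ x ∈ iv s.1 s.2, ∀ k ∈ Finset.Icc a K0, ((k, idx k x) ∈ J ↔ s.1 ≤ k) := by
      intro s hs x hx k hk
      rw [Finset.mem_Icc] at hk
      obtain ⟨h1, h2, h3⟩ := hMB s hs
      constructor
      · intro hkJ
        by_contra hc
        refine (Finset.mem_filter.1 hkJ).2 s h2 (by simp only; omega) ?_ h3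
        exact (iv_subset_iff_of (by simp only; omega) (x := x) rfl).2 hx
      · intro hk'
        exact hJ.up x s.1 k (by rw [mem_iv.1 hx]; exact h1) hk' hk.2
    have hdisj : ∀ s ∈ MB, ∀ t ∈ MB, ∀ x, x ∈ iv s.1 s.2 → x ∈ iv t.1 t.2 → s = t := by
      intro s hs t ht x hxs hxt
      have e1 : s.1 ≤ t.1 := by
        refine (hκ s hs x hxs t.1 (Finset.mem_Icc.2 ⟨(h.mem _ (hMB t ht).2.1).1, (hlt t ht).le⟩)).1 ?_
        rw [mem_iv.1 hxt]; exact (hMB t ht).1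
      have e2 : t.1 ≤ s.1 := by
        refine (hκ t ht x hxt s.1 (Finset.mem_Icc.2 ⟨(h.mem _ (hMB s hs).2.1).1, (hlt s hs).le⟩)).1 ?_
        rw [mem_iv.1 hxs]; exact (hMB s hs).1
      have e3 : s.1 = t.1 := le_antisymm e1 e2
      rw [mem_iv, e3] at hxs
      exact Prod.ext e3 (hxs.symm.trans (mem_iv.1 hxt))
    -- measure of the bad set
    have hmeas : ∑ s ∈ MB, sc s.1 ≤ sc K0 / 2 := by
      have hl2 := hJ.l2 hE.le (lam := lam) (by positivity) hl
      have hint : ∀ s ∈ MB, IntegrableOn ((iv s.1 s.2).indicator fun _ => (lam/2)^2) (iv K0 M0) := by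
        intro s _
        refine Integrable.indicator ?_ (measurableSet_iv _ _)
        rw [integrable_const_iff]; right
        constructor; rw [Measure.restrict_apply_univ, volume_iv]; exact ENNReal.ofReal_lt_top
      have h1 : ∑ s ∈ MB, (lam/2)^2 * sc s.1 = ∫ x in iv K0 M0, ∑ s ∈ MB, (iv s.1 s.2).indicator (fun _ => (lam/2)^2) x := by
        rw [integral_finsetSum _ hint]
        refine Finset.sum_congr rfl fun s hs => ?_
        rw [integral_indicator (measurableSet_iv _ _), Measure.restrict_restrict (measurableSet_iv _ _),
          inter_eq_left.2 (h.mem s (hMB s hs).2.1).2]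
        simp [Measure.real, volume_iv, (sc_pos _).le]; ring
      have h2 : ∫ x in iv K0 M0, ∑ s ∈ MB, (iv s.1 s.2).indicator (fun _ => (lam/2)^2) x ≤
          (2 * E^2 + 16 * lam * E) * sc K0 := by
        refine le_trans (integral_mono (integrable_finsetSum _ hint) ?_ fun x => ?_) hl2
        · refine integrable_finsetSum _ fun k _ => ?_
          refine (integral_level (fun s hs => (hJ.mem s hs).2) k (fun m _ => Continuous.intOn_iv ?_ k m)).1
          have := h.cG k; have := h.cG (k+1); fun_prop
        · simp only
          by_cases hx : ∃ s ∈ MB, x ∈ iv s.1 s.2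
          · obtain ⟨s, hs, hxs⟩ := hx
            rw [Finset.sum_eq_single s, indicator_of_mem hxs,
              tele_up _ (fun k => ‖GS g K0 k x‖^2) a K0 s.1 (h.mem _ (hMB s hs).2.1).1 (hlt s hs).le (hκ s hs x hxs), hGtop]
            · have := hbig s hs x hxs
              have : 0 ≤ lam / 2 := by positivity
              simp only [norm_zero]
              nlinarith
            · intro t ht hne
              rw [indicator_of_notMem]
              intro hxt; exact hne (hdisj t ht s hs x hxt hxs)
            · simp [hs]
          · rw [Finset.sum_eq_zero]
            · by_cases hex : ∃ k ∈ Finset.Icc a K0, (k, idx k x) ∈ J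
              · have hne : ((Finset.Icc a K0).filter (fun k => (k, idx k x) ∈ J)).Nonempty := by
                  obtain ⟨k, hk, hk'⟩ := hex
                  exact ⟨k, Finset.mem_filter.2 ⟨hk, hk'⟩⟩
                set κ := ((Finset.Icc a K0).filter (fun k => (k, idx k x) ∈ J)).min' hne with hκd
                have hκm := Finset.min'_mem _ hne
                rw [← hκd, Finset.mem_filter, Finset.mem_Icc] at hκm
                rw [tele_up _ (fun k => ‖GS g K0 k x‖^2) a K0 κ hκm.1.1 hκm.1.2, hGtop]
                · simp
                · intro k hk
                  constructor
                  · intro hk'; exact Finset.min'_le _ _ (Finset.mem_filter.2 ⟨hk, hk'⟩)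
                  · intro hk'; exact hJ.up x κ k hκm.2 hk' (Finset.mem_Icc.1 hk).2
              · push Not at hex
                rw [Finset.sum_eq_zero]
                intro k hk; rw [if_neg (hex k hk)]
            · intro s hs
              rw [indicator_of_notMem]
              intro hxs; exact hx ⟨s, hs, hxs⟩
      rw [← h1, ← Finset.mul_sum] at h2
      have hp := sc_pos K0
      have h3 : E^2 * (65^2 * ∑ s ∈ MB, sc s.1) ≤ E^2 * (2082 * sc K0) := by
        rw [hlam] at h2; nlinarith
      have := le_of_mul_le_mul_left h3 (by positivity)
      linarith
    -- pointwise bound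
    have hpt : ∀ x ∈ iv K0 M0, Zf I g a K0 x ≤ ENNReal.ofReal lam + ∑ s ∈ MB, (iv s.1 s.2).indicator
        (Zf (I.filter (fun t => iv t.1 t.2 ⊆ iv s.1 s.2)) g a s.1) x := by
      intro x hx
      refine Finset.sup_le fun k hk => ?_
      split_ifs with hI
      swap
      · exact zero_le
      by_cases hle : ‖GS g K0 k x‖ ≤ lam
      · exact (enorm_le_ofReal hle).trans le_self_add
      have hkb : bad (k, idx k x) := ⟨x, iv_mem_Icc (mem_iv.2 rfl), not_le.1 hle⟩
      have hne : ((Finset.Icc k K0).filter (fun j => bad (j, idx j x))).Nonempty :=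
        ⟨k, Finset.mem_filter.2 ⟨Finset.mem_Icc.2 ⟨le_rfl, (Finset.mem_Icc.1 hk).2⟩, hkb⟩⟩
      obtain ⟨t, htm, htmax⟩ := Finset.exists_max_image _ id hne
      rw [Finset.mem_filter, Finset.mem_Icc] at htm
      simp only [id] at htmax
      have htI : (t, idx t x) ∈ I := h.up x k t hI htm.1.1 htm.1.2
      have htJ : (t, idx t x) ∈ J := by
        refine Finset.mem_filter.2 ⟨htI, fun s hs h1 h2 hb => ?_⟩
        simp only at h1 h2
        have e := h2 (mem_iv.2 (rfl : idx t x = idx t x))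
        rw [mem_iv] at e
        have := htmax s.1 (Finset.mem_filter.2 ⟨Finset.mem_Icc.2 ⟨by omega, hK s hs⟩, by rw [e]; exact hb⟩)
        omega
      have htM : (t, idx t x) ∈ MB := Finset.mem_filter.2 ⟨htJ, htm.2⟩
      have hsplit : GS g K0 k x = GS g K0 (t+1) x + GS g t k x := by
        unfold GS
        rw [add_comm, ← Finset.sum_union]
        · congr 1; ext j; simp only [Finset.mem_union, Finset.mem_Icc]; omega
        · rw [Finset.disjoint_left]; intro j; simp only [Finset.mem_Icc]; omega
      rw [hsplit]
      refine (enorm_add_le _ _).trans (add_le_add (enorm_le_ofReal (hl _ htJ x (iv_mem_Icc (mem_iv.2 rfl)))) ?_)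
      refine le_trans ?_ (Finset.single_le_sum (fun _ _ => zero_le) htM)
      rw [indicator_of_mem (mem_iv.2 rfl)]
      exact le_Zf (Finset.mem_Icc.2 ⟨(Finset.mem_Icc.1 hk).1, htm.1.1⟩)
        (Finset.mem_filter.2 ⟨hI, iv_idx_subset htm.1.1 x⟩)
    have hmz : ∀ s ∈ MB, Measurable ((iv s.1 s.2).indicator
        (Zf (I.filter (fun t => iv t.1 t.2 ⊆ iv s.1 s.2)) g a s.1)) := fun s _ =>
      (measurable_Zf h.cg).indicator (measurableSet_iv _ _)
    refine (setLIntegral_mono' (measurableSet_iv _ _) hpt).trans ?_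
    rw [lintegral_add_left measurable_const, setLIntegral_const, volume_iv, lintegral_finsetSum' _ (fun s hs => (hmz s hs).aemeasurable)]
    have hsub : ∀ s ∈ MB, ∫⁻ x in iv K0 M0, (iv s.1 s.2).indicator
        (Zf (I.filter (fun t => iv t.1 t.2 ⊆ iv s.1 s.2)) g a s.1) x ≤ ENNReal.ofReal (260 * E * sc s.1) := by
      intro s hs
      have hsI := (hMB s hs).2.1
      rw [lintegral_indicator (measurableSet_iv _ _), Measure.restrict_restrict (measurableSet_iv _ _),
          inter_eq_left.2 (h.mem s hsI).2]
      refine ih _ s.1 s.2 (by have := hlt s hs; push_cast at hn; omega) ?_ ?_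
      · exact
        { mem := fun t ht => ⟨(h.mem t (Finset.mem_filter.1 ht).1).1, (Finset.mem_filter.1 ht).2⟩
          up := by
            intro x j k hj hjk hk
            rw [Finset.mem_filter] at hj ⊢
            refine ⟨h.up x j k hj.1 hjk (hk.trans (hlt s hs).le), ?_⟩
            exact (iv_subset_iff_of hk (x := x) rfl).2 (hj.2 rfl)
          dγ := h.dγ
          dg := h.dg
          cg' := h.cg'
          bd := fun t ht => h.bd t (Finset.mem_filter.1 ht).1
          F0 := fun t ht => h.F0 t (Finset.mem_filter.1 ht).1
          FE := fun t ht => h.FE t (Finset.mem_filter.1 ht).1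
          car := hcar _ _ (h.mem s hsI).2 }
      · intro K M hKM
        refine le_trans ?_ (hcar K M (hKM.trans (h.mem s hsI).2))
        refine Finset.sum_le_sum_of_subset_of_nonneg (Finset.filter_subset_filter _ (Finset.filter_subset _ _)) ?_
        intro t _ _; have := sc_pos t.1; positivity
    refine (add_le_add_right (Finset.sum_le_sum hsub) _).trans ?_
    have hp := sc_pos K0
    rw [← ENNReal.ofReal_sum_of_nonneg (fun s _ => by have := sc_pos s.1; positivity), ← ENNReal.ofReal_mul (by positivity),
      ← ENNReal.ofReal_add (by positivity) (Finset.sum_nonneg fun s _ => by have := sc_pos s.1; positivity), ← Finset.mul_sum]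
    refine ENNReal.ofReal_le_ofReal ?_
    have : 260 * E * ∑ s ∈ MB, sc s.1 ≤ 260 * E * (sc K0 / 2) := by gcongr
    rw [hlam]; linarith
end

section
open MeasureTheory Filter Set
open scoped ENNReal Topology

/-! ### Packets -/
noncomputable def ee (x : ℝ) : ℂ := (Real.fourierChar x : ℂ)
lemma norm_ee (x : ℝ) : ‖ee x‖ = 1 := Circle.norm_coe _
lemma ee_add (x y : ℝ) : ee (x + y) = ee x * ee y := by simp [ee, AddChar.map_add_eq_mul]
lemma ee_zero : ee 0 = 1 := by simp [ee]
lemma ee_neg (x : ℝ) : ee (-x) = (starRingEnd ℂ) (ee x) := by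
  simp [ee, AddChar.map_neg_eq_inv]
lemma hasDerivAt_ee (x : ℝ) : HasDerivAt ee (2 * Real.pi * Complex.I * ee x) x :=
  Real.hasDerivAt_fourierChar x
lemma continuous_ee : Continuous ee :=
  continuous_iff_continuousAt.2 fun x => (hasDerivAt_ee x).continuousAt
lemma norm_ee_sub_le (x y : ℝ) : ‖ee x - ee y‖ ≤ 8 * |x - y| := by
  have := (convex_univ (𝕜 := ℝ)).norm_image_sub_le_of_norm_hasDerivWithin_le (f := ee)
    (f' := fun x => 2 * Real.pi * Complex.I * ee x) (C := 8) (x := y) (y := x)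
    (fun z _ => (hasDerivAt_ee z).hasDerivWithinAt) (fun z _ => ?_) (mem_univ _) (mem_univ _)
  · simpa using this
  · have := Real.pi_lt_d2
    simp [norm_ee, abs_of_pos Real.pi_pos]; linarith

noncomputable def wt (k : ℤ) (c y : ℝ) : ℝ := (sc k)⁻¹ * ((1 + |y - c| / sc k) ^ 6)⁻¹
lemma wt_nonneg (k : ℤ) (c y : ℝ) : 0 ≤ wt k c y := by have := sc_pos k; unfold wt; positivity
lemma wt_le (k : ℤ) (c y : ℝ) : wt k c y ≤ (sc k)⁻¹ := by
  have := sc_pos k; unfold wt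
  refine mul_le_of_le_one_right (by positivity) (inv_le_one_of_one_le₀ ?_)
  exact one_le_pow₀ (by have : 0 ≤ |y - c| / sc k := by positivity
                        linarith)
lemma continuous_wt (k : ℤ) (c : ℝ) : Continuous (wt k c) := by
  have := sc_pos k; unfold wt
  refine continuous_const.mul (Continuous.inv₀ (by fun_prop) fun y => by positivity)

/-- `tile = (k, m, n)` -/
abbrev Tile := ℤ × ℤ × ℤ
noncomputable def lc (s : Tile) : ℝ := s.2.1 * sc s.1

structure Pk (s : Tile) (w : ℝ → ℂ) : Prop where
  cont : Continuous w
  dec : ∀ y, ‖w y‖ ≤ wt s.1 (lc s) y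
  lip : ∀ ξ, nix s.1 ξ = s.2.2 → ∀ y y', ‖w y * ee (ξ * y) - w y' * ee (ξ * y')‖ ≤
    |y - y'| / sc s.1 * (wt s.1 (lc s) y + wt s.1 (lc s) y')
  ft : ∀ η, (η < s.2.2 / sc s.1 ∨ (s.2.2 + 1/2) / sc s.1 ≤ η) → ∫ y, w y * ee (η * y) = 0

structure PKer (ψ : ℝ → ℂ) (c : ℝ) : Prop where
  dif : ∃ ψ' : ℝ → ℂ, (∀ t, HasDerivAt ψ (ψ' t) t) ∧ ∀ t, ‖ψ' t‖ ≤ c * ((1 + |t|) ^ 6)⁻¹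
  dec : ∀ t, ‖ψ t‖ ≤ c * ((1 + |t|) ^ 6)⁻¹
  ft : ∀ ζ, (ζ < -1/4 ∨ -1/16 < ζ) → ∫ t, ψ t * ee (-ζ * t) = 0

lemma inv6_le {u v : ℝ} (hu : 0 ≤ u) (hv : 0 ≤ v) (h : v ≤ u + 1) : ((1 + u) ^ 6)⁻¹ ≤ 64 * ((1 + v) ^ 6)⁻¹ := by
  have h1 : (1 + v) ^ 6 ≤ (2 * (1 + u)) ^ 6 := pow_le_pow_left₀ (by positivity) (by linarith) 6
  rw [inv_le_iff_one_le_mul₀ (by positivity)]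
  have h2 : 0 < (1 + v) ^ 6 := by positivity
  rw [mul_assoc, mul_comm ((1+v)^6)⁻¹, ← div_eq_mul_inv, ← mul_div_assoc, le_div_iff₀ h2]
  rw [mul_pow] at h1; linarith

/-- the frequency condition for the upper child -/
def c2 (k : ℤ) (ξ : ℝ) : Prop := nix (k+1) ξ = 64 * nix k ξ + 32

lemma c2_bd {k n : ℤ} {ξ : ℝ} (h : nix k ξ = n) (h2 : c2 k ξ) :
    (n + 1/2) / sc k ≤ ξ ∧ ξ < (n + 33/64) / sc k := by
  unfold c2 at h2
  rw [h, nix_iff, sc_succ] at h2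
  have := sc_pos k
  push_cast at h2
  rw [div_le_iff₀ (by positivity), lt_div_iff₀ (by positivity)] at h2 ⊢
  constructor <;> linarith [h2.1, h2.2]

/-- rescaled modulated kernel -/
noncomputable def pack (ψ : ℝ → ℂ) (k : ℤ) (ξ x y : ℝ) : ℂ :=
  ((sc k)⁻¹ : ℝ) * ψ ((x - y) / sc k) * ee (ξ * (x - y))

lemma PKer.pk {ψ : ℝ → ℂ} {c : ℝ} (hc : 0 < c) (h : PKer ψ c) (s : Tile) (ξ x : ℝ)
    (hx : x ∈ Icc (s.2.1 * sc s.1) ((s.2.1+1) * sc s.1)) (hξ : nix s.1 ξ = s.2.2) (h2 : c2 s.1 ξ) :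
    Pk s (fun y => ((65536 * c)⁻¹ : ℝ) * pack ψ s.1 ξ x y) := by
  obtain ⟨ψ', hψ', hb'⟩ := h.dif
  have hs := sc_pos s.1
  have hψc : Continuous ψ := continuous_iff_continuousAt.2 fun t => (hψ' t).continuousAt
  set S := sc s.1 with hS
  have hcmp : ∀ y, ((1 + |(x - y) / S|) ^ 6)⁻¹ ≤ 64 * ((1 + |y - lc s| / S) ^ 6)⁻¹ := by
    intro y
    refine inv6_le (abs_nonneg _) (by positivity) ?_
    rw [abs_div, abs_of_pos hs, div_add_one hs.ne', div_le_div_iff_of_pos_right hs]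
    have h1 : |x - lc s| ≤ S := by
      unfold lc; rw [abs_le]; constructor <;> linarith [hx.1, hx.2]
    have := abs_sub_le y x (lc s)
    rw [abs_sub_comm y x] at this; linarith
  have hdec : ∀ y, ‖pack ψ s.1 ξ x y‖ ≤ 64 * c * wt s.1 (lc s) y := by
    intro y
    unfold pack wt
    rw [norm_mul, norm_mul, norm_ee, mul_one, Complex.norm_real, Real.norm_of_nonneg (by positivity), ← hS]
    calc S⁻¹ * ‖ψ ((x - y) / S)‖ ≤ S⁻¹ * (c * (64 * ((1 + |y - lc s| / S) ^ 6)⁻¹)) := by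
          gcongr; exact (h.dec _).trans (by gcongr; exact hcmp y)
      _ = _ := by ring
  have hcont : Continuous (pack ψ s.1 ξ x) := by
    unfold pack
    have := continuous_ee
    fun_prop
  have hA : ∀ z : ℂ, ‖(((65536 * c)⁻¹ : ℝ) : ℂ) * z‖ = (65536 * c)⁻¹ * ‖z‖ := fun z => by
    rw [norm_mul, Complex.norm_real, Real.norm_of_nonneg (by positivity)]
  refine ⟨by fun_prop, fun y => ?_, fun ξ' hξ' y y' => ?_, fun η hη => ?_⟩
  · rw [hA]
    have := wt_nonneg s.1 (lc s) y
    rw [inv_mul_le_iff₀ (by positivity)]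
    refine (hdec y).trans ?_
    nlinarith
  · simp only [mul_assoc, ← mul_sub]
    rw [hA, inv_mul_le_iff₀ (by positivity)]
    have w1 := wt_nonneg s.1 (lc s) y
    have w2 := wt_nonneg s.1 (lc s) y'
    by_cases hyy : S < |y - y'|
    · have t1 : ‖pack ψ s.1 ξ x y * ee (ξ' * y) - pack ψ s.1 ξ x y' * ee (ξ' * y')‖ ≤
          64 * c * wt s.1 (lc s) y + 64 * c * wt s.1 (lc s) y' := by
        refine (norm_sub_le _ _).trans ?_
        rw [norm_mul, norm_mul, norm_ee, norm_ee, mul_one, mul_one]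
        exact add_le_add (hdec y) (hdec y')
      have t2 : 1 ≤ |y - y'| / S := by rw [le_div_iff₀ hs]; linarith
      have t3 : 0 ≤ c * (wt s.1 (lc s) y + wt s.1 (lc s) y') := by positivity
      nlinarith
    · push Not at hyy
      have hder : ∀ z, HasDerivAt (fun y => pack ψ s.1 ξ x y * ee (ξ' * y))
          ((S⁻¹ : ℝ) * ((-S⁻¹ : ℝ) * ψ' ((x - z) / S) + (ξ' - ξ : ℝ) * (2 * Real.pi * Complex.I) * ψ ((x - z) / S)) * ee (ξ * (x - z)) * ee (ξ' * z)) z := by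
        intro z
        have d1 : HasDerivAt (fun y => (x - y) / S) (-S⁻¹) z := by
          have := ((hasDerivAt_id z).const_sub x).div_const S
          simpa [neg_div] using this
        have d2 := (hψ' ((x - z) / S)).scomp z d1
        have d3 : HasDerivAt (fun y => ξ * (x - y)) (-ξ) z := by
          have := ((hasDerivAt_id z).const_sub x).const_mul ξ
          simpa using this
        have d4 := (hasDerivAt_ee (ξ * (x - z))).scomp z d3
        have d5 : HasDerivAt (fun y => ξ' * y) ξ' z := by simpa using (hasDerivAt_id z).const_mul ξ'
        have d6 := (hasDerivAt_ee (ξ' * z)).scomp z d5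
        have := (((d2.const_mul ((S⁻¹ : ℝ) : ℂ)).mul d4).mul d6)
        refine this.congr_deriv ?_
        simp only [Function.comp, Complex.real_smul, Pi.mul_apply]
        push_cast; ring
      have hξξ : |ξ' - ξ| ≤ S⁻¹ := by
        rw [nix_iff, ← hS] at hξ hξ'
        have : (((s.2.2 : ℤ) : ℝ) + 1) / S = s.2.2 / S + S⁻¹ := by field_simp
        rw [abs_le]; constructor <;> linarith [hξ.1, hξ.2, hξ'.1, hξ'.2]
      have hbd : ∀ z ∈ uIcc y y', ‖((S⁻¹ : ℝ) * ((-S⁻¹ : ℝ) * ψ' ((x - z) / S) + (ξ' - ξ : ℝ) * (2 * Real.pi * Complex.I) * ψ ((x - z) / S)) * ee (ξ * (x - z)) * ee (ξ' * z) : ℂ)‖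
          ≤ 65536 * c * S⁻¹ * wt s.1 (lc s) y := by
        intro z hz
        have hzy : |z - y| ≤ S := (abs_sub_left_of_mem_uIcc hz).trans (by rwa [abs_sub_comm])
        have hw : ((1 + |(x - z) / S|) ^ 6)⁻¹ ≤ 4096 * ((1 + |y - lc s| / S) ^ 6)⁻¹ := by
          refine (hcmp z).trans ?_
          have : ((1 + |z - lc s| / S) ^ 6)⁻¹ ≤ 64 * ((1 + |y - lc s| / S) ^ 6)⁻¹ := by
            refine inv6_le (by positivity) (by positivity) ?_
            rw [div_add_one hs.ne', div_le_div_iff_of_pos_right hs]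
            have := abs_sub_le y z (lc s)
            rw [abs_sub_comm y z] at this; linarith
          linarith
        rw [norm_mul, norm_mul, norm_ee, norm_ee, mul_one, mul_one, norm_mul, Complex.norm_real, Real.norm_of_nonneg (by positivity)]
        have n1 : ‖((-S⁻¹ : ℝ) : ℂ) * ψ' ((x - z) / S)‖ ≤ S⁻¹ * (c * (4096 * ((1 + |y - lc s| / S) ^ 6)⁻¹)) := by
          rw [norm_mul, Complex.norm_real, norm_neg, Real.norm_of_nonneg (by positivity)]
          gcongr; exact (hb' _).trans (by gcongr)
        have n2 : ‖((ξ' - ξ : ℝ) : ℂ) * (2 * Real.pi * Complex.I) * ψ ((x - z) / S)‖ ≤ S⁻¹ * 7 * (c * (4096 * ((1 + |y - lc s| / S) ^ 6)⁻¹)) := by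
          rw [norm_mul, norm_mul, Complex.norm_real, Real.norm_eq_abs]
          gcongr
          · have := Real.pi_lt_d2
            simp [abs_of_pos Real.pi_pos]; linarith
          · exact (h.dec _).trans (by gcongr)
        have n3 := (norm_add_le (((-S⁻¹ : ℝ) : ℂ) * ψ' ((x - z) / S)) (((ξ' - ξ : ℝ) : ℂ) * (2 * Real.pi * Complex.I) * ψ ((x - z) / S))).trans (add_le_add n1 n2)
        have hp : 0 ≤ ((1 + |y - lc s| / S) ^ 6)⁻¹ := by positivity
        unfold wt; rw [← hS]
        refine (mul_le_mul_of_nonneg_left n3 (by positivity)).trans ?_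
        have : S⁻¹ * (S⁻¹ * (c * (4096 * ((1 + |y - lc s| / S) ^ 6)⁻¹)) + S⁻¹ * 7 * (c * (4096 * ((1 + |y - lc s| / S) ^ 6)⁻¹)))
          = 32768 * (c * S⁻¹ * (S⁻¹ * ((1 + |y - lc s| / S) ^ 6)⁻¹)) := by ring
        rw [this]
        have : 0 ≤ c * S⁻¹ * (S⁻¹ * ((1 + |y - lc s| / S) ^ 6)⁻¹) := by positivity
        linarith
      have := (convex_uIcc y y').norm_image_sub_le_of_norm_hasDerivWithin_le
        (fun z _ => (hder z).hasDerivWithinAt) hbd right_mem_uIcc left_mem_uIcc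
      refine this.trans ?_
      rw [Real.norm_eq_abs]
      have : 0 ≤ c * (|y - y'| / S) * wt s.1 (lc s) y' := by positivity
      calc _ = 65536 * (c * (|y - y'| / S) * wt s.1 (lc s) y) := by ring
        _ ≤ 65536 * (c * (|y - y'| / S) * wt s.1 (lc s) y) + 65536 * (c * (|y - y'| / S) * wt s.1 (lc s) y') := by linarith
        _ = _ := by ring
  · have e1 : ∀ y, ((65536 * c)⁻¹ : ℝ) * pack ψ s.1 ξ x y * ee (η * y) =
        (fun t => (((65536 * c)⁻¹ * S⁻¹ : ℝ) * ee (η * x)) * (ψ (t / S) * ee (-(S * (η - ξ)) * (t / S)))) (x - y) := by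
      intro y
      simp only [pack]
      have : ee (ξ * (x - y)) * ee (η * y) = ee (η * x) * ee (-(S * (η - ξ)) * ((x - y) / S)) := by
        rw [← ee_add, ← ee_add]; congr 1; field_simp; ring
      push_cast
      linear_combination (((65536 * c : ℂ))⁻¹ * (S:ℂ)⁻¹ * ψ ((x - y) / S)) * this
    simp_rw [e1]
    rw [integral_sub_left_eq_self (μ := volume) (f := fun t => (((65536 * c)⁻¹ * S⁻¹ : ℝ) * ee (η * x)) * (ψ (t / S) * ee (-(S * (η - ξ)) * (t / S)))),
      integral_const_mul, Measure.integral_comp_div (fun t => ψ t * ee (-(S * (η - ξ)) * t)), h.ft, smul_zero, mul_zero]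
    have hb := c2_bd hξ h2
    rw [← hS, div_le_iff₀ hs, lt_div_iff₀ hs] at hb
    rw [← hS, lt_div_iff₀ hs, div_le_iff₀ hs] at hη
    rcases hη with h' | h'
    · left; nlinarith
    · right; nlinarith
end

section
open MeasureTheory Filter Set
open scoped ENNReal Topology

/-! ### Weights and Bessel -/
lemma inv_sq_le (t : ℝ) : ((1 + |t|) ^ 2)⁻¹ ≤ (1 + t ^ 2)⁻¹ := by
  apply inv_anti₀ (by positivity)
  nlinarith [abs_nonneg t, sq_abs t]
lemma continuous_inv_pow (c : ℝ) {S : ℝ} (hS : 0 < S) (p : ℕ) : Continuous fun y : ℝ => ((1 + |y - c| / S) ^ p)⁻¹ :=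
  Continuous.inv₀ (by fun_prop) fun y => by positivity
lemma int_v : Integrable fun t : ℝ => ((1 + |t|) ^ 2)⁻¹ := by
  refine integrable_inv_one_add_sq.mono' ?_ (ae_of_all _ fun t => ?_)
  · have := continuous_inv_pow 0 one_pos 2
    simp only [sub_zero, div_one] at this
    exact this.aestronglyMeasurable
  · rw [Real.norm_of_nonneg (by positivity)]; exact inv_sq_le t
lemma int_v_le : ∫ t : ℝ, ((1 + |t|) ^ 2)⁻¹ ≤ 4 := by
  refine (integral_mono int_v integrable_inv_one_add_sq inv_sq_le).trans ?_
  rw [integral_univ_inv_one_add_sq]; exact Real.pi_le_four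
lemma int_vs (c : ℝ) {S : ℝ} (hS : 0 < S) : Integrable fun t : ℝ => ((1 + |t - c| / S) ^ 2)⁻¹ := by
  have h1 : (fun t : ℝ => ((1 + |t - c| / S) ^ 2)⁻¹) = fun t => (fun u : ℝ => ((1 + |u / S|) ^ 2)⁻¹) (t - c) := by
    ext t; simp [abs_div, abs_of_pos hS]
  rw [h1]
  exact (int_v.comp_div hS.ne').comp_sub_right c
lemma int_vs_le (c : ℝ) {S : ℝ} (hS : 0 < S) : ∫ t : ℝ, ((1 + |t - c| / S) ^ 2)⁻¹ ≤ 4 * S := by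
  have h1 : (fun t : ℝ => ((1 + |t - c| / S) ^ 2)⁻¹) = fun t => (fun u : ℝ => ((1 + |u / S|) ^ 2)⁻¹) (t - c) := by
    ext t; simp [abs_div, abs_of_pos hS]
  rw [h1, integral_sub_right_eq_self (fun u : ℝ => ((1 + |u / S|) ^ 2)⁻¹) c,
    Measure.integral_comp_div (fun u : ℝ => ((1 + |u|) ^ 2)⁻¹), abs_of_pos hS, smul_eq_mul]
  nlinarith [int_v_le]
lemma pow_inv_mono {t : ℝ} (ht : 0 ≤ t) {p q : ℕ} (h : p ≤ q) : ((1 + t) ^ q)⁻¹ ≤ ((1 + t) ^ p)⁻¹ :=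
  inv_anti₀ (by positivity) (pow_le_pow_right₀ (by linarith) h)

lemma int_wt (k : ℤ) (c : ℝ) : Integrable (wt k c) := by
  have hs := sc_pos k
  refine ((int_vs c hs).const_mul (sc k)⁻¹).mono' (continuous_wt k c).aestronglyMeasurable (ae_of_all _ fun t => ?_)
  rw [Real.norm_of_nonneg (wt_nonneg k c t)]
  unfold wt; gcongr (sc k)⁻¹ * ?_
  exact pow_inv_mono (by positivity) (by norm_num)
lemma int_wt_le (k : ℤ) (c : ℝ) : ∫ y, wt k c y ≤ 4 := by
  have hs := sc_pos k
  refine (integral_mono (int_wt k c) ((int_vs c hs).const_mul (sc k)⁻¹) fun t => ?_).trans ?_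
  · unfold wt; gcongr (sc k)⁻¹ * ?_
    exact pow_inv_mono (by positivity) (by norm_num)
  · rw [integral_const_mul, inv_mul_le_iff₀ hs]; linarith [int_vs_le c hs]

/-- sum over the integer translates -/
lemma sum_v (k : ℤ) (x : ℝ) (S : Finset ℤ) : ∑ m ∈ S, ((1 + |x - m * sc k| / sc k) ^ 2)⁻¹ ≤ 16 := by
  have hs := sc_pos k
  set h : ℝ → ℝ := fun y => ((1 + |y - x| / sc k) ^ 2)⁻¹ with hh
  have hi : Integrable h := int_vs x hs
  have h1 : ∀ m ∈ S, sc k * ((1 + |x - m * sc k| / sc k) ^ 2)⁻¹ ≤ 4 * ∫ y in iv k m, h y := by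
    intro m _
    have : ∫ y in iv k m, (1/4) * ((1 + |x - m * sc k| / sc k) ^ 2)⁻¹ ≤ ∫ y in iv k m, h y := by
      refine setIntegral_mono_on ?_ hi.integrableOn (measurableSet_iv k m) fun y hy => ?_
      · exact integrableOn_const (by rw [volume_iv]; exact ENNReal.ofReal_ne_top)
      · rw [mem_iv, idx_iff] at hy
        have : |y - x| / sc k ≤ 1 + |x - m * sc k| / sc k := by
          rw [div_le_iff₀ hs, add_mul, div_mul_cancel₀ _ hs.ne', one_mul]
          have h1 := abs_sub_le y (m * sc k) x
          rw [abs_sub_comm (m * sc k) x, abs_of_nonneg (by linarith : 0 ≤ y - m * sc k)] at h1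
          linarith
        have hp : 0 ≤ |x - m * sc k| / sc k := by positivity
        simp only [hh]
        rw [one_div, ← mul_inv]
        apply inv_anti₀ (by positivity)
        calc _ ≤ (2 * (1 + |x - m * sc k| / sc k)) ^ 2 := by gcongr; linarith
          _ = _ := by ring
    rw [setIntegral_const, smul_eq_mul, Measure.real, volume_iv, ENNReal.toReal_ofReal hs.le] at this
    linarith
  have h2 := Finset.sum_le_sum h1
  rw [← Finset.mul_sum, ← Finset.mul_sum, ← integral_biUnion_finset S (fun m _ => measurableSet_iv k m) ?_ (fun m _ => hi.integrableOn)] at h2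
  · have h3 : ∫ y in ⋃ m ∈ S, iv k m, h y ≤ 4 * sc k := by
      refine (setIntegral_le_integral hi (ae_of_all _ fun y => ?_)).trans (int_vs_le x hs)
      simp only [hh, Pi.zero_apply]; positivity
    nlinarith
  · intro m _ m' _ hmm
    refine Set.disjoint_left.2 fun y h1 h2 => hmm ?_
    exact (mem_iv.1 h1).symm.trans (mem_iv.1 h2)

lemma sum_wt (k : ℤ) (x : ℝ) (S : Finset ℤ) : ∑ m ∈ S, sc k * wt k (m * sc k) x ≤ 16 := by
  have hs := sc_pos k
  refine (Finset.sum_le_sum fun m _ => ?_).trans (sum_v k x S)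
  unfold wt; rw [mul_inv_cancel_left₀ hs.ne']
  exact pow_inv_mono (by positivity) (by norm_num)

lemma Pk.int {s : Tile} {w : ℝ → ℂ} (h : Pk s w) : Integrable w :=
  (int_wt s.1 (lc s)).mono' h.cont.aestronglyMeasurable (ae_of_all _ h.dec)

lemma Pk.orth {s s' : Tile} {w w' : ℝ → ℂ} (h : Pk s w) (h' : Pk s' w')
    (hd : ∀ η : ℝ, (η < s.2.2 / sc s.1 ∨ (s.2.2 + 1/2) / sc s.1 ≤ η) ∨ (η < s'.2.2 / sc s'.1 ∨ (s'.2.2 + 1/2) / sc s'.1 ≤ η)) :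
    ∫ y, w y * (starRingEnd ℂ) (w' y) = 0 := by
  open Real FourierTransform in
  have eI : ∀ η, 𝓕⁻ w η = ∫ y, w y * ee (η * y) := by
    intro η; rw [Real.fourierInv_eq]
    refine integral_congr_ae (ae_of_all _ fun y => ?_)
    simp only [ee, Circle.smul_def, smul_eq_mul, RCLike.inner_apply, conj_trivial]; rw [mul_comm]
  have hz : ∀ η, η ∉ Icc (s.2.2 / sc s.1) ((s.2.2 + 1/2) / sc s.1) → (∫ y, w y * ee (η * y)) = 0 := by
    intro η hη
    apply h.ft
    by_contra hc; push Not at hc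
    exact hη ⟨hc.1, hc.2.le⟩
  have hcont : Continuous (fun η => ∫ y, w y * ee (η * y)) := by
    refine continuous_of_dominated (bound := fun y => ‖w y‖) (fun η => ?_) (fun η => ae_of_all _ fun y => ?_) h.int.norm (ae_of_all _ fun y => ?_)
    · have := h.cont; have := continuous_ee
      exact Continuous.aestronglyMeasurable (by fun_prop)
    · rw [norm_mul, norm_ee, mul_one]
    · have := continuous_ee; fun_prop
  have hint : Integrable (fun η => ∫ y, w y * ee (η * y)) :=
    hcont.integrable_of_hasCompactSupport (HasCompactSupport.intro isCompact_Icc hz)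
  open Real FourierTransform in
  have inv : ∀ y, w y = ∫ η, (∫ y, w y * ee (η * y)) * ee (-(η * y)) := by
    intro y
    have e2 : 𝓕⁻ w = fun η => ∫ y, w y * ee (η * y) := funext eI
    have e3 : Integrable (𝓕 w) := by
      have : 𝓕 w = fun η => 𝓕⁻ w (-η) := by
        ext η; rw [Real.fourierInv_eq_fourier_neg, neg_neg]
      rw [this, e2]; exact hint.comp_neg
    conv_lhs => rw [← h.cont.fourier_fourierInv_eq h.int e3, Real.fourier_eq]
    refine integral_congr_ae (ae_of_all _ fun η => ?_)
    simp only [eI, ee, Circle.smul_def, smul_eq_mul, RCLike.inner_apply, conj_trivial]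
    rw [mul_comm, mul_comm y η]
  set W := fun η => ∫ y, w y * ee (η * y) with hW
  calc ∫ y, w y * (starRingEnd ℂ) (w' y) = ∫ y, ∫ η, W η * (ee (-(η * y)) * (starRingEnd ℂ) (w' y)) := by
        congr 1; ext y
        rw [inv y, ← integral_mul_const]; congr 1; ext η; ring
    _ = ∫ η, ∫ y, W η * (ee (-(η * y)) * (starRingEnd ℂ) (w' y)) := by
        refine integral_integral_swap ?_
        refine (h'.int.norm.mul_prod hint.norm).mono' ?_ (ae_of_all _ fun p => ?_)
        · have := h'.cont; have := continuous_ee; have hWc : Continuous W := hcont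
          refine Continuous.aestronglyMeasurable ?_
          simp only [Function.uncurry_def]
          have := Complex.continuous_conj
          fun_prop
        · simp only [Function.uncurry_def, norm_mul, norm_ee, one_mul, RCLike.norm_conj]
          rw [mul_comm]
    _ = ∫ η, (0:ℂ) := by
        congr 1; ext η
        rw [integral_const_mul]
        have e3 : ∫ y, ee (-(η * y)) * (starRingEnd ℂ) (w' y) = (starRingEnd ℂ) (∫ y, w' y * ee (η * y)) := by
          rw [← integral_conj]; congr 1; ext y; rw [ee_neg, map_mul, mul_comm]
        rcases hd η with h1 | h1
        · simp only [hW, h.ft η h1, zero_mul]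
        · rw [e3, h'.ft η h1, map_zero, mul_zero]
    _ = 0 := by simp

def crs (s s' : Tile) : Prop := s'.1 < s.1 ∧ nix s'.1 (s.2.2 / sc s.1) = s'.2.2 ∧ (s.2.2 : ℝ) / sc s.1 < (s'.2.2 + 1/2) / sc s'.1
def sm (s s' : Tile) : Prop := s.1 = s'.1 ∧ s.2.2 = s'.2.2

lemma disj_of {s s' : Tile} (hlt : s'.1 ≤ s.1) (h : ¬ crs s s') (h0 : ¬ sm s s') (η : ℝ) :
    (η < s.2.2 / sc s.1 ∨ (s.2.2 + 1/2) / sc s.1 ≤ η) ∨ (η < s'.2.2 / sc s'.1 ∨ (s'.2.2 + 1/2) / sc s'.1 ≤ η) := by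
  by_contra hc
  push Not at hc
  obtain ⟨⟨h1, h2⟩, h3, h4⟩ := hc
  have p1 := sc_pos s.1
  have p2 := sc_pos s'.1
  have n1 : nix s.1 η = s.2.2 := nix_iff.2 ⟨h1, h2.trans (by gcongr; norm_num)⟩
  have n2 : nix s'.1 η = s'.2.2 := nix_iff.2 ⟨h3, h4.trans (by gcongr; norm_num)⟩
  have n0 : nix s.1 (s.2.2 / sc s.1) = s.2.2 := nix_iff.2 ⟨le_rfl, by gcongr; linarith⟩
  rcases hlt.lt_or_eq with hl | hl
  · exact h ⟨hl, by rw [← n2]; exact nix_down hlt (n0.trans n1.symm), h1.trans_lt h4⟩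
  · exact h0 ⟨hl.symm, by rw [← n1, ← n2, hl]⟩

noncomputable def Wp (s s' : Tile) : ℝ := ∫ y, wt s.1 (lc s) y * wt s'.1 (lc s') y
lemma int_wtwt (s s' : Tile) : Integrable fun y => wt s.1 (lc s) y * wt s'.1 (lc s') y := by
  refine (int_wt s.1 (lc s)).mul_bdd (c := (sc s'.1)⁻¹) (continuous_wt _ _).aestronglyMeasurable (ae_of_all _ fun y => ?_)
  rw [Real.norm_of_nonneg (wt_nonneg _ _ _)]; exact wt_le _ _ _
lemma Wp_nonneg (s s' : Tile) : 0 ≤ Wp s s' :=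
  integral_nonneg fun y => mul_nonneg (wt_nonneg _ _ _) (wt_nonneg _ _ _)
lemma Wp_comm (s s' : Tile) : Wp s s' = Wp s' s := by simp only [Wp, mul_comm]

lemma sum_tile_le (U : Finset Tile) (s : Tile) (c : ℝ → ℤ → ℝ) (y : ℝ) (hc : ∀ S : Finset ℤ, ∑ m ∈ S, c y m ≤ 16) :
    ∑ s' ∈ U with s'.1 = s.1 ∧ s'.2.2 = s.2.2, c y s'.2.1 ≤ 16 := by
  rw [← Finset.sum_image (f := c y) (g := fun s' : Tile => s'.2.1)]
  · exact hc _
  · intro t ht t' ht' h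
    simp only [Finset.coe_filter, mem_ofPred_eq] at ht ht'
    exact Prod.ext (ht.2.1.trans ht'.2.1.symm) (Prod.ext h (ht.2.2.trans ht'.2.2.symm))

open Classical in
lemma bessel (U : Finset Tile) (w : Tile → ℝ → ℂ) (hw : ∀ s ∈ U, Pk s (w s)) (c : Tile → ℂ) :
    ∫ y, ‖∑ s ∈ U, c s * w s y‖ ^ 2 ≤ 64 * ∑ s ∈ U, ‖c s‖ ^ 2 / sc s.1 +
      2 * ∑ s ∈ U, ∑ s' ∈ U with crs s s', ‖c s‖ * ‖c s'‖ * Wp s s' := by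
  have iB : ∀ s ∈ U, ∀ s' ∈ U, Integrable fun y => w s y * (starRingEnd ℂ) (w s' y) := by
    intro s hs s' hs'
    refine (int_wtwt s s').mono' ?_ (ae_of_all _ fun y => ?_)
    · exact ((hw s hs).cont.mul (Complex.continuous_conj.comp (hw s' hs').cont)).aestronglyMeasurable
    · rw [norm_mul, RCLike.norm_conj]
      exact mul_le_mul ((hw s hs).dec y) ((hw s' hs').dec y) (norm_nonneg _) (wt_nonneg _ _ _)
  have nB : ∀ s ∈ U, ∀ s' ∈ U, ‖∫ y, w s y * (starRingEnd ℂ) (w s' y)‖ ≤ Wp s s' := by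
    intro s hs s' hs'
    refine norm_integral_le_of_norm_le (int_wtwt s s') (ae_of_all _ fun y => ?_)
    rw [norm_mul, RCLike.norm_conj]
    exact mul_le_mul ((hw s hs).dec y) ((hw s' hs').dec y) (norm_nonneg _) (wt_nonneg _ _ _)
  have e1 : ((∫ y, ‖∑ s ∈ U, c s * w s y‖ ^ 2 : ℝ) : ℂ) = ∑ s ∈ U, ∑ s' ∈ U, c s * (starRingEnd ℂ) (c s') * ∫ y, w s y * (starRingEnd ℂ) (w s' y) := by
    rw [← integral_complex_ofReal]
    have : ∀ y, ((‖∑ s ∈ U, c s * w s y‖ ^ 2 : ℝ) : ℂ) = ∑ s ∈ U, ∑ s' ∈ U, c s * (starRingEnd ℂ) (c s') * (w s y * (starRingEnd ℂ) (w s' y)) := by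
      intro y
      rw [Complex.ofReal_pow, ← Complex.mul_conj', map_sum, Finset.sum_mul_sum]
      refine Finset.sum_congr rfl fun s _ => Finset.sum_congr rfl fun s' _ => ?_
      rw [map_mul]; ring
    simp_rw [this]
    rw [integral_finsetSum _ fun s hs => integrable_finsetSum _ fun s' hs' => (iB s hs s' hs').const_mul _]
    refine Finset.sum_congr rfl fun s hs => ?_
    rw [integral_finsetSum _ fun s' hs' => (iB s hs s' hs').const_mul _]
    refine Finset.sum_congr rfl fun s' hs' => ?_
    rw [integral_const_mul]
  have e2 : ∫ y, ‖∑ s ∈ U, c s * w s y‖ ^ 2 ≤ ∑ s ∈ U, ∑ s' ∈ U, ((if s'.1 = s.1 ∧ s'.2.2 = s.2.2 then ‖c s‖ * ‖c s'‖ * Wp s s' else 0) +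
      (if crs s s' then ‖c s‖ * ‖c s'‖ * Wp s s' else 0) + (if crs s' s then ‖c s'‖ * ‖c s‖ * Wp s' s else 0)) := by
    have : ∫ y, ‖∑ s ∈ U, c s * w s y‖ ^ 2 = ‖((∫ y, ‖∑ s ∈ U, c s * w s y‖ ^ 2 : ℝ) : ℂ)‖ := by
      rw [Complex.norm_real, Real.norm_of_nonneg (integral_nonneg fun y => by positivity)]
    rw [this, e1]
    refine (norm_sum_le _ _).trans (Finset.sum_le_sum fun s hs => (norm_sum_le _ _).trans (Finset.sum_le_sum fun s' hs' => ?_))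
    rw [norm_mul, norm_mul, RCLike.norm_conj]
    have hW := Wp_nonneg s s'
    have hW' := Wp_nonneg s' s
    have n1 : ‖c s‖ * ‖c s'‖ * ‖∫ y, w s y * (starRingEnd ℂ) (w s' y)‖ ≤ ‖c s‖ * ‖c s'‖ * Wp s s' :=
      mul_le_mul_of_nonneg_left (nB s hs s' hs') (by positivity)
    have q1 : 0 ≤ (if s'.1 = s.1 ∧ s'.2.2 = s.2.2 then ‖c s‖ * ‖c s'‖ * Wp s s' else 0) := by split_ifs <;> positivity
    have q2 : 0 ≤ (if crs s s' then ‖c s‖ * ‖c s'‖ * Wp s s' else 0) := by split_ifs <;> positivity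
    have q3 : 0 ≤ (if crs s' s then ‖c s'‖ * ‖c s‖ * Wp s' s else 0) := by split_ifs <;> positivity
    by_cases c1 : s'.1 = s.1 ∧ s'.2.2 = s.2.2
    · rw [if_pos c1]; linarith
    by_cases c2 : crs s s'
    · rw [if_pos c2]; linarith
    by_cases c3 : crs s' s
    · rw [if_pos c3, Wp_comm s' s, mul_comm ‖c s'‖]; linarith
    · have : ∫ y, w s y * (starRingEnd ℂ) (w s' y) = 0 := by
        refine (hw s hs).orth (hw s' hs') fun η => ?_
        rcases le_total s'.1 s.1 with hl | hl
        · exact disj_of hl c2 (fun h => c1 ⟨h.1.symm, h.2.symm⟩) η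
        · exact (disj_of hl c3 c1 η).symm
      rw [this, norm_zero, mul_zero]; linarith
  have e3 : ∑ s ∈ U, ∑ s' ∈ U, (if s'.1 = s.1 ∧ s'.2.2 = s.2.2 then ‖c s‖ * ‖c s'‖ * Wp s s' else 0) ≤ 64 * ∑ s ∈ U, ‖c s‖ ^ 2 / sc s.1 := by
    have a1 : ∀ s ∈ U, ∑ s' ∈ U, (if s'.1 = s.1 ∧ s'.2.2 = s.2.2 then ‖c s‖ ^ 2 * Wp s s' else 0) ≤ 64 * (‖c s‖ ^ 2 / sc s.1) := by
      intro s _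
      have hs := sc_pos s.1
      rw [← Finset.sum_filter, ← Finset.mul_sum]
      have : ∑ s' ∈ U with s'.1 = s.1 ∧ s'.2.2 = s.2.2, Wp s s' ≤ 64 / sc s.1 := by
        unfold Wp
        rw [← integral_finsetSum _ fun s' _ => int_wtwt s s']
        calc _ ≤ ∫ y, wt s.1 (lc s) y * (16 / sc s.1) := by
              refine integral_mono (integrable_finsetSum _ fun s' _ => int_wtwt s s') ((int_wt _ _).mul_const _) fun y => ?_
              simp only
              rw [← Finset.mul_sum]
              refine mul_le_mul_of_nonneg_left ?_ (wt_nonneg _ _ _)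
              rw [le_div_iff₀ hs, Finset.sum_mul]
              refine le_trans (Finset.sum_le_sum fun s' hs' => ?_) (sum_tile_le U s (fun y m => sc s.1 * wt s.1 (m * sc s.1) y) y (sum_wt s.1 y))
              rw [Finset.mem_filter] at hs'
              rw [lc, hs'.2.1, mul_comm]
          _ ≤ 64 / sc s.1 := by
              rw [integral_mul_const, ← mul_div_assoc]
              gcongr; linarith [int_wt_le s.1 (lc s)]
      calc _ ≤ ‖c s‖ ^ 2 * (64 / sc s.1) := by gcongr
        _ = _ := by ring
    have a2 : ∀ s ∈ U, ∀ s' ∈ U, (if s'.1 = s.1 ∧ s'.2.2 = s.2.2 then ‖c s‖ * ‖c s'‖ * Wp s s' else 0) ≤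
        (1/2) * (if s'.1 = s.1 ∧ s'.2.2 = s.2.2 then ‖c s‖ ^ 2 * Wp s s' else 0) + (1/2) * (if s.1 = s'.1 ∧ s.2.2 = s'.2.2 then ‖c s'‖ ^ 2 * Wp s' s else 0) := by
      intro s _ s' _
      by_cases hc : s'.1 = s.1 ∧ s'.2.2 = s.2.2
      · rw [if_pos hc, if_pos hc, if_pos ⟨hc.1.symm, hc.2.symm⟩, Wp_comm s' s]
        have := mul_nonneg (sq_nonneg (‖c s‖ - ‖c s'‖)) (Wp_nonneg s s')
        nlinarith
      · rw [if_neg hc, if_neg hc, if_neg (fun h => hc ⟨h.1.symm, h.2.symm⟩)]; simp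
    calc _ ≤ ∑ s ∈ U, ∑ s' ∈ U, ((1/2) * (if s'.1 = s.1 ∧ s'.2.2 = s.2.2 then ‖c s‖ ^ 2 * Wp s s' else 0) + (1/2) * (if s.1 = s'.1 ∧ s.2.2 = s'.2.2 then ‖c s'‖ ^ 2 * Wp s' s else 0)) :=
          Finset.sum_le_sum fun s hs => Finset.sum_le_sum fun s' hs' => a2 s hs s' hs'
      _ = ∑ s ∈ U, ∑ s' ∈ U, (if s'.1 = s.1 ∧ s'.2.2 = s.2.2 then ‖c s‖ ^ 2 * Wp s s' else 0) := by
          simp_rw [Finset.sum_add_distrib, ← Finset.mul_sum]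
          rw [Finset.sum_comm (f := fun s s' : Tile => (if s.1 = s'.1 ∧ s.2.2 = s'.2.2 then ‖c s'‖ ^ 2 * Wp s' s else 0))]
          ring
      _ ≤ _ := by rw [Finset.mul_sum]; exact Finset.sum_le_sum a1
  refine e2.trans ?_
  simp_rw [Finset.sum_add_distrib]
  rw [Finset.sum_comm (f := fun s s' : Tile => (if crs s' s then ‖c s'‖ * ‖c s‖ * Wp s' s else 0))]
  simp_rw [Finset.sum_filter]
  linarith
end

section
open MeasureTheory Filter Set
open scoped ENNReal Topology

lemma sum_sc {A : Finset ℤ} {K : ℤ} (h : ∀ k ∈ A, k ≤ K) : ∑ k ∈ A, sc k ≤ 2 * sc K := by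
  rcases A.eq_empty_or_nonempty with rfl | hne
  · have := sc_pos K; simp; linarith
  calc _ ≤ ∑ k ∈ Finset.Ico (A.min' hne) (K+1), sc k := by
        refine Finset.sum_le_sum_of_subset_of_nonneg (fun k hk => ?_) fun k _ _ => (sc_pos k).le
        have := A.min'_le k hk; have := h k hk; rw [Finset.mem_Ico]; omega
    _ ≤ sc (K+1) / 63 := sum_geom_sc _ _
    _ ≤ _ := by rw [sc_succ]; have := sc_pos K; linarith
lemma sum_inv_sc {A : Finset ℤ} {j : ℤ} (h : ∀ k ∈ A, j ≤ k) : ∑ k ∈ A, (sc k)⁻¹ ≤ 2 * (sc j)⁻¹ := by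
  rcases A.eq_empty_or_nonempty with rfl | hne
  · have := sc_pos j; simp; positivity
  refine (Finset.sum_le_sum_of_subset_of_nonneg (fun k hk => ?_) fun k _ _ => (inv_pos.2 (sc_pos k)).le).trans (sum_geom_inv' j (A.max' hne))
  have := A.le_max' k hk; have := h k hk; rw [Finset.mem_Icc]; omega

lemma sum_tree (V : Finset Tile) (ξ : ℝ) (hV : ∀ s ∈ V, nix s.1 ξ = s.2.2) (h : ℤ → ℤ → ℝ) (h0 : ∀ k m, 0 ≤ h k m) :
    ∑ s ∈ V, h s.1 s.2.1 ≤ ∑ k ∈ V.image (fun s => s.1), ∑ m ∈ V.image (fun s => s.2.1), h k m := by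
  rw [← Finset.sum_product', ← Finset.sum_image (f := fun p : ℤ × ℤ => h p.1 p.2) (g := fun s : Tile => (s.1, s.2.1))]
  · refine Finset.sum_le_sum_of_subset_of_nonneg (fun p hp => ?_) fun p _ _ => h0 _ _
    obtain ⟨s, hs, rfl⟩ := Finset.mem_image.1 hp
    exact Finset.mem_product.2 ⟨Finset.mem_image_of_mem _ hs, Finset.mem_image_of_mem (fun s : Tile => s.2.1) hs⟩
  · intro s hs s' hs' e
    simp only [Prod.mk.injEq] at e
    refine Prod.ext e.1 (Prod.ext e.2 ?_)
    rw [← hV s hs, ← hV s' hs', e.1]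

lemma iv_disj {j k m n : ℤ} (h : j ≤ k) (hn : ¬ iv j m ⊆ iv k n) : Disjoint (iv j m) (iv k n) :=
  Set.disjoint_left.2 fun _ h1 h2 => hn ((iv_subset_iff_of h h1).2 h2)

lemma lc_mem (s : Tile) : lc s ∈ iv s.1 s.2.1 := left_mem_iv _ _

lemma Wp_le {s s' : Tile} (h : s'.1 ≤ s.1) {z : ℝ} (hz : z ∈ iv s'.1 s'.2.1) :
    Wp s s' ≤ 64 * (sc s.1)⁻¹ * ((1 + |z - lc s| / sc s.1) ^ 4)⁻¹ := by
  have p := sc_pos s.1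
  have p' := sc_pos s'.1
  set A := ((1 + |z - lc s| / sc s.1) ^ 4)⁻¹ with hA
  have hA0 : 0 ≤ A := by positivity
  have key : ∀ y, wt s.1 (lc s) y * wt s'.1 (lc s') y ≤ 16 * (sc s.1)⁻¹ * A * ((sc s'.1)⁻¹ * ((1 + |y - lc s'| / sc s'.1) ^ 2)⁻¹) := by
    intro y
    set B := |y - lc s'| / sc s'.1 with hB
    have hB0 : 0 ≤ B := by positivity
    have hC0 : 0 ≤ |y - lc s| / sc s.1 := by positivity
    have h1 : 1 + |z - lc s| / sc s.1 ≤ 2 * (1 + |y - lc s| / sc s.1) * (1 + B) := by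
      have h2 : |z - lc s'| ≤ sc s'.1 := by
        rw [mem_iv, idx_iff] at hz
        unfold lc; rw [abs_le]; constructor <;> linarith [hz.1, hz.2]
      have h3 : |z - lc s| ≤ |y - lc s| + |y - lc s'| + sc s'.1 := by
        have a := abs_sub_le z y (lc s)
        have b := abs_sub_le z (lc s') y
        rw [abs_sub_comm (lc s') y] at b; linarith
      have h4 : |z - lc s| / sc s.1 ≤ |y - lc s| / sc s.1 + (1 + B) := by
        have h5 : (|y - lc s'| + sc s'.1) / sc s.1 ≤ 1 + B := by
          have : 1 + B = (|y - lc s'| + sc s'.1) / sc s'.1 := by rw [hB]; field_simp; ring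
          rw [this]
          exact div_le_div_of_nonneg_left (by positivity) p' (sc_mono h)
        calc _ ≤ (|y - lc s| + (|y - lc s'| + sc s'.1)) / sc s.1 := by gcongr; linarith
          _ = |y - lc s| / sc s.1 + (|y - lc s'| + sc s'.1) / sc s.1 := by ring
          _ ≤ _ := by gcongr
      nlinarith
    have h2 : ((1 + |y - lc s| / sc s.1) ^ 6)⁻¹ ≤ 16 * A * (1 + B) ^ 4 := by
      refine (pow_inv_mono hC0 (by norm_num : 4 ≤ 6)).trans ?_
      rw [inv_le_iff_one_le_mul₀ (by positivity), hA]
      have := pow_le_pow_left₀ (by positivity) h1 4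
      rw [mul_pow, mul_pow] at this
      have hq : 0 < (1 + |z - lc s| / sc s.1) ^ 4 := by positivity
      calc (1:ℝ) ≤ (2 ^ 4 * (1 + |y - lc s| / sc s.1) ^ 4 * (1 + B) ^ 4) / (1 + |z - lc s| / sc s.1) ^ 4 := by
            rw [le_div_iff₀ hq]; linarith
        _ = _ := by rw [div_eq_mul_inv]; ring
    unfold wt
    rw [← hB]
    calc _ ≤ (sc s.1)⁻¹ * (16 * A * (1 + B) ^ 4) * ((sc s'.1)⁻¹ * ((1 + B) ^ 6)⁻¹) := by gcongr
      _ = 16 * (sc s.1)⁻¹ * A * ((sc s'.1)⁻¹ * ((1 + B) ^ 4 * ((1 + B) ^ 6)⁻¹)) := by ring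
      _ = _ := by
        congr 3
        have : (1 + B) ≠ 0 := by positivity
        field_simp
  unfold Wp
  refine (integral_mono (int_wtwt s s') (((int_vs (lc s') p').const_mul _).const_mul _) key).trans ?_
  rw [integral_const_mul, integral_const_mul]
  have : (sc s'.1)⁻¹ * ∫ y, ((1 + |y - lc s'| / sc s'.1) ^ 2)⁻¹ ≤ 4 := by
    rw [inv_mul_le_iff₀ p']; linarith [int_vs_le (lc s') p']
  calc _ ≤ 16 * (sc s.1)⁻¹ * A * 4 := by gcongr
    _ = _ := by ring

abbrev Tp := ℤ × ℤ × ℝ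
/-- membership in the down-set below a top -/
def InD (t : Tp) (s : Tile) : Prop := iv s.1 s.2.1 ⊆ iv t.1 t.2.1 ∧ nix s.1 t.2.2 = s.2.2
def In2 (t : Tp) (s : Tile) : Prop := InD t s ∧ c2 s.1 t.2.2

lemma nix_self (k n : ℤ) : nix k (n / sc k) = n :=
  nix_iff.2 ⟨le_rfl, by have := sc_pos k; gcongr; linarith⟩

lemma crs_lt {s s' : Tile} {ξ : ℝ} (h : nix s.1 ξ = s.2.2) (hc : crs s s') :
    nix s'.1 ξ = s'.2.2 ∧ ξ < (s'.2.2 + 1/2) / sc s'.1 := by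
  obtain ⟨h1, h2, h3⟩ := hc
  have e : nix s.1 ξ = nix s.1 (s.2.2 / sc s.1) := h.trans (nix_self _ _).symm
  refine ⟨(nix_down h1.le e).trans h2, ?_⟩
  have e2 := nix_down (by omega : s'.1 + 1 ≤ s.1) e
  have p := sc_pos s'.1
  obtain ⟨q, hq⟩ : ∃ q, q = nix (s'.1+1) ξ := ⟨_, rfl⟩
  have a1 := (nix_iff.1 hq.symm).2
  have a2 := (nix_iff.1 (e2.symm.trans hq.symm)).1
  rw [sc_succ] at a1 a2
  have : (q:ℝ) < 64 * s'.2.2 + 32 := by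
    have := a2.trans_lt h3
    rw [div_lt_div_iff₀ (by positivity) p] at this
    nlinarith
  have : q + 1 ≤ 64 * s'.2.2 + 32 := by exact_mod_cast this
  have : (q:ℝ) + 1 ≤ 64 * s'.2.2 + 32 := by exact_mod_cast this
  refine a1.trans_le ?_
  rw [div_le_div_iff₀ (by positivity) p]
  nlinarith

structure Forest (U : Finset Tile) (τ : Tile → Tp) : Prop where
  mem : ∀ s ∈ U, In2 (τ s) s
  sep : ∀ s ∈ U, ∀ s' ∈ U, (τ s).2.2 < (τ s').2.2 → ¬ InD (τ s) s'

lemma Forest.disj {U : Finset Tile} {τ : Tile → Tp} (h : Forest U τ) {s s' : Tile} (hs : s ∈ U) (hs' : s' ∈ U) (hc : crs s s') :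
    Disjoint (iv s'.1 s'.2.1) (iv (τ s).1 (τ s).2.1) := by
  have h1 := crs_lt (h.mem s hs).1.2 hc
  have h2 := c2_bd (h.mem s' hs').1.2 (h.mem s' hs').2
  have h3 := h.sep s hs s' hs' (h1.2.trans_le h2.1)
  exact iv_disj (hc.1.le.trans (le_of_iv_subset (h.mem s hs).1.1)) fun h4 => h3 ⟨h4, h1.1⟩

lemma Forest.disj2 {U : Finset Tile} {τ : Tile → Tp} (h : Forest U τ) {s s' s'' : Tile} (hs' : s' ∈ U) (hs'' : s'' ∈ U)
    (hc : crs s s') (hc' : crs s s'') (hne : s' ≠ s'') : Disjoint (iv s'.1 s'.2.1) (iv s''.1 s''.2.1) := by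
  wlog hl : s'.1 ≤ s''.1 generalizing s' s''
  · exact (this hs'' hs' hc' hc hne.symm (by omega)).symm
  refine iv_disj hl fun hsub => ?_
  rcases hl.lt_or_eq with hl | hl
  · have h1 : crs s'' s' := by
      refine ⟨hl, ?_, ?_⟩
      · rw [← hc.2.1]
        exact nix_down hl.le ((nix_self _ _).trans hc'.2.1.symm)
      · exact (nix_iff.1 hc'.2.1).1.trans_lt hc.2.2
    have h2 := crs_lt (h.mem s'' hs'').1.2 h1
    have h3 := c2_bd (h.mem s' hs').1.2 (h.mem s' hs').2
    exact h.sep s'' hs'' s' hs' (h2.2.trans_le h3.1) ⟨hsub.trans (h.mem s'' hs'').1.1, h2.1⟩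
  · refine hne (Prod.ext hl (Prod.ext ?_ ?_))
    · have := hsub (lc_mem s'); have h2 := mem_iv.1 (lc_mem s')
      rw [mem_iv, ← hl] at this; rw [← this, ← h2]
    · rw [← hc.2.1, ← hc'.2.1, hl]

lemma int_v4 (c : ℝ) {S : ℝ} (hS : 0 < S) : Integrable fun t : ℝ => ((1 + |t - c| / S) ^ 4)⁻¹ := by
  refine (int_vs c hS).mono' (continuous_inv_pow c hS 4).aestronglyMeasurable (ae_of_all _ fun t => ?_)
  rw [Real.norm_of_nonneg (by positivity)]
  exact pow_inv_mono (by positivity) (by norm_num)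

open Classical in
lemma Forest.cross {U : Finset Tile} {τ : Tile → Tp} (h : Forest U τ) :
    ∑ s ∈ U, ∑ s' ∈ U with crs s s', sc s.1 * sc s'.1 * Wp s s' ≤ 16384 * ∑ t ∈ U.image τ, sc t.1 := by
  have a1 : ∀ s ∈ U, ∑ s' ∈ U with crs s s', sc s.1 * sc s'.1 * Wp s s' ≤
      64 * ∫ z in (iv (τ s).1 (τ s).2.1)ᶜ, ((1 + |z - lc s| / sc s.1) ^ 4)⁻¹ := by
    intro s hs
    have p := sc_pos s.1
    have hi := int_v4 (lc s) p
    calc _ ≤ ∑ s' ∈ U with crs s s', 64 * ∫ z in iv s'.1 s'.2.1, ((1 + |z - lc s| / sc s.1) ^ 4)⁻¹ := by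
          refine Finset.sum_le_sum fun s' hs' => ?_
          rw [Finset.mem_filter] at hs'
          have p' := sc_pos s'.1
          have : ∫ z in iv s'.1 s'.2.1, sc s.1 * Wp s s' ≤ ∫ z in iv s'.1 s'.2.1, 64 * ((1 + |z - lc s| / sc s.1) ^ 4)⁻¹ := by
            refine setIntegral_mono_on ?_ (hi.const_mul _).integrableOn (measurableSet_iv _ _) fun z hz => ?_
            · exact integrableOn_const (by rw [volume_iv]; exact ENNReal.ofReal_ne_top)
            · have := Wp_le hs'.2.1.le hz
              calc _ ≤ sc s.1 * (64 * (sc s.1)⁻¹ * ((1 + |z - lc s| / sc s.1) ^ 4)⁻¹) := by gcongr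
                _ = _ := by field_simp
          rw [setIntegral_const, smul_eq_mul, Measure.real, volume_iv, ENNReal.toReal_ofReal p'.le, integral_const_mul] at this
          linarith
      _ = 64 * ∫ z in ⋃ s' ∈ U.filter (fun s' => crs s s'), iv s'.1 s'.2.1, ((1 + |z - lc s| / sc s.1) ^ 4)⁻¹ := by
          rw [← Finset.mul_sum, integral_biUnion_finset _ (fun s' _ => measurableSet_iv _ _) ?_ (fun s' _ => hi.integrableOn)]
          intro s' h1 s'' h2 hne
          rw [Finset.mem_coe, Finset.mem_filter] at h1 h2
          exact h.disj2 h1.1 h2.1 h1.2 h2.2 hne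
      _ ≤ _ := by
          gcongr ?_ * ?_
          refine setIntegral_mono_set hi.integrableOn (ae_of_all _ fun z => by simp only [Pi.zero_apply]; positivity) (LE.le.eventuallyLE ?_)
          refine iUnion₂_subset fun s' h1 => ?_
          rw [Finset.mem_filter] at h1
          exact (h.disj hs h1.1 h1.2).subset_compl_right
  have a2 : ∀ t ∈ U.image τ, ∑ s ∈ U with τ s = t, 64 * ∫ z in (iv t.1 t.2.1)ᶜ, ((1 + |z - lc s| / sc s.1) ^ 4)⁻¹ ≤ 16384 * sc t.1 := by
    intro t _
    set V := U.filter (fun s => τ s = t) with hV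
    have hVm : ∀ s ∈ V, In2 t s := by
      intro s hs; rw [hV, Finset.mem_filter] at hs; rw [← hs.2]; exact h.mem s hs.1
    set p := t.2.1 * sc t.1 with hp
    set q := (t.2.1 + 1) * sc t.1 with hq
    set H : ℤ → ℝ → ℝ := fun k z => 16 * (((1 + |z - p| / sc k) ^ 2)⁻¹ + ((1 + |z - q| / sc k) ^ 2)⁻¹) with hH
    have iH : ∀ k, Integrable (H k) := fun k => ((int_vs p (sc_pos k)).add (int_vs q (sc_pos k))).const_mul _
    have b1 : ∀ z ∈ (iv t.1 t.2.1)ᶜ, ∑ s ∈ V, ((1 + |z - lc s| / sc s.1) ^ 4)⁻¹ ≤ ∑ k ∈ V.image (fun s => s.1), H k z := by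
      intro z hz
      calc _ ≤ ∑ s ∈ V, ((1 + |z - s.2.1 * sc s.1| / sc s.1) ^ 2)⁻¹ * (((1 + |z - p| / sc s.1) ^ 2)⁻¹ + ((1 + |z - q| / sc s.1) ^ 2)⁻¹) := by
            refine Finset.sum_le_sum fun s hs => ?_
            have ps := sc_pos s.1
            have hb := hVm s hs
            have hb := hb.1.1 (lc_mem s)
            rw [mem_iv, idx_iff] at hb
            rw [mem_compl_iff, mem_iv, idx_iff, not_and_or] at hz
            rw [show ((1 + |z - lc s| / sc s.1) ^ 4)⁻¹ = ((1 + |z - s.2.1 * sc s.1| / sc s.1) ^ 2)⁻¹ * ((1 + |z - lc s| / sc s.1) ^ 2)⁻¹ by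
              show _ = ((1 + |z - lc s| / sc s.1) ^ 2)⁻¹ * _; rw [← mul_inv, ← pow_add]]
            gcongr ?_ * ?_
            rcases hz with hz | hz
            · push Not at hz
              have : ((1 + |z - lc s| / sc s.1) ^ 2)⁻¹ ≤ ((1 + |z - p| / sc s.1) ^ 2)⁻¹ := by
                apply inv_anti₀ (by positivity)
                gcongr ((1 + ?_ / _) ^ 2)
                rw [abs_of_nonpos (by linarith), abs_of_nonpos (by linarith)]; linarith
              have : 0 ≤ ((1 + |z - q| / sc s.1) ^ 2)⁻¹ := by positivity
              linarith
            · push Not at hz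
              have : ((1 + |z - lc s| / sc s.1) ^ 2)⁻¹ ≤ ((1 + |z - q| / sc s.1) ^ 2)⁻¹ := by
                apply inv_anti₀ (by positivity)
                gcongr ((1 + ?_ / _) ^ 2)
                rw [abs_of_nonneg (by linarith), abs_of_nonneg (by linarith)]; linarith
              have : 0 ≤ ((1 + |z - p| / sc s.1) ^ 2)⁻¹ := by positivity
              linarith
        _ ≤ ∑ k ∈ V.image (fun s => s.1), ∑ m ∈ V.image (fun s => s.2.1), ((1 + |z - m * sc k| / sc k) ^ 2)⁻¹ * (((1 + |z - p| / sc k) ^ 2)⁻¹ + ((1 + |z - q| / sc k) ^ 2)⁻¹) :=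
            sum_tree V t.2.2 (fun s hs => (hVm s hs).1.2) (fun k m => ((1 + |z - m * sc k| / sc k) ^ 2)⁻¹ * (((1 + |z - p| / sc k) ^ 2)⁻¹ + ((1 + |z - q| / sc k) ^ 2)⁻¹))
              fun k m => by have := sc_pos k; positivity
        _ ≤ _ := by
            refine Finset.sum_le_sum fun k _ => ?_
            have := sc_pos k
            rw [← Finset.sum_mul]
            exact mul_le_mul_of_nonneg_right (sum_v k z _) (by positivity)
    have hi : ∀ s, Integrable fun z => ((1 + |z - lc s| / sc s.1) ^ 4)⁻¹ := fun s => int_v4 (lc s) (sc_pos s.1)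
    rw [← Finset.mul_sum, ← integral_finsetSum _ fun s _ => (hi s).integrableOn]
    have b2 : ∫ z in (iv t.1 t.2.1)ᶜ, ∑ s ∈ V, ((1 + |z - lc s| / sc s.1) ^ 4)⁻¹ ≤ ∑ k ∈ V.image (fun s => s.1), 128 * sc k := by
      calc _ ≤ ∫ z in (iv t.1 t.2.1)ᶜ, ∑ k ∈ V.image (fun s => s.1), H k z :=
            setIntegral_mono_on (integrable_finsetSum _ fun s _ => hi s).integrableOn (integrable_finsetSum _ fun k _ => iH k).integrableOn (measurableSet_iv _ _).compl b1
        _ ≤ ∫ z, ∑ k ∈ V.image (fun s => s.1), H k z :=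
            setIntegral_le_integral (integrable_finsetSum _ fun k _ => iH k) (ae_of_all _ fun z => Finset.sum_nonneg fun k _ => by have := sc_pos k; simp only [hH]; positivity)
        _ = ∑ k ∈ V.image (fun s => s.1), ∫ z, H k z := integral_finsetSum _ fun k _ => iH k
        _ ≤ _ := by
            refine Finset.sum_le_sum fun k _ => ?_
            simp only [hH]
            rw [integral_const_mul, integral_add (int_vs p (sc_pos k)) (int_vs q (sc_pos k))]
            linarith [int_vs_le p (sc_pos k), int_vs_le q (sc_pos k)]
    rw [← Finset.mul_sum] at b2
    have := sum_sc (A := V.image (fun s => s.1)) (K := t.1) (fun k hk => by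
      obtain ⟨s, hs, rfl⟩ := Finset.mem_image.1 hk
      exact le_of_iv_subset (hVm s hs).1.1)
    linarith
  refine (Finset.sum_le_sum a1).trans ?_
  rw [← Finset.sum_fiberwise_of_maps_to (fun s hs => Finset.mem_image_of_mem τ hs), Finset.mul_sum]
  refine Finset.sum_le_sum fun t ht => le_trans (le_of_eq ?_) (a2 t ht)
  refine Finset.sum_congr rfl fun s hs => ?_
  rw [(Finset.mem_filter.1 hs).2]
end

section
open MeasureTheory Filter Set
open scoped ENNReal Topology

structure Nice (f : ℝ → ℂ) : Prop where
  meas : Measurable f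
  bdd : ∃ B : ℝ, 0 ≤ B ∧ ∀ x, ‖f x‖ ≤ B
  int : Integrable f

lemma Nice.sq {f : ℝ → ℂ} (h : Nice f) : Integrable fun x => ‖f x‖ ^ 2 := by
  obtain ⟨B, _, hB⟩ := h.bdd
  simp only [pow_two]
  exact h.int.norm.mul_bdd (c := B) h.int.norm.aestronglyMeasurable (ae_of_all _ fun x => by simpa using hB x)
lemma Nice.mulPk {f : ℝ → ℂ} (h : Nice f) {s : Tile} {w : ℝ → ℂ} (hw : Pk s w) : Integrable fun x => f x * w x := by
  obtain ⟨B, _, hB⟩ := h.bdd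
  exact hw.int.bdd_mul (c := B) h.meas.aestronglyMeasurable (ae_of_all _ hB)

lemma Pk.zero (s : Tile) : Pk s (fun _ => 0) where
  cont := continuous_const
  dec y := by simpa using wt_nonneg _ _ _
  lip ξ _ y y' := by
    have := wt_nonneg s.1 (lc s) y; have := wt_nonneg s.1 (lc s) y'; have := sc_pos s.1
    simp; positivity
  ft η _ := by simp

noncomputable def FF (f : ℝ → ℂ) (s : Tile) : ℝ := sSup {r | ∃ w, Pk s w ∧ r = ‖∫ x, f x * w x‖}

lemma FF_bdd {f : ℝ → ℂ} (h : Nice f) (s : Tile) : BddAbove {r | ∃ w, Pk s w ∧ r = ‖∫ x, f x * w x‖} := by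
  obtain ⟨B, _, hB⟩ := h.bdd
  refine ⟨∫ x, B * wt s.1 (lc s) x, ?_⟩
  rintro r ⟨w, hw, rfl⟩
  refine norm_integral_le_of_norm_le ((int_wt _ _).const_mul B) (ae_of_all _ fun x => ?_)
  rw [norm_mul]
  exact mul_le_mul (hB x) (hw.dec x) (norm_nonneg _) (by linarith [norm_nonneg (f x), hB x])
lemma le_FF {f : ℝ → ℂ} (h : Nice f) {s : Tile} {w : ℝ → ℂ} (hw : Pk s w) : ‖∫ x, f x * w x‖ ≤ FF f s :=
  le_csSup (FF_bdd h s) ⟨w, hw, rfl⟩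
lemma FF_nonneg {f : ℝ → ℂ} (h : Nice f) (s : Tile) : 0 ≤ FF f s := (norm_nonneg _).trans (le_FF h (Pk.zero s))
lemma FF_max {f : ℝ → ℂ} (h : Nice f) (s : Tile) : ∃ w, Pk s w ∧ FF f s ≤ 2 * ‖∫ x, f x * w x‖ := by
  rcases (FF_nonneg h s).eq_or_lt with h0 | h0
  · exact ⟨_, Pk.zero s, by rw [← h0]; positivity⟩
  · obtain ⟨r, ⟨w, hw, rfl⟩, hr⟩ := exists_lt_of_lt_csSup (s := {r | ∃ w, Pk s w ∧ r = ‖∫ x, f x * w x‖}) (b := FF f s / 2) ⟨_, _, Pk.zero s, rfl⟩ (show _ < FF f s by linarith)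
    exact ⟨w, hw, by linarith⟩

open Classical in
/-- energy bound -/
def EB (f : ℝ → ℂ) (P : Finset Tile) (E : ℝ) : Prop :=
  ∀ t : Tp, ∑ s ∈ P with In2 t s, sc s.1 * FF f s ^ 2 ≤ E ^ 2 * sc t.1

lemma mid_nix (k n : ℤ) : nix k ((n + 1/2) / sc k) = n ∧ c2 k ((n + 1/2) / sc k) := by
  have p := sc_pos k
  have h1 : nix k ((n + 1/2) / sc k) = n := nix_iff.2 ⟨by gcongr; linarith, by gcongr; linarith⟩
  refine ⟨h1, ?_⟩
  unfold c2; rw [h1, nix_iff, sc_succ]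
  push_cast
  constructor
  · rw [div_le_div_iff₀ (by positivity) p]; nlinarith
  · rw [div_lt_div_iff₀ p (by positivity)]; nlinarith

lemma EB.le {f : ℝ → ℂ} (hf : Nice f) {P : Finset Tile} {E : ℝ} (hE : 0 ≤ E) (h : EB f P E) {s : Tile} (hs : s ∈ P) : FF f s ≤ E := by
  classical
  have p := sc_pos s.1
  have h1 := h (s.1, s.2.1, (s.2.2 + 1/2) / sc s.1)
  have h2 : sc s.1 * FF f s ^ 2 ≤ E ^ 2 * sc s.1 := by
    refine le_trans ?_ h1
    refine Finset.single_le_sum (f := fun s : Tile => sc s.1 * FF f s ^ 2) (fun s _ => by have := sc_pos s.1; positivity) ?_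
    rw [Finset.mem_filter]
    exact ⟨hs, ⟨subset_rfl, (mid_nix _ _).1⟩, (mid_nix _ _).2⟩
  have h3 : FF f s ^ 2 ≤ E ^ 2 := by nlinarith
  exact (sq_le_sq₀ (FF_nonneg hf s) hE).1 h3

open Classical in
lemma forest_energy {f : ℝ → ℂ} (hf : Nice f) {U : Finset Tile} {τ : Tile → Tp} (h : Forest U τ) {E : ℝ} 
    (h1 : ∀ s ∈ U, FF f s ≤ E) (h2 : ∀ t ∈ U.image τ, (E/2)^2 * sc t.1 ≤ ∑ s ∈ U with τ s = t, sc s.1 * FF f s ^ 2) :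
    E ^ 2 * ∑ t ∈ U.image τ, sc t.1 ≤ 2 ^ 24 * ∫ x, ‖f x‖ ^ 2 := by
  choose w hw hm using FF_max hf
  set a : Tile → ℂ := fun s => ∫ x, f x * w s x with ha
  set c : Tile → ℂ := fun s => sc s.1 * (starRingEnd ℂ) (a s) with hc
  set X := ∑ s ∈ U, sc s.1 * ‖a s‖ ^ 2 with hX
  have hX0 : 0 ≤ X := Finset.sum_nonneg fun s _ => by have := sc_pos s.1; positivity
  have nc : ∀ s, ‖c s‖ = sc s.1 * ‖a s‖ := fun s => by
    rw [hc]; simp [abs_of_pos (sc_pos s.1)]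
  have haF : ∀ s, ‖a s‖ ≤ FF f s := fun s => le_FF hf (hw s)
  have hFX : ∑ s ∈ U, sc s.1 * FF f s ^ 2 ≤ 4 * X := by
    rw [hX, Finset.mul_sum]
    refine Finset.sum_le_sum fun s _ => ?_
    have := sc_pos s.1
    have := pow_le_pow_left₀ (FF_nonneg hf s) (hm s) 2
    nlinarith
  have hS : E ^ 2 * ∑ t ∈ U.image τ, sc t.1 ≤ 4 * ∑ s ∈ U, sc s.1 * FF f s ^ 2 := by
    rw [← Finset.sum_fiberwise_of_maps_to (fun s hs => Finset.mem_image_of_mem τ hs), Finset.mul_sum, Finset.mul_sum]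
    refine Finset.sum_le_sum fun t ht => ?_
    have := h2 t ht
    linarith
  have hB := bessel U w (fun s _ => hw s) c
  have hcr : ∑ s ∈ U, ∑ s' ∈ U with crs s s', ‖c s‖ * ‖c s'‖ * Wp s s' ≤ 2 ^ 18 * X := by
    calc _ ≤ ∑ s ∈ U, ∑ s' ∈ U with crs s s', E ^ 2 * (sc s.1 * sc s'.1 * Wp s s') := by
          refine Finset.sum_le_sum fun s hs => Finset.sum_le_sum fun s' hs' => ?_
          have hs' := (Finset.mem_filter.1 hs').1
          have := sc_pos s.1; have := sc_pos s'.1; have := Wp_nonneg s s'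
          rw [nc, nc]
          have e1 := (haF s).trans (h1 s hs); have e2 := (haF s').trans (h1 s' hs')
          have e0 := norm_nonneg (a s); have e0' := norm_nonneg (a s')
          have : ‖a s‖ * ‖a s'‖ ≤ E ^ 2 := by rw [sq]; gcongr; linarith
          calc _ = (‖a s‖ * ‖a s'‖) * (sc s.1 * sc s'.1 * Wp s s') := by ring
            _ ≤ _ := by gcongr
      _ = E ^ 2 * ∑ s ∈ U, ∑ s' ∈ U with crs s s', (sc s.1 * sc s'.1 * Wp s s') := by simp only [Finset.mul_sum]
      _ ≤ E ^ 2 * (16384 * ∑ t ∈ U.image τ, sc t.1) := by gcongr; exact h.cross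
      _ ≤ _ := by linarith
  have hdiag : ∑ s ∈ U, ‖c s‖ ^ 2 / sc s.1 = X := by
    refine Finset.sum_congr rfl fun s _ => ?_
    have := sc_pos s.1
    rw [nc]; field_simp
  rw [hdiag] at hB
  have iw : ∀ s ∈ U, Integrable fun x => c s * w s x := fun s _ => (hw s).int.const_mul _
  set Ψ : ℝ → ℂ := fun y => ∑ s ∈ U, c s * w s y with hΨ
  have cΨ : Continuous Ψ := continuous_finsetSum _ fun s _ => ((hw s).cont).const_smul (c s) 
  have iΨ : Integrable Ψ := integrable_finsetSum _ iw
  have bΨ : ∃ B, ∀ y, ‖Ψ y‖ ≤ B := by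
    refine ⟨∑ s ∈ U, ‖c s‖ * (sc s.1)⁻¹, fun y => (norm_sum_le _ _).trans (Finset.sum_le_sum fun s _ => ?_)⟩
    rw [norm_mul]; gcongr; exact ((hw s).dec y).trans (wt_le _ _ _)
  obtain ⟨B, hB'⟩ := bΨ
  have iΨ2 : Integrable fun y => ‖Ψ y‖ ^ 2 := by
    simp only [sq]
    exact iΨ.norm.mul_bdd (c := B) iΨ.norm.aestronglyMeasurable (ae_of_all _ fun x => by simpa using hB' x)
  have eX : (X : ℂ) = ∫ y, f y * Ψ y := by
    simp only [hΨ, Finset.mul_sum]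
    rw [integral_finsetSum]
    · rw [hX]; push_cast
      refine Finset.sum_congr rfl fun s _ => ?_
      have : (fun y => f y * (c s * w s y)) = fun y => c s * (f y * w s y) := by ext; ring
      rw [this, integral_const_mul, ← Complex.ofReal_pow, ← Complex.normSq_eq_norm_sq, ← Complex.mul_conj]
      simp only [hc, ha]; ring
    · intro s _
      have : (fun y => f y * (c s * w s y)) = fun y => c s * (f y * w s y) := by ext; ring
      rw [this]; exact (hf.mulPk (hw s)).const_mul _
  have hle : X ≤ ∫ y, (2 ^ 19 * ‖f y‖ ^ 2 + (2^21)⁻¹ * ‖Ψ y‖ ^ 2) := by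
    have : ‖(X:ℂ)‖ ≤ ∫ y, (2 ^ 19 * ‖f y‖ ^ 2 + (2^21)⁻¹ * ‖Ψ y‖ ^ 2) := by
      rw [eX]
      refine norm_integral_le_of_norm_le ((hf.sq.const_mul _).add (iΨ2.const_mul _)) (ae_of_all _ fun y => ?_)
      rw [norm_mul]
      nlinarith [sq_nonneg (2 ^ 20 * ‖f y‖ - ‖Ψ y‖)]
    rwa [Complex.norm_real, Real.norm_of_nonneg hX0] at this
  rw [integral_add (hf.sq.const_mul _) (iΨ2.const_mul _), integral_const_mul, integral_const_mul] at hle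
  linarith

/-- the order on tiles -/
def tle (s s' : Tile) : Prop := iv s.1 s.2.1 ⊆ iv s'.1 s'.2.1 ∧ nix s.1 (s'.2.2 / sc s'.1) = s.2.2
lemma tle.inD {s s' : Tile} (h : tle s s') {t : Tp} (ht : InD t s') : InD t s :=
  ⟨h.1.trans ht.1, (nix_down (le_of_iv_subset h.1) (ht.2.trans (nix_self _ _).symm)).trans h.2⟩

open Classical in
def bad (f : ℝ → ℂ) (E : ℝ) (P : Finset Tile) (t : Tp) : Prop := 
  (E/2) ^ 2 * sc t.1 < ∑ s ∈ P with In2 t s, sc s.1 * FF f s ^ 2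

noncomputable def mid (s : Tile) : ℝ := (s.2.2 + 1/2) / sc s.1

lemma bad.mono {f : ℝ → ℂ} {E : ℝ} {P P' : Finset Tile} (hP : P' ⊆ P) {t : Tp} (h : bad f E P' t) : bad f E P t := by
  classical
  refine lt_of_lt_of_le h ?_
  refine Finset.sum_le_sum_of_subset_of_nonneg (Finset.filter_subset_filter _ hP) fun s _ _ => ?_
  have := sc_pos s.1; positivity

lemma bad.cand {f : ℝ → ℂ} {E : ℝ} {P : Finset Tile} {t : Tp} (h : bad f E P t) :
    ∃ s ∈ P, bad f E P (t.1, t.2.1, mid s) := by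
  classical
  have hne : (P.filter (In2 t)).Nonempty := by
    by_contra hn
    rw [Finset.not_nonempty_iff_eq_empty] at hn
    have := sc_pos t.1
    unfold bad at h
    rw [hn, Finset.sum_empty] at h
    nlinarith [sq_nonneg (E/2)]
  obtain ⟨s, hs, hmax⟩ := Finset.exists_max_image _ (fun s : Tile => s.1) hne
  rw [Finset.mem_filter] at hs
  refine ⟨s, hs.1, lt_of_lt_of_le h ?_⟩
  refine Finset.sum_le_sum_of_subset_of_nonneg (fun s' hs' => ?_) fun s _ _ => by have := sc_pos s.1; positivity
  have hk := hmax s' hs'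
  rw [Finset.mem_filter] at hs' ⊢
  have e0 := mid_nix s.1 s.2.2
  have e : nix (s.1+1) (mid s) = nix (s.1+1) t.2.2 := by
    have a := hs.2.2; have b := e0.2
    unfold c2 at a b
    rw [e0.1] at b
    rw [hs.2.1.2] at a
    rw [a, ← b]; rfl
  refine ⟨hs'.1, ⟨hs'.2.1.1, ?_⟩, ?_⟩
  · rw [← hs'.2.1.2]; exact nix_down (by omega) e
  · have := hs'.2.2
    unfold c2 at this ⊢
    dsimp only
    rwa [nix_down (by omega) e, nix_down (by omega : s'.1 ≤ s.1 + 1) e]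

open Classical in
lemma select (f : ℝ → ℂ) (E : ℝ) : ∀ n, ∀ P : Finset Tile, P.card ≤ n → ∃ (U : Finset Tile) (τ : Tile → Tp),
    U ⊆ P ∧ Forest U τ ∧ EB f (P.filter fun s => ∀ t ∈ U.image τ, ¬ InD t s) (E/2) ∧
    (∀ s ∈ U, bad f E P (τ s) ∧ (τ s).2.2 ∈ P.image mid) ∧
    ∀ t ∈ U.image τ, (E/2)^2 * sc t.1 ≤ ∑ s ∈ U with τ s = t, sc s.1 * FF f s ^ 2 := by
  intro n
  induction n with
  | zero =>
    intro P hP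
    have : P = ∅ := Finset.card_eq_zero.1 (by omega)
    subst this
    refine ⟨∅, fun _ => (0,0,0), by simp, ⟨by simp, by simp⟩, fun t => ?_, by simp, by simp⟩
    have := sc_pos t.1
    simp; positivity
  | succ n ih =>
    intro P hP
    by_cases hb : ∃ t, bad f E P t
    · obtain ⟨t0, ht0⟩ := hb
      obtain ⟨s0, hs0, hb0⟩ := ht0.cand
      have hne : ((P.image mid).filter fun ξ => ∃ K M, bad f E P (K, M, ξ)).Nonempty :=
        ⟨mid s0, Finset.mem_filter.2 ⟨Finset.mem_image_of_mem _ hs0, _, _, hb0⟩⟩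
      obtain ⟨ξ, hξ, hmin⟩ := Finset.exists_min_image _ id hne
      rw [Finset.mem_filter] at hξ
      obtain ⟨hξ, K, M, hbt⟩ := hξ
      set t : Tp := (K, M, ξ) with ht
      set T := P.filter (In2 t) with hT
      set P1 := P.filter (fun s => ¬ InD t s) with hP1
      have hTne : T.Nonempty := by
        by_contra hn
        rw [Finset.not_nonempty_iff_eq_empty] at hn
        have := sc_pos t.1
        unfold bad at hbt
        rw [← hT, hn, Finset.sum_empty] at hbt
        nlinarith [sq_nonneg (E/2)]
      have hc : P1.card ≤ n := by
        have : P1 ⊂ P := by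
          rw [hP1, Finset.filter_ssubset]
          obtain ⟨s, hs⟩ := hTne
          rw [hT, Finset.mem_filter] at hs
          exact ⟨s, hs.1, not_not.2 hs.2.1⟩
        have := Finset.card_lt_card this; omega
      obtain ⟨U1, τ1, a1, a2, a3, a4, a5⟩ := ih P1 hc
      set τ : Tile → Tp := fun s => if In2 t s then t else τ1 s with hτ
      have hP1P : P1 ⊆ P := Finset.filter_subset _ _
      have nD : ∀ s ∈ U1, ¬ InD t s := fun s hs => (Finset.mem_filter.1 (a1 hs)).2
      have τU : ∀ s ∈ U1, τ s = τ1 s := fun s hs => by rw [hτ]; exact if_neg fun h => nD s hs h.1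
      have τT : ∀ s ∈ T, τ s = t := fun s hs => by rw [hτ]; exact if_pos (Finset.mem_filter.1 hs).2
      have hge : ∀ s ∈ U1, ξ ≤ (τ1 s).2.2 := fun s hs => by
        refine hmin _ (Finset.mem_filter.2 ⟨Finset.image_subset_image hP1P (a4 s hs).2, (τ1 s).1, (τ1 s).2.1, (a4 s hs).1.mono hP1P⟩)
      have him : (T ∪ U1).image τ = insert t (U1.image τ1) := by
        rw [Finset.image_union, Finset.insert_eq]
        congr 1
        · rw [Finset.image_congr (g := fun _ => t) fun s hs => τT s hs, Finset.image_const hTne]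
        · exact Finset.image_congr fun s hs => τU s hs
      refine ⟨T ∪ U1, τ, Finset.union_subset (Finset.filter_subset _ _) (a1.trans hP1P), ⟨?_, ?_⟩, ?_, ?_, ?_⟩
      · intro s hs
        rcases Finset.mem_union.1 hs with hs | hs
        · rw [τT s hs]; exact (Finset.mem_filter.1 hs).2
        · rw [τU s hs]; exact a2.mem s hs
      · intro s hs s' hs' hlt
        rcases Finset.mem_union.1 hs with hs | hs <;> rcases Finset.mem_union.1 hs' with hs' | hs'
        · rw [τT s hs, τT s' hs'] at hlt; exact absurd hlt (lt_irrefl _)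
        · rw [τT s hs]; exact nD s' hs'
        · rw [τU s hs, τT s' hs'] at hlt; exact absurd hlt (not_lt.2 (hge s hs))
        · rw [τU s hs, τU s' hs'] at hlt; rw [τU s hs]; exact a2.sep s hs s' hs' hlt
      · rw [him]
        convert a3 using 1
        rw [hP1, Finset.filter_filter]
        simp only [Finset.forall_mem_insert]
      · intro s hs
        rcases Finset.mem_union.1 hs with hs | hs
        · rw [τT s hs]; exact ⟨hbt, hξ⟩
        · rw [τU s hs]; exact ⟨(a4 s hs).1.mono hP1P, Finset.image_subset_image hP1P (a4 s hs).2⟩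
      · rw [him]
        intro t' ht'
        rcases Finset.mem_insert.1 ht' with rfl | ht'
        · refine (le_of_lt hbt).trans ?_
          refine Finset.sum_le_sum_of_subset_of_nonneg (fun s hs => ?_) fun s _ _ => by have := sc_pos s.1; positivity
          exact Finset.mem_filter.2 ⟨Finset.mem_union_left _ hs, τT s hs⟩
        · refine (a5 t' ht').trans ?_
          refine Finset.sum_le_sum_of_subset_of_nonneg (fun s hs => ?_) fun s _ _ => by have := sc_pos s.1; positivity
          rw [Finset.mem_filter] at hs ⊢
          exact ⟨Finset.mem_union_right _ hs.1, (τU s hs.1).trans hs.2⟩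
    · refine ⟨∅, fun _ => (0,0,0), by simp, ⟨by simp, by simp⟩, fun t => ?_, by simp, by simp⟩
      simp only [Finset.image_empty, Finset.notMem_empty, false_imp_iff, implies_true, Finset.filter_true]
      by_contra hn
      exact hb ⟨t, not_le.1 hn⟩

open Classical in
lemma energy_lemma {f : ℝ → ℂ} (hf : Nice f) {P : Finset Tile} {E : ℝ} (hE : 0 ≤ E) (h : EB f P E) :
    ∃ 𝒯 : Finset Tp, EB f (P.filter fun s => ∀ t ∈ 𝒯, ¬ InD t s) (E/2) ∧ 
      E ^ 2 * ∑ t ∈ 𝒯, sc t.1 ≤ 2 ^ 24 * ∫ x, ‖f x‖ ^ 2 := by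
  obtain ⟨U, τ, a1, a2, a3, a4, a5⟩ := select f E _ P le_rfl
  exact ⟨U.image τ, a3, forest_energy hf a2 (fun s hs => h.le hf hE (a1 hs)) a5⟩
end

section
open MeasureTheory Filter Set
open scoped ENNReal Topology

def dens (F : Set ℝ) (c r0 a : ℝ) : Prop := ∀ r, r0 ≤ r → volume (F ∩ Metric.closedBall c r) ≤ ENNReal.ofReal (a * r)

lemma tail_int {F : Set ℝ} {c r0 a : ℝ} (h0 : 0 < r0) (ha : 0 ≤ a) (h : dens F c r0 a) :
    ∫⁻ x in F, ENNReal.ofReal (((1 + |x - c| / r0) ^ 4)⁻¹) ≤ ENNReal.ofReal (19 * a * r0) := by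
  have key : ∀ x, ENNReal.ofReal (((1 + |x - c| / r0) ^ 4)⁻¹) ≤
      ∑' i : ℕ, ENNReal.ofReal (16 * (16⁻¹) ^ i) * (Metric.closedBall c (2 ^ i * r0)).indicator 1 x := by
    intro x
    have hex : ∃ i : ℕ, |x - c| ≤ 2 ^ i * r0 := by
      obtain ⟨i, hi⟩ := pow_unbounded_of_one_lt (|x - c| / r0) (by norm_num : (1:ℝ) < 2)
      exact ⟨i, by rw [div_lt_iff₀ h0] at hi; exact hi.le⟩
    classical
    set i := Nat.find hex with hi
    have hi1 : |x - c| ≤ 2 ^ i * r0 := Nat.find_spec hex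
    refine le_trans ?_ (ENNReal.le_tsum i)
    rw [indicator_of_mem (by rwa [Metric.mem_closedBall, Real.dist_eq])]
    simp only [Pi.one_apply, mul_one]
    apply ENNReal.ofReal_le_ofReal
    rcases Nat.eq_zero_or_pos i with h1 | h1
    · rw [h1, pow_zero, mul_one]
      refine (inv_le_one_of_one_le₀ ?_).trans (by norm_num)
      exact one_le_pow₀ (by have : 0 ≤ |x - c| / r0 := by positivity
                            linarith)
    · obtain ⟨j, hj⟩ : ∃ j, i = j + 1 := ⟨i - 1, by omega⟩
      have h2 : 2 ^ j * r0 < |x - c| := not_le.1 (Nat.find_min hex (by omega : j < i))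
      rw [hj, show (16:ℝ) * 16⁻¹ ^ (j+1) = (16 ^ j)⁻¹ by rw [pow_succ, inv_pow]; ring]
      apply inv_anti₀ (by positivity)
      rw [show (16:ℝ) ^ j = (2 ^ j) ^ 4 by rw [← pow_mul, mul_comm, pow_mul]; norm_num]
      gcongr
      have : 2 ^ j ≤ |x - c| / r0 := by rw [le_div_iff₀ h0]; exact h2.le
      linarith
  refine (lintegral_mono key).trans ?_
  rw [lintegral_tsum fun i => ((measurable_one.indicator Metric.isClosed_closedBall.measurableSet).const_mul _).aemeasurable]
  have : ∀ i : ℕ, ∫⁻ x in F, ENNReal.ofReal (16 * (16⁻¹) ^ i) * (Metric.closedBall c (2 ^ i * r0)).indicator 1 x ≤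
      ENNReal.ofReal (16 * a * r0 * (8⁻¹) ^ i) := by
    intro i
    rw [lintegral_const_mul _ (measurable_one.indicator Metric.isClosed_closedBall.measurableSet),
      lintegral_indicator_one Metric.isClosed_closedBall.measurableSet, Measure.restrict_apply Metric.isClosed_closedBall.measurableSet, inter_comm]
    calc _ ≤ ENNReal.ofReal (16 * (16⁻¹) ^ i) * ENNReal.ofReal (a * (2 ^ i * r0)) := by
          gcongr; exact h _ (by nlinarith [one_le_pow₀ (by norm_num : (1:ℝ) ≤ 2) (n := i)])
      _ = ENNReal.ofReal (16 * a * r0 * (8⁻¹) ^ i) := by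
          rw [← ENNReal.ofReal_mul (by positivity)]
          congr 1
          rw [show (8:ℝ)⁻¹ = 16⁻¹ * 2 by norm_num, mul_pow]; ring
  refine (ENNReal.tsum_le_tsum this).trans ?_
  have hs : Summable fun i : ℕ => 16 * a * r0 * (8⁻¹:ℝ) ^ i := (summable_geometric_of_lt_one (by norm_num) (by norm_num)).mul_left _
  rw [← ENNReal.ofReal_tsum_of_nonneg (fun i => by positivity) hs, tsum_mul_left, tsum_geometric_of_lt_one (by norm_num) (by norm_num)]
  apply ENNReal.ofReal_le_ofReal
  have : 0 ≤ a * r0 := by positivity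
  norm_num; linarith

lemma v_split {u : ℝ} (hu : 0 ≤ u) : ((1 + u) ^ 6)⁻¹ = ((1 + u) ^ 2)⁻¹ * ((1 + u) ^ 4)⁻¹ := by
  rw [← mul_inv, ← pow_add]

lemma sum_tree_v (T : Finset Tile) (ξ : ℝ) (hT : ∀ s ∈ T, nix s.1 ξ = s.2.2) (G : ℤ → ℝ) (hG : ∀ k, 0 ≤ G k) (x : ℝ) :
    ∑ s ∈ T, G s.1 * ((1 + |x - lc s| / sc s.1) ^ 2)⁻¹ ≤ 16 * ∑ k ∈ T.image (fun s => s.1), G k := by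
  refine (sum_tree T ξ hT (fun k m => G k * ((1 + |x - m * sc k| / sc k) ^ 2)⁻¹) fun k m => mul_nonneg (hG k) (by have := sc_pos k; positivity)).trans ?_
  rw [Finset.mul_sum]
  refine Finset.sum_le_sum fun k _ => ?_
  rw [← Finset.mul_sum, mul_comm]
  exact mul_le_mul_of_nonneg_right (sum_v k x _) (hG k)

def near (T : Finset Tile) (j m : ℤ) : Prop := ∃ s ∈ T, s.1 ≤ j ∧ |idx j (lc s) - m| ≤ 1

lemma tree_far (T : Finset Tile) (ξ : ℝ) (hT : ∀ s ∈ T, nix s.1 ξ = s.2.2) {j m : ℤ} (hn : ¬ near T j m) {x : ℝ} (hx : x ∈ iv j m) :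
    sc j * ∑ s ∈ T, wt s.1 (lc s) x ≤ 64 := by
  have pj := sc_pos j
  set G : ℤ → ℝ := fun k => if j < k then sc j * (sc k)⁻¹ else (sc j)⁻¹ * sc k with hG
  have hG0 : ∀ k, 0 ≤ G k := fun k => by have := sc_pos k; simp only [hG]; split_ifs <;> positivity
  rw [Finset.mul_sum]
  calc _ ≤ ∑ s ∈ T, G s.1 * ((1 + |x - lc s| / sc s.1) ^ 2)⁻¹ := by
        refine Finset.sum_le_sum fun s hs => ?_
        have pk := sc_pos s.1
        set u := |x - lc s| / sc s.1 with hu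
        have u0 : 0 ≤ u := by positivity
        show sc j * ((sc s.1)⁻¹ * ((1 + u) ^ 6)⁻¹) ≤ G s.1 * ((1 + u) ^ 2)⁻¹
        rw [v_split u0]
        simp only [hG]
        split_ifs with hk
        · have : ((1 + u) ^ 4)⁻¹ ≤ 1 := inv_le_one_of_one_le₀ (one_le_pow₀ (by linarith))
          calc _ = sc j * (sc s.1)⁻¹ * ((1 + u) ^ 2)⁻¹ * ((1 + u) ^ 4)⁻¹ := by ring
            _ ≤ sc j * (sc s.1)⁻¹ * ((1 + u) ^ 2)⁻¹ * 1 := by gcongr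
            _ = _ := by ring
        · push Not at hk
          have hd : sc j ≤ |x - lc s| := by
            by_contra hlt
            push Not at hlt
            refine hn ⟨s, hs, hk, ?_⟩
            rw [mem_iv, idx_iff] at hx
            obtain ⟨q, hq⟩ : ∃ q, q = idx j (lc s) := ⟨_, rfl⟩
            rw [← hq]
            have hq := idx_iff.1 hq.symm
            rw [abs_lt] at hlt
            have h1 : (q:ℝ) < m + 2 := by
              by_contra hc; push Not at hc
              nlinarith [mul_le_mul_of_nonneg_right hc pj.le]
            have h2 : (m:ℝ) < q + 2 := by
              by_contra hc; push Not at hc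
              nlinarith [mul_le_mul_of_nonneg_right hc pj.le]
            have h1 : q < m + 2 := by exact_mod_cast h1
            have h2 : m < q + 2 := by exact_mod_cast h2
            rw [abs_le]; omega
          have hr : 1 ≤ sc j / sc s.1 := by rw [le_div_iff₀ pk, one_mul]; exact sc_mono hk
          have h4 : ((1 + u) ^ 4)⁻¹ ≤ (sc s.1 / sc j) ^ 2 := by
            rw [show (sc s.1 / sc j) ^ 2 = ((sc j / sc s.1) ^ 2)⁻¹ by rw [← inv_pow, inv_div]]
            apply inv_anti₀ (by positivity)
            calc (sc j / sc s.1) ^ 2 ≤ (sc j / sc s.1) ^ 4 := pow_le_pow_right₀ hr (by norm_num)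
              _ ≤ _ := by gcongr; rw [hu]; have : sc j / sc s.1 ≤ |x - lc s| / sc s.1 := by gcongr
                          linarith
          calc _ = sc j * (sc s.1)⁻¹ * ((1 + u) ^ 2)⁻¹ * ((1 + u) ^ 4)⁻¹ := by ring
            _ ≤ sc j * (sc s.1)⁻¹ * ((1 + u) ^ 2)⁻¹ * (sc s.1 / sc j) ^ 2 := by gcongr
            _ = _ := by field_simp
    _ ≤ _ := sum_tree_v T ξ hT G hG0 x
    _ ≤ _ := by
        simp only [hG]
        rw [Finset.sum_ite, ← Finset.mul_sum, ← Finset.mul_sum]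
        have h1 := sum_inv_sc (A := (T.image (fun s : Tile => s.1)).filter (fun k => j < k)) (j := j) (fun k hk => (Finset.mem_filter.1 hk).2.le)
        have h2 := sum_sc (A := (T.image (fun s : Tile => s.1)).filter (fun k => ¬ j < k)) (K := j) (fun k hk => not_lt.1 (Finset.mem_filter.1 hk).2)
        have h1 := mul_le_mul_of_nonneg_left h1 pj.le
        have h2 := mul_le_mul_of_nonneg_left h2 (inv_pos.2 pj).le
        rw [mul_left_comm, mul_inv_cancel₀ pj.ne'] at h1
        rw [mul_left_comm, inv_mul_cancel₀ pj.ne'] at h2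
        linarith

lemma tree_tail (T : Finset Tile) (t : Tp) (hT : ∀ s ∈ T, InD t s) {x : ℝ} (hx : 2 ≤ |idx t.1 x - t.2.1|) {s0 : Tile} (hs0 : s0 ∈ T) :
    ∑ s ∈ T, sc s.1 * wt s.1 (lc s) x ≤ 8192 * ((1 + |x - lc s0| / sc t.1) ^ 4)⁻¹ := by
  have pK := sc_pos t.1
  set R := ((1 + |x - lc s0| / sc t.1) ^ 4)⁻¹ with hR
  have R0 : 0 ≤ R := by positivity
  have hdist : ∀ s ∈ T, sc t.1 ≤ |x - lc s| ∧ |lc s - lc s0| ≤ sc t.1 := by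
    intro s hs
    have h1 := idx_iff.1 (mem_iv.1 ((hT s hs).1 (lc_mem s)))
    have h2 := idx_iff.1 (mem_iv.1 ((hT s0 hs0).1 (lc_mem s0)))
    obtain ⟨q, hq⟩ : ∃ q, q = idx t.1 x := ⟨_, rfl⟩
    rw [← hq] at hx
    have hq := idx_iff.1 hq.symm
    constructor
    · rcases le_abs.1 hx with h | h
      · have : (2:ℝ) ≤ q - t.2.1 := by exact_mod_cast h
        refine le_trans ?_ (le_abs_self _)
        nlinarith [mul_le_mul_of_nonneg_right this pK.le]
      · have : (2:ℝ) ≤ -(q - t.2.1) := by exact_mod_cast h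
        refine le_trans ?_ (neg_le_abs _)
        nlinarith [mul_le_mul_of_nonneg_right this pK.le]
    · rw [abs_le]; constructor <;> linarith [h1.1, h1.2, h2.1, h2.2]
  calc _ ≤ ∑ s ∈ T, (256 * R * (sc t.1)⁻¹ * sc s.1) * ((1 + |x - lc s| / sc s.1) ^ 2)⁻¹ := by
        refine Finset.sum_le_sum fun s hs => ?_
        have pk := sc_pos s.1
        obtain ⟨hd1, hd2⟩ := hdist s hs
        have hk := sc_mono (le_of_iv_subset (hT s hs).1)
        set d := |x - lc s| with hd
        have u0 : 0 ≤ d / sc s.1 := by positivity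
        show sc s.1 * ((sc s.1)⁻¹ * ((1 + d / sc s.1) ^ 6)⁻¹) ≤ (256 * R * (sc t.1)⁻¹ * sc s.1) * ((1 + d / sc s.1) ^ 2)⁻¹
        rw [mul_inv_cancel_left₀ pk.ne', v_split u0, mul_comm]
        gcongr
        have hD : |x - lc s0| ≤ 2 * d := by
          have := abs_sub_le x (lc s) (lc s0); linarith
        have d0 : 0 < d := pK.trans_le hd1
        have h1 : 1 + |x - lc s0| / sc t.1 ≤ 4 * (d / sc t.1) := by
          rw [← mul_div_assoc, le_div_iff₀ pK, add_mul, div_mul_cancel₀ _ pK.ne']; linarith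
        have h2 : ((4 * (d / sc t.1)) ^ 4)⁻¹ ≤ R := inv_anti₀ (by positivity) (by gcongr)
        calc ((1 + d / sc s.1) ^ 4)⁻¹ ≤ ((d / sc s.1) ^ 4)⁻¹ := inv_anti₀ (by positivity) (by gcongr; linarith)
          _ = 256 * ((4 * (d / sc t.1)) ^ 4)⁻¹ * (sc s.1 / sc t.1) ^ 4 := by field_simp; norm_num
          _ ≤ 256 * R * (sc s.1 / sc t.1) := by
              gcongr
              exact pow_le_of_le_one (by positivity) (by rw [div_le_one pK]; exact hk) (by norm_num)
          _ = _ := by ring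
    _ ≤ _ := sum_tree_v T t.2.2 (fun s hs => (hT s hs).2) (fun k => 256 * R * (sc t.1)⁻¹ * sc k) (fun k => by have := sc_pos k; positivity) x
    _ = 16 * 256 * R * ((sc t.1)⁻¹ * ∑ k ∈ T.image (fun s => s.1), sc k) := by 
        simp only [Finset.mul_sum]
        exact Finset.sum_congr rfl fun k _ => by ring
    _ ≤ 16 * 256 * R * ((sc t.1)⁻¹ * (2 * sc t.1)) := by
        gcongr
        exact sum_sc fun k hk => by
          obtain ⟨s, hs, rfl⟩ := Finset.mem_image.1 hk
          exact le_of_iv_subset (hT s hs).1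
    _ = _ := by field_simp; ring
end

section
open MeasureTheory Filter Set
open scoped ENNReal Topology

lemma osc_cell {μ : Measure ℝ} {B : Set ℝ} (hB : volume B ≠ ∞) {H : ℝ → ℝ≥0∞} (hH : Measurable H) {c ν : ℝ≥0∞}
    (h1 : μ B ≤ ν * volume B) (h2 : ∀ x ∈ B, ∀ y ∈ B, H x ≤ H y + c) :
    ∫⁻ x in B, H x ∂μ ≤ ν * ∫⁻ x in B, (H x + c) := by
  rcases eq_or_ne (volume B) 0 with h0 | h0
  · rw [h0, mul_zero, nonpos_iff_eq_zero] at h1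
    rw [setLIntegral_measure_zero _ _ h1]; exact zero_le
  have h3 : ∀ y ∈ B, ∫⁻ x in B, H x ∂μ ≤ (H y + c) * μ B := fun y hy => by
    rw [← setLIntegral_const]
    exact setLIntegral_mono measurable_const fun x hx => h2 x hx y hy
  have h4 : (∫⁻ x in B, H x ∂μ) * volume B ≤ ν * (∫⁻ x in B, (H x + c)) * volume B := by
    calc _ = ∫⁻ y in B, (∫⁻ x in B, H x ∂μ) := by rw [setLIntegral_const]
      _ ≤ ∫⁻ y in B, (H y + c) * μ B := setLIntegral_mono ((hH.add_const _).mul_const _) h3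
      _ = (∫⁻ y in B, (H y + c)) * μ B := lintegral_mul_const _ (hH.add_const _)
      _ ≤ (∫⁻ y in B, (H y + c)) * (ν * volume B) := by gcongr
      _ = _ := by ring
  exact (ENNReal.mul_le_mul_iff_left h0 hB).1 h4

lemma iv_children (j m : ℤ) : iv (j+1) m = ⋃ n ∈ Finset.Ico (64*m) (64*m+64), iv j n := by
  ext x
  simp only [mem_iUnion, mem_iv, Finset.mem_Ico, exists_prop, exists_eq_right']
  rw [idx_eq_div (by omega : j ≤ j+1)]
  simp only [add_sub_cancel_left, Int.toNat_one, pow_one]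
  omega

lemma lint_children (μ : Measure ℝ) (j m : ℤ) (H : ℝ → ℝ≥0∞) :
    ∫⁻ x in iv (j+1) m, H x ∂μ = ∑ n ∈ Finset.Ico (64*m) (64*m+64), ∫⁻ x in iv j n, H x ∂μ := by
  rw [iv_children, lintegral_biUnion_finset _ (fun n _ => measurableSet_iv j n)]
  intro n _ n' _ h
  exact Set.disjoint_left.2 fun x h1 h2 => h (h1.symm.trans h2)

lemma size_ind (T : Finset Tile) (k0 : ℤ) (hk : ∀ s ∈ T, k0 ≤ s.1) {μ : Measure ℝ} {H : ℝ → ℝ≥0∞} (hH : Measurable H) {c ν : ℝ≥0∞}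
    (hs : ∀ j m p, near T (j+1) p → m ∈ Finset.Ico (64*p) (64*p+64) → ¬ near T j m →
      μ (iv j m) ≤ ν * volume (iv j m) ∧ ∀ x ∈ iv j m, ∀ y ∈ iv j m, H x ≤ H y + c) :
    ∀ n : ℕ, ∀ j m, j ≤ k0 - 1 + n → near T j m → ∫⁻ x in iv j m, H x ∂μ ≤ ν * ∫⁻ x in iv j m, (H x + c) := by
  intro n
  induction n with
  | zero => 
    rintro j m hj ⟨s, h1, h2, h3⟩
    have := hk s h1
    simp at hj; omega
  | succ n ih =>
    intro j m hj hn
    obtain ⟨i, rfl⟩ : ∃ i, j = i + 1 := ⟨j - 1, by omega⟩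
    rw [lint_children, lint_children, Finset.mul_sum]
    refine Finset.sum_le_sum fun m' hm' => ?_
    by_cases hc : near T i m'
    · exact ih i m' (by push_cast at hj; omega) hc
    · obtain ⟨h1, h2⟩ := hs i m' m hn hm' hc
      exact osc_cell (by rw [volume_iv]; exact ENNReal.ofReal_ne_top) hH h1 h2

lemma near_vol {F : Set ℝ} {T : Finset Tile} {a : ℝ} (ha : 0 ≤ a) (hd : ∀ s ∈ T, dens F (lc s) (sc s.1) a) {j m p : ℤ}
    (hn : near T (j+1) p) (hm : m ∈ Finset.Ico (64*p) (64*p+64)) :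
    volume.restrict F (iv j m) ≤ ENNReal.ofReal (128 * a) * volume (iv j m) := by
  obtain ⟨s, hs, hk, hi⟩ := hn
  have pj := sc_pos j
  have p1 := sc_pos (j+1)
  rw [Measure.restrict_apply (measurableSet_iv _ _), inter_comm]
  refine (measure_mono (t := F ∩ Metric.closedBall (lc s) (2 * sc (j+1))) ?_).trans ((hd s hs _ (by have := sc_mono hk; linarith)).trans ?_)
  · refine inter_subset_inter_right _ fun x hx => ?_
    have hx : x ∈ iv (j+1) p := by
      rw [iv_children]; exact mem_biUnion hm hx
    rw [mem_iv, idx_iff] at hx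
    obtain ⟨q, hq⟩ : ∃ q, q = idx (j+1) (lc s) := ⟨_, rfl⟩
    rw [← hq] at hi
    have hq := idx_iff.1 hq.symm
    rw [Metric.mem_closedBall, Real.dist_eq]
    rw [abs_le] at hi
    have h1 : (-1:ℝ) ≤ q - p := by exact_mod_cast hi.1
    have h2 : (q:ℝ) - p ≤ 1 := by exact_mod_cast hi.2
    rw [abs_le]
    constructor <;> nlinarith
  · rw [volume_iv, ← ENNReal.ofReal_mul (by positivity), sc_succ]
    apply ENNReal.ofReal_le_ofReal; linarith

lemma size_lemma {f : ℝ → ℂ} (hf : Nice f) {F : Set ℝ} (hF : MeasurableSet F) (hfF : ∀ x, ‖f x‖ ≤ F.indicator 1 x) {a : ℝ} (ha : 0 ≤ a)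
    {P : Finset Tile} (hd : ∀ s ∈ P, dens F (lc s) (sc s.1) a) : EB f P (2 ^ 13 * a) := by
  classical
  intro t
  set T := P.filter (In2 t) with hT
  have hTm : ∀ s ∈ T, In2 t s := fun s hs => (Finset.mem_filter.1 hs).2
  have hdT : ∀ s ∈ T, dens F (lc s) (sc s.1) a := fun s hs => hd s (Finset.mem_filter.1 hs).1
  have pK := sc_pos t.1
  rcases T.eq_empty_or_nonempty with h0 | hne
  · rw [h0]; simp; positivity
  obtain ⟨s0, hs0⟩ := hne
  choose w hw hm using FF_max hf
  set A : Tile → ℂ := fun s => ∫ x, f x * w s x with hA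
  set c : Tile → ℂ := fun s => sc s.1 * (starRingEnd ℂ) (A s) with hc
  set X := ∑ s ∈ T, sc s.1 * ‖A s‖ ^ 2 with hX
  have hX0 : 0 ≤ X := Finset.sum_nonneg fun s _ => by have := sc_pos s.1; positivity
  have nc : ∀ s, ‖c s‖ = sc s.1 * ‖A s‖ := fun s => by
    rw [hc]; simp [abs_of_pos (sc_pos s.1)]
  have hFX : ∑ s ∈ T, sc s.1 * FF f s ^ 2 ≤ 4 * X := by
    rw [hX, Finset.mul_sum]
    refine Finset.sum_le_sum fun s _ => ?_
    have := sc_pos s.1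
    have := pow_le_pow_left₀ (FF_nonneg hf s) (hm s) 2
    nlinarith
  have enn : ∀ g : ℝ → ℂ, ‖∫ x, f x * g x‖ₑ ≤ ∫⁻ x in F, ‖g x‖ₑ := fun g => by
    refine (enorm_integral_le_lintegral_enorm _).trans ?_
    rw [← lintegral_indicator hF]
    refine lintegral_mono fun x => ?_
    rw [enorm_mul]
    have := hfF x
    by_cases hx : x ∈ F
    · rw [indicator_of_mem hx] at this ⊢
      calc _ ≤ 1 * ‖g x‖ₑ := by gcongr; simpa using enorm_le_ofReal this
        _ = _ := one_mul _
    · rw [indicator_of_notMem hx] at this ⊢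
      have : f x = 0 := norm_le_zero_iff.1 this
      simp [this]
  have hAa : ∀ s ∈ T, ‖A s‖ ≤ 19 * a := by
    intro s hs
    have ps := sc_pos s.1
    have h1 : ‖A s‖ₑ ≤ ENNReal.ofReal (19 * a) := by
      refine (enn _).trans ?_
      calc _ ≤ ∫⁻ x in F, ENNReal.ofReal (sc s.1)⁻¹ * ENNReal.ofReal (((1 + |x - lc s| / sc s.1) ^ 4)⁻¹) := by
            refine lintegral_mono fun x => ?_
            rw [← ENNReal.ofReal_mul (by positivity)]
            refine enorm_le_ofReal (((hw s).dec x).trans ?_)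
            unfold wt; gcongr (sc s.1)⁻¹ * ?_
            exact pow_inv_mono (by positivity) (by norm_num)
        _ = ENNReal.ofReal (sc s.1)⁻¹ * ∫⁻ x in F, ENNReal.ofReal (((1 + |x - lc s| / sc s.1) ^ 4)⁻¹) := 
            lintegral_const_mul _ (continuous_inv_pow _ ps 4).measurable.ennreal_ofReal
        _ ≤ ENNReal.ofReal (sc s.1)⁻¹ * ENNReal.ofReal (19 * a * sc s.1) := by
            gcongr; exact tail_int ps ha (hdT s hs)
        _ = _ := by rw [← ENNReal.ofReal_mul (by positivity)]; congr 1; field_simp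
    rw [← ofReal_norm] at h1
    exact (ENNReal.ofReal_le_ofReal_iff (by positivity)).1 h1
  have hB := bessel T w (fun s _ => hw s) c
  have hdiag : ∑ s ∈ T, ‖c s‖ ^ 2 / sc s.1 = X := by
    refine Finset.sum_congr rfl fun s _ => ?_
    have := sc_pos s.1
    rw [nc]; field_simp
  have hcr : ∀ s ∈ T, T.filter (fun s' => crs s s') = ∅ := by
    intro s hs
    refine Finset.filter_eq_empty_iff.2 fun s' hs' hcc => ?_
    have h1 := crs_lt (hTm s hs).1.2 hcc
    have h2 := c2_bd (hTm s' hs').1.2 (hTm s' hs').2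
    linarith [h1.2, h2.1]
  rw [hdiag, Finset.sum_eq_zero (fun s hs => by rw [hcr s hs, Finset.sum_empty]), mul_zero, add_zero] at hB
  set Ψ : ℝ → ℂ := fun y => ∑ s ∈ T, c s * w s y with hΨ
  have cΨ : Continuous Ψ := continuous_finsetSum _ fun s _ => ((hw s).cont).const_smul (c s)
  have iΨ : Integrable Ψ := integrable_finsetSum _ fun s _ => (hw s).int.const_mul _
  have bΨ : ∃ B, ∀ y, ‖Ψ y‖ ≤ B := by
    refine ⟨∑ s ∈ T, ‖c s‖ * (sc s.1)⁻¹, fun y => (norm_sum_le _ _).trans (Finset.sum_le_sum fun s _ => ?_)⟩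
    rw [norm_mul]; gcongr; exact ((hw s).dec y).trans (wt_le _ _ _)
  obtain ⟨B, hB'⟩ := bΨ
  have iΨ2 : Integrable fun y => ‖Ψ y‖ ^ 2 := by
    simp only [sq]
    exact iΨ.norm.mul_bdd (c := B) iΨ.norm.aestronglyMeasurable (ae_of_all _ fun x => by simpa using hB' x)
  have eX : (X : ℂ) = ∫ y, f y * Ψ y := by
    simp only [hΨ, Finset.mul_sum]
    rw [integral_finsetSum]
    · rw [hX]; push_cast
      refine Finset.sum_congr rfl fun s _ => ?_
      have : (fun y => f y * (c s * w s y)) = fun y => c s * (f y * w s y) := by ext; ring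
      rw [this, integral_const_mul, ← Complex.ofReal_pow, ← Complex.normSq_eq_norm_sq, ← Complex.mul_conj]
      simp only [hc, hA]; ring
    · intro s _
      have : (fun y => f y * (c s * w s y)) = fun y => c s * (f y * w s y) := by ext; ring
      rw [this]; exact (hf.mulPk (hw s)).const_mul _
  -- oscillation
  have hosc : ∀ j m p, near T (j+1) p → m ∈ Finset.Ico (64*p) (64*p+64) → ¬ near T j m →
      volume.restrict F (iv j m) ≤ ENNReal.ofReal (128 * a) * volume (iv j m) ∧ ∀ x ∈ iv j m, ∀ y ∈ iv j m, ‖Ψ x‖ₑ ≤ ‖Ψ y‖ₑ + ENNReal.ofReal (2432 * a) := by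
    intro j m p h1 h2 h3
    refine ⟨near_vol ha hdT h1 h2, fun x hx y hy => ?_⟩
    have pj := sc_pos j
    have hxy : |x - y| ≤ sc j := by
      rw [mem_iv, idx_iff] at hx hy
      rw [abs_le]; constructor <;> linarith [hx.1, hx.2, hy.1, hy.2]
    have e1 : ‖Ψ x * ee (t.2.2 * x) - Ψ y * ee (t.2.2 * y)‖ ≤ 2432 * a := by
      simp only [hΨ, Finset.sum_mul, ← Finset.sum_sub_distrib]
      calc _ ≤ ∑ s ∈ T, 19 * a * (sc j * (wt s.1 (lc s) x + wt s.1 (lc s) y)) := by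
            refine (norm_sum_le _ _).trans (Finset.sum_le_sum fun s hs => ?_)
            have ps := sc_pos s.1
            have w1 := wt_nonneg s.1 (lc s) x; have w2 := wt_nonneg s.1 (lc s) y
            rw [mul_assoc (c s), mul_assoc (c s), ← mul_sub, norm_mul, nc]
            calc _ ≤ (sc s.1 * (19 * a)) * (sc j / sc s.1 * (wt s.1 (lc s) x + wt s.1 (lc s) y)) := by
                  gcongr
                  · exact hAa s hs
                  · exact ((hw s).lip _ (hTm s hs).1.2 x y).trans (by gcongr)
              _ = _ := by field_simp
        _ = 19 * a * (sc j * ∑ s ∈ T, wt s.1 (lc s) x + sc j * ∑ s ∈ T, wt s.1 (lc s) y) := by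
            simp only [← mul_add, ← Finset.sum_add_distrib, Finset.mul_sum]
        _ ≤ 19 * a * (64 + 64) := by
            gcongr
            · exact tree_far T t.2.2 (fun s hs => (hTm s hs).1.2) h3 hx
            · exact tree_far T t.2.2 (fun s hs => (hTm s hs).1.2) h3 hy
        _ = _ := by ring
    have e2 : ‖Ψ x‖ ≤ ‖Ψ y‖ + 2432 * a := by
      have := norm_sub_norm_le (Ψ x * ee (t.2.2 * x)) (Ψ y * ee (t.2.2 * y))
      simp only [norm_mul, norm_ee, mul_one] at this
      linarith
    refine (enorm_le_ofReal e2).trans ?_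
    rw [ENNReal.ofReal_add (norm_nonneg _) (by positivity), ofReal_norm]
  have hHm : Measurable fun x => ‖Ψ x‖ₑ := cΨ.measurable.enorm
  obtain ⟨k0, hk0⟩ : ∃ k0, ∀ s ∈ T, k0 ≤ s.1 := by
    obtain ⟨s, hs, h⟩ := Finset.exists_min_image T (fun s => s.1) ⟨s0, hs0⟩
    exact ⟨s.1, h⟩
  have hin : ∀ m, |t.2.1 - m| ≤ 1 → ∫⁻ x in iv t.1 m, ‖Ψ x‖ₑ ∂(volume.restrict F) ≤
      ∫⁻ x in iv t.1 m, ENNReal.ofReal (128⁻¹ * ‖Ψ x‖ ^ 2 + 835584 * a ^ 2) := by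
    intro m hm
    refine (size_ind T k0 hk0 hHm hosc (t.1 - k0 + 1).toNat t.1 m (by omega) ⟨s0, hs0, le_of_iv_subset (hTm s0 hs0).1.1, ?_⟩).trans ?_
    · rw [mem_iv.1 ((hTm s0 hs0).1.1 (lc_mem s0))]; exact hm
    · rw [← lintegral_const_mul _ (hHm.add_const _)]
      refine lintegral_mono fun x => ?_
      rw [← ofReal_norm, ← ENNReal.ofReal_add (norm_nonneg _) (by positivity), ← ENNReal.ofReal_mul (by positivity)]
      apply ENNReal.ofReal_le_ofReal
      nlinarith [sq_nonneg (‖Ψ x‖ - 128 * 64 * a)]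
  set D : Set ℝ := {x | 2 ≤ |idx t.1 x - t.2.1|} with hD
  have hDm : MeasurableSet D := (measurable_idx t.1) (MeasurableSet.of_discrete (s := {z : ℤ | 2 ≤ |z - t.2.1|}))
  have hout : ∫⁻ x in D, ‖Ψ x‖ₑ ∂(volume.restrict F) ≤ ENNReal.ofReal (2957312 * a ^ 2 * sc t.1) := by
    calc _ ≤ ∫⁻ x in D, ENNReal.ofReal (19 * a * 8192) * ENNReal.ofReal (((1 + |x - lc s0| / sc t.1) ^ 4)⁻¹) ∂(volume.restrict F) := by
          refine setLIntegral_mono ((continuous_inv_pow _ pK 4).measurable.ennreal_ofReal.const_mul _) fun x hx => ?_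
          rw [← ENNReal.ofReal_mul (by positivity)]
          refine enorm_le_ofReal ((norm_sum_le _ _).trans ?_)
          calc _ ≤ ∑ s ∈ T, 19 * a * (sc s.1 * wt s.1 (lc s) x) := by
                refine Finset.sum_le_sum fun s hs => ?_
                have ps := sc_pos s.1
                rw [norm_mul, nc]
                calc _ ≤ (sc s.1 * (19 * a)) * wt s.1 (lc s) x := by
                      gcongr
                      · exact hAa s hs
                      · exact (hw s).dec x
                  _ = _ := by ring
            _ = 19 * a * ∑ s ∈ T, sc s.1 * wt s.1 (lc s) x := by rw [Finset.mul_sum]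
            _ ≤ 19 * a * (8192 * ((1 + |x - lc s0| / sc t.1) ^ 4)⁻¹) := by
                gcongr; exact tree_tail T t (fun s hs => (hTm s hs).1) hx hs0
            _ = _ := by ring
      _ ≤ ∫⁻ x in F, ENNReal.ofReal (19 * a * 8192) * ENNReal.ofReal (((1 + |x - lc s0| / sc t.1) ^ 4)⁻¹) := setLIntegral_le_lintegral _ _
      _ = ENNReal.ofReal (19 * a * 8192) * ∫⁻ x in F, ENNReal.ofReal (((1 + |x - lc s0| / sc t.1) ^ 4)⁻¹) := 
            lintegral_const_mul _ (continuous_inv_pow _ pK 4).measurable.ennreal_ofReal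
      _ ≤ ENNReal.ofReal (19 * a * 8192) * ENNReal.ofReal (19 * a * sc t.1) := by
            gcongr
            refine tail_int pK ha fun r hr => hdT s0 hs0 r (le_trans (sc_mono (le_of_iv_subset (hTm s0 hs0).1.1)) hr)
      _ = _ := by rw [← ENNReal.ofReal_mul (by positivity)]; congr 1; ring
  have hcov : (univ : Set ℝ) ⊆ ((iv t.1 (t.2.1 - 1) ∪ iv t.1 t.2.1) ∪ iv t.1 (t.2.1 + 1)) ∪ D := by
    intro x _
    simp only [mem_union, mem_iv, hD, mem_ofPred_eq]
    by_contra hh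
    push Not at hh
    have := hh.2
    rw [abs_lt] at this
    omega
  have i1 : Integrable fun x => 128⁻¹ * ‖Ψ x‖ ^ 2 := iΨ2.const_mul _
  have hfin : ∀ m, IntegrableOn (fun x => 128⁻¹ * ‖Ψ x‖ ^ 2 + 835584 * a ^ 2) (iv t.1 m) := fun m =>
    i1.integrableOn.add (integrableOn_const (by rw [volume_iv]; exact ENNReal.ofReal_ne_top))
  set I : ℤ → ℝ := fun m => ∫ x in iv t.1 m, 128⁻¹ * ‖Ψ x‖ ^ 2 with hI
  have I0 : ∀ m, 0 ≤ I m := fun m => integral_nonneg fun x => by positivity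
  have hin' : ∀ m, |t.2.1 - m| ≤ 1 → ∫⁻ x in iv t.1 m, ‖Ψ x‖ₑ ∂(volume.restrict F) ≤ ENNReal.ofReal (I m + 835584 * a ^ 2 * sc t.1) := by
    intro m hm
    refine (hin m hm).trans (le_of_eq ?_)
    rw [← ofReal_integral_eq_lintegral_ofReal (hfin m) (ae_of_all _ fun x => by positivity)]
    congr 1
    rw [integral_add i1.integrableOn (integrableOn_const (by rw [volume_iv]; exact ENNReal.ofReal_ne_top)), setIntegral_const, Measure.real, volume_iv,
      ENNReal.toReal_ofReal pK.le, smul_eq_mul]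
    simp only [hI]; ring
  have hsumI : I (t.2.1 - 1) + I t.2.1 + I (t.2.1 + 1) ≤ X / 2 := by
    have d : ∀ m n, m ≠ n → Disjoint (iv t.1 m) (iv t.1 n) := fun m n h => Set.disjoint_left.2 fun x h1 h2 => h (h1.symm.trans h2)
    simp only [hI]
    rw [← setIntegral_union (d _ _ (by omega)) (measurableSet_iv _ _) i1.integrableOn i1.integrableOn,
      ← setIntegral_union (disjoint_union_left.2 ⟨d _ _ (by omega), d _ _ (by omega)⟩) (measurableSet_iv _ _) i1.integrableOn i1.integrableOn]
    refine (setIntegral_le_integral i1 (ae_of_all _ fun x => by positivity)).trans ?_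
    rw [integral_const_mul]; linarith
  have hfinal : ENNReal.ofReal X ≤ ENNReal.ofReal (X / 2 + 5464064 * a ^ 2 * sc t.1) := by
    calc ENNReal.ofReal X = ‖(X:ℂ)‖ₑ := by rw [← ofReal_norm, Complex.norm_real, Real.norm_of_nonneg hX0]
      _ ≤ ∫⁻ x, ‖Ψ x‖ₑ ∂(volume.restrict F) := by rw [eX]; exact enn Ψ
      _ ≤ ∫⁻ x in ((iv t.1 (t.2.1 - 1) ∪ iv t.1 t.2.1) ∪ iv t.1 (t.2.1 + 1)) ∪ D, ‖Ψ x‖ₑ ∂(volume.restrict F) := by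
          rw [← setLIntegral_univ]; exact lintegral_mono_set hcov
      _ ≤ ((ENNReal.ofReal (I (t.2.1 - 1) + 835584 * a ^ 2 * sc t.1) + ENNReal.ofReal (I (t.2.1) + 835584 * a ^ 2 * sc t.1)) + 
            ENNReal.ofReal (I (t.2.1 + 1) + 835584 * a ^ 2 * sc t.1)) + ENNReal.ofReal (2957312 * a ^ 2 * sc t.1) := by
          refine (lintegral_union_le _ _ _).trans (add_le_add ?_ hout)
          refine (lintegral_union_le _ _ _).trans (add_le_add ?_ (hin' _ (by simp)))
          exact (lintegral_union_le _ _ _).trans (add_le_add (hin' _ (by simp)) (hin' _ (by simp)))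
      _ = ENNReal.ofReal (((I (t.2.1 - 1) + 835584 * a ^ 2 * sc t.1) + (I (t.2.1) + 835584 * a ^ 2 * sc t.1) + 
            (I (t.2.1 + 1) + 835584 * a ^ 2 * sc t.1)) + (2957312 * a ^ 2 * sc t.1)) := by
          have := I0 (t.2.1 - 1); have := I0 t.2.1; have := I0 (t.2.1 + 1)
          rw [← ENNReal.ofReal_add (by positivity) (by positivity), ← ENNReal.ofReal_add (by positivity) (by positivity), ← ENNReal.ofReal_add (by positivity) (by positivity)]
      _ ≤ _ := by apply ENNReal.ofReal_le_ofReal; linarith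
  have hf2 := (ENNReal.ofReal_le_ofReal_iff (by positivity)).1 hfinal
  have : 0 ≤ a ^ 2 * sc t.1 := by positivity
  calc _ ≤ 4 * X := hFX
    _ ≤ _ := by nlinarith
end

section
open MeasureTheory Filter Set
open scoped ENNReal Topology

structure Ker (φ γ φ' θ : ℝ → ℂ) (c : ℝ) : Prop where
  c0 : 0 < c
  pφ : PKer φ c
  pγ : PKer γ c
  pφ' : PKer φ' c
  pθ : PKer θ c
  dγ : ∀ t, HasDerivAt γ (φ t) t
  dφ : ∀ t, HasDerivAt φ (φ' t) t
  θe : ∀ t : ℝ, θ t = 2 * Real.pi * Complex.I * t * φ t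

lemma PKer.cont {ψ : ℝ → ℂ} {c : ℝ} (h : PKer ψ c) : Continuous ψ := by
  obtain ⟨ψ', hψ', _⟩ := h.dif
  exact continuous_iff_continuousAt.2 fun t => (hψ' t).continuousAt

lemma PKer.bd {ψ : ℝ → ℂ} {c : ℝ} (hc : 0 < c) (h : PKer ψ c) (t : ℝ) : ‖ψ t‖ ≤ c := by
  refine (h.dec t).trans (mul_le_of_le_one_right hc.le (inv_le_one_of_one_le₀ (one_le_pow₀ ?_)))
  linarith [abs_nonneg t]

noncomputable def AA (ψ f : ℝ → ℂ) (k : ℤ) (ξ x : ℝ) : ℂ := ∫ y, f y * pack ψ k ξ x y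
noncomputable def Wg (ψ f : ℝ → ℂ) (k : ℤ) (ξ x : ℝ) : ℂ := ∫ y, f y * ee (-(ξ * y)) * ψ ((x - y) / sc k)

lemma AA_Wg (ψ f : ℝ → ℂ) (k : ℤ) (ξ x : ℝ) : AA ψ f k ξ x = ((sc k)⁻¹ : ℝ) * ee (ξ * x) * Wg ψ f k ξ x := by
  unfold AA Wg
  rw [← integral_const_mul]
  refine integral_congr_ae (ae_of_all _ fun y => ?_)
  simp only [pack]
  rw [show ξ * (x - y) = ξ * x + -(ξ * y) by ring, ee_add]; ring

lemma norm_Wg (ψ f : ℝ → ℂ) (k : ℤ) (ξ x : ℝ) : ‖Wg ψ f k ξ x‖ = sc k * ‖AA ψ f k ξ x‖ := by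
  have := sc_pos k
  rw [AA_Wg, norm_mul, norm_mul, norm_ee, Complex.norm_real, Real.norm_of_nonneg (by positivity)]
  field_simp

lemma AA_le {ψ f : ℝ → ℂ} {c : ℝ} (hf : Nice f) (hc : 0 < c) (h : PKer ψ c) {k m n : ℤ} {ξ x : ℝ}
    (hx : x ∈ Icc (m * sc k) ((m+1) * sc k)) (hξ : nix k ξ = n) (h2 : c2 k ξ) :
    ‖AA ψ f k ξ x‖ ≤ 65536 * c * FF f (k, m, n) := by
  have h1 := le_FF hf (h.pk hc (k, m, n) ξ x hx hξ h2)
  have : ∫ y, f y * (((65536 * c)⁻¹ : ℝ) * pack ψ k ξ x y) = (((65536 * c)⁻¹ : ℝ) : ℂ) * AA ψ f k ξ x := by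
    unfold AA; rw [← integral_const_mul]; congr 1; ext y; ring
  rw [this, norm_mul, Complex.norm_real, Real.norm_of_nonneg (by positivity), inv_mul_le_iff₀ (by positivity)] at h1
  exact h1

lemma Wg_int {ψ f : ℝ → ℂ} {c : ℝ} (hf : Nice f) (hψ : Continuous ψ) (hb : ∀ t, ‖ψ t‖ ≤ c) (k : ℤ) (ξ x : ℝ) :
    Integrable fun y => f y * ee (-(ξ * y)) * ψ ((x - y) / sc k) := by
  have h1 := continuous_ee
  refine (hf.int.mul_bdd (c := 1) (g := fun y => ee (-(ξ * y))) (by fun_prop) (ae_of_all _ fun y => (norm_ee _).le)).mul_bdd (c := c) (by fun_prop) (ae_of_all _ fun y => hb _)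

lemma Wg_deriv {ψ ψ' f : ℝ → ℂ} {c : ℝ} (hc : 0 < c) (hf : Nice f) (h : PKer ψ c) (h' : PKer ψ' c)
    (hd : ∀ t, HasDerivAt ψ (ψ' t) t) (k : ℤ) (ξ x : ℝ) :
    HasDerivAt (Wg ψ f k ξ) (((sc k)⁻¹ : ℝ) * Wg ψ' f k ξ x) x := by
  have p := sc_pos k
  have hi := (Wg_int hf h.cont (h.bd hc) k ξ)
  have hi' := (Wg_int hf h'.cont (h'.bd hc) k ξ)
  have := (hasDerivAt_integral_of_dominated_loc_of_deriv_le (μ := volume) (s := univ) (x₀ := x)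
    (F := fun x y => f y * ee (-(ξ * y)) * ψ ((x - y) / sc k))
    (F' := fun x y => ((sc k)⁻¹ : ℝ) * (f y * ee (-(ξ * y)) * ψ' ((x - y) / sc k))) 
    (bound := fun y => (sc k)⁻¹ * c * ‖f y‖) univ_mem 
    (Eventually.of_forall fun z => (hi z).aestronglyMeasurable) (hi x)
    ((hi' x).aestronglyMeasurable.const_mul _) (ae_of_all _ fun y z _ => ?_) (hf.int.norm.const_mul _)
    (ae_of_all _ fun y z _ => ?_)).2
  · rw [integral_const_mul] at this; exact this
  · rw [norm_mul, norm_mul, norm_mul, norm_ee, Complex.norm_real, Real.norm_of_nonneg (by positivity)]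
    have := h'.bd hc ((z - y) / sc k)
    have n := norm_nonneg (f y)
    calc _ ≤ (sc k)⁻¹ * (‖f y‖ * 1 * c) := by gcongr
      _ = _ := by ring
  · have d1 : HasDerivAt (fun x => (x - y) / sc k) ((sc k)⁻¹) z := by
      have := ((hasDerivAt_id z).sub_const y).div_const (sc k)
      simpa using this
    have d2 := ((hd ((z - y) / sc k)).scomp z d1).const_mul (f y * ee (-(ξ * y)))
    refine d2.congr_deriv ?_
    simp only [Complex.real_smul]; ring

lemma Wg_cont {ψ f : ℝ → ℂ} {c : ℝ} (hc : 0 < c) (hf : Nice f) (h : PKer ψ c) (k : ℤ) (ξ : ℝ) : Continuous (Wg ψ f k ξ) := by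
  unfold Wg
  have h1 := continuous_ee
  have h2 := h.cont
  refine continuous_of_dominated (bound := fun y => c * ‖f y‖) (fun x => (Wg_int hf h.cont (h.bd hc) k ξ x).aestronglyMeasurable)
    (fun x => ae_of_all _ fun y => ?_) (hf.int.norm.const_mul _) (ae_of_all _ fun y => by fun_prop)
  rw [norm_mul, norm_mul, norm_ee, mul_one, mul_comm]
  gcongr; exact h.bd hc _

lemma AA_freq {φ γ φ' θ f : ℝ → ℂ} {c : ℝ} (hK : Ker φ γ φ' θ c) (hf : Nice f) (k : ℤ) (x ξ : ℝ) :
    HasDerivAt (fun ξ => AA φ f k ξ x) (sc k * AA θ f k ξ x) ξ := by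
  have p := sc_pos k
  have he := continuous_ee
  have hmeas : ∀ ψ : ℝ → ℂ, PKer ψ c → ∀ ζ, Integrable fun y => f y * pack ψ k ζ x y := fun ψ hψ ζ => by
    have hc := hψ.cont
    refine hf.int.mul_bdd (c := (sc k)⁻¹ * c) (by unfold pack; fun_prop) (ae_of_all _ fun y => ?_)
    unfold pack
    rw [norm_mul, norm_mul, norm_ee, mul_one, Complex.norm_real, Real.norm_of_nonneg (by positivity)]
    gcongr; exact hψ.bd hK.c0 _
  have := (hasDerivAt_integral_of_dominated_loc_of_deriv_le (μ := volume) (s := univ) (x₀ := ξ)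
    (F := fun ξ y => f y * pack φ k ξ x y)
    (F' := fun ξ y => (sc k : ℂ) * (f y * pack θ k ξ x y)) 
    (bound := fun y => c * ‖f y‖) univ_mem 
    (Eventually.of_forall fun z => (hmeas _ hK.pφ z).aestronglyMeasurable) (hmeas _ hK.pφ ξ)
    ((hmeas _ hK.pθ ξ).aestronglyMeasurable.const_mul _) (ae_of_all _ fun y z _ => ?_) (hf.int.norm.const_mul _)
    (ae_of_all _ fun y z _ => ?_)).2
  · rw [integral_const_mul] at this; exact this
  · unfold pack
    rw [norm_mul, norm_mul, norm_mul, norm_mul, norm_ee, mul_one, Complex.norm_real, Complex.norm_real, Real.norm_of_nonneg p.le, Real.norm_of_nonneg (by positivity)]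
    have := hK.pθ.bd hK.c0 ((x - y) / sc k)
    calc sc k * (‖f y‖ * ((sc k)⁻¹ * ‖θ ((x - y) / sc k)‖)) = ‖θ ((x - y) / sc k)‖ * ‖f y‖ := by field_simp
      _ ≤ _ := by gcongr
  · have d1 : HasDerivAt (fun ξ => ξ * (x - y)) (x - y) z := by simpa using (hasDerivAt_id z).mul_const (x - y)
    have d2 := ((hasDerivAt_ee (z * (x - y))).scomp z d1).const_mul (f y * (((sc k)⁻¹ : ℝ) * φ ((x - y) / sc k)))
    simp only [pack, ← mul_assoc] at d2 ⊢
    refine d2.congr_deriv ?_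
    simp only [Complex.real_smul, hK.θe]
    push_cast
    have : (sc k : ℂ) ≠ 0 := by exact_mod_cast p.ne'
    field_simp

lemma c2_seg {k n : ℤ} {ξ N ζ : ℝ} (h1 : nix k ξ = n) (h2 : nix (k+1) N = nix (k+1) ξ) (h3 : c2 k ξ) (hz : ζ ∈ uIcc ξ N) :
    nix k ζ = n ∧ c2 k ζ := by
  have h4 : nix (k+1) ζ = nix (k+1) ξ := by
    have a1 := nix_iff.1 (rfl : nix (k+1) ξ = nix (k+1) ξ)
    have a2 := nix_iff.1 h2
    rw [mem_uIcc] at hz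
    refine nix_iff.2 ?_
    rcases hz with hz | hz <;> constructor <;> linarith [a1.1, a1.2, a2.1, a2.2, hz.1, hz.2]
  have h5 := nix_down (by omega : k ≤ k+1) h4
  refine ⟨h5.trans h1, ?_⟩
  unfold c2 at h3 ⊢; rw [h4, h5, h3]

lemma AA_diff {φ γ φ' θ f : ℝ → ℂ} {c : ℝ} (hK : Ker φ γ φ' θ c) (hf : Nice f) {k m n : ℤ} {x ξ N : ℝ}
    (hx : x ∈ Icc (m * sc k) ((m+1) * sc k)) (h1 : nix k ξ = n) (h2 : nix (k+1) N = nix (k+1) ξ) (h3 : c2 k ξ) :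
    ‖AA φ f k N x - AA φ f k ξ x‖ ≤ sc k * (65536 * c * FF f (k, m, n)) * |N - ξ| := by
  have p := sc_pos k
  have := (convex_uIcc ξ N).norm_image_sub_le_of_norm_hasDerivWithin_le (f := fun ζ => AA φ f k ζ x) 
    (f' := fun ζ => sc k * AA θ f k ζ x) (C := sc k * (65536 * c * FF f (k, m, n))) (x := ξ) (y := N) 
    (fun z _ => (AA_freq hK hf k x z).hasDerivWithinAt) (fun z hz => ?_) left_mem_uIcc right_mem_uIcc
  · simpa using this
  · rw [norm_mul, Complex.norm_real, Real.norm_of_nonneg p.le]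
    obtain ⟨h4, h5⟩ := c2_seg h1 h2 h3 hz
    gcongr; exact AA_le hf hK.c0 hK.pθ hx h4 h5
end

section
open MeasureTheory Filter Set
open scoped ENNReal Topology

noncomputable def tl (N : ℝ → ℝ) (k : ℤ) (x : ℝ) : Tile := (k, idx k x, nix k (N x))
open Classical in
noncomputable def TS (φ f : ℝ → ℂ) (N : ℝ → ℝ) (κ : ℝ → ℤ) (a b : ℤ) (P : Finset Tile) (x : ℝ) : ℂ :=
  ∑ k ∈ Finset.Icc a b, if tl N k x ∈ P ∧ c2 k (N x) ∧ κ x ≤ k then AA φ f k (N x) x else 0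

def cvx (P : Finset Tile) : Prop := ∀ s s' s'', tle s s' → tle s' s'' → s ∈ P → s'' ∈ P → s' ∈ P

def Em (N : ℝ → ℝ) (E : Set ℝ) (s : Tile) : Set ℝ := {x | x ∈ E ∧ tl N s.1 x = s}

lemma measurable_tl {N : ℝ → ℝ} (hN : Measurable N) (k : ℤ) : Measurable (tl N k) :=
  measurable_const.prodMk ((measurable_idx k).prodMk ((measurable_nix k).comp hN))
lemma measurableSet_Em {N : ℝ → ℝ} (hN : Measurable N) {E : Set ℝ} (hE : MeasurableSet E) (s : Tile) : MeasurableSet (Em N E s) :=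
  hE.inter (measurable_tl hN s.1 (measurableSet_singleton s))

lemma measurable_AA {φ f : ℝ → ℂ} (hφ : Continuous φ) (hf : Nice f) {N : ℝ → ℝ} (hN : Measurable N) (k : ℤ) :
    Measurable fun x => AA φ f k (N x) x := by
  unfold AA
  refine StronglyMeasurable.measurable ?_
  refine StronglyMeasurable.integral_prod_right' (f := fun p : ℝ × ℝ => f p.2 * pack φ k (N p.1) p.1 p.2) ?_
  refine Measurable.stronglyMeasurable ?_
  unfold pack
  have h1 := hf.meas
  have h2 := continuous_ee.measurable
  have h3 := hφ.measurable
  fun_prop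

lemma measurable_TS {φ f : ℝ → ℂ} (hφ : Continuous φ) (hf : Nice f) {N : ℝ → ℝ} (hN : Measurable N) {κ : ℝ → ℤ} (hκ : Measurable κ)
    (a b : ℤ) (P : Finset Tile) : Measurable (TS φ f N κ a b P) := by
  classical
  unfold TS
  refine Finset.measurable_sum _ fun k _ => Measurable.ite ?_ (measurable_AA hφ hf hN k) measurable_const
  refine MeasurableSet.inter (measurable_tl hN k P.measurableSet) (MeasurableSet.inter ?_ ?_)
  · exact measurableSet_eq_fun ((measurable_nix _).comp hN) (((measurable_nix k).comp hN).const_mul 64 |>.add_const 32)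
  · exact measurableSet_le hκ measurable_const

lemma tle_tl (N : ℝ → ℝ) {j k : ℤ} (h : j ≤ k) (x : ℝ) : tle (tl N j x) (tl N k x) :=
  ⟨iv_idx_subset h x, nix_down h (nix_self k (nix k (N x)))⟩

lemma tle_tree {j k : ℤ} (h : j ≤ k) (x ξ : ℝ) : tle (j, idx j x, nix j ξ) (k, idx k x, nix k ξ) := tle_tl (fun _ => ξ) h x

open Classical in
lemma TS_split {φ f : ℝ → ℂ} {N : ℝ → ℝ} {κ : ℝ → ℤ} {a b : ℤ} (P : Finset Tile) (p : Tile → Prop) (x : ℝ) :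
    TS φ f N κ a b P x = TS φ f N κ a b (P.filter p) x + TS φ f N κ a b (P.filter fun s => ¬ p s) x := by
  unfold TS
  rw [← Finset.sum_add_distrib]
  refine Finset.sum_congr rfl fun k _ => ?_
  simp only [Finset.mem_filter]
  by_cases h1 : tl N k x ∈ P <;> by_cases h2 : p (tl N k x) <;> simp [h1, h2]

section tree
variable {φ γ φ' θ f : ℝ → ℂ} {c : ℝ} {N : ℝ → ℝ} {κ : ℝ → ℤ} {a b : ℤ} {P : Finset Tile} {E : ℝ}

open Classical in
noncomputable def stG (ψ f : ℝ → ℂ) (ξ : ℝ) (j : ℤ) (k : ℤ) (x : ℝ) : ℂ :=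
  if c2 k ξ then ((sc k ^ j : ℝ) : ℂ) * Wg ψ f k ξ x else 0

lemma stG_deriv {ψ ψ' : ℝ → ℂ} (hc : 0 < c) (hf : Nice f) (h : PKer ψ c) (h' : PKer ψ' c)
    (hd : ∀ t, HasDerivAt ψ (ψ' t) t) (ξ : ℝ) (j k : ℤ) (x : ℝ) : HasDerivAt (stG ψ f ξ j k) (stG ψ' f ξ (j-1) k x) x := by
  unfold stG
  by_cases h2 : c2 k ξ
  · simp only [h2, if_true]
    refine ((Wg_deriv hc hf h h' hd k ξ x).const_mul _).congr_deriv ?_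
    rw [zpow_sub_one₀ (sc_pos k).ne']; push_cast; ring
  · simp only [h2, if_false]; exact hasDerivAt_const _ _

lemma stG_norm {ψ : ℝ → ℂ} (hc : 0 < c) (hf : Nice f) (h : PKer ψ c) {ξ : ℝ} (j : ℤ) {k m : ℤ} {x : ℝ} 
    (hx : x ∈ Icc (m * sc k) ((m+1) * sc k)) :
    ‖stG ψ f ξ j k x‖ ≤ sc k ^ (j+1) * (open Classical in if c2 k ξ then 65536 * c * FF f (k, m, nix k ξ) else 0) := by
  unfold stG
  have p := sc_pos k
  by_cases h2 : c2 k ξ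
  · simp only [h2, if_true]
    rw [norm_mul, norm_Wg, Complex.norm_real, Real.norm_of_nonneg (by positivity), ← mul_assoc, ← zpow_add_one₀ p.ne']
    gcongr; exact AA_le hf hc h hx rfl h2
  · simp [h2]

open Classical in
lemma tree_stop (hK : Ker φ γ φ' θ c) (hf : Nice f) (hcv : cvx P) {t : Tp} (hP : ∀ s ∈ P, InD t s) 
    (htop : (t.1, t.2.1, nix t.1 t.2.2) ∈ P) (hE : 0 < E) (hEB : EB f P E) (ha : ∀ s ∈ P, a ≤ s.1) :
    Stop (P.image fun s => (s.1, s.2.1)) (stG γ f t.2.2 0) (stG φ f t.2.2 (-1)) (stG φ' f t.2.2 (-2))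
      (fun s => if c2 s.1 t.2.2 then 65536 * c * FF f (s.1, s.2, nix s.1 t.2.2) else 0) (65536 * c * E) a t.1 t.2.1 ∧
    (∀ k m, (k, m) ∈ (P.image fun s => (s.1, s.2.1)) ↔ (k, m, nix k t.2.2) ∈ P) ∧
    ∀ K M, iv K M ⊆ iv t.1 t.2.1 →
      ∑ s ∈ (P.image fun s => (s.1, s.2.1)).filter (fun s => iv s.1 s.2 ⊆ iv K M), sc s.1 * (if c2 s.1 t.2.2 then 65536 * c * FF f (s.1, s.2, nix s.1 t.2.2) else 0) ^ 2 ≤ (65536 * c * E) ^ 2 * sc K := by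
  have c0 := hK.c0
  have hmem : ∀ k m, (k, m) ∈ (P.image fun s => (s.1, s.2.1)) ↔ (k, m, nix k t.2.2) ∈ P := by
    intro k m
    rw [Finset.mem_image]
    constructor
    · rintro ⟨⟨k', m', n'⟩, hs, he⟩
      have := (hP _ hs).2
      simp only [Prod.mk.injEq] at he this
      obtain ⟨rfl, rfl⟩ := he
      rw [this]; exact hs
    · intro h; exact ⟨_, h, rfl⟩
  have hcar : ∀ K M, ∑ s ∈ (P.image fun s => (s.1, s.2.1)).filter (fun s => iv s.1 s.2 ⊆ iv K M), sc s.1 * (if c2 s.1 t.2.2 then 65536 * c * FF f (s.1, s.2, nix s.1 t.2.2) else 0) ^ 2 ≤ (65536 * c * E) ^ 2 * sc K := by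
    intro K M
    have h1 := hEB (K, M, t.2.2)
    calc _ = ∑ s ∈ (P.image fun s => (s.1, s.2.1)).filter (fun s => iv s.1 s.2 ⊆ iv K M ∧ c2 s.1 t.2.2), (65536 * c) ^ 2 * (sc s.1 * FF f (s.1, s.2, nix s.1 t.2.2) ^ 2) := by
          rw [← Finset.filter_filter, Finset.sum_filter (fun s : ℤ × ℤ => c2 s.1 t.2.2)]
          refine Finset.sum_congr rfl fun s _ => ?_
          split_ifs <;> ring
      _ = (65536 * c) ^ 2 * ∑ s ∈ P with In2 (K, M, t.2.2) s, sc s.1 * FF f s ^ 2 := by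
          rw [← Finset.mul_sum]
          congr 1
          refine Finset.sum_nbij' (fun s => (s.1, s.2, nix s.1 t.2.2)) (fun s => (s.1, s.2.1)) ?_ ?_ ?_ ?_ ?_
          · rintro ⟨k, m⟩ hs
            rw [Finset.mem_filter, hmem] at hs
            exact Finset.mem_filter.2 ⟨hs.1, ⟨⟨hs.2.1, rfl⟩, hs.2.2⟩⟩
          · rintro ⟨k, m, n⟩ hs
            rw [Finset.mem_filter] at hs
            exact Finset.mem_filter.2 ⟨Finset.mem_image_of_mem _ hs.1, hs.2.1.1, hs.2.2⟩
          · intro s _; rfl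
          · rintro ⟨k, m, n⟩ hs
            have := (hP _ (Finset.mem_filter.1 hs).1).2
            simp only at this ⊢; rw [this]
          · intro s _; rfl
      _ ≤ (65536 * c) ^ 2 * (E ^ 2 * sc K) := by gcongr
      _ = _ := by ring
  refine ⟨⟨?_, ?_, ?_, ?_, ?_, ?_, ?_, ?_, ?_⟩, hmem, fun K M _ => hcar K M⟩
  · rintro ⟨k, m⟩ hs
    rw [hmem] at hs
    exact ⟨ha _ hs, (hP _ hs).1⟩
  · intro x j k h1 h2 h3
    rw [hmem] at h1 ⊢
    have h4 : idx t.1 x = t.2.1 := (hP _ h1).1 rfl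
    refine hcv _ _ _ (tle_tree h2 x t.2.2) (tle_tree h3 x t.2.2) h1 ?_
    rw [h4]; exact htop
  · intro k x; simpa using stG_deriv c0 hf hK.pγ hK.pφ hK.dγ t.2.2 0 k x
  · intro k x; simpa using stG_deriv c0 hf hK.pφ hK.pφ' hK.dφ t.2.2 (-1) k x
  · intro k
    unfold stG
    by_cases h2 : c2 k t.2.2
    · simp only [h2, if_true]; exact continuous_const.mul (Wg_cont c0 hf hK.pφ' k t.2.2)
    · simp only [h2, if_false]; exact continuous_const
  · rintro ⟨k, m⟩ _ x hx
    refine ⟨?_, ?_, ?_⟩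
    · simpa using stG_norm c0 hf hK.pφ (ξ := t.2.2) (-1) hx
    · refine (stG_norm c0 hf hK.pφ' (ξ := t.2.2) (-2) hx).trans (le_of_eq ?_)
      norm_num [zpow_neg_one]; split_ifs <;> ring
    · refine (stG_norm c0 hf hK.pγ (ξ := t.2.2) 0 hx).trans (le_of_eq ?_)
      norm_num; split_ifs <;> ring
  · rintro ⟨k, m⟩ _
    have := FF_nonneg hf (k, m, nix k t.2.2)
    split_ifs <;> positivity
  · rintro ⟨k, m⟩ hs
    rw [hmem] at hs
    have := hEB.le hf hE.le hs
    split_ifs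
    · gcongr
    · positivity
  · refine le_trans (le_of_eq ?_) (hcar t.1 t.2.1)
    rw [Finset.filter_true_of_mem]
    rintro ⟨k, m⟩ hs
    rw [hmem] at hs
    exact (hP _ hs).1

open Classical in
lemma tree_pt (hK : Ker φ γ φ' θ c) (hf : Nice f) (hcv : cvx P) {t : Tp} (hP : ∀ s ∈ P, InD t s) 
    (hE : 0 < E) (hEB : EB f P E) (x : ℝ) :
    ‖TS φ f N κ a b P x‖ₑ ≤ 2 * Zf (P.image fun s => (s.1, s.2.1)) (stG φ f t.2.2 (-1)) a t.1 x + ENNReal.ofReal (2 * (65536 * c * E)) := by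
  have c0 := hK.c0
  set E' := 65536 * c * E with hE'
  have pE' : 0 < E' := by positivity
  set I := P.image fun s => (s.1, s.2.1) with hI
  set g := stG φ f t.2.2 (-1) with hg
  set S := (Finset.Icc a b).filter fun k => tl N k x ∈ P ∧ κ x ≤ k with hS
  have hTS : TS φ f N κ a b P x = ∑ k ∈ S, if c2 k (N x) then AA φ f k (N x) x else 0 := by
    unfold TS
    rw [hS, Finset.sum_filter]
    refine Finset.sum_congr rfl fun k _ => ?_
    by_cases h1 : tl N k x ∈ P <;> by_cases h2 : c2 k (N x) <;> by_cases h3 : κ x ≤ k <;> simp [h1, h2, h3]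
  rcases S.eq_empty_or_nonempty with h0 | hne
  · rw [hTS, h0]; simp
  set k2 := S.min' hne with hk2
  set k3 := S.max' hne with hk3
  have m2 := S.min'_mem hne
  have m3 := S.max'_mem hne
  rw [← hk2] at m2; rw [← hk3] at m3
  rw [hS, Finset.mem_filter, Finset.mem_Icc] at m2 m3
  have h23 : k2 ≤ k3 := S.min'_le_max' hne
  have hSI : S = Finset.Icc k2 k3 := by
    ext k
    constructor
    · intro h; exact Finset.mem_Icc.2 ⟨S.min'_le k h, S.le_max' k h⟩
    · intro h
      rw [Finset.mem_Icc] at h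
      rw [hS, Finset.mem_filter, Finset.mem_Icc]
      exact ⟨⟨m2.1.1.trans h.1, h.2.trans m3.1.2⟩, hcv _ _ _ (tle_tl N h.1 x) (tle_tl N h.2 x) m2.2.1 m3.2.1, m2.2.2.trans h.1⟩
  have hInP : ∀ k ∈ Finset.Icc k2 k3, tl N k x ∈ P := fun k hk => by
    rw [← hSI, hS, Finset.mem_filter] at hk; exact hk.2.1
  have hnk : ∀ k ∈ Finset.Icc k2 k3, nix k t.2.2 = nix k (N x) := fun k hk => (hP _ (hInP k hk)).2
  have hk3m : k3 ∈ Finset.Icc k2 k3 := Finset.right_mem_Icc.2 h23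
  have hxI : ∀ k, x ∈ Icc (idx k x * sc k) ((idx k x + 1) * sc k) := fun k => iv_mem_Icc (mem_iv.2 rfl)
  have hK3 : k3 ≤ t.1 := le_of_iv_subset (hP _ (hInP k3 hk3m)).1
  have hZ : ∀ k ∈ Finset.Icc k2 k3, ‖GS g t.1 k x‖ₑ ≤ Zf I g a t.1 x := fun k hk => by
    refine le_Zf ?_ (Finset.mem_image_of_mem (fun s : Tile => (s.1, s.2.1)) (hInP k hk))
    rw [Finset.mem_Icc] at hk ⊢
    exact ⟨m2.1.1.trans hk.1, hk.2.trans hK3⟩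
  have hlast : Finset.Icc k2 k3 = insert k3 (Finset.Ico k2 k3) := by
    ext j; simp only [Finset.mem_Icc, Finset.mem_insert, Finset.mem_Ico]; omega
  have hGS : GS g t.1 k2 x - GS g t.1 k3 x = ∑ k ∈ Finset.Ico k2 k3, g k x := by
    unfold GS
    have : Finset.Icc k2 t.1 = Finset.Ico k2 k3 ∪ Finset.Icc k3 t.1 := by
      ext j; simp only [Finset.mem_Icc, Finset.mem_union, Finset.mem_Ico]; omega
    rw [this, Finset.sum_union]
    · ring
    · rw [Finset.disjoint_left]; intro j; simp only [Finset.mem_Icc, Finset.mem_Ico]; omega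
  have hsp : TS φ f N κ a b P x = (if c2 k3 (N x) then AA φ f k3 (N x) x else 0) + ee (t.2.2 * x) * (GS g t.1 k2 x - GS g t.1 k3 x) +
      ∑ k ∈ Finset.Ico k2 k3, (if c2 k t.2.2 then AA φ f k (N x) x - AA φ f k t.2.2 x else 0) := by
    rw [hTS, hSI, hlast, Finset.sum_insert (by simp), hGS, Finset.mul_sum, add_assoc, ← Finset.sum_add_distrib]
    congr 1
    refine Finset.sum_congr rfl fun k hk => ?_
    rw [Finset.mem_Ico] at hk
    have e1 := hnk k (Finset.mem_Icc.2 ⟨hk.1, hk.2.le⟩)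
    have e2 := hnk (k+1) (Finset.mem_Icc.2 ⟨by omega, by omega⟩)
    have e3 : c2 k (N x) ↔ c2 k t.2.2 := by unfold c2; rw [e1, e2]
    simp only [e3, hg, stG]
    split_ifs
    · rw [AA_Wg φ f k t.2.2 x, zpow_neg_one]; ring
    · ring
  have b1 : ‖(if c2 k3 (N x) then AA φ f k3 (N x) x else 0)‖ ≤ E' := by
    split_ifs with h
    · refine (AA_le hf c0 hK.pφ (hxI k3) rfl h).trans ?_
      have := hEB.le hf hE.le (hInP k3 hk3m)
      rw [hE']; gcongr; exact this
    · simpa using pE'.le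
  have hNξ : |N x - t.2.2| ≤ (sc k3)⁻¹ := by
    have a1 := nix_iff.1 (hnk k3 hk3m)
    have a2 := nix_iff.1 (rfl : nix k3 (N x) = nix k3 (N x))
    have p := sc_pos k3
    have : (((nix k3 (N x) : ℤ) : ℝ) + 1) / sc k3 = nix k3 (N x) / sc k3 + (sc k3)⁻¹ := by field_simp
    rw [abs_le]; constructor <;> linarith [a1.1, a1.2, a2.1, a2.2]
  have b2 : ‖∑ k ∈ Finset.Ico k2 k3, (if c2 k t.2.2 then AA φ f k (N x) x - AA φ f k t.2.2 x else 0)‖ ≤ E' := by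
    have p3 := sc_pos k3
    calc _ ≤ ∑ k ∈ Finset.Ico k2 k3, sc k * (E' * (sc k3)⁻¹) := by
          refine (norm_sum_le _ _).trans (Finset.sum_le_sum fun k hk => ?_)
          rw [Finset.mem_Ico] at hk
          have p := sc_pos k
          split_ifs with h
          · have e1 := hnk k (Finset.mem_Icc.2 ⟨hk.1, hk.2.le⟩)
            have e2 := hnk (k+1) (Finset.mem_Icc.2 ⟨by omega, by omega⟩)
            have := hEB.le hf hE.le (hInP k (Finset.mem_Icc.2 ⟨hk.1, hk.2.le⟩))
            have q := AA_diff hK hf (hxI k) e1 e2.symm h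
            refine q.trans ?_
            rw [mul_assoc]
            have nn := FF_nonneg hf (k, idx k x, nix k (N x))
            gcongr
            rw [hE']; gcongr; exact this
          · simp; positivity
      _ = (∑ k ∈ Finset.Ico k2 k3, sc k) * (E' * (sc k3)⁻¹) := by rw [Finset.sum_mul]
      _ ≤ (sc k3 / 63) * (E' * (sc k3)⁻¹) := by gcongr; exact sum_geom_sc _ _
      _ = E' / 63 := by field_simp
      _ ≤ E' := by linarith
  rw [hsp]
  calc _ ≤ ‖(if c2 k3 (N x) then AA φ f k3 (N x) x else 0)‖ₑ + ‖ee (t.2.2 * x) * (GS g t.1 k2 x - GS g t.1 k3 x)‖ₑ + ‖∑ k ∈ Finset.Ico k2 k3, (if c2 k t.2.2 then AA φ f k (N x) x - AA φ f k t.2.2 x else 0)‖ₑ := 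
        (enorm_add_le _ _).trans (by gcongr; exact enorm_add_le _ _)
    _ ≤ ENNReal.ofReal E' + (Zf I g a t.1 x + Zf I g a t.1 x) + ENNReal.ofReal E' := by
        gcongr
        · exact enorm_le_ofReal b1
        · rw [enorm_mul, show ‖ee (t.2.2 * x)‖ₑ = 1 by rw [← ofReal_norm, norm_ee]; simp, one_mul]
          refine enorm_sub_le.trans (add_le_add (hZ _ (Finset.left_mem_Icc.2 h23)) (hZ _ hk3m))
        · exact enorm_le_ofReal b2
    _ = _ := by
        rw [two_mul E', ENNReal.ofReal_add pE'.le pE'.le]; ring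

end tree
end

section
open MeasureTheory Filter Set
open scoped ENNReal Topology

section tree
variable {φ γ φ' θ f : ℝ → ℂ} {c : ℝ} {N : ℝ → ℝ} {κ : ℝ → ℤ} {a b : ℤ} {P : Finset Tile} {E μ : ℝ} {G : Set ℝ}

def XX (I : Finset (ℤ × ℤ)) (a : ℤ) (s : Tile) : Set ℝ := {x | x ∈ iv s.1 s.2.1 ∧ ∀ j ∈ Finset.Ico a s.1, (j, idx j x) ∉ I}

lemma measurableSet_XX (I : Finset (ℤ × ℤ)) (a : ℤ) (s : Tile) : MeasurableSet (XX I a s) := by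
  have : XX I a s = iv s.1 s.2.1 ∩ ⋂ j ∈ Finset.Ico a s.1, {x | (j, idx j x) ∈ I}ᶜ := by
    ext x; simp [XX]
  rw [this]
  exact (measurableSet_iv _ _).inter (Finset.measurableSet_biInter _ fun j _ => (measurableSet_lvl I j).compl)

open Classical in
lemma tree1 (hK : Ker φ γ φ' θ c) (hf : Nice f) (hN : Measurable N) (hG : MeasurableSet G) (hcv : cvx P) {t : Tp} (hP : ∀ s ∈ P, InD t s) 
    (htop : (t.1, t.2.1, nix t.1 t.2.2) ∈ P) (hE : 0 < E) (hEB : EB f P E) (ha : ∀ s ∈ P, a ≤ s.1)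
    (hμ : 0 ≤ μ) (hm : ∀ s ∈ P, volume (Em N G s) ≤ ENNReal.ofReal (μ * sc s.1)) :
    ∫⁻ x in G, ‖TS φ f N κ a b P x‖ₑ ≤ ENNReal.ofReal (2 ^ 32 * c * μ * E) * volume (iv t.1 t.2.1) := by
  have c0 := hK.c0
  obtain ⟨hst, hmem, hcar⟩ := tree_stop hK hf hcv hP htop hE hEB ha
  have hpt := tree_pt (N := N) (κ := κ) (a := a) (b := b) hK hf hcv hP hE hEB
  set E' := 65536 * c * E with hE'
  have pE' : 0 < E' := by positivity
  set I := P.image fun s => (s.1, s.2.1) with hI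
  set g := stG φ f t.2.2 (-1) with hg
  set Z := Zf I g a t.1 with hZ
  have mZ : Measurable Z := measurable_Zf hst.cg
  set H : ℝ → ℝ≥0∞ := fun x => 2 * Z x + ENNReal.ofReal (2 * E') with hH
  have mH : Measurable H := (mZ.const_mul 2).add_const _
  have hsm := stop_main _ _ _ _ E' pE' a (t.1 - a).toNat I t.1 t.2.1 (Int.self_le_toNat _) hst hcar
  -- pointwise
  have h1 : ∀ x ∈ G, ‖TS φ f N κ a b P x‖ₑ ≤ ∑ s ∈ P, (XX I a s ∩ Em N G s).indicator H x := by
    intro x hx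
    by_cases h0 : TS φ f N κ a b P x = 0
    · rw [h0]; simp
    have : ∃ k, a ≤ k ∧ tl N k x ∈ P := by
      by_contra hcon
      push Not at hcon
      refine h0 ?_
      unfold TS
      refine Finset.sum_eq_zero fun k hk => if_neg fun h => hcon k (Finset.mem_Icc.1 hk).1 h.1
    obtain ⟨k, hak, hk⟩ := this
    set J := (Finset.Icc a k).filter fun j => (j, idx j x) ∈ I with hJ
    have hJn : J.Nonempty := ⟨k, Finset.mem_filter.2 ⟨Finset.right_mem_Icc.2 hak, Finset.mem_image_of_mem (fun s : Tile => (s.1, s.2.1)) hk⟩⟩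
    have m0 := J.min'_mem hJn
    set k0 := J.min' hJn with hk0
    rw [hJ, Finset.mem_filter, Finset.mem_Icc, hmem] at m0
    have e1 : nix k0 (N x) = nix k0 t.2.2 := nix_down m0.1.2 (hP _ hk).2.symm
    have e2 : tl N k0 x = (k0, idx k0 x, nix k0 t.2.2) := by unfold tl; rw [e1]
    refine (hpt x).trans ?_
    refine le_trans ?_ (Finset.single_le_sum (f := fun s => (XX I a s ∩ Em N G s).indicator H x) (fun _ _ => zero_le) m0.2)
    rw [indicator_of_mem]
    refine ⟨⟨rfl, fun j hj hj2 => ?_⟩, hx, e2⟩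
    rw [Finset.mem_Ico] at hj
    have : k0 ≤ j := J.min'_le j (Finset.mem_filter.2 ⟨Finset.mem_Icc.2 ⟨hj.1, by have := hj.2; omega⟩, hj2⟩)
    have := hj.2; omega
  -- volume of cells
  have h2 : ∀ s ∈ P, volume.restrict (Em N G s) (XX I a s) ≤ ENNReal.ofReal (64 * μ) * volume (XX I a s) := by
    intro s hs
    rcases (XX I a s).eq_empty_or_nonempty with h0 | ⟨x, hx⟩
    · rw [h0]; simp
    have hsub : iv (s.1 - 1) (idx (s.1 - 1) x) ⊆ XX I a s := by
      intro y hy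
      rw [mem_iv] at hy
      refine ⟨(idx_up (by omega) hy).trans hx.1, fun j hj hj2 => ?_⟩
      rw [Finset.mem_Ico] at hj
      have hj3 := hst.up y j (s.1 - 1) hj2 (by omega) (by have := le_of_iv_subset (hP _ hs).1; omega)
      rw [hy] at hj3
      exact hx.2 (s.1 - 1) (Finset.mem_Ico.2 ⟨by omega, by omega⟩) hj3
    have hv := measure_mono (μ := volume) hsub
    rw [volume_iv] at hv
    calc _ ≤ volume (Em N G s) := by
          rw [Measure.restrict_apply (measurableSet_XX _ _ _)]; exact measure_mono inter_subset_right
      _ ≤ ENNReal.ofReal (μ * sc s.1) := hm s hs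
      _ = ENNReal.ofReal (64 * μ) * ENNReal.ofReal (sc (s.1 - 1)) := by
          rw [← ENNReal.ofReal_mul (by positivity), sc_pred s.1]; ring_nf
      _ ≤ _ := by gcongr
  have h3 : ∀ s ∈ P, ∀ x ∈ XX I a s, ∀ y ∈ XX I a s, H x ≤ H y + ENNReal.ofReal (4 * E') := by
    intro s hs x hx y hy
    have : Z x ≤ Z y + ENNReal.ofReal (2 * E') := by
      refine Finset.sup_le fun k hk => ?_
      split_ifs with hkI
      · have hsk : s.1 ≤ k := by
          by_contra hlt
          exact hx.2 k (Finset.mem_Ico.2 ⟨(Finset.mem_Icc.1 hk).1, by omega⟩) hkI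
        have e : idx k x = idx k y := idx_up hsk (hx.1.trans hy.1.symm)
        have o := hst.osc pE'.le (Finset.mem_image_of_mem (fun s : Tile => (s.1, s.2.1)) hs) hsk (iv_mem_Icc hx.1) (iv_mem_Icc hy.1)
        calc ‖GS g t.1 k x‖ₑ = ‖GS g t.1 k y + (GS g t.1 k x - GS g t.1 k y)‖ₑ := by congr 1; ring
          _ ≤ _ := (enorm_add_le _ _).trans (add_le_add (le_Zf hk (e ▸ hkI)) (enorm_le_ofReal o))
      · exact zero_le
    calc H x ≤ 2 * (Z y + ENNReal.ofReal (2 * E')) + ENNReal.ofReal (2 * E') := by simp only [hH]; gcongr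
      _ = H y + ENNReal.ofReal (4 * E') := by
        simp only [hH]
        rw [show 4 * E' = 2 * E' + 2 * E' by ring, ENNReal.ofReal_add (p := 2 * E') (by positivity) (by positivity)]
        ring
  calc ∫⁻ x in G, ‖TS φ f N κ a b P x‖ₑ ≤ ∫⁻ x in G, ∑ s ∈ P, (XX I a s ∩ Em N G s).indicator H x := 
        setLIntegral_mono' hG h1
    _ = ∑ s ∈ P, ∫⁻ x in G, (XX I a s ∩ Em N G s).indicator H x := 
        lintegral_finsetSum _ fun s _ => mH.indicator ((measurableSet_XX _ _ _).inter (measurableSet_Em hN hG s))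
    _ ≤ ∑ s ∈ P, ENNReal.ofReal (64 * μ) * ∫⁻ x in XX I a s, (H x + ENNReal.ofReal (4 * E')) := by
        refine Finset.sum_le_sum fun s hs => ?_
        refine (setLIntegral_le_lintegral _ _).trans ?_
        rw [lintegral_indicator ((measurableSet_XX _ _ _).inter (measurableSet_Em hN hG s)), ← Measure.restrict_restrict (measurableSet_XX _ _ _)]
        refine osc_cell (ne_top_of_le_ne_top ?_ (measure_mono (fun x hx => hx.1 : XX I a s ⊆ iv s.1 s.2.1))) mH (h2 s hs) (h3 s hs)
        rw [volume_iv]; exact ENNReal.ofReal_ne_top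
    _ = ENNReal.ofReal (64 * μ) * ∫⁻ x in ⋃ s ∈ P, XX I a s, (H x + ENNReal.ofReal (4 * E')) := by
        rw [← Finset.mul_sum, lintegral_biUnion_finset]
        · intro s hs s' hs' hne
          rw [Function.onFun, Set.disjoint_left]
          intro x hx hx'
          have key : ∀ s ∈ P, ∀ s' ∈ P, x ∈ XX I a s → x ∈ XX I a s' → ¬ s.1 < s'.1 := by
            intro s hs s' hs' hx hx' hlt
            refine hx'.2 s.1 (Finset.mem_Ico.2 ⟨ha s hs, hlt⟩) ?_
            rw [mem_iv.1 hx.1]; exact Finset.mem_image_of_mem (fun s : Tile => (s.1, s.2.1)) hs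
          have e1 : s.1 = s'.1 := by have := key s hs s' hs' hx hx'; have := key s' hs' s hs hx' hx; omega
          have e2 : s.2.1 = s'.2.1 := by rw [← mem_iv.1 hx.1, ← mem_iv.1 hx'.1, e1]
          have e3 : s.2.2 = s'.2.2 := by rw [← (hP s hs).2, ← (hP s' hs').2, e1]
          exact hne (Prod.ext e1 (Prod.ext e2 e3))
        · intro s _; exact measurableSet_XX _ _ _
    _ ≤ ENNReal.ofReal (64 * μ) * ∫⁻ x in iv t.1 t.2.1, (H x + ENNReal.ofReal (4 * E')) := by
        gcongr
        exact iUnion₂_subset fun s hs x hx => (hP s hs).1 hx.1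
    _ ≤ ENNReal.ofReal (64 * μ) * (ENNReal.ofReal (526 * E' * sc t.1)) := by
        gcongr
        have pt := sc_pos t.1
        calc ∫⁻ x in iv t.1 t.2.1, (H x + ENNReal.ofReal (4 * E')) = ∫⁻ x in iv t.1 t.2.1, (2 * Z x + ENNReal.ofReal (6 * E')) := by
              congr 1; ext x; simp only [hH]; rw [add_assoc, ← ENNReal.ofReal_add (by positivity) (by positivity)]; ring_nf
          _ = 2 * (∫⁻ x in iv t.1 t.2.1, Z x) + ENNReal.ofReal (6 * E') * ENNReal.ofReal (sc t.1) := by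
              rw [lintegral_add_right _ measurable_const, lintegral_const_mul _ mZ, setLIntegral_const, volume_iv]
          _ ≤ 2 * ENNReal.ofReal (260 * E' * sc t.1) + ENNReal.ofReal (6 * E') * ENNReal.ofReal (sc t.1) := by gcongr
          _ = _ := by
              rw [← ENNReal.ofReal_ofNat 2, ← ENNReal.ofReal_mul (by positivity), ← ENNReal.ofReal_mul (by positivity), ← ENNReal.ofReal_add (by positivity) (by positivity)]
              ring_nf
    _ ≤ _ := by
        have pt := sc_pos t.1
        rw [volume_iv, ← ENNReal.ofReal_mul (by positivity), ← ENNReal.ofReal_mul (by positivity), hE']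
        refine ENNReal.ofReal_le_ofReal ?_
        have : 0 ≤ c * μ * E * sc t.1 := by positivity
        nlinarith

open Classical in
lemma TS_lint_split (hφ : Continuous φ) (hf : Nice f) (hN : Measurable N) (hκ : Measurable κ) (p : Tile → Prop) :
    ∫⁻ x in G, ‖TS φ f N κ a b P x‖ₑ ≤ (∫⁻ x in G, ‖TS φ f N κ a b (P.filter p) x‖ₑ) + ∫⁻ x in G, ‖TS φ f N κ a b (P.filter fun s => ¬ p s) x‖ₑ := by
  rw [← lintegral_add_left (measurable_TS hφ hf hN hκ a b _).enorm]
  refine lintegral_mono fun x => ?_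
  rw [TS_split P p x]; exact enorm_add_le _ _

lemma cvx.filt (h : cvx P) {p : Tile → Prop} [DecidablePred p] (hp : ∀ s s', tle s s' → p s' → p s) : cvx (P.filter p) := by
  intro s s' s'' h1 h2 h3 h4
  rw [Finset.mem_filter] at h3 h4 ⊢
  exact ⟨h _ _ _ h1 h2 h3.1 h4.1, hp _ _ h2 h4.2⟩
lemma cvx.filt' (h : cvx P) {p : Tile → Prop} [DecidablePred p] (hp : ∀ s s', tle s s' → p s → p s') : cvx (P.filter p) := by
  intro s s' s'' h1 h2 h3 h4
  rw [Finset.mem_filter] at h3 h4 ⊢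
  exact ⟨h _ _ _ h1 h2 h3.1 h4.1, hp _ _ h1 h3.2⟩
lemma EB.mono (h : EB f P E) {P' : Finset Tile} (hs : P' ⊆ P) : EB f P' E := by
  classical
  intro t
  refine le_trans (Finset.sum_le_sum_of_subset_of_nonneg (Finset.filter_subset_filter _ hs) fun s _ _ => ?_) (h t)
  have := sc_pos s.1; positivity

lemma tree (hK : Ker φ γ φ' θ c) (hf : Nice f) (hN : Measurable N) (hκ : Measurable κ) (hG : MeasurableSet G) {t : Tp} 
    (hE : 0 < E) (hμ : 0 ≤ μ) (n : ℕ) : ∀ P : Finset Tile, P.card ≤ n → cvx P → (∀ s ∈ P, InD t s) → EB f P E → (∀ s ∈ P, a ≤ s.1) →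
    (∀ s ∈ P, volume (Em N G s) ≤ ENNReal.ofReal (μ * sc s.1)) →
    ∫⁻ x in G, ‖TS φ f N κ a b P x‖ₑ ≤ ENNReal.ofReal (2 ^ 32 * c * μ * E) * volume (⋃ s ∈ P, iv s.1 s.2.1) := by
  classical
  have hcase : ∫⁻ x in G, ‖TS φ f N κ a b ∅ x‖ₑ = 0 := by simp [TS]
  induction n with
  | zero =>
    intro P hc _ _ _ _ _
    rw [Finset.card_eq_zero.1 (Nat.le_zero.1 hc), hcase]; exact zero_le
  | succ n ih =>
    intro P hc hcv hP hEB ha hm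
    rcases P.eq_empty_or_nonempty with h0 | hne
    · rw [h0, hcase]; exact zero_le
    obtain ⟨s, hs, hmax⟩ := P.exists_max_image (fun s => s.1) hne
    set t' : Tp := (s.1, s.2.1, t.2.2) with ht'
    have hst' : InD t' s := ⟨subset_rfl, (hP s hs).2⟩
    refine (TS_lint_split hK.pφ.cont hf hN hκ (InD t')).trans ?_
    have q1 : ∫⁻ x in G, ‖TS φ f N κ a b (P.filter (InD t')) x‖ₑ ≤ ENNReal.ofReal (2 ^ 32 * c * μ * E) * volume (iv t'.1 t'.2.1) := by
      refine tree1 (t := t') hK hf hN hG (hcv.filt fun s s' h h' => h.inD h') (fun s hs => (Finset.mem_filter.1 hs).2) ?_ hE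
        (hEB.mono (Finset.filter_subset _ _)) (fun s hs => ha s (Finset.mem_filter.1 hs).1) hμ (fun s hs => hm s (Finset.mem_filter.1 hs).1)
      have : (t'.1, t'.2.1, nix t'.1 t'.2.2) = s := Prod.ext rfl (Prod.ext rfl hst'.2)
      rw [this]; exact Finset.mem_filter.2 ⟨hs, hst'⟩
    have q2 := ih (P.filter fun s => ¬ InD t' s) (by
        have : (P.filter fun s => ¬ InD t' s).card < P.card := Finset.card_lt_card (Finset.filter_ssubset.2 ⟨s, hs, by simpa using hst'⟩)
        omega) (hcv.filt' (p := fun s => ¬ InD t' s) fun s s' h h' h2 => h' (h.inD h2)) (fun s hs => hP s (Finset.mem_filter.1 hs).1)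
        (hEB.mono (Finset.filter_subset _ _)) (fun s hs => ha s (Finset.mem_filter.1 hs).1) (fun s hs => hm s (Finset.mem_filter.1 hs).1)
    refine (add_le_add q1 q2).trans ?_
    rw [← mul_add]
    gcongr
    rw [← measure_union]
    · refine measure_mono (union_subset ?_ ?_)
      · exact subset_biUnion_of_mem (u := fun s : Tile => iv s.1 s.2.1) hs
      · exact biUnion_mono (Finset.filter_subset _ _) fun _ _ => subset_rfl
    · rw [Set.disjoint_iUnion₂_right]
      intro s' hs'
      rw [Finset.mem_filter] at hs'
      rw [Set.disjoint_left]
      intro x hx hx'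
      refine hs'.2 ⟨(iv_subset_iff_of (hmax s' hs'.1) hx').2 hx, (hP s' hs'.1).2⟩
    · exact Finset.measurableSet_biUnion _ fun s _ => measurableSet_iv _ _

lemma forest (hK : Ker φ γ φ' θ c) (hf : Nice f) (hN : Measurable N) (hκ : Measurable κ) (hG : MeasurableSet G)
    (hE : 0 < E) (hμ : 0 ≤ μ) (𝒯 : Finset Tp) : ∀ P : Finset Tile, cvx P → (∀ s ∈ P, ∃ t ∈ 𝒯, InD t s) → EB f P E → (∀ s ∈ P, a ≤ s.1) →
    (∀ s ∈ P, volume (Em N G s) ≤ ENNReal.ofReal (μ * sc s.1)) →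
    ∫⁻ x in G, ‖TS φ f N κ a b P x‖ₑ ≤ ENNReal.ofReal (2 ^ 32 * c * μ * E * ∑ t ∈ 𝒯, sc t.1) := by
  classical
  have c0 := hK.c0
  induction 𝒯 using Finset.induction_on with
  | empty =>
    intro P _ h _ _ _
    have : P = ∅ := Finset.eq_empty_of_forall_notMem fun s hs => by obtain ⟨t, ht, _⟩ := h s hs; simp at ht
    rw [this]; simp [TS]
  | insert t 𝒯 ht ih =>
    intro P hcv hP hEB ha hm
    refine (TS_lint_split hK.pφ.cont hf hN hκ (InD t)).trans ?_
    have q1 := tree (κ := κ) (b := b) (t := t) hK hf hN hκ hG hE hμ _ (P.filter (InD t)) le_rfl (hcv.filt fun s s' h h' => h.inD h') (fun s hs => (Finset.mem_filter.1 hs).2)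
        (hEB.mono (Finset.filter_subset _ _)) (fun s hs => ha s (Finset.mem_filter.1 hs).1) (fun s hs => hm s (Finset.mem_filter.1 hs).1)
    have q2 := ih (P.filter fun s => ¬ InD t s) (hcv.filt' (p := fun s => ¬ InD t s) fun s s' h h' h2 => h' (h.inD h2)) (fun s hs => by
        rw [Finset.mem_filter] at hs
        obtain ⟨t', ht', h⟩ := hP s hs.1
        rcases Finset.mem_insert.1 ht' with rfl | h'
        · exact absurd h hs.2
        · exact ⟨t', h', h⟩)
        (hEB.mono (Finset.filter_subset _ _)) (fun s hs => ha s (Finset.mem_filter.1 hs).1) (fun s hs => hm s (Finset.mem_filter.1 hs).1)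
    have q3 : volume (⋃ s ∈ P.filter (InD t), iv s.1 s.2.1) ≤ ENNReal.ofReal (sc t.1) := by
      rw [← volume_iv t.1 t.2.1]
      exact measure_mono (iUnion₂_subset fun s hs => (Finset.mem_filter.1 hs).2.1)
    refine (add_le_add (q1.trans (mul_le_mul_right q3 _)) q2).trans (le_of_eq ?_)
    have p := sc_pos t.1
    have p2 : 0 ≤ ∑ t ∈ 𝒯, sc t.1 := Finset.sum_nonneg fun t _ => (sc_pos _).le
    rw [← ENNReal.ofReal_mul (by positivity), ← ENNReal.ofReal_add (by positivity) (by positivity), Finset.sum_insert ht]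
    ring_nf
end tree
end

section
open MeasureTheory Filter Set
open scoped ENNReal Topology

lemma vitali_cover {ι : Type*} (S : Finset ι) (x r : ι → ℝ) {μ : Measure ℝ} {ρ : ℝ} (hρ : 0 < ρ)
    (h : ∀ s ∈ S, ENNReal.ofReal (ρ * r s) ≤ μ (Metric.closedBall (x s) (r s))) :
    volume (⋃ s ∈ S, Metric.closedBall (x s) (r s)) ≤ ENNReal.ofReal (10 / ρ) * μ univ := by
  classical
  obtain ⟨R, hR⟩ := (S.image r).exists_le
  obtain ⟨u, hu, hd, hc⟩ := Vitali.exists_disjoint_subfamily_covering_enlargement_closedBall (S : Set ι) x r R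
    (fun a ha => hR _ (Finset.mem_image_of_mem _ ha)) 5 (by norm_num)
  obtain ⟨U, rfl⟩ := (S.finite_toSet.subset hu).exists_finset_coe
  calc volume (⋃ s ∈ S, Metric.closedBall (x s) (r s)) ≤ volume (⋃ s ∈ U, Metric.closedBall (x s) (5 * r s)) := by
        refine measure_mono (iUnion₂_subset fun s hs => ?_)
        obtain ⟨b, hb, hsub⟩ := hc s hs
        exact hsub.trans (subset_biUnion_of_mem (u := fun s => Metric.closedBall (x s) (5 * r s)) hb)
    _ ≤ ∑ s ∈ U, volume (Metric.closedBall (x s) (5 * r s)) := measure_biUnion_finset_le _ _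
    _ ≤ ∑ s ∈ U, ENNReal.ofReal (10 / ρ) * μ (Metric.closedBall (x s) (r s)) := by
        refine Finset.sum_le_sum fun s hs => ?_
        rw [Real.volume_closedBall]
        refine le_trans (le_of_eq ?_) (mul_le_mul_right (h s (hu hs)) _)
        rw [← ENNReal.ofReal_mul (by positivity)]; congr 1; field_simp; ring
    _ = ENNReal.ofReal (10 / ρ) * μ (⋃ s ∈ U, Metric.closedBall (x s) (r s)) := by
        rw [← Finset.mul_sum, measure_biUnion_finset hd fun s _ => Metric.isClosed_closedBall.measurableSet]
    _ ≤ _ := by gcongr; exact subset_univ _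

lemma tle_trans {s s' s'' : Tile} (h : tle s s') (h' : tle s' s'') : tle s s'' :=
  ⟨h.1.trans h'.1, (h.inD ⟨h'.1, h'.2⟩ : InD (s''.1, s''.2.1, s''.2.2 / sc s''.1) s).2⟩
lemma tle_refl (s : Tile) : tle s s := ⟨subset_rfl, nix_self _ _⟩
lemma tle_antisymm {s s' : Tile} (h : tle s s') (h' : tle s' s) : s = s' := by
  have e1 : s.1 = s'.1 := le_antisymm (le_of_iv_subset h.1) (le_of_iv_subset h'.1)
  have e2 : s.2.1 = s'.2.1 := by
    have := h.1 (left_mem_iv s.1 s.2.1)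
    have h3 := left_mem_iv s.1 s.2.1
    rw [mem_iv] at this h3
    rw [← this, ← e1, h3]
  have e3 : s.2.2 = s'.2.2 := by rw [← h.2, e1, nix_self]
  exact Prod.ext e1 (Prod.ext e2 e3)

section asm
variable {φ γ φ' θ f : ℝ → ℂ} {c : ℝ} {N : ℝ → ℝ} {κ : ℝ → ℤ} {a b : ℤ} {P : Finset Tile} {E μ : ℝ} {G F : Set ℝ}

lemma levels (hφ : Continuous φ) (hf : Nice f) (hN : Measurable N) (hκ : Measurable κ) (L : ℕ → Tile → Prop) (h0 : ∀ s ∈ P, L 0 s)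
    (hL : ∀ i s, L (i+1) s → L i s) (B : ℕ → ℝ≥0∞) 
    (hB : ∀ i P', (∀ s, s ∈ P' ↔ s ∈ P ∧ L i s ∧ ¬ L (i+1) s) → ∫⁻ x in G, ‖TS φ f N κ a b P' x‖ₑ ≤ B i)
    (hr : ∀ P', (∀ s, s ∈ P' ↔ s ∈ P ∧ ∀ i, L i s) → ∫⁻ x in G, ‖TS φ f N κ a b P' x‖ₑ = 0) :
    ∫⁻ x in G, ‖TS φ f N κ a b P x‖ₑ ≤ ∑' i, B i := by
  classical
  have anti : ∀ i j s, i ≤ j → L j s → L i s := fun i j s h => by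
    induction j, h using Nat.le_induction with
    | base => exact id
    | succ j _ ih => exact fun h => ih (hL _ _ h)
  have key : ∀ n, ∫⁻ x in G, ‖TS φ f N κ a b P x‖ₑ ≤ ∑ i ∈ Finset.range n, B i + ∫⁻ x in G, ‖TS φ f N κ a b (P.filter (L n)) x‖ₑ := by
    intro n
    induction n with
    | zero => rw [Finset.filter_true_of_mem h0]; simp
    | succ n ih =>
      refine ih.trans ?_
      rw [Finset.sum_range_succ, add_assoc]
      gcongr
      refine (TS_lint_split (P := P.filter (L n)) hφ hf hN hκ (fun s => ¬ L (n+1) s)).trans ?_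
      refine add_le_add (hB n _ fun s => by simp only [Finset.mem_filter, and_assoc]) (le_of_eq ?_)
      congr 1; ext x; congr 2; ext s; simp only [Finset.mem_filter, not_not]
      exact ⟨fun h => ⟨h.1.1, h.2⟩, fun h => ⟨⟨h.1, hL _ _ h.2⟩, h.2⟩⟩
  have : ∃ n, P.filter (L n) = P.filter fun s => ∀ i, L i s := by
    have h1 : ∀ s, ∃ n, L n s → ∀ i, L i s := fun s => by
      by_cases h : ∀ i, L i s
      · exact ⟨0, fun _ => h⟩
      · push Not at h; obtain ⟨n, hn⟩ := h; exact ⟨n, fun h => absurd h hn⟩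
    choose m hm using h1
    refine ⟨P.sup m, Finset.filter_congr fun s hs => ⟨fun h => hm s (anti _ _ s (Finset.le_sup hs) h), fun h => h _⟩⟩
  obtain ⟨n, hn⟩ := this
  refine (key n).trans ?_
  rw [hn, hr _ (by simp), add_zero]
  exact ENNReal.sum_le_tsum _

lemma energy_iter (hK : Ker φ γ φ' θ c) (hf : Nice f) (hN : Measurable N) (hκ : Measurable κ) (hG : MeasurableSet G)
    (hμ : 0 ≤ μ) {𝒯 : Finset Tp} {S D : ℝ} (hS : ∑ t ∈ 𝒯, sc t.1 ≤ S) (hD : 2 ^ 24 * ∫ x, ‖f x‖ ^ 2 ≤ D) (n : ℕ) : 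
    ∀ (P : Finset Tile) (E : ℝ), 0 < E → cvx P → (∀ s ∈ P, ∃ t ∈ 𝒯, InD t s) → EB f P E → (∀ s ∈ P, a ≤ s.1) →
    (∀ s ∈ P, volume (Em N G s) ≤ ENNReal.ofReal (μ * sc s.1)) →
    ∫⁻ x in G, ‖TS φ f N κ a b P x‖ₑ ≤ ENNReal.ofReal (2 ^ 32 * c * μ * (∑ l ∈ Finset.range n, min (E / 2 ^ l * S) (D / (E / 2 ^ l)) + E / 2 ^ n * S)) := by
  classical
  have c0 := hK.c0
  have S0 : 0 ≤ S := (Finset.sum_nonneg fun t _ => (sc_pos _).le).trans hS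
  have D0 : 0 ≤ D := (mul_nonneg (by norm_num) (integral_nonneg fun x => by positivity)).trans hD
  induction n with
  | zero =>
    intro P E hE hcv hP hEB ha hm
    refine (forest hK hf hN hκ hG hE hμ 𝒯 P hcv hP hEB ha hm).trans (ENNReal.ofReal_le_ofReal ?_)
    simp only [Finset.range_zero, Finset.sum_empty, pow_zero, div_one, zero_add]
    rw [← mul_assoc]; gcongr
  | succ n ih =>
    intro P E hE hcv hP hEB ha hm
    obtain ⟨𝒯', h1, h2⟩ := energy_lemma hf hE.le hEB
    refine (TS_lint_split hK.pφ.cont hf hN hκ (fun s => ∀ t ∈ 𝒯', ¬ InD t s)).trans ?_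
    rw [add_comm]
    set Pa := P.filter fun s => ¬ ∀ t ∈ 𝒯', ¬ InD t s with hPa
    set Pb := P.filter fun s => ∀ t ∈ 𝒯', ¬ InD t s with hPb
    have ca : cvx Pa := hcv.filt fun s s' h h' h2 => h' fun t ht h3 => h2 t ht (h.inD h3)
    have cb : cvx Pb := hcv.filt' (p := fun s => ∀ t ∈ 𝒯', ¬ InD t s) fun s s' h h' t ht h3 => h' t ht (h.inD h3)
    have sa : Pa ⊆ P := Finset.filter_subset _ _
    have sb : Pb ⊆ P := Finset.filter_subset _ _
    have q1 := forest (κ := κ) (b := b) hK hf hN hκ hG hE hμ 𝒯 Pa ca (fun s hs => hP s (sa hs)) (hEB.mono sa) (fun s hs => ha s (sa hs)) (fun s hs => hm s (sa hs))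
    have q2 := forest (κ := κ) (b := b) hK hf hN hκ hG hE hμ 𝒯' Pa ca (fun s hs => by
      have := (Finset.mem_filter.1 hs).2; push Not at this; exact this) (hEB.mono sa) (fun s hs => ha s (sa hs)) (fun s hs => hm s (sa hs))
    have q3 := ih Pb (E / 2) (by positivity) cb (fun s hs => hP s (sb hs)) h1 (fun s hs => ha s (sb hs)) (fun s hs => hm s (sb hs))
    have q4 : ∫⁻ x in G, ‖TS φ f N κ a b Pa x‖ₑ ≤ ENNReal.ofReal (2 ^ 32 * c * μ * min (E * S) (D / E)) := by
      rw [mul_min_of_nonneg _ _ (by positivity), ENNReal.ofReal_min]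
      refine le_min (q1.trans (ENNReal.ofReal_le_ofReal ?_)) (q2.trans (ENNReal.ofReal_le_ofReal ?_))
      · rw [← mul_assoc]; gcongr
      · rw [mul_assoc (2 ^ 32 * c * μ)]; gcongr
        rw [le_div_iff₀ hE]; nlinarith
    refine le_trans (le_of_eq (by congr!)) ((add_le_add q4 q3).trans ?_)
    rw [← ENNReal.ofReal_add (by positivity) (by positivity)]
    refine ENNReal.ofReal_le_ofReal (le_of_eq ?_)
    rw [Finset.sum_range_succ']
    simp only [pow_zero, div_one, pow_succ', div_div]
    ring

def DF (F : Set ℝ) (s : Tile) (a : ℝ) : Prop := ∀ k m : ℤ, iv s.1 s.2.1 ⊆ iv k m → dens F (m * sc k) (sc k) a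
lemma DF.up {s s' : Tile} {a : ℝ} (h : DF F s a) (hs : tle s s') : DF F s' a := fun k m hk => h k m (hs.1.trans hk)

/-- an eighth root of `1/2` -/
lemma exists_r : ∃ r : ℝ, 0 < r ∧ r < 1 ∧ r ^ 8 = 1 / 2 := by
  refine ⟨√√√(1/2), by positivity, ?_, ?_⟩
  · rw [Real.sqrt_lt' one_pos, one_pow, Real.sqrt_lt' one_pos, one_pow, Real.sqrt_lt' one_pos]; norm_num
  · rw [show (8:ℕ) = 2 * 2 * 2 by norm_num, pow_mul, pow_mul, Real.sq_sqrt (by positivity), Real.sq_sqrt (by positivity), Real.sq_sqrt (by positivity)]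

lemma tsum_geo {K r : ℝ} (hK : 0 ≤ K) (h0 : 0 ≤ r) (h1 : r < 1) : ∑' n : ℕ, ENNReal.ofReal (K * r ^ n) = ENNReal.ofReal (K * (1 - r)⁻¹) := by
  rw [← ENNReal.ofReal_tsum_of_nonneg (fun n => by positivity) ((summable_geometric_of_lt_one h0 h1).mul_left K), tsum_mul_left, tsum_geometric_of_lt_one h0 h1]

lemma sum_geo_le {r : ℝ} (h0 : 0 ≤ r) (h1 : r < 1) (n : ℕ) : ∑ l ∈ Finset.range n, r ^ l ≤ (1 - r)⁻¹ := by
  rw [← tsum_geometric_of_lt_one h0 h1]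
  exact (summable_geometric_of_lt_one h0 h1).sum_le_tsum _ fun i _ => by positivity

lemma min_pow {x y z : ℝ} (hx : 0 ≤ x) (hy : 0 ≤ y) (hz : 0 ≤ z) (h : x ^ 3 * y = z ^ 4) : min x y ≤ z := by
  have h0 : 0 ≤ min x y := le_min hx hy
  refine le_of_pow_le_pow_left₀ (n := 4) (by norm_num) hz ?_
  rw [← h, pow_succ]
  gcongr
  · exact min_le_left _ _
  · exact min_le_right _ _

/-- one density/mass level -/
lemma mass_level {r : ℝ} (r0 : 0 < r) (r1 : r < 1) (r8 : r ^ 8 = 1 / 2) (hK : Ker φ γ φ' θ c) (hf : Nice f) (hN : Measurable N) (hκ : Measurable κ) (hG : MeasurableSet G)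
    {ε β : ℝ} (hε : 0 ≤ ε) (hβ : 0 ≤ β) (hGε : volume G = ENNReal.ofReal (ε ^ 8)) (hfβ : ∫ x, ‖f x‖ ^ 2 ≤ β ^ 8) (i : ℕ)
    (hcv : cvx P) (hEB : EB f P (2 ^ 14 / 2 ^ i)) (ha : ∀ s ∈ P, a ≤ s.1) :
    ∫⁻ x in G, ‖TS φ f N κ a b P x‖ₑ ≤ ENNReal.ofReal (2 ^ 56 * c * ((1 - r)⁻¹) ^ 2 * (r ^ (4 * i) * ε ^ 6 * β ^ 2)) := by
  classical
  have c0 := hK.c0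
  have i0 : 0 < 1 - r := by linarith
  set M : Tile → ℝ → Prop := fun s m => ∀ s' ∈ P, tle s s' → volume (Em N G s') ≤ ENNReal.ofReal (m * sc s'.1) with hM
  have hMup : ∀ m s s', tle s s' → M s m → M s' m := fun m s s' h h1 s'' h2 h3 => h1 s'' h2 (tle_trans h h3)
  have hMm : ∀ {m m'} s, m ≤ m' → M s m → M s m' := fun {m m'} s h h1 s' h2 h3 => (h1 s' h2 h3).trans (ENNReal.ofReal_le_ofReal (by have := sc_pos s'.1; gcongr))
  refine (levels hK.pφ.cont hf hN hκ (fun q s => M s (1 / 2 ^ q)) ?_ ?_ (fun q => ENNReal.ofReal (2 ^ 56 * c * (1 - r)⁻¹ * (r ^ (4 * i) * ε ^ 6 * β ^ 2) * r ^ q)) ?_ ?_).trans (le_of_eq ?_)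
  · intro s _ s' _ _
    simp only [pow_zero, div_one, one_mul]
    rw [← volume_iv s'.1 s'.2.1]
    refine measure_mono fun x hx => ?_
    exact congrArg (fun t : Tile => t.2.1) hx.2
  · intro q s h
    exact hMm s (by rw [pow_succ]; gcongr; linarith [show (0:ℝ) < 2 ^ q by positivity]) h
  · intro q P' hP'
    have sP : P' ⊆ P := fun s hs => ((hP' s).1 hs).1
    have cP : cvx P' := by
      rw [show P' = (P.filter fun s => M s (1 / 2 ^ q)).filter fun s => ¬ M s (1 / 2 ^ (q+1)) by ext s; rw [hP', Finset.mem_filter, Finset.mem_filter, and_assoc]]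
      exact (hcv.filt' (p := fun s => M s (1 / 2 ^ q)) fun s s' h h1 => hMup _ s s' h h1).filt fun s s' h h1 h2 => h1 (hMup _ s s' h h2)
    -- the tops
    set V := P.filter fun s => ENNReal.ofReal (1 / 2 ^ (q+1) * sc s.1) < volume (Em N G s) with hV
    set V' := V.filter fun s => ∀ s' ∈ V, tle s s' → s' = s with hV'
    have hcov : ∀ s ∈ V, ∃ s' ∈ V', tle s s' := by
      intro s hs
      obtain ⟨s', hs', hmax⟩ := (V.filter (tle s)).exists_max_image (fun s => s.1) ⟨s, Finset.mem_filter.2 ⟨hs, tle_refl s⟩⟩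
      rw [Finset.mem_filter] at hs'
      refine ⟨s', Finset.mem_filter.2 ⟨hs'.1, fun s'' h1 h2 => ?_⟩, hs'.2⟩
      have h3 := hmax s'' (Finset.mem_filter.2 ⟨h1, tle_trans hs'.2 h2⟩)
      have e1 : s''.1 = s'.1 := le_antisymm h3 (le_of_iv_subset h2.1)
      refine tle_antisymm ⟨?_, ?_⟩ h2
      · have hx := left_mem_iv s'.1 s'.2.1
        have := h2.1 hx
        rw [mem_iv] at hx this
        have e2 : s''.2.1 = s'.2.1 := by rw [← this, e1, hx]
        rw [e2, e1]
      · rw [← h2.2, e1, nix_self, nix_self]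
    set 𝒯 : Finset Tp := V'.image fun s => (s.1, s.2.1, s.2.2 / sc s.1) with h𝒯
    have h𝒯c : ∀ s ∈ P', ∃ t ∈ 𝒯, InD t s := by
      intro s hs
      rw [hP'] at hs
      have := hs.2.2
      simp only [hM] at this
      push Not at this
      obtain ⟨s', h1, h2, h3⟩ := this
      obtain ⟨s'', h4, h5⟩ := hcov s' (Finset.mem_filter.2 ⟨h1, h3⟩)
      exact ⟨_, Finset.mem_image_of_mem _ h4, tle_trans h2 h5⟩
    have hS : ∑ t ∈ 𝒯, sc t.1 ≤ 2 ^ (q+1) * ε ^ 8 := by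
      have h1 : ∑ t ∈ 𝒯, sc t.1 ≤ ∑ s ∈ V', sc s.1 := by
        refine Finset.sum_image_le_of_nonneg (g := fun s : Tile => ((s.1, s.2.1, s.2.2 / sc s.1) : Tp)) (f := fun t : Tp => sc t.1) (fun s _ => (sc_pos _).le)
      refine h1.trans ?_
      have h2 : ∑ s ∈ V', ENNReal.ofReal (1 / 2 ^ (q+1) * sc s.1) ≤ volume G := by
        calc _ ≤ ∑ s ∈ V', volume (Em N G s) := Finset.sum_le_sum fun s hs => (Finset.mem_filter.1 (Finset.mem_filter.1 hs).1).2.le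
          _ = volume (⋃ s ∈ V', Em N G s) := by
              rw [measure_biUnion_finset]
              · intro s hs s' hs' hne
                rw [Function.onFun, Set.disjoint_left]
                intro x hx hx'
                rw [SetLike.mem_coe, hV', Finset.mem_filter] at hs hs'
                rcases le_total s.1 s'.1 with h | h
                · have := tle_tl N h x
                  rw [hx.2, hx'.2] at this
                  exact hne (hs.2 s' hs'.1 this).symm
                · have := tle_tl N h x
                  rw [hx.2, hx'.2] at this
                  exact hne (hs'.2 s hs.1 this)
              · intro s _; exact measurableSet_Em hN hG s
          _ ≤ volume G := measure_mono (iUnion₂_subset fun s _ x hx => hx.1)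
      rw [hGε, ← ENNReal.ofReal_sum_of_nonneg (fun s _ => by have := sc_pos s.1; positivity), ENNReal.ofReal_le_ofReal_iff (by positivity), ← Finset.mul_sum] at h2
      rw [one_div, inv_mul_le_iff₀ (by positivity)] at h2
      exact h2
    set D := 2 ^ 24 * β ^ 8 with hD
    have hit := fun n => energy_iter (κ := κ) (b := b) (μ := 1 / 2 ^ q) hK hf hN hκ hG (by positivity) hS (show 2 ^ 24 * ∫ x, ‖f x‖ ^ 2 ≤ D by rw [hD]; gcongr) n P' (2 ^ 14 / 2 ^ i) (by positivity) cP h𝒯c (hEB.mono sP)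
      (fun s hs => ha s (sP hs)) (fun s hs => ((hP' s).1 hs).2.1 s (sP hs) (tle_refl s))
    have hterm : ∀ l : ℕ, min ((2:ℝ) ^ 14 / 2 ^ i / 2 ^ l * (2 ^ (q+1) * ε ^ 8)) (D / (2 ^ 14 / 2 ^ i / 2 ^ l)) ≤ 2 ^ 24 * 2 ^ q * (r ^ (4 * i) * ε ^ 6 * β ^ 2 * r ^ q) * r ^ l := by
      intro l
      have e2 : (2:ℝ) = (r ^ 8)⁻¹ := by rw [r8]; norm_num
      have hi : ∀ j : ℕ, (2:ℝ) ^ j = (r ^ (8 * j))⁻¹ := fun j => by rw [pow_mul, r8]; simp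
      have h1 : min ((r ^ (8 * (i + l))) * ε ^ 8) (r ^ (8 * q) * β ^ 8 / r ^ (8 * (i + l))) ≤ r ^ (4 * (i + l) + 2 * q) * ε ^ 6 * β ^ 2 := by
        refine min_pow (by positivity) (by positivity) (by positivity) ?_
        field_simp
        ring
      have h2 : (2:ℝ) ^ 14 / 2 ^ i / 2 ^ l * (2 ^ (q+1) * ε ^ 8) ≤ 2 ^ 24 * 2 ^ q * ((r ^ (8 * (i + l))) * ε ^ 8) := by
        rw [mul_add 8 i l, pow_add r, hi i, hi l, pow_succ (2:ℝ) q]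
        rw [div_inv_eq_mul, div_inv_eq_mul]
        have : 0 ≤ r ^ (8 * i) * r ^ (8 * l) * 2 ^ q * ε ^ 8 := by positivity
        nlinarith
      have h3 : D / (2 ^ 14 / 2 ^ i / 2 ^ l) ≤ 2 ^ 24 * 2 ^ q * (r ^ (8 * q) * β ^ 8 / r ^ (8 * (i + l))) := by
        rw [mul_add 8 i l, pow_add r, hi i, hi l, hi q, div_inv_eq_mul, div_inv_eq_mul, hD]
        have : 2 ^ 24 * β ^ 8 / (2 ^ 14 * r ^ (8 * i) * r ^ (8 * l)) = 2 ^ 10 * (β ^ 8 / (r ^ (8 * i) * r ^ (8 * l))) := by field_simp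
        rw [this]
        have : 2 ^ 24 * (r ^ (8 * q))⁻¹ * (r ^ (8 * q) * β ^ 8 / (r ^ (8 * i) * r ^ (8 * l))) = 2 ^ 24 * (β ^ 8 / (r ^ (8 * i) * r ^ (8 * l))) := by field_simp
        rw [this]; gcongr <;> norm_num
      calc _ ≤ min (2 ^ 24 * 2 ^ q * ((r ^ (8 * (i + l))) * ε ^ 8)) (2 ^ 24 * 2 ^ q * (r ^ (8 * q) * β ^ 8 / r ^ (8 * (i + l)))) := min_le_min h2 h3
        _ = 2 ^ 24 * 2 ^ q * min ((r ^ (8 * (i + l))) * ε ^ 8) (r ^ (8 * q) * β ^ 8 / r ^ (8 * (i + l))) := (mul_min_of_nonneg _ _ (by positivity)).symm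
        _ ≤ 2 ^ 24 * 2 ^ q * (r ^ (4 * (i + l) + 2 * q) * ε ^ 6 * β ^ 2) := by gcongr
        _ = 2 ^ 24 * 2 ^ q * (r ^ (4 * i) * ε ^ 6 * β ^ 2 * r ^ (2 * q)) * r ^ (4 * l) := by ring
        _ ≤ _ := by
          gcongr 2 ^ 24 * 2 ^ q * (r ^ (4 * i) * ε ^ 6 * β ^ 2 * ?_) * ?_
          · exact pow_le_pow_of_le_one r0.le r1.le (by omega)
          · exact pow_le_pow_of_le_one r0.le r1.le (by omega)
    have hlim : Tendsto (fun n : ℕ => ENNReal.ofReal (2 ^ 32 * c * (1 / 2 ^ q) * (2 ^ 24 * 2 ^ q * (r ^ (4 * i) * ε ^ 6 * β ^ 2 * r ^ q) * (1 - r)⁻¹ + 2 ^ 14 / 2 ^ i / 2 ^ n * (2 ^ (q+1) * ε ^ 8)))) atTop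
        (𝓝 (ENNReal.ofReal (2 ^ 32 * c * (1 / 2 ^ q) * (2 ^ 24 * 2 ^ q * (r ^ (4 * i) * ε ^ 6 * β ^ 2 * r ^ q) * (1 - r)⁻¹ + 0 * (2 ^ (q+1) * ε ^ 8))))) := by
      refine ENNReal.tendsto_ofReal (Tendsto.const_mul _ (Tendsto.const_add _ (Tendsto.mul_const _ ?_)))
      exact tendsto_const_nhds.div_atTop (tendsto_pow_atTop_atTop_of_one_lt (by norm_num))
    refine (ge_of_tendsto' hlim fun n => (hit n).trans (ENNReal.ofReal_le_ofReal ?_)).trans (ENNReal.ofReal_le_ofReal (le_of_eq ?_))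
    · gcongr
      refine (Finset.sum_le_sum fun l _ => hterm l).trans ?_
      rw [← Finset.mul_sum]
      gcongr
      exact sum_geo_le r0.le r1 n
    · field_simp; ring
  · intro P' hP'
    have sP : P' ⊆ P := fun s hs => ((hP' s).1 hs).1
    have := forest (κ := κ) (b := b) (μ := 0) (G := G) hK hf hN hκ hG (by positivity : (0:ℝ) < 2 ^ 14 / 2 ^ i) le_rfl (P'.image fun s => ((s.1, s.2.1, s.2.2 / sc s.1) : Tp)) P' 
      (by rw [show P' = P.filter fun s => ∀ q : ℕ, M s (1 / 2 ^ q) by ext s; rw [hP', Finset.mem_filter]]; exact hcv.filt' (p := fun s => ∀ q : ℕ, M s (1 / 2 ^ q)) fun s s' h h1 q => hMup _ s s' h (h1 q)) (fun s hs => ⟨(s.1, s.2.1, s.2.2 / sc s.1), Finset.mem_image_of_mem (fun s => ((s.1, s.2.1, s.2.2 / sc s.1) : Tp)) hs, tle_refl s⟩) (hEB.mono sP)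
      (fun s hs => ha s (sP hs)) (fun s hs => ?_)
    · rwa [mul_zero, zero_mul, zero_mul, ENNReal.ofReal_zero, nonpos_iff_eq_zero] at this
    · rw [zero_mul, ENNReal.ofReal_zero]
      have hl : Tendsto (fun q : ℕ => ENNReal.ofReal (1 / 2 ^ q * sc s.1)) atTop (𝓝 (ENNReal.ofReal (0 * sc s.1))) := by
        refine ENNReal.tendsto_ofReal (Tendsto.mul_const _ ?_)
        exact tendsto_const_nhds.div_atTop (tendsto_pow_atTop_atTop_of_one_lt (by norm_num))
      rw [zero_mul, ENNReal.ofReal_zero] at hl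
      refine ge_of_tendsto' hl fun q => ?_
      exact ((hP' s).1 hs).2 q s (sP hs) (tle_refl s)
  · rw [tsum_geo (by positivity) r0.le r1]; exact congrArg ENNReal.ofReal (by ring)
end asm
end

section
open MeasureTheory Filter Set
open scoped ENNReal Topology

lemma exists_eight {x : ℝ≥0∞} (h : x ≠ ∞) : ∃ e : ℝ, 0 ≤ e ∧ x = ENNReal.ofReal (e ^ 8) :=
  ⟨√√√x.toReal, by positivity, by
    rw [show (8:ℕ) = 2 * 2 * 2 by norm_num, pow_mul, pow_mul, Real.sq_sqrt (by positivity), Real.sq_sqrt (by positivity), Real.sq_sqrt (by positivity),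
      ENNReal.ofReal_toReal h]⟩

section asm
variable {φ γ φ' θ f : ℝ → ℂ} {c : ℝ} {N : ℝ → ℝ} {κ : ℝ → ℤ} {a b : ℤ} {P : Finset Tile} {E μ : ℝ} {G F : Set ℝ}

def Om (P : Finset Tile) : Set ℝ := ⋃ s ∈ P, iv s.1 s.2.1
lemma measurableSet_Om (P : Finset Tile) : MeasurableSet (Om P) := P.measurableSet_biUnion fun _ _ => measurableSet_iv _ _
lemma TS_Om {x : ℝ} (hx : x ∉ Om P) : TS φ f N κ a b P x = 0 :=
  Finset.sum_eq_zero fun k _ => if_neg fun h => hx (mem_biUnion h.1 (mem_iv.2 rfl))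

lemma restr {r : ℝ} (r0 : 0 < r) (r1 : r < 1) (r8 : r ^ 8 = 1 / 2) (hK : Ker φ γ φ' θ c) (hf : Nice f) (hN : Measurable N) (hκ : Measurable κ) (hG : MeasurableSet G)
    (hF : MeasurableSet F) (hfF : ∀ x, ‖f x‖ ≤ F.indicator 1 x) {α β : ℝ} (hα : 0 ≤ α) (hβ : 0 ≤ β) (hGα : volume G = ENNReal.ofReal (α ^ 8)) 
    (hFβ : volume F = ENNReal.ofReal (β ^ 8)) (hcv : cvx P) (ha : ∀ s ∈ P, a ≤ s.1) :
    ∫⁻ x in G, ‖TS φ f N κ a b P x‖ₑ ≤ ENNReal.ofReal (2 ^ 59 * c * ((1 - r)⁻¹) ^ 3 * min (α ^ 6 * β ^ 2) (α ^ 3 * β ^ 5)) := by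
  classical
  have c0 := hK.c0
  have i0 : 0 < 1 - r := by linarith
  have hfβ : ∫ x, ‖f x‖ ^ 2 ≤ β ^ 8 := by
    calc ∫ x, ‖f x‖ ^ 2 ≤ ∫ x, F.indicator (1 : ℝ → ℝ) x := by
          refine integral_mono_of_nonneg (ae_of_all _ fun x => by positivity) ?_ (ae_of_all _ fun x => ?_)
          · rw [integrable_indicator_iff hF]; exact integrableOn_const (by rw [hFβ]; exact ENNReal.ofReal_ne_top) (by simp)
          · have h := hfF x
            simp only [Set.indicator, Pi.one_apply] at h ⊢
            split_ifs at h ⊢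
            · exact pow_le_one₀ (norm_nonneg _) h
            · rw [le_antisymm h (norm_nonneg _)]; norm_num
      _ = β ^ 8 := by rw [integral_indicator_one hF, measureReal_def, hFβ, ENNReal.toReal_ofReal (by positivity)]
  have dlim : ∀ y : ℝ, Tendsto (fun q : ℕ => ENNReal.ofReal (2 / 2 ^ q * y)) atTop (𝓝 0) := fun y => by
    have : Tendsto (fun q : ℕ => ENNReal.ofReal (2 / 2 ^ q * y)) atTop (𝓝 (ENNReal.ofReal (0 * y))) :=
      ENNReal.tendsto_ofReal (Tendsto.mul_const _ (tendsto_const_nhds.div_atTop (tendsto_pow_atTop_atTop_of_one_lt (by norm_num))))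
    rwa [zero_mul, ENNReal.ofReal_zero] at this
  have eb : ∀ (i : ℕ) (P' : Finset Tile), (∀ s ∈ P', DF F s (2 / 2 ^ i)) → EB f P' (2 ^ 14 / 2 ^ i) := fun i P' h => by
    have := size_lemma hf hF hfF (a := 2 / 2 ^ i) (by positivity) (P := P') fun s hs => h s hs _ _ subset_rfl
    rwa [← mul_div_assoc, ← pow_succ] at this
  refine (levels hK.pφ.cont hf hN hκ (fun i s => DF F s (2 / 2 ^ i)) ?_ ?_ (fun i => ENNReal.ofReal (2 ^ 59 * c * ((1 - r)⁻¹) ^ 2 * min (α ^ 6 * β ^ 2) (α ^ 3 * β ^ 5) * r ^ i)) ?_ ?_).trans (le_of_eq ?_)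
  · intro s _ k m _ ρ hρ
    rw [pow_zero, div_one, ← Real.volume_closedBall]
    exact measure_mono inter_subset_right
  · intro i s h k m hk ρ hρ
    refine (h k m hk ρ hρ).trans (ENNReal.ofReal_le_ofReal ?_)
    have : 0 < ρ := (sc_pos k).trans_le hρ
    gcongr
    · norm_num
    · omega
  · intro i P' hP'
    have sP : P' ⊆ P := fun s hs => ((hP' s).1 hs).1
    have cP : cvx P' := by
      rw [show P' = (P.filter fun s => DF F s (2 / 2 ^ i)).filter fun s => ¬ DF F s (2 / 2 ^ (i+1)) by ext s; rw [hP', Finset.mem_filter, Finset.mem_filter, and_assoc]]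
      exact (hcv.filt' (p := fun s => DF F s (2 / 2 ^ i)) fun s s' h h1 => h1.up h).filt fun s s' h h1 h2 => h1 (h2.up h)
    have e1 : ∫⁻ x in G, ‖TS φ f N κ a b P' x‖ₑ = ∫⁻ x in Om P' ∩ G, ‖TS φ f N κ a b P' x‖ₑ := by
      rw [← setLIntegral_indicator (measurableSet_Om P')]
      refine lintegral_congr fun x => ?_
      by_cases hx : x ∈ Om P'
      · rw [indicator_of_mem hx]
      · rw [indicator_of_notMem hx, TS_Om hx, enorm_zero]
    have hle : volume (Om P' ∩ G) ≤ volume G := measure_mono inter_subset_right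
    obtain ⟨e, he, hee⟩ := exists_eight (x := volume (Om P' ∩ G)) ((hle.trans_lt (hGα ▸ ENNReal.ofReal_lt_top)).ne)
    have heα : e ≤ α := by
      rw [hee, hGα, ENNReal.ofReal_le_ofReal_iff (by positivity)] at hle
      exact le_of_pow_le_pow_left₀ (by norm_num) hα hle
    have heβ : r ^ i * e ≤ 2 * β := by
      have h1 : ∀ s ∈ P', ∃ q : ℝ × ℝ, iv s.1 s.2.1 ⊆ Metric.closedBall q.1 q.2 ∧ ENNReal.ofReal (2 / 2 ^ (i+1) * q.2) ≤ volume.restrict F (Metric.closedBall q.1 q.2) := by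
        intro s hs
        have h2 := ((hP' s).1 hs).2.2
        simp only [DF, dens] at h2
        push Not at h2
        obtain ⟨k, m, h3, ρ, h4, h5⟩ := h2
        refine ⟨(m * sc k, ρ), h3.trans fun x hx => ?_, ?_⟩
        · rw [iv_eq] at hx
          rw [Metric.mem_closedBall, Real.dist_eq, abs_le]
          have := hx.1; have := hx.2; have := sc_pos k
          constructor <;> linarith
        · rw [Measure.restrict_apply Metric.isClosed_closedBall.measurableSet, inter_comm]; exact h5.le
      choose! q hq1 hq2 using h1
      have h3 := vitali_cover P' (fun s => (q s).1) (fun s => (q s).2) (by positivity) hq2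
      have h4 : volume (Om P' ∩ G) ≤ ENNReal.ofReal (10 / (2 / 2 ^ (i+1))) * ENNReal.ofReal (β ^ 8) := by
        rw [Measure.restrict_apply_univ, hFβ] at h3
        exact (measure_mono (inter_subset_left.trans (iUnion₂_mono hq1))).trans h3
      rw [hee, ← ENNReal.ofReal_mul (by positivity), ENNReal.ofReal_le_ofReal_iff (by positivity)] at h4
      refine le_of_pow_le_pow_left₀ (n := 8) (by norm_num) (by positivity) ?_
      have h5 : (r ^ i) ^ 8 = (2 ^ i)⁻¹ := by rw [← pow_mul, mul_comm, pow_mul, r8]; simp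
      rw [mul_pow, mul_pow, h5, inv_mul_le_iff₀ (by positivity)]
      refine h4.trans ?_
      rw [show (10:ℝ) / (2 / 2 ^ (i+1)) = 10 * 2 ^ i by rw [pow_succ]; field_simp]
      have : 0 ≤ 2 ^ i * β ^ 8 := by positivity
      nlinarith
    rw [e1]
    refine (mass_level r0 r1 r8 hK hf hN hκ ((measurableSet_Om P').inter hG) he hβ hee hfβ i cP (eb i P' fun s hs => ((hP' s).1 hs).2.1) fun s hs => ha s (sP hs)).trans (ENNReal.ofReal_le_ofReal ?_)
    have h6 : r ^ (4 * i) * e ^ 6 * β ^ 2 ≤ 8 * min (α ^ 6 * β ^ 2) (α ^ 3 * β ^ 5) * r ^ i := by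
      have p1 : r ^ (4 * i) ≤ r ^ i := pow_le_pow_of_le_one r0.le r1.le (by omega)
      rw [mul_min_of_nonneg _ _ (by norm_num), min_mul_of_nonneg _ _ (by positivity)]
      refine le_min ?_ ?_
      · calc _ ≤ r ^ i * α ^ 6 * β ^ 2 := by gcongr
          _ ≤ _ := by have : 0 ≤ r ^ i * α ^ 6 * β ^ 2 := by positivity
                      nlinarith
      · calc _ = r ^ i * β ^ 2 * e ^ 3 * (r ^ i * e) ^ 3 := by ring
          _ ≤ r ^ i * β ^ 2 * α ^ 3 * (2 * β) ^ 3 := by gcongr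
          _ = _ := by ring
    calc _ ≤ 2 ^ 56 * c * ((1 - r)⁻¹) ^ 2 * (8 * min (α ^ 6 * β ^ 2) (α ^ 3 * β ^ 5) * r ^ i) := by gcongr
      _ = _ := by ring
  · intro P' hP'
    have sP : P' ⊆ P := fun s hs => ((hP' s).1 hs).1
    rcases P'.eq_empty_or_nonempty with rfl | ⟨s, hs⟩
    · simp [TS]
    have F0 : ∫ x, ‖f x‖ ^ 2 ≤ 0 ^ 8 := by
      have h1 : ∀ n : ℕ, volume (F ∩ Metric.closedBall (lc s) (sc s.1 + n)) = 0 := fun n =>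
        le_antisymm (ge_of_tendsto' (dlim _) fun q => ((hP' s).1 hs).2 q _ _ subset_rfl _ (by simp)) zero_le
      have h2 : volume F = 0 := by
        refine measure_mono_null (fun x hx => ?_) (measure_iUnion_null h1)
        obtain ⟨n, hn⟩ := exists_nat_ge (dist x (lc s))
        exact mem_iUnion.2 ⟨n, hx, hn.trans (by linarith [sc_pos s.1])⟩
      rw [integral_eq_zero_of_ae]
      · positivity
      · filter_upwards [compl_mem_ae_iff.2 h2] with x hx
        have := hfF x
        rw [indicator_of_notMem hx] at this
        simp [le_antisymm this (norm_nonneg _)]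
    have := mass_level (κ := κ) (b := b) r0 r1 r8 hK hf hN hκ hG hα le_rfl hGα F0 0 (P := P') (by
      rw [show P' = P.filter fun s => ∀ i : ℕ, DF F s (2 / 2 ^ i) by ext s; rw [hP', Finset.mem_filter]]
      exact hcv.filt' (p := fun s => ∀ i : ℕ, DF F s (2 / 2 ^ i)) fun s s' h h1 i => (h1 i).up h) (eb 0 P' fun s hs => ((hP' s).1 hs).2 0) fun s hs => ha s (sP hs)
    rwa [zero_pow (by norm_num), mul_zero, mul_zero, ENNReal.ofReal_zero, nonpos_iff_eq_zero] at this
  · rw [tsum_geo (by positivity) r0.le r1]; exact congrArg ENNReal.ofReal (by ring)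
end asm
end

section
open MeasureTheory Filter Set
open scoped ENNReal Topology

lemma summable_natAbs {r : ℝ} (r0 : 0 < r) (r1 : r < 1) : Summable fun n : ℤ => r ^ n.natAbs := by
  refine Summable.of_nat_of_neg ?_ ?_ <;> simpa using summable_geometric_of_lt_one r0.le r1

lemma young_term {r : ℝ} (r0 : 0 < r) (r1 : r < 1) (r8 : r ^ 8 = 1 / 2) {δ α β : ℝ} (d0 : 0 < δ) (d1 : δ ≤ 1) (hα : 0 ≤ α) (hβ : 0 ≤ β) (i j : ℤ) :
    (2:ℝ) ^ j * 2 ^ i * min (α ^ 6 * β ^ 2) (α ^ 3 * β ^ 5) ≤ r ^ (i - j).natAbs * (δ * (4 ^ j * α ^ 8) + (δ ^ 6)⁻¹ * (4 ^ i * β ^ 8)) := by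
  have e2 : ∀ n : ℤ, (2:ℝ) ^ n = ((r ^ (2 * n)) ^ 4)⁻¹ := fun n => by
    rw [← zpow_natCast, ← zpow_mul, show 2 * n * ((4:ℕ):ℤ) = ((8:ℕ):ℤ) * n by push_cast; ring, zpow_mul, zpow_natCast, r8]; simp
  have e4 : ∀ n : ℤ, (4:ℝ) ^ n = ((r ^ (2 * n)) ^ 8)⁻¹ := fun n => by
    rw [show (4:ℝ) = 2 * 2 by norm_num, mul_zpow, e2]; ring
  have hpt : ∀ {i j : ℤ}, i ≤ j → r ^ (2 * j) / r ^ (2 * i) ≤ r ^ (i - j).natAbs := fun {i j} h => by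
    rw [← zpow_sub₀ r0.ne', ← zpow_natCast]
    exact zpow_le_zpow_right_of_le_one₀ r0 r1.le (by omega)
  rw [e2, e2, e4, e4]
  have hij := @hpt i j; have hji := @hpt j i
  set w := r ^ (i - j).natAbs with hw
  rw [show (j - i).natAbs = (i - j).natAbs by omega, ← hw] at hji
  have w0 : 0 < w := by positivity
  have w1 : w ≤ 1 := pow_le_one₀ r0.le r1.le
  have p0 : 0 < r ^ (2 * j) := by positivity
  have t0 : 0 < r ^ (2 * i) := by positivity
  set p := r ^ (2 * j); set t := r ^ (2 * i)
  obtain ⟨s, rfl⟩ : ∃ s, α = s * p := ⟨α / p, by field_simp⟩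
  obtain ⟨q, rfl⟩ : ∃ q, β = q * t := ⟨β / t, by field_simp⟩
  have s0 : 0 ≤ s := nonneg_of_mul_nonneg_left hα p0
  have q0 : 0 ≤ q := nonneg_of_mul_nonneg_left hβ t0
  rw [show (p ^ 8)⁻¹ * (s * p) ^ 8 = s ^ 8 by field_simp, show (t ^ 8)⁻¹ * (q * t) ^ 8 = q ^ 8 by field_simp]
  have y : s ^ 6 * q ^ 2 ≤ δ * s ^ 8 + (δ ^ 6)⁻¹ * q ^ 8 ∧ s ^ 3 * q ^ 5 ≤ δ * s ^ 8 + (δ ^ 6)⁻¹ * q ^ 8 := by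
    have a1 : 0 ≤ (δ ^ 6)⁻¹ * q ^ 8 := by positivity
    have a2 : 0 ≤ δ * s ^ 8 := by positivity
    rcases le_or_gt q (δ * s) with h | h
    · refine ⟨?_, ?_⟩
      · calc s ^ 6 * q ^ 2 ≤ s ^ 6 * (δ * s) ^ 2 := by gcongr
          _ = δ ^ 2 * s ^ 8 := by ring
          _ ≤ δ * s ^ 8 := by gcongr; exact pow_le_of_le_one d0.le d1 (by norm_num)
          _ ≤ _ := by linarith
      · calc s ^ 3 * q ^ 5 ≤ s ^ 3 * (δ * s) ^ 5 := by gcongr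
          _ = δ ^ 5 * s ^ 8 := by ring
          _ ≤ δ * s ^ 8 := by gcongr; exact pow_le_of_le_one d0.le d1 (by norm_num)
          _ ≤ _ := by linarith
    · have h' : s ≤ q / δ := by rw [le_div_iff₀ d0]; linarith
      refine ⟨?_, ?_⟩
      · calc s ^ 6 * q ^ 2 ≤ (q / δ) ^ 6 * q ^ 2 := by gcongr
          _ = (δ ^ 6)⁻¹ * q ^ 8 := by field_simp
          _ ≤ _ := by linarith
      · calc s ^ 3 * q ^ 5 ≤ (q / δ) ^ 3 * q ^ 5 := by gcongr
          _ = (δ ^ 3)⁻¹ * q ^ 8 := by field_simp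
          _ ≤ (δ ^ 6)⁻¹ * q ^ 8 := by gcongr ?_⁻¹ * _; exact pow_le_pow_of_le_one d0.le d1 (by norm_num)
          _ ≤ _ := by linarith
  set Y := δ * s ^ 8 + (δ ^ 6)⁻¹ * q ^ 8
  have Y0 : 0 ≤ Y := (by positivity : 0 ≤ s ^ 6 * q ^ 2).trans y.1
  rcases le_total i j with h | h
  · calc _ ≤ (p ^ 4)⁻¹ * (t ^ 4)⁻¹ * ((s * p) ^ 6 * (q * t) ^ 2) := by gcongr; exact min_le_left _ _
      _ = (p / t) * (p / t) * (s ^ 6 * q ^ 2) := by field_simp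
      _ ≤ w * 1 * Y := by gcongr; exacts [hij h, (hij h).trans w1, y.1]
      _ = _ := by ring
  · calc _ ≤ (p ^ 4)⁻¹ * (t ^ 4)⁻¹ * ((s * p) ^ 3 * (q * t) ^ 5) := by gcongr; exact min_le_right _ _
      _ = (t / p) * (s ^ 3 * q ^ 5) := by field_simp
      _ ≤ w * Y := by gcongr; exacts [hji h, y.2]

lemma young_sum {r : ℝ} (r0 : 0 < r) (r1 : r < 1) (r8 : r ^ 8 = 1 / 2) {C : ℝ} (hC : 0 < C) : ∃ A : ℝ, 0 < A ∧ ∀ (I J : Finset ℤ) (α β : ℤ → ℝ),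
    (∀ j, 0 ≤ α j) → (∀ i, 0 ≤ β i) → (∀ j ∈ J, (4:ℝ) ^ j * α j ^ 8 ≤ ∑ i ∈ I, (2:ℝ) ^ j * 2 ^ i * (C * min (α j ^ 6 * β i ^ 2) (α j ^ 3 * β i ^ 5))) →
    ∑ j ∈ J, (4:ℝ) ^ j * α j ^ 8 ≤ A * ∑ i ∈ I, (4:ℝ) ^ i * β i ^ 8 := by
  set W := ∑' n : ℤ, r ^ n.natAbs with hW
  have sW := summable_natAbs r0 r1
  have W0 : 0 < W := sW.tsum_pos (fun _ => by positivity) 0 (by simp)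
  have w1 : ∀ (I : Finset ℤ) (j : ℤ), ∑ i ∈ I, r ^ (i - j).natAbs ≤ W := fun I j => by
    have := ((Equiv.subRight j).summable_iff.2 sW).sum_le_tsum I fun i _ => by simp only [Function.comp]; positivity
    rwa [Function.comp_def, (Equiv.subRight j).tsum_eq (fun n : ℤ => r ^ n.natAbs)] at this
  set δ := (1 + 2 * C * W)⁻¹ with hδ
  have d0 : 0 < δ := by positivity
  have d1 : δ ≤ 1 := inv_le_one_of_one_le₀ (by nlinarith [mul_pos hC W0])
  refine ⟨2 * C * W * (δ ^ 6)⁻¹, by positivity, fun I J α β hα hβ h => ?_⟩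
  set S := ∑ j ∈ J, (4:ℝ) ^ j * α j ^ 8 with hS
  set Q := ∑ i ∈ I, (4:ℝ) ^ i * β i ^ 8 with hQ
  have S0 : 0 ≤ S := Finset.sum_nonneg fun j _ => by positivity
  have key : S ≤ C * (W * (δ * S) + W * ((δ ^ 6)⁻¹ * Q)) := by
    calc S ≤ ∑ j ∈ J, ∑ i ∈ I, C * (r ^ (i - j).natAbs * (δ * (4 ^ j * α j ^ 8)) + r ^ (i - j).natAbs * ((δ ^ 6)⁻¹ * (4 ^ i * β i ^ 8))) := by
          refine Finset.sum_le_sum fun j hj => (h j hj).trans (Finset.sum_le_sum fun i _ => ?_)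
          have := young_term r0 r1 r8 d0 d1 (hα j) (hβ i) i j
          rw [← mul_add]
          nlinarith
      _ = C * (∑ j ∈ J, (∑ i ∈ I, r ^ (i - j).natAbs) * (δ * (4 ^ j * α j ^ 8)) + ∑ i ∈ I, (∑ j ∈ J, r ^ (j - i).natAbs) * ((δ ^ 6)⁻¹ * (4 ^ i * β i ^ 8))) := by
          simp only [← Finset.mul_sum, Finset.sum_add_distrib, Finset.sum_mul]
          congr 2
          rw [Finset.sum_comm]
          refine Finset.sum_congr rfl fun i _ => Finset.sum_congr rfl fun j _ => ?_
          rw [show (j - i).natAbs = (i - j).natAbs by omega]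
      _ ≤ C * (∑ j ∈ J, W * (δ * (4 ^ j * α j ^ 8)) + ∑ i ∈ I, W * ((δ ^ 6)⁻¹ * (4 ^ i * β i ^ 8))) := by
          gcongr <;> first | positivity | exact w1 _ _
      _ = _ := by simp only [← Finset.mul_sum]; rfl
  have : C * W * δ ≤ 1 / 2 := by rw [hδ, ← div_eq_mul_inv, div_le_iff₀ (by positivity)]; linarith
  nlinarith [mul_le_mul_of_nonneg_right this S0]

def Lv (h : ℝ → ℂ) (j : ℤ) : Set ℝ := {x | (2:ℝ) ^ j < ‖h x‖ ∧ ‖h x‖ ≤ 2 ^ (j+1)}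
lemma measurableSet_Lv {h : ℝ → ℂ} (hh : Measurable h) (j : ℤ) : MeasurableSet (Lv h j) :=
  (measurableSet_lt measurable_const hh.norm).inter (measurableSet_le hh.norm measurable_const)
lemma Lv_disj (h : ℝ → ℂ) : Pairwise (Function.onFun Disjoint (Lv h)) := by
  have : ∀ i j : ℤ, i < j → Disjoint (Lv h i) (Lv h j) := fun i j hij => by
    rw [Set.disjoint_left]; intro x hx hx'
    have := zpow_le_zpow_right₀ (one_le_two (α := ℝ)) (show i + 1 ≤ j by omega)
    linarith [hx.2, hx'.1]
  intro i j hij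
  rcases lt_or_gt_of_ne hij with h1 | h1
  · exact this i j h1
  · exact (this j i h1).symm
lemma zp4 (j : ℤ) : ENNReal.ofReal (2 ^ j) ^ 2 = ENNReal.ofReal (4 ^ j) := by
  rw [← ENNReal.ofReal_pow (by positivity), ← zpow_natCast, zpow_comm]; norm_num
lemma level_le {h : ℝ → ℂ} (hh : Measurable h) (I : Finset ℤ) : ∑ i ∈ I, ENNReal.ofReal (4 ^ i) * volume (Lv h i) ≤ ∫⁻ x, ‖h x‖ₑ ^ 2 := by
  calc _ ≤ ∑ i ∈ I, ∫⁻ x in Lv h i, ‖h x‖ₑ ^ 2 := by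
        refine Finset.sum_le_sum fun i _ => ?_
        rw [← setLIntegral_const, ← zp4]
        refine setLIntegral_mono' (measurableSet_Lv hh i) fun x hx => ?_
        rw [← ofReal_norm]; gcongr; exact hx.1.le
    _ = ∫⁻ x in ⋃ i ∈ I, Lv h i, ‖h x‖ₑ ^ 2 := by
        rw [lintegral_biUnion_finset (fun i _ j _ hij => Lv_disj h hij) fun i _ => measurableSet_Lv hh i]
    _ ≤ _ := setLIntegral_le_lintegral _ _
lemma level_ge {h : ℝ → ℂ} (hh : Measurable h) {B : ℝ≥0∞} (hB : ∀ J : Finset ℤ, ∑ j ∈ J, ENNReal.ofReal (4 ^ j) * volume (Lv h j) ≤ B) :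
    ∫⁻ x, ‖h x‖ₑ ^ 2 ≤ 4 * B := by
  calc ∫⁻ x, ‖h x‖ₑ ^ 2 = ∫⁻ x in ⋃ j, Lv h j, ‖h x‖ₑ ^ 2 := by
        rw [← lintegral_indicator (MeasurableSet.iUnion (measurableSet_Lv hh))]
        refine lintegral_congr fun x => ?_
        by_cases hx : h x = 0
        · simp [Set.indicator, hx]
        · obtain ⟨j, hj⟩ := exists_mem_Ioc_zpow (norm_pos_iff.2 hx) (one_lt_two (α := ℝ))
          rw [indicator_of_mem (mem_iUnion.2 ⟨j, hj⟩)]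
    _ = ∑' j, ∫⁻ x in Lv h j, ‖h x‖ₑ ^ 2 := lintegral_iUnion (measurableSet_Lv hh) (Lv_disj h) _
    _ ≤ ∑' j, 4 * (ENNReal.ofReal (4 ^ j) * volume (Lv h j)) := by
        refine ENNReal.tsum_le_tsum fun j => ?_
        have e : 4 * (ENNReal.ofReal (4 ^ j) * volume (Lv h j)) = ∫⁻ x in Lv h j, ENNReal.ofReal (4 ^ (j+1)) := by
          rw [setLIntegral_const, zpow_add_one₀ (by norm_num), ENNReal.ofReal_mul (by positivity), ENNReal.ofReal_ofNat]; ring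
        rw [e, ← zp4]
        refine setLIntegral_mono' (measurableSet_Lv hh j) fun x hx => ?_
        rw [← ofReal_norm]; gcongr; exact hx.2
    _ = 4 * ∑' j, ENNReal.ofReal (4 ^ j) * volume (Lv h j) := ENNReal.tsum_mul_left
    _ ≤ _ := by gcongr; exact ENNReal.summable.tsum_le_of_sum_le hB
end

section
open MeasureTheory Filter Set
open scoped ENNReal Topology

lemma fatou2 {X : Type*} [MeasurableSpace X] {μ : Measure X} {h : ℕ → X → ℂ} {g : X → ℂ} {B : ℝ≥0∞} (hm : ∀ n, AEMeasurable (h n) μ) 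
    (hl : ∀ᵐ x ∂μ, Tendsto (fun n => h n x) atTop (𝓝 (g x))) (hB : ∀ n, ∫⁻ x, ‖h n x‖ₑ ^ 2 ∂μ ≤ B) : ∫⁻ x, ‖g x‖ₑ ^ 2 ∂μ ≤ B := by
  calc ∫⁻ x, ‖g x‖ₑ ^ 2 ∂μ = ∫⁻ x, liminf (fun n : ℕ => ‖h n x‖ₑ ^ 2) atTop ∂μ :=
        lintegral_congr_ae (hl.mono fun x hx => ((ENNReal.continuous_pow 2).tendsto _ |>.comp hx.enorm).liminf_eq.symm)
    _ ≤ liminf (fun n : ℕ => ∫⁻ x, ‖h n x‖ₑ ^ 2 ∂μ) atTop := lintegral_liminf_le' fun n => (hm n).enorm.pow_const 2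
    _ ≤ _ := by
        refine liminf_le_of_le (by isBoundedDefault) fun A hA => ?_
        obtain ⟨n, hn⟩ := hA.exists
        exact hn.trans (hB n)

section str
variable {φ γ φ' θ f : ℝ → ℂ} {c : ℝ} {N : ℝ → ℝ} {κ : ℝ → ℤ} {a b : ℤ} {P : Finset Tile}

lemma pack_bd (hc : 0 < c) (h : PKer φ c) (k : ℤ) (ξ x y : ℝ) : ‖pack φ k ξ x y‖ ≤ (sc k)⁻¹ * c := by
  rw [pack, norm_mul, norm_mul, norm_ee, mul_one, Complex.norm_real, Real.norm_of_nonneg (inv_nonneg.2 (sc_pos k).le)]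
  have := sc_pos k
  gcongr; exact h.bd hc _
lemma pack_cont (h : PKer φ c) (k : ℤ) (ξ x : ℝ) : Continuous (pack φ k ξ x) := by
  unfold pack
  have := continuous_ee; have := h.cont
  fun_prop
lemma int_pack (hc : 0 < c) (h : PKer φ c) (hf : Nice f) (k : ℤ) (ξ x : ℝ) : Integrable fun y => f y * pack φ k ξ x y :=
  hf.int.mul_bdd (c := (sc k)⁻¹ * c) (pack_cont h k ξ x).aestronglyMeasurable (ae_of_all _ fun y => pack_bd hc h k ξ x y)

lemma TS_lin (hc : 0 < c) (h : PKer φ c) (I : Finset ℤ) (w : ℤ → ℂ) (g : ℤ → ℝ → ℂ) (hg : ∀ i, Nice (g i)) (x : ℝ) :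
    TS φ (fun y => ∑ i ∈ I, w i * g i y) N κ a b P x = ∑ i ∈ I, w i * TS φ (g i) N κ a b P x := by
  unfold TS
  simp_rw [Finset.mul_sum]
  rw [Finset.sum_comm]
  refine Finset.sum_congr rfl fun k _ => ?_
  split_ifs
  · unfold AA
    simp_rw [← integral_const_mul, Finset.sum_mul]
    rw [← integral_finsetSum _ fun i _ => (int_pack hc h (hg i) k _ x).const_mul _]
    simp_rw [mul_assoc]
  · simp

lemma TS_tendsto (hc : 0 < c) (h : PKer φ c) (hf : Nice f) {g : ℕ → ℝ → ℂ} (hg : ∀ n, Nice (g n)) (hgf : ∀ n x, ‖g n x‖ ≤ ‖f x‖)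
    (hl : ∀ x, Tendsto (fun n => g n x) atTop (𝓝 (f x))) (x : ℝ) : 
    Tendsto (fun n => TS φ (g n) N κ a b P x) atTop (𝓝 (TS φ f N κ a b P x)) := by
  refine tendsto_finsetSum _ fun k _ => ?_
  split_ifs
  · refine tendsto_integral_of_dominated_convergence (fun y => ‖f y‖ * ((sc k)⁻¹ * c)) (fun n => (int_pack hc h (hg n) k _ x).aestronglyMeasurable) (hf.int.norm.mul_const _) 
      (fun n => ae_of_all _ fun y => ?_) (ae_of_all _ fun y => (hl y).mul_const _)
    rw [norm_mul]; gcongr; exacts [hgf n y, pack_bd hc h k _ x y]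
  · exact tendsto_const_nhds

lemma Nice.ind (hf : Nice f) {S : Set ℝ} (hS : MeasurableSet S) : Nice (S.indicator f) := by
  obtain ⟨B, h0, hB⟩ := hf.bdd
  exact ⟨hf.meas.indicator hS, ⟨B, h0, fun x => (norm_indicator_le_norm_self f x).trans (hB x)⟩, hf.int.indicator hS⟩
lemma Nice.cmul (hf : Nice f) (w : ℂ) : Nice fun x => w * f x := by
  obtain ⟨B, h0, hB⟩ := hf.bdd
  exact ⟨hf.meas.const_mul w, ⟨‖w‖ * B, by positivity, fun x => by rw [norm_mul]; gcongr; exact hB x⟩, hf.int.const_mul w⟩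

lemma strong (hK : Ker φ γ φ' θ c) : ∃ A : ℝ, 0 < A ∧ ∀ (f : ℝ → ℂ) (N : ℝ → ℝ) (κ : ℝ → ℤ) (a b : ℤ) (P : Finset Tile), Nice f → Measurable N → Measurable κ → cvx P → (∀ s ∈ P, a ≤ s.1) →
    ∫⁻ x, ‖TS φ f N κ a b P x‖ₑ ^ 2 ≤ ENNReal.ofReal A * ∫⁻ x, ‖f x‖ₑ ^ 2 := by
  obtain ⟨r, r0, r1, r8⟩ := exists_r
  have i0 : 0 < 1 - r := by linarith
  have c0 := hK.c0
  obtain ⟨A, A0, hA⟩ := young_sum r0 r1 r8 (C := 2 * (2 ^ 59 * c * ((1 - r)⁻¹) ^ 3)) (by positivity)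
  refine ⟨4 * A, by positivity, fun f N κ a b P hf hN hκ hcv ha => ?_⟩
  have hL := fun i => measurableSet_Lv hf.meas i
  have fL : ∀ i, volume (Lv f i) ≠ ∞ := fun i =>
    ((measure_mono fun x hx => hx.1).trans_lt (hf.int.measure_norm_gt_lt_top (ε := 2 ^ i) (by positivity))).ne
  choose β β0 hβ using fun i => exists_eight (fL i)
  set g : ℤ → ℝ → ℂ := fun i y => ((2 ^ (i+1) : ℝ)⁻¹ : ℝ) * (Lv f i).indicator f y with hg
  have ng : ∀ i, Nice (g i) := fun i => (hf.ind (hL i)).cmul _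
  have gF : ∀ i x, ‖g i x‖ ≤ (Lv f i).indicator 1 x := fun i x => by
    simp only [hg, norm_mul, Complex.norm_real, norm_inv, norm_zpow, Real.norm_ofNat]
    by_cases hx : x ∈ Lv f i
    · rw [indicator_of_mem hx, indicator_of_mem hx, inv_mul_le_iff₀ (by positivity)]; simpa using hx.2
    · simp [indicator_of_notMem hx]
  have fin : volume (Om P) ≠ ∞ := ((measure_biUnion_finset_le P _).trans_lt (ENNReal.sum_lt_top.2 fun s _ => by rw [volume_iv]; exact ENNReal.ofReal_lt_top)).ne
  -- finitely many levels
  have key : ∀ I : Finset ℤ, ∫⁻ x, ‖TS φ (fun y => ∑ i ∈ I, ((2 ^ (i+1) : ℝ) : ℂ) * g i y) N κ a b P x‖ₑ ^ 2 ≤ ENNReal.ofReal (4 * A) * ∫⁻ x, ‖f x‖ₑ ^ 2 := by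
    intro I
    set h := TS φ (fun y => ∑ i ∈ I, ((2 ^ (i+1) : ℝ) : ℂ) * g i y) N κ a b P with hh
    have he : h = fun x => ∑ i ∈ I, ((2 ^ (i+1) : ℝ) : ℂ) * TS φ (g i) N κ a b P x := funext fun x => TS_lin c0 hK.pφ I _ g ng x
    have mh : Measurable h := by
      rw [he]; exact Finset.measurable_sum _ fun i _ => (measurable_TS hK.pφ.cont (ng i) hN hκ a b P).const_mul _
    have hO : ∀ j, Lv h j ⊆ Om P := fun j x hx => by
      by_contra h1
      have := hx.1
      rw [hh, TS_Om h1, norm_zero] at this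
      exact absurd this (not_lt.2 (by positivity))
    choose α α0 hα using fun j => exists_eight ((measure_mono (hO j)).trans_lt fin.lt_top).ne
    rw [ENNReal.ofReal_mul (by norm_num), ENNReal.ofReal_ofNat, mul_assoc]
    refine level_ge mh fun J => ?_
    have h1 := hA I J α β α0 β0 fun j _ => ?_
    · have e : ∀ (w : ℤ → ℝ) (I : Finset ℤ), ∑ i ∈ I, ENNReal.ofReal (4 ^ i) * ENNReal.ofReal (w i ^ 8) = ENNReal.ofReal (∑ i ∈ I, 4 ^ i * w i ^ 8) := fun w I => by
        rw [ENNReal.ofReal_sum_of_nonneg fun i _ => by positivity]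
        exact Finset.sum_congr rfl fun i _ => (ENNReal.ofReal_mul (by positivity)).symm
      have h2 := level_le hf.meas I
      simp_rw [hβ] at h2
      simp_rw [hα]
      rw [e] at h2 ⊢
      refine (ENNReal.ofReal_le_ofReal h1).trans ?_
      rw [ENNReal.ofReal_mul A0.le]
      gcongr
    · have h3 : ENNReal.ofReal (2 ^ j * α j ^ 8) ≤ ENNReal.ofReal (∑ i ∈ I, 2 ^ (i+1) * (2 ^ 59 * c * ((1 - r)⁻¹) ^ 3 * min (α j ^ 6 * β i ^ 2) (α j ^ 3 * β i ^ 5))) := by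
        have m0 : ∀ i, 0 ≤ min (α j ^ 6 * β i ^ 2) (α j ^ 3 * β i ^ 5) := fun i => by have := α0 j; have := β0 i; exact le_min (by positivity) (by positivity)
        calc _ = ∫⁻ x in Lv h j, ENNReal.ofReal (2 ^ j) := by rw [setLIntegral_const, hα, ENNReal.ofReal_mul (by positivity)]
          _ ≤ ∫⁻ x in Lv h j, ∑ i ∈ I, ENNReal.ofReal (2 ^ (i+1)) * ‖TS φ (g i) N κ a b P x‖ₑ := by
              refine setLIntegral_mono' (measurableSet_Lv mh j) fun x hx => ?_
              refine (ENNReal.ofReal_le_ofReal hx.1.le).trans ?_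
              rw [ofReal_norm, he]
              refine (enorm_sum_le _ _).trans (Finset.sum_le_sum fun i _ => le_of_eq ?_)
              rw [enorm_mul, ← ofReal_norm (((2 ^ (i+1) : ℝ)) : ℂ), Complex.norm_real, Real.norm_of_nonneg (by positivity)]
          _ = ∑ i ∈ I, ENNReal.ofReal (2 ^ (i+1)) * ∫⁻ x in Lv h j, ‖TS φ (g i) N κ a b P x‖ₑ := by
              rw [lintegral_finsetSum _ fun i _ => ((measurable_TS hK.pφ.cont (ng i) hN hκ a b P).enorm.const_mul _)]
              exact Finset.sum_congr rfl fun i _ => lintegral_const_mul _ (measurable_TS hK.pφ.cont (ng i) hN hκ a b P).enorm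
          _ ≤ ∑ i ∈ I, ENNReal.ofReal (2 ^ (i+1)) * ENNReal.ofReal (2 ^ 59 * c * ((1 - r)⁻¹) ^ 3 * min (α j ^ 6 * β i ^ 2) (α j ^ 3 * β i ^ 5)) := by
              gcongr with i _
              exact restr r0 r1 r8 hK (ng i) hN hκ (measurableSet_Lv mh j) (hL i) (gF i) (α0 j) (β0 i) (hα j) (hβ i) hcv ha
          _ = _ := by
              rw [ENNReal.ofReal_sum_of_nonneg fun i _ => by have := m0 i; positivity]
              exact Finset.sum_congr rfl fun i _ => (ENNReal.ofReal_mul (by positivity)).symm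
      rw [ENNReal.ofReal_le_ofReal_iff (Finset.sum_nonneg fun i _ => by have := α0 j; have := β0 i; have : 0 ≤ min (α j ^ 6 * β i ^ 2) (α j ^ 3 * β i ^ 5) := le_min (by positivity) (by positivity)
                                                                        positivity)] at h3
      calc (4:ℝ) ^ j * α j ^ 8 = 2 ^ j * (2 ^ j * α j ^ 8) := by rw [show (4:ℝ) = 2 * 2 by norm_num, mul_zpow]; ring
        _ ≤ _ := mul_le_mul_of_nonneg_left h3 (by positivity)
        _ = _ := by rw [Finset.mul_sum]; refine Finset.sum_congr rfl fun i _ => ?_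
                    rw [zpow_add_one₀ (by norm_num)]; ring
  have hG : ∀ (I : Finset ℤ) y, ∑ i ∈ I, ((2 ^ (i+1) : ℝ) : ℂ) * g i y = (⋃ i ∈ I, Lv f i).indicator f y := fun I y => by
    have e0 : ∀ i, ((2 ^ (i+1) : ℝ) : ℂ) * g i y = (Lv f i).indicator f y := fun i => by
      simp only [hg]; rw [← mul_assoc, ← Complex.ofReal_mul, mul_inv_cancel₀ (by positivity), Complex.ofReal_one, one_mul]
    simp_rw [e0]
    rw [Finset.indicator_biUnion I _ fun i _ j _ hij => Lv_disj f hij]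
  have lim := TS_tendsto (N := N) (κ := κ) (a := a) (b := b) (P := P) c0 hK.pφ hf (g := fun n => (⋃ i ∈ Finset.Icc (-(n:ℤ)) n, Lv f i).indicator f)
    (fun n => hf.ind (Finset.measurableSet_biUnion _ fun i _ => hL i)) (fun n x => norm_indicator_le_norm_self f x) fun x => by
      by_cases hx : f x = 0
      · simp only [Set.indicator, hx, ite_self]; exact tendsto_const_nhds
      · obtain ⟨j, hj⟩ := exists_mem_Ioc_zpow (norm_pos_iff.2 hx) (one_lt_two (α := ℝ))
        refine tendsto_const_nhds.congr' ?_
        filter_upwards [eventually_ge_atTop j.natAbs] with n hn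
        exact (indicator_of_mem (mem_iUnion₂.2 ⟨j, Finset.mem_Icc.2 (by omega), hj⟩) _).symm
  refine fatou2 (fun n => (measurable_TS hK.pφ.cont (hf.ind (Finset.measurableSet_biUnion _ fun i _ => hL i)) hN hκ a b P).aemeasurable) (ae_of_all _ lim) fun n => ?_
  rw [← funext (hG (Finset.Icc (-(n:ℤ)) n))]
  exact key _

open Classical in
noncomputable def TM (φ f : ℝ → ℂ) (N : ℝ → ℝ) (κ : ℝ → ℤ) (a b : ℤ) (x : ℝ) : ℂ :=
  ∑ k ∈ Finset.Icc a b, if c2 k (N x) ∧ κ x ≤ k then AA φ f k (N x) x else 0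

lemma abs_ediv_le {m L : ℤ} (d : ℕ) (h : m ∈ Finset.Icc (-L) L) : m / 64 ^ d ∈ Finset.Icc (-L) L := by
  rw [Finset.mem_Icc] at *
  have : (0:ℤ) < 64 ^ d := by positivity
  constructor
  · rw [Int.le_ediv_iff_mul_le this]; nlinarith
  · refine Int.ediv_le_of_le_mul this ?_; nlinarith

lemma model (hK : Ker φ γ φ' θ c) : ∃ A : ℝ, 0 < A ∧ ∀ (f : ℝ → ℂ) (N : ℝ → ℝ) (κ : ℝ → ℤ) (a b : ℤ), Nice f → Measurable N → Measurable κ → 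
    ∫⁻ x, ‖TM φ f N κ a b x‖ₑ ^ 2 ≤ ENNReal.ofReal A * ∫⁻ x, ‖f x‖ₑ ^ 2 := by
  obtain ⟨A, A0, hA⟩ := strong hK
  refine ⟨A, A0, fun f N κ a b hf hN hκ => ?_⟩
  set P : ℕ → Finset Tile := fun n => Finset.Icc a b ×ˢ Finset.Icc (-(n:ℤ)) n ×ˢ Finset.Icc (-(n:ℤ)) n with hP
  have cP : ∀ n, cvx (P n) := by
    intro n s s' s'' h h' hs hs''
    have k1 := le_of_iv_subset h.1
    have k2 := le_of_iv_subset h'.1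
    simp only [hP, Finset.mem_product] at hs hs'' ⊢
    refine ⟨?_, ?_, ?_⟩
    · have h1 := hs.1; have h2 := hs''.1
      rw [Finset.mem_Icc] at *; omega
    · have h1 := h.1 (left_mem_iv s.1 s.2.1)
      have h2 := left_mem_iv s.1 s.2.1
      rw [mem_iv] at h1 h2
      rw [idx_eq_div k1, h2] at h1
      rw [← h1]; exact abs_ediv_le _ hs.2.1
    · have h1 := h'.2
      rw [nix_eq_div k2, nix_self] at h1
      rw [← h1]; exact abs_ediv_le _ hs''.2.2
  have lim : ∀ x, Tendsto (fun n => TS φ f N κ a b (P n) x) atTop (𝓝 (TM φ f N κ a b x)) := by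
    intro x
    refine tendsto_finsetSum _ fun k hk => tendsto_const_nhds.congr' ?_
    filter_upwards [eventually_ge_atTop (max (idx k x).natAbs (nix k (N x)).natAbs)] with n hn
    have h1 := (le_max_left _ _).trans hn
    have h2 := (le_max_right _ _).trans hn
    have : tl N k x ∈ P n := by
      simp only [hP, tl, Finset.mem_product]
      exact ⟨hk, Finset.mem_Icc.2 (by omega), Finset.mem_Icc.2 (by omega)⟩
    congr 1; simp only [this, true_and]
  exact fatou2 (fun n => (measurable_TS hK.pφ.cont hf hN hκ a b _).aemeasurable) (ae_of_all _ lim) fun n => 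
    hA f N κ a b (P n) hf hN hκ (cP n) fun s hs => (Finset.mem_Icc.1 (Finset.mem_product.1 hs).1).1
end str
end

section
open MeasureTheory Filter Set
open scoped ENNReal Topology

lemma csq {X : Type*} [MeasurableSpace X] {μ : Measure X} {f g : X → ℝ≥0∞} (hf : AEMeasurable f μ) (hg : AEMeasurable g μ) :
    (∫⁻ x, f x * g x ∂μ) ^ 2 ≤ (∫⁻ x, f x ^ 2 ∂μ) * ∫⁻ x, g x ^ 2 ∂μ := by
  have h := ENNReal.lintegral_mul_le_Lp_mul_Lq μ Real.HolderConjugate.two_two hf hg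
  simp only [Pi.mul_apply, ENNReal.rpow_two] at h
  refine (pow_le_pow_left' h 2).trans ?_
  rw [mul_pow, ← ENNReal.rpow_two, ← ENNReal.rpow_two, ← ENNReal.rpow_mul, ← ENNReal.rpow_mul]
  norm_num

lemma measurable_c2 (k : ℤ) : MeasurableSet {τ | c2 k τ} :=
  measurableSet_eq_fun (measurable_nix _) (((measurable_nix k)).const_mul 64 |>.add_const 32)

open Classical in
lemma c2_ii (k : ℤ) (ξ a b : ℝ) : IntervalIntegrable (fun τ => if c2 k (ξ + τ) then (1:ℂ) else 0) volume a b := by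
  rw [intervalIntegrable_iff]
  refine Integrable.mono' (g := fun _ => 1) (intervalIntegrable_iff.1 intervalIntegrable_const) (Measurable.aestronglyMeasurable ?_) (ae_of_all _ fun τ => by split_ifs <;> simp)
  exact Measurable.ite ((measurable_c2 k).preimage (measurable_const.add measurable_id)) measurable_const measurable_const

open Classical in
lemma c2_int {a k : ℤ} (h : a ≤ k) (ξ : ℝ) : ∫ τ in (0:ℝ)..(sc a)⁻¹, (if c2 k (ξ + τ) then (1:ℂ) else 0) = ((sc a)⁻¹ / 64 : ℝ) := by
  have s := sc_pos k
  have sa := sc_pos a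
  set p := (sc k)⁻¹ with hp
  have p0 : 0 < p := inv_pos.2 s
  set g : ℝ → ℂ := fun τ => if c2 k τ then (1:ℂ) else 0 with hg
  have per : Function.Periodic g p := by
    intro τ
    have : c2 k (τ + p) ↔ c2 k τ := by
      unfold c2 nix
      rw [sc_succ]
      have h1 : (τ + p) * (64 * sc k) = τ * (64 * sc k) + (64:ℤ) := by rw [hp]; push_cast; field_simp
      have h2 : (τ + p) * sc k = τ * sc k + (1:ℤ) := by rw [hp]; push_cast; field_simp
      rw [h1, h2, Int.floor_add_intCast, Int.floor_add_intCast]; omega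
    simp only [hg, this]
  have e1 : (sc a)⁻¹ = (64 ^ (k - a).toNat : ℤ) • p := by
    rw [zsmul_eq_mul, hp, sc_eq_mul h]; push_cast; field_simp
  have e2 : ∀ τ ∈ Ioo 0 p, g τ = (Ico (p / 2) (p / 2 + p / 64)).indicator (fun _ => (1:ℂ)) τ := by
    intro τ hτ
    have : nix k τ = 0 := nix_iff.2 ⟨by simpa using hτ.1.le, by simpa [hp] using hτ.2⟩
    have h2 : c2 k τ ↔ τ ∈ Ico (p / 2) (p / 2 + p / 64) := by
      unfold c2; rw [this, nix_iff, sc_succ, mem_Ico]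
      have h1 : p / 2 = ((64 * 0 + 32 : ℤ):ℝ) / (64 * sc k) := by rw [hp]; push_cast; field_simp; norm_num
      have h3 : p / 2 + p / 64 = (((64 * 0 + 32 : ℤ):ℝ) + 1) / (64 * sc k) := by rw [hp]; push_cast; field_simp; norm_num
      rw [h3, h1]
    simp only [hg, indicator, h2]
  have e3 : ∫ τ in (0:ℝ)..0 + p, g τ = (p / 64 : ℝ) := by
    rw [zero_add, intervalIntegral.integral_of_le p0.le, integral_Ioc_eq_integral_Ioo, setIntegral_congr_fun measurableSet_Ioo e2,
      setIntegral_indicator measurableSet_Ico, setIntegral_const, inter_eq_self_of_subset_right]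
    · simp [Measure.real, ENNReal.toReal_ofReal (show 0 ≤ p / 64 by positivity)]
    · intro τ hτ; exact ⟨by linarith [hτ.1], by linarith [hτ.2]⟩
  calc _ = ∫ τ in (0:ℝ)..(sc a)⁻¹, g (ξ + τ) := rfl
    _ = ∫ τ in ξ..ξ + (64 ^ (k - a).toNat : ℤ) • p, g τ := by rw [intervalIntegral.integral_comp_add_left, add_zero, ← e1]
    _ = _ := by
      rw [per.intervalIntegral_add_zsmul_eq, per.intervalIntegral_add_eq ξ 0, e3, e1]
      · simp; ring
      · intro s t; simpa using c2_ii k 0 s t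

section
variable {φ γ φ' θ : ℝ → ℂ} {c : ℝ}

open Classical in
noncomputable def TN (φ f : ℝ → ℂ) (N : ℝ → ℝ) (κ : ℝ → ℤ) (a b : ℤ) (x : ℝ) : ℂ :=
  ∑ k ∈ Finset.Icc a b, if κ x ≤ k then AA φ f k (N x) x else 0

open Classical in
lemma modelN (hK : Ker φ γ φ' θ c) : ∃ A : ℝ, 0 < A ∧ ∀ (f : ℝ → ℂ) (N : ℝ → ℝ) (κ : ℝ → ℤ) (a b : ℤ), Nice f → Measurable N → Measurable κ → 
    ∫⁻ x, ‖TN φ f N κ a b x‖ₑ ^ 2 ≤ ENNReal.ofReal A * ∫⁻ x, ‖f x‖ₑ ^ 2 := by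
  obtain ⟨A, A0, hA⟩ := model hK
  refine ⟨64 ^ 2 * A, by positivity, fun f N κ a b hf hN hκ => ?_⟩
  set I := ∫⁻ x, ‖f x‖ₑ ^ 2
  set Λ := (sc a)⁻¹ with hΛ
  have Λ0 : 0 < Λ := inv_pos.2 (sc_pos a)
  set Q : ℝ → ℝ → ℂ := fun x τ => ∑ k ∈ Finset.Icc a b, (if c2 k (N x + τ) then (1:ℂ) else 0) * (if κ x ≤ k then AA φ f k (N x) x else 0) with hQ
  have mQ : Measurable (Function.uncurry Q) := by
    refine Finset.measurable_fun_sum _ fun k _ => Measurable.mul (Measurable.ite ?_ measurable_const measurable_const) (Measurable.ite ?_ ?_ measurable_const)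
    · exact (measurable_c2 k).preimage ((hN.comp measurable_fst).add measurable_snd)
    · exact measurableSet_le (hκ.comp measurable_fst) measurable_const
    · exact (measurable_AA hK.pφ.cont hf hN k).comp measurable_fst
  have b1 : ∀ τ, ∫⁻ x, ‖Q x τ‖ₑ ^ 2 ≤ ENNReal.ofReal A * I := by
    intro τ
    have hf' : Nice fun y => f y * ee (τ * y) := by
      obtain ⟨h1, ⟨B, B0, hB⟩, h3⟩ := hf
      have : Measurable fun y => ee (τ * y) := (continuous_ee.comp (continuous_const.mul continuous_id)).measurable
      refine ⟨h1.mul this, ⟨B, B0, fun x => ?_⟩, h3.mul_bdd (c := 1) this.aestronglyMeasurable (ae_of_all _ fun x => (norm_ee _).le)⟩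
      rw [norm_mul, norm_ee, mul_one]; exact hB x
    refine Eq.trans_le (lintegral_congr fun x => ?_) ((hA _ (fun x => N x + τ) κ a b hf' (hN.add_const _) hκ).trans (Eq.le ?_))
    · have : TM φ (fun y => f y * ee (τ * y)) (fun x => N x + τ) κ a b x = ee (τ * x) * Q x τ := by
        simp only [TM, hQ, Finset.mul_sum]
        refine Finset.sum_congr rfl fun k _ => ?_
        have : AA φ (fun y => f y * ee (τ * y)) k (N x + τ) x = ee (τ * x) * AA φ f k (N x) x := by
          unfold AA pack
          rw [← integral_const_mul]
          congr 1; ext y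
          have : ee ((N x + τ) * (x - y)) * ee (τ * y) = ee (τ * x) * ee (N x * (x - y)) := by
            rw [← ee_add, ← ee_add]; congr 1; ring
          linear_combination (f y * ((sc k)⁻¹:ℝ) * φ ((x - y) / sc k)) * this
        rw [this]; split_ifs <;> first | tauto | simp
      rw [this, enorm_mul, ← ofReal_norm (ee _), norm_ee]; simp
    · congr 1; refine lintegral_congr fun x => ?_
      rw [enorm_mul, ← ofReal_norm (ee _), norm_ee]; simp
  have b2 : ∀ x, ENNReal.ofReal (Λ / 64) ^ 2 * ‖TN φ f N κ a b x‖ₑ ^ 2 ≤ ENNReal.ofReal Λ * ∫⁻ τ in Ioc 0 Λ, ‖Q x τ‖ₑ ^ 2 := by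
    intro x
    have h1 : ∫ τ in (0:ℝ)..Λ, Q x τ = (Λ / 64 : ℝ) * TN φ f N κ a b x := by
      simp only [hQ, TN, Finset.mul_sum]
      rw [intervalIntegral.integral_finsetSum]
      · refine Finset.sum_congr rfl fun k hk => ?_
        rw [intervalIntegral.integral_mul_const, c2_int (Finset.mem_Icc.1 hk).1]
      · exact fun k _ => (c2_ii k _ _ _).mul_const _
    have h2 : ENNReal.ofReal (Λ / 64) * ‖TN φ f N κ a b x‖ₑ ≤ ∫⁻ τ in Ioc 0 Λ, 1 * ‖Q x τ‖ₑ := by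
      simp_rw [one_mul]
      refine le_trans (Eq.le ?_) (enorm_integral_le_lintegral_enorm _)
      rw [← intervalIntegral.integral_of_le Λ0.le, h1, enorm_mul, ← ofReal_norm ((_:ℝ):ℂ), Complex.norm_real, Real.norm_of_nonneg (by positivity)]
    rw [← mul_pow]
    refine (pow_le_pow_left' h2 2).trans ((csq aemeasurable_const (mQ.comp measurable_prodMk_left).enorm.aemeasurable).trans (Eq.le ?_))
    simp
  have b3 : ENNReal.ofReal (Λ / 64) ^ 2 * ∫⁻ x, ‖TN φ f N κ a b x‖ₑ ^ 2 ≤ ENNReal.ofReal (Λ / 64) ^ 2 * (ENNReal.ofReal (64 ^ 2 * A) * I) := by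
    rw [← lintegral_const_mul' _ _ (by finiteness)]
    refine (lintegral_mono b2).trans ?_
    rw [lintegral_const_mul' _ _ (by finiteness), lintegral_lintegral_swap (mQ.enorm.pow_const 2).aemeasurable]
    refine (mul_le_mul_right (setLIntegral_mono' measurableSet_Ioc fun τ _ => b1 τ) _).trans (Eq.le ?_)
    rw [setLIntegral_const, Real.volume_Ioc, sub_zero]
    rw [← mul_assoc, mul_comm _ (ENNReal.ofReal Λ), ← mul_assoc, ← mul_assoc, ← ENNReal.ofReal_mul Λ0.le, ← ENNReal.ofReal_mul (by positivity), ← ENNReal.ofReal_pow (by positivity), ← mul_assoc, ← ENNReal.ofReal_mul (by positivity)]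
    congr 2; ring
  have hne : ENNReal.ofReal (Λ / 64) ^ 2 ≠ 0 := by
    have : 0 < Λ / 64 := by positivity
    simpa using this
  exact (ENNReal.mul_le_mul_iff_right hne (by finiteness)).1 b3
end
end

section
open MeasureTheory Filter Set
open scoped ENNReal Topology
open scoped SchwartzMap FourierTransform ContDiff

lemma sch_dec (f : 𝓢(ℝ, ℂ)) : ∃ c, ∀ t, ‖f t‖ ≤ c * ((1 + |t|) ^ 6)⁻¹ :=
  ⟨_, fun t => (le_div_iff₀ (by positivity)).2 (by
    simpa [norm_iteratedFDeriv_zero, mul_comm] using SchwartzMap.one_add_le_sup_seminorm_apply (𝕜 := ℝ) (m := (6, 0)) (le_refl 6) (le_refl 0) f t)⟩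

lemma sch_pk {m : ℝ → ℂ} (h1 : ContDiff ℝ ∞ m) (h2 : ∀ x ∉ Icc (1/16:ℝ) (1/4), m x = 0) :
    (∃ c0, ∀ c, c0 ≤ c → PKer (𝓕 m) c) ∧ Integrable m ∧ Integrable (fun x : ℝ => x • m x) ∧ Integrable (deriv m) := by
  have hc : HasCompactSupport m := HasCompactSupport.intro isCompact_Icc h2
  let M := hc.toSchwartzMap h1
  obtain ⟨c1, hc1⟩ := sch_dec (𝓕 M)
  obtain ⟨c2, hc2⟩ := sch_dec (SchwartzMap.derivCLM ℝ ℂ (𝓕 M))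
  have e : 𝓕 m = (𝓕 M : 𝓢(ℝ, ℂ)) := rfl
  refine ⟨⟨max c1 c2, fun c hcc => ⟨⟨_, fun t => (𝓕 M).differentiable.differentiableAt.hasDerivAt, fun t => ?_⟩, fun t => ?_, fun ζ hζ => ?_⟩⟩,
    h1.continuous.integrable_of_hasCompactSupport hc, (continuous_id.smul h1.continuous).integrable_of_hasCompactSupport hc.smul_left,
    (h1.continuous_deriv (by simp)).integrable_of_hasCompactSupport hc.deriv⟩
  · exact (hc2 t).trans (mul_le_mul_of_nonneg_right ((le_max_right _ _).trans hcc) (by positivity))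
  · exact (hc1 t).trans (mul_le_mul_of_nonneg_right ((le_max_left _ _).trans hcc) (by positivity))
  · have h3 : (𝓕⁻ (𝓕 M) : 𝓢(ℝ, ℂ)) (-ζ) = m (-ζ) := by rw [FourierPair.fourierInv_fourier_eq]; rfl
    rw [h2 (-ζ) (fun h => by rcases hζ with h' | h' <;> linarith [h.1, h.2]), SchwartzMap.fourierInv_coe, Real.fourierInv_eq'] at h3
    rw [← h3]
    congr 1; ext t
    rw [e, ee, Real.fourierChar_apply, smul_eq_mul, mul_comm]
    congr 2

lemma ker_exists : ∃ (φ γ φ' θ D : ℝ → ℂ) (c : ℝ), Ker φ γ φ' θ c ∧ Continuous D ∧ (∀ t : ℝ, 2 * Real.pi * Complex.I * t * φ t = D (t / 2) - D t) ∧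
    (∀ t, ‖D t‖ ≤ c * ((1 + |t|) ^ 6)⁻¹) ∧ ∀ t, ‖D t - 1‖ ≤ c * |t| := by
  set s : ℝ → ℝ := fun x => Real.smoothTransition (8 * x - 1) with hs
  have ss : ContDiff ℝ ∞ s := Real.smoothTransition.contDiff.comp (by fun_prop)
  have s0 : ∀ x ≤ 1/8, s x = 0 := fun x hx => Real.smoothTransition.zero_of_nonpos (by linarith)
  have s1 : ∀ x, 1/4 ≤ x → s x = 1 := fun x hx => Real.smoothTransition.one_of_one_le (by linarith)
  set χ : ℝ → ℂ := fun x => ((s (2 * x) - s x : ℝ) : ℂ) with hχ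
  have cχ : ContDiff ℝ ∞ χ := Complex.ofRealCLM.contDiff.comp ((ss.comp (by fun_prop : ContDiff ℝ ∞ fun x : ℝ => 2 * x)).sub ss)
  have zχ : ∀ x ∉ Icc (1/16:ℝ) (1/4), χ x = 0 := by
    intro x hx
    rw [mem_Icc, not_and_or, not_le, not_le] at hx
    rcases hx with h | h
    · simp [hχ, s0 x (by linarith), s0 (2*x) (by linarith)]
    · simp [hχ, s1 x (by linarith), s1 (2*x) (by linarith)]
  set m0 : ℝ → ℂ := fun x => χ x / (-2 * Real.pi * Complex.I * x) with hm0
  have z0 : ∀ x ∉ Icc (1/16:ℝ) (1/4), m0 x = 0 := fun x hx => by simp [hm0, zχ x hx]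
  have c0 : ContDiff ℝ ∞ m0 := by
    rw [contDiff_iff_contDiffAt]
    intro x
    rcases lt_or_ge x (1/16) with h | h
    · refine contDiffAt_const (c := 0) |>.congr_of_eventuallyEq ?_
      filter_upwards [Iio_mem_nhds h] with y hy using z0 y fun h => not_le.2 hy h.1
    · simp only [hm0, div_eq_mul_inv]
      refine cχ.contDiffAt.mul ((contDiffAt_const.mul Complex.ofRealCLM.contDiff.contDiffAt).inv ?_)
      have : (x:ℂ) ≠ 0 := by norm_cast; linarith
      simp [Real.pi_ne_zero, this]
  have e0 : (fun x : ℝ => (-2 * Real.pi * Complex.I * x) • m0 x) = χ := by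
    ext x
    by_cases h : x ∈ Icc (1/16:ℝ) (1/4)
    · have : (x:ℂ) ≠ 0 := by norm_cast; linarith [h.1]
      have := Complex.ofReal_ne_zero.2 Real.pi_ne_zero
      simp only [hm0, smul_eq_mul]; field_simp
    · rw [z0 x h, zχ x h, smul_zero]
  obtain ⟨⟨k1, p1⟩, i1, i1', -⟩ := sch_pk c0 z0
  obtain ⟨⟨k2, p2⟩, i2, i2', i2''⟩ := sch_pk cχ zχ
  obtain ⟨⟨k3, p3⟩, -⟩ := sch_pk (m := fun x : ℝ => (-2 * Real.pi * Complex.I * x) • χ x)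
    ((contDiff_const.mul Complex.ofRealCLM.contDiff).smul cχ) (fun x hx => by rw [zχ x hx, smul_zero])
  have dz : ∀ {f : ℝ → ℂ}, (∀ x ∉ Icc (1/16:ℝ) (1/4), f x = 0) → ∀ x ∉ Icc (1/16:ℝ) (1/4), deriv f x = 0 := by
    intro f hf x hx
    have : f =ᶠ[𝓝 x] fun _ => 0 := by filter_upwards [isClosed_Icc.isOpen_compl.mem_nhds hx] with y hy using hf y hy
    rw [this.deriv_eq]; simp
  obtain ⟨⟨k4, p4⟩, -⟩ := sch_pk (m := deriv χ) (contDiff_infty_iff_deriv.1 cχ).2 (dz zχ)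
  have cs' : ContDiff ℝ ∞ (deriv s) := (contDiff_infty_iff_deriv.1 ss).2
  set σ : ℝ → ℂ := fun x => ((deriv s x : ℝ) : ℂ) with hσ
  have cσ : ContDiff ℝ ∞ σ := Complex.ofRealCLM.contDiff.comp cs'
  have zσ : ∀ x ∉ Icc (1/16:ℝ) (1/4), σ x = 0 := by
    intro x hx
    rw [mem_Icc, not_and_or, not_le, not_le] at hx
    rcases hx with h | h
    · have : s =ᶠ[𝓝 x] fun _ => 0 := by filter_upwards [Iio_mem_nhds h] with y hy using s0 y (by linarith [mem_Iio.1 hy])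
      simp [hσ, this.deriv_eq]
    · have : s =ᶠ[𝓝 x] fun _ => 1 := by filter_upwards [Ioi_mem_nhds h] with y hy using s1 y (by linarith [mem_Ioi.1 hy])
      simp [hσ, this.deriv_eq]
  obtain ⟨⟨k5, p5⟩, i5, -, -⟩ := sch_pk cσ zσ
  set c := max (max k1 k2) (max (max k3 k4) (max k5 1)) with hcd
  have l1 : k1 ≤ c := by simp [hcd]
  have l2 : k2 ≤ c := by simp [hcd]
  have l3 : k3 ≤ c := by simp [hcd]
  have l4 : k4 ≤ c := by simp [hcd]
  have l5 : k5 ≤ c := by simp [hcd]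
  have l6 : 1 ≤ c := by simp [hcd]
  have D0 : 𝓕 σ 0 = 1 := by
    rw [Real.fourier_real_eq]
    simp only [mul_zero, neg_zero, AddChar.map_zero_eq_one, one_smul, hσ]
    rw [integral_complex_ofReal]
    have h1 : ∫ x, deriv s x = ∫ x in (0:ℝ)..1, deriv s x := by
      rw [intervalIntegral.integral_of_le zero_le_one, setIntegral_eq_integral_of_forall_compl_eq_zero]
      intro x hx
      exact Complex.ofReal_eq_zero.1 (zσ x fun h => hx ⟨by linarith [h.1], by linarith [h.2]⟩)
    rw [h1, intervalIntegral.integral_deriv_eq_sub (fun x _ => ss.differentiable (by simp) x) (cs'.continuous.intervalIntegrable _ _), s0 0 (by norm_num), s1 1 (by norm_num)]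
    simp
  have fd := Real.fourier_deriv i2 (cχ.differentiable (by simp)) i2''
  refine ⟨𝓕 χ, 𝓕 m0, 𝓕 fun x : ℝ => (-2 * Real.pi * Complex.I * x) • χ x, 𝓕 (deriv χ), 𝓕 σ, c, 
    ⟨by linarith, p2 c l2, p1 c l1, p3 c l3, p4 c l4, fun t => ?_, fun t => Real.hasDerivAt_fourier i2 i2' t, fun t => ?_⟩, (p5 c l5).cont, fun t => ?_, (p5 c l5).dec, fun t => ?_⟩
  · have := Real.hasDerivAt_fourier i1 i1' t
    rwa [e0] at this
  · rw [fd]; rfl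
  · have h1 : 2 * Real.pi * Complex.I * t * 𝓕 χ t = 𝓕 (deriv χ) t := by rw [fd]; rfl
    have h2 : deriv χ = fun x => 2 * σ (2 * x) - σ x := by
      ext x
      have d := fun y => (ss.differentiable (by simp) y).hasDerivAt
      have := (((d (2 * x)).comp x ((hasDerivAt_id x).const_mul 2)).sub (d x)).ofReal_comp
      refine this.deriv.trans ?_
      simp [hσ]; ring
    rw [h1, h2, Real.fourier_real_eq, Real.fourier_real_eq, Real.fourier_real_eq]
    have ib : ∀ {f : ℝ → ℂ}, Integrable f → Integrable fun v => Real.fourierChar (-(v * t)) • f v := by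
      intro f hf
      exact hf.bdd_mul (c := 1) (f := fun v : ℝ => (Real.fourierChar (-(v * t)) : ℂ))
        (by fun_prop) (ae_of_all _ fun v => (Circle.norm_coe _).le)
    simp_rw [smul_sub]
    rw [integral_sub (ib ((i5.comp_mul_left' two_ne_zero).const_mul 2)) (ib i5)]
    congr 1
    have := Measure.integral_comp_mul_left (fun v => Real.fourierChar (-(v * (t / 2))) • (2 * σ v)) 2
    simp only [show ∀ v : ℝ, 2 * v * (t / 2) = v * t from fun v => by ring] at this
    rw [this, ← integral_smul]
    congr 1; ext v; simp [Circle.smul_def]; ring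
  · obtain ⟨D', h1, h2⟩ := (p5 c l5).dif
    have := Convex.norm_image_sub_le_of_norm_hasDerivWithin_le (s := univ) (x := 0) (y := t) (C := c) (fun x _ => (h1 x).hasDerivWithinAt) (fun x _ => (h2 x).trans ?_) convex_univ trivial trivial
    · simpa [D0] using this
    · exact mul_le_of_le_one_right (by linarith) (inv_le_one_of_one_le₀ (one_le_pow₀ (by linarith [abs_nonneg x])))
end

section
open MeasureTheory Filter Set
open scoped ENNReal Topology

lemma esq {ι : Type*} (s : Finset ι) (f : ι → ℝ≥0∞) : (∑ i ∈ s, f i) ^ 2 ≤ s.card * ∑ i ∈ s, f i ^ 2 := by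
  have := ENNReal.rpow_sum_le_const_mul_sum_rpow s f (p := 2) (by norm_num)
  norm_num at this
  simpa using this

lemma add_sq2 (a b : ℝ≥0∞) : (a + b) ^ 2 ≤ 2 * (a ^ 2 + b ^ 2) := by
  simpa [Fin.sum_univ_two] using esq Finset.univ ![a, b]

lemma ldil (F : ℝ → ℝ≥0∞) {d : ℝ} (hd : d ≠ 0) : ∫⁻ x, F (d * x) = ENNReal.ofReal |d⁻¹| * ∫⁻ x, F x := by
  rw [← smul_eq_mul, ← lintegral_smul_measure, ← Real.map_volume_mul_left hd]
  exact ((MeasurableEquiv.mulLeft₀ d hd).measurableEmbedding.lintegral_map F).symm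

lemma Nice.dil {f : ℝ → ℂ} (hf : Nice f) {d : ℝ} (hd : d ≠ 0) : Nice fun x => f (d * x) := by
  obtain ⟨h1, ⟨B, B0, hB⟩, h3⟩ := hf
  exact ⟨h1.comp (measurable_const_mul d), ⟨B, B0, fun x => hB _⟩, h3.comp_mul_left' hd⟩

lemma int_tele (G : ℤ → ℂ) (a : ℤ) (m : ℕ) : ∑ k ∈ Finset.Icc a (a + m - 1), (G (k + 1) - G k) = G (a + m) - G a := by
  induction m with
  | zero => simp
  | succ m ih =>
    rw [show Finset.Icc a (a + (m + 1 : ℕ) - 1) = insert (a + m) (Finset.Icc a (a + m - 1)) by ext; simp; omega,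
      Finset.sum_insert (by simp), ih]
    push_cast; rw [← add_assoc]; ring

section
variable {φ γ φ' θ : ℝ → ℂ} {c : ℝ}

open Classical in
lemma model_dil (hK : Ker φ γ φ' θ c) : ∃ A : ℝ, 0 < A ∧ ∀ (v : ℝ → ℂ) (N : ℝ → ℝ) (κ : ℝ → ℤ) (a b : ℤ) (ρ : ℕ), Nice v → Measurable N → Measurable κ → 
    ∫⁻ x, ‖∑ k ∈ Finset.Icc a b, if κ x ≤ 6 * k + ρ then ∫ t, v (x - t) * ((((2:ℝ) ^ (6 * k + ρ))⁻¹ : ℝ) * φ (t / 2 ^ (6 * k + ρ)) * ee (N x * t)) else 0‖ₑ ^ 2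
      ≤ ENNReal.ofReal A * ∫⁻ x, ‖v x‖ₑ ^ 2 := by
  obtain ⟨A, A0, hA⟩ := modelN hK
  refine ⟨A, A0, fun v N κ a b ρ hv hN hκ => ?_⟩
  set d : ℝ := 2 ^ ρ with hd
  have d0 : 0 < d := by positivity
  have h := hA (fun x => v (d * x)) (fun x => d * N (d * x)) (fun x => -((ρ - κ (d * x)) / 6)) a b (hv.dil d0.ne')
    ((hN.comp (measurable_const_mul d)).const_mul d) ((measurable_of_countable fun z : ℤ => -(((ρ:ℤ) - z) / 6)).comp (hκ.comp (measurable_const_mul d)))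
  rw [ldil (fun x => ‖v x‖ₑ ^ 2) d0.ne', mul_left_comm] at h
  have e : ∀ x, TN φ (fun x => v (d * x)) (fun x => d * N (d * x)) (fun x => -((ρ - κ (d * x)) / 6)) a b x = 
      ∑ k ∈ Finset.Icc a b, if κ (d * x) ≤ 6 * k + ρ then ∫ t, v (d * x - t) * ((((2:ℝ) ^ (6 * k + ρ))⁻¹ : ℝ) * φ (t / 2 ^ (6 * k + ρ)) * ee (N (d * x) * t)) else 0 := by
    intro x
    refine Finset.sum_congr rfl fun k _ => ?_
    have hs : (2:ℝ) ^ (6 * k + (ρ:ℤ)) = sc k * d := by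
      rw [zpow_add₀ two_ne_zero, zpow_mul, sc, hd, zpow_natCast]; norm_num
    have sp := sc_pos k
    have e1 : AA φ (fun x => v (d * x)) k (d * N (d * x)) x = ∫ t, v (d * x - t) * ((((2:ℝ) ^ (6 * k + ρ))⁻¹ : ℝ) * φ (t / 2 ^ (6 * k + ρ)) * ee (N (d * x) * t)) := by
      have h1 := Measure.integral_comp_mul_left (fun t => v (d * x - t) * ((((2:ℝ) ^ (6 * k + ρ))⁻¹ : ℝ) * φ (t / 2 ^ (6 * k + ρ)) * ee (N (d * x) * t))) d
      rw [← smul_inv_smul₀ d0.ne' (∫ t, v (d * x - t) * _), ← abs_of_pos (inv_pos.2 d0), ← h1, ← integral_sub_left_eq_self _ _ x, ← integral_smul]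
      unfold AA pack
      congr 1; ext y
      have : (d * (x - y)) / (sc k * d) = (x - y) / sc k := by field_simp
      rw [hs, this, show d * x - d * (x - y) = d * y by ring, show N (d * x) * (d * (x - y)) = d * N (d * x) * (x - y) by ring,
        Complex.real_smul]
      have d1 : (d:ℂ) ≠ 0 := Complex.ofReal_ne_zero.2 d0.ne'
      push_cast; rw [mul_inv]; field_simp
    rw [e1]
    exact if_congr (by dsimp only; omega) rfl rfl
  simp only [e] at h
  rw [ldil (fun x => ‖∑ k ∈ Finset.Icc a b, if κ x ≤ 6 * k + ρ then ∫ t, v (x - t) * ((((2:ℝ) ^ (6 * k + ρ))⁻¹ : ℝ) * φ (t / 2 ^ (6 * k + ρ)) * ee (N x * t)) else 0‖ₑ ^ 2) d0.ne'] at h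
  exact (ENNReal.mul_le_mul_iff_right (by simpa using d0.ne') (by finiteness)).1 h

lemma carl0 (hK : Ker φ γ φ' θ c) {D : ℝ → ℂ} (hD : ∀ t : ℝ, 2 * Real.pi * Complex.I * t * φ t = D (t / 2) - D t) :
    ∃ A : ℝ, 0 < A ∧ ∀ (v : ℝ → ℂ) (N : ℝ → ℝ) (κ : ℝ → ℤ) (n : ℕ), Nice v → Measurable N → Measurable κ → (∀ x, -(6 * n) ≤ κ x ∧ κ x ≤ 6 * n) →
    ∫⁻ x, ‖∫ t, v (x - t) * (ee (N x * t) * ((D (t / 2 ^ (6 * n)) - D (t / (2:ℝ) ^ κ x)) / t))‖ₑ ^ 2 ≤ ENNReal.ofReal A * ∫⁻ x, ‖v x‖ₑ ^ 2 := by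
  classical
  obtain ⟨A, A0, hA⟩ := model_dil hK
  refine ⟨50 * (36 * A), by positivity, fun v N κ n hv hN hκ hb => ?_⟩
  set B : ℕ → ℤ → ℝ → ℂ := fun ρ k x => ∫ t, v (x - t) * ((((2:ℝ) ^ (6 * k + ρ))⁻¹ : ℝ) * φ (t / 2 ^ (6 * k + ρ)) * ee (N x * t)) with hB
  set S : ℕ → ℝ → ℂ := fun ρ x => ∑ k ∈ Finset.Icc (-n:ℤ) (-n + (2 * n : ℕ) - 1), if κ x ≤ 6 * k + ρ then B ρ k x else 0 with hS
  have e : ∀ x, ∫ t, v (x - t) * (ee (N x * t) * ((D (t / 2 ^ (6 * n)) - D (t / (2:ℝ) ^ κ x)) / t)) = 2 * Real.pi * Complex.I * ∑ ρ ∈ Finset.range 6, S ρ x := by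
    intro x
    have ib : ∀ ρ : ℕ, ∀ k : ℤ, Integrable fun t => v (x - t) * ((((2:ℝ) ^ (6 * k + ρ))⁻¹ : ℝ) * φ (t / 2 ^ (6 * k + ρ)) * ee (N x * t)) := by
      intro ρ k
      have := hK.pφ.cont
      have := continuous_ee
      refine (hv.int.comp_sub_left x).mul_bdd (c := ((2:ℝ) ^ (6 * k + ρ))⁻¹ * c) (by fun_prop) (ae_of_all _ fun t => ?_)
      rw [norm_mul, norm_mul, norm_ee, mul_one, Complex.norm_real, Real.norm_of_nonneg (by positivity)]
      exact mul_le_mul_of_nonneg_left (hK.pφ.bd hK.c0 _) (by positivity)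
    have ib' : ∀ ρ : ℕ, ∀ k : ℤ, Integrable fun t => if κ x ≤ 6 * k + ρ then v (x - t) * ((((2:ℝ) ^ (6 * k + ρ))⁻¹ : ℝ) * φ (t / 2 ^ (6 * k + ρ)) * ee (N x * t)) else 0 := by
      intro ρ k; split_ifs
      · exact ib ρ k
      · simp
    have h1 : ∑ ρ ∈ Finset.range 6, S ρ x = ∫ t, ∑ ρ ∈ Finset.range 6, ∑ k ∈ Finset.Icc (-n:ℤ) (-n + (2 * n : ℕ) - 1), 
        if κ x ≤ 6 * k + ρ then v (x - t) * ((((2:ℝ) ^ (6 * k + ρ))⁻¹ : ℝ) * φ (t / 2 ^ (6 * k + ρ)) * ee (N x * t)) else 0 := by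
      rw [integral_finsetSum _ fun ρ _ => integrable_finsetSum _ fun k _ => ib' ρ k]
      refine Finset.sum_congr rfl fun ρ _ => ?_
      rw [integral_finsetSum _ fun k _ => ib' ρ k]
      refine Finset.sum_congr rfl fun k _ => ?_
      split_ifs <;> simp [hB]
    rw [h1, ← integral_const_mul]
    refine integral_congr_ae ?_
    filter_upwards [compl_mem_ae_iff.2 (measure_singleton (0:ℝ))] with t ht
    have t0 : (t:ℂ) ≠ 0 := Complex.ofReal_ne_zero.2 ht
    set g : ℤ → ℂ := fun j => D (t / (2:ℝ) ^ max j (κ x)) with hg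
    have h2 : ∀ k : ℤ, ∀ ρ : ℕ, (if κ x ≤ 6 * k + ρ then v (x - t) * ((((2:ℝ) ^ (6 * k + ρ))⁻¹ : ℝ) * φ (t / 2 ^ (6 * k + ρ)) * ee (N x * t)) else 0)
        = v (x - t) * ee (N x * t) / (2 * Real.pi * Complex.I * t) * (g (6 * k + ρ + 1) - g (6 * k + ρ)) := by
      intro k ρ
      simp only [hg]
      split_ifs with h
      · rw [max_eq_left h, max_eq_left (by omega), zpow_add_one₀ two_ne_zero, ← div_div t, ← hD]
        have := Complex.ofReal_ne_zero.2 Real.pi_ne_zero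
        push_cast; field_simp
      · rw [max_eq_right (by omega), max_eq_right (by omega)]; simp
    have h3 : ∀ k : ℤ, ∑ ρ ∈ Finset.range 6, (g (6 * k + ρ + 1) - g (6 * k + ρ)) = g (6 * (k + 1)) - g (6 * k) := by
      intro k
      have : 6 * (k + 1) = 6 * k + 5 + 1 := by ring
      rw [this]; norm_num [Finset.sum_range_succ, add_assoc]; ring
    simp_rw [h2, ← Finset.mul_sum]
    rw [Finset.sum_comm]
    simp_rw [h3]
    rw [int_tele fun k => g (6 * k)]
    simp only [hg]
    rw [max_eq_left (by push_cast; linarith [(hb x).2]), max_eq_right (by linarith [(hb x).1]), show (6 * (-n + ((2 * n : ℕ):ℤ))) = ((6 * n : ℕ) : ℤ) by push_cast; ring, zpow_natCast]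
    have := Complex.ofReal_ne_zero.2 Real.pi_ne_zero
    field_simp
  simp_rw [e]
  have hp : ‖2 * Real.pi * Complex.I‖ₑ ^ 2 ≤ ENNReal.ofReal 50 := by
    rw [← ofReal_norm, ← ENNReal.ofReal_pow (norm_nonneg _)]
    apply ENNReal.ofReal_le_ofReal
    simp only [norm_mul, Complex.norm_I, Complex.norm_real, Complex.norm_ofNat, Real.norm_of_nonneg Real.pi_pos.le]
    nlinarith [Real.pi_pos, Real.pi_lt_d2]
  have mS : ∀ ρ, Measurable (S ρ) := by
    intro ρ
    refine Finset.measurable_fun_sum _ fun k _ => Measurable.ite (measurableSet_le hκ measurable_const) ?_ measurable_const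
    refine (StronglyMeasurable.integral_prod_right' (f := fun p : ℝ × ℝ => v (p.1 - p.2) * ((((2:ℝ) ^ (6 * k + ρ))⁻¹ : ℝ) * φ (p.2 / 2 ^ (6 * k + ρ)) * ee (N p.1 * p.2))) ?_).measurable
    have := hv.meas; have := hK.pφ.cont.measurable; have := continuous_ee.measurable
    exact Measurable.stronglyMeasurable (by fun_prop)
  calc _ ≤ ∫⁻ x, ENNReal.ofReal 50 * (6 * ∑ ρ ∈ Finset.range 6, ‖S ρ x‖ₑ ^ 2) := by
        refine lintegral_mono fun x => ?_
        rw [enorm_mul, mul_pow]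
        exact mul_le_mul' hp ((pow_le_pow_left' (enorm_sum_le _ _) 2).trans (by simpa using esq (Finset.range 6) fun ρ => ‖S ρ x‖ₑ))
    _ = ENNReal.ofReal 50 * (6 * ∑ ρ ∈ Finset.range 6, ∫⁻ x, ‖S ρ x‖ₑ ^ 2) := by
        rw [lintegral_const_mul' _ _ (by finiteness), lintegral_const_mul' _ _ (by finiteness), lintegral_finsetSum _ fun ρ _ => (mS ρ).enorm.pow_const 2]
    _ ≤ ENNReal.ofReal 50 * (6 * ∑ ρ ∈ Finset.range 6, ENNReal.ofReal A * ∫⁻ x, ‖v x‖ₑ ^ 2) := by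
        gcongr with ρ; exact hA v N κ _ _ ρ hv hN hκ
    _ = _ := by
        rw [Finset.sum_const, Finset.card_range, ENNReal.ofReal_mul (by norm_num), ENNReal.ofReal_mul (by norm_num)]
        simp only [nsmul_eq_mul, ENNReal.ofReal_ofNat]; push_cast; ring
end

lemma carl : ∃ (E : ℝ → ℂ) (A c : ℝ), 0 < A ∧ 0 < c ∧ Continuous E ∧ (∀ t, E (-t) = E t) ∧ (∀ t, ‖E t‖ ≤ c * ((1 + |t|) ^ 6)⁻¹) ∧ (∀ t, ‖E t - 1‖ ≤ c * |t|) ∧ 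
    ∀ (v : ℝ → ℂ) (N : ℝ → ℝ) (κ : ℝ → ℤ) (n : ℕ), Nice v → Measurable N → Measurable κ → (∀ x, -(6 * n) ≤ κ x ∧ κ x ≤ 6 * n) →
    ∫⁻ x, ‖∫ t, v (x - t) * (ee (N x * t) * ((E (t / 2 ^ (6 * n)) - E (t / (2:ℝ) ^ κ x)) / t))‖ₑ ^ 2 ≤ ENNReal.ofReal A * ∫⁻ x, ‖v x‖ₑ ^ 2 := by
  obtain ⟨φ, γ, φ', θ, D, c, hK, cD, hD, bD, lD⟩ := ker_exists
  obtain ⟨A, A0, hA⟩ := carl0 hK hD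
  refine ⟨fun t => (D t + D (-t)) / 2, 4 * A, c, by positivity, hK.c0, by fun_prop, fun t => by simp [add_comm], fun t => ?_, fun t => ?_, fun v N κ n hv hN hκ hb => ?_⟩
  · have h1 := bD t; have h2 := bD (-t)
    rw [abs_neg] at h2
    rw [norm_div, Complex.norm_ofNat]
    linarith [norm_add_le (D t) (D (-t))]
  · have h1 := lD t; have h2 := lD (-t)
    rw [abs_neg] at h2
    rw [show (D t + D (-t)) / 2 - 1 = ((D t - 1) + (D (-t) - 1)) / 2 by ring, norm_div, Complex.norm_ofNat]
    linarith [norm_add_le (D t - 1) (D (-t) - 1)]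
  set W : (ℝ → ℂ) → (ℝ → ℝ) → (ℝ → ℤ) → ℝ → ℝ → ℂ := fun v N κ x t => v (x - t) * (ee (N x * t) * ((D (t / 2 ^ (6 * n)) - D (t / (2:ℝ) ^ κ x)) / t)) with hW
  have h1 := hA v N κ n hv hN hκ hb
  have h2 := hA (fun y => v (-1 * y)) (fun y => -N (-y)) (fun y => κ (-y)) n (hv.dil (by norm_num)) (hN.comp measurable_neg).neg (hκ.comp measurable_neg) fun x => hb _
  rw [ldil (fun x => ‖v x‖ₑ ^ 2) (by norm_num)] at h2
  have mW : ∀ {v N κ}, Nice v → Measurable N → Measurable κ → Measurable (Function.uncurry (W v N κ)) := by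
    intro v N κ hv hN hκ
    have := hv.meas; have := cD.measurable; have := continuous_ee.measurable
    have : Measurable fun x => (2:ℝ) ^ κ x := (measurable_of_countable fun z : ℤ => (2:ℝ) ^ z).comp hκ
    simp only [hW, Function.uncurry_def]; fun_prop
  have iW : ∀ {v N κ}, Nice v → Measurable N → Measurable κ → ∀ x, Integrable (W v N κ x) := by
    intro v N κ hv hN hκ x
    have := cD.measurable; have := continuous_ee.measurable
    refine (hv.int.comp_sub_left x).mul_bdd (c := c * (((2:ℝ) ^ (6 * n))⁻¹ + ((2:ℝ) ^ κ x)⁻¹)) (Measurable.aestronglyMeasurable (by fun_prop)) (ae_of_all _ fun t => ?_)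
    rw [norm_mul, norm_ee, one_mul, norm_div, Complex.norm_real]
    refine div_le_of_le_mul₀ (norm_nonneg _) (by have := hK.c0; positivity) ?_
    have h1 := lD (t / 2 ^ (6 * n)); have h2 := lD (t / (2:ℝ) ^ κ x)
    rw [abs_div, abs_of_pos (by positivity : (0:ℝ) < 2 ^ (6 * n))] at h1
    rw [abs_div, abs_of_pos (by positivity : (0:ℝ) < 2 ^ κ x)] at h2
    rw [← sub_sub_sub_cancel_right _ _ 1, Real.norm_eq_abs]
    refine (norm_sub_le _ _).trans ((add_le_add h1 h2).trans (Eq.le ?_))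
    ring
  set v' : ℝ → ℂ := fun y => v (-1 * y)
  have e : ∀ x, ∫ t, v (x - t) * (ee (N x * t) * (((D (t / 2 ^ (6 * n)) + D (-(t / 2 ^ (6 * n)))) / 2 - (D (t / (2:ℝ) ^ κ x) + D (-(t / (2:ℝ) ^ κ x))) / 2) / t))
      = (1/2:ℂ) * ((∫ t, W v N κ x t) - ∫ t, W v' (fun y => -N (-y)) (fun y => κ (-y)) (-1 * x) t) := by
    intro x
    have iw : Integrable (W v' (fun y => -N (-y)) (fun y => κ (-y)) (-1 * x)) := iW (hv.dil (d := -1) (by norm_num)) (hN.comp measurable_neg).neg (hκ.comp measurable_neg) _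
    rw [← integral_neg_eq_self (W v' (fun y => -N (-y)) (fun y => κ (-y)) (-1 * x)) volume, ← integral_sub (iW hv hN hκ x) iw.comp_neg, ← integral_const_mul]
    congr 1; ext t
    simp only [hW, v', neg_mul, one_mul, neg_neg, mul_neg, neg_div, Complex.ofReal_neg]
    rw [show -(-x - -t) = x - t by ring]; ring
  simp_rw [e]
  calc _ ≤ ∫⁻ x, 2 * (‖∫ t, W v N κ x t‖ₑ ^ 2 + ‖∫ t, W v' (fun y => -N (-y)) (fun y => κ (-y)) (-1 * x) t‖ₑ ^ 2) := by
        refine lintegral_mono fun x => ?_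
        refine le_trans (pow_le_pow_left' ?_ 2) (add_sq2 _ _)
        rw [enorm_mul]
        refine (mul_le_of_le_one_left' ?_).trans (enorm_sub_le)
        rw [← ofReal_norm]; norm_num
    _ = 2 * ((∫⁻ x, ‖∫ t, W v N κ x t‖ₑ ^ 2) + ∫⁻ x, ‖∫ t, W v' (fun y => -N (-y)) (fun y => κ (-y)) x t‖ₑ ^ 2) := by
        rw [lintegral_const_mul' _ _ (by finiteness), lintegral_add_left, ldil (fun x => ‖∫ t, W v' (fun y => -N (-y)) (fun y => κ (-y)) x t‖ₑ ^ 2) (by norm_num)]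
        · norm_num
        · exact (StronglyMeasurable.integral_prod_right' (mW hv hN hκ).stronglyMeasurable).measurable.enorm.pow_const 2
    _ ≤ 2 * (ENNReal.ofReal A * (∫⁻ x, ‖v x‖ₑ ^ 2) + ENNReal.ofReal A * ∫⁻ x, ‖v x‖ₑ ^ 2) := by
        gcongr
        refine h2.trans (Eq.le ?_); norm_num
    _ = _ := by rw [ENNReal.ofReal_mul (by norm_num), ENNReal.ofReal_ofNat]; ring
end

section
open MeasureTheory Filter Set
open scoped ENNReal Topology

noncomputable def q (r t : ℝ) : ℝ≥0∞ := ENNReal.ofReal (r⁻¹ * ((1 + |t| / r) ^ 2)⁻¹)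

lemma q_int {r : ℝ} (hr : 0 < r) (x : ℝ) : ∫⁻ y, q r (x - y) ≤ 4 := by
  simp only [q, abs_sub_comm x]
  rw [← ofReal_integral_eq_lintegral_ofReal ((int_vs x hr).const_mul _) (ae_of_all _ fun y => by positivity), integral_const_mul, ← ENNReal.ofReal_ofNat]
  refine ENNReal.ofReal_le_ofReal ((mul_le_mul_of_nonneg_left (int_vs_le x hr) (by positivity)).trans (Eq.le ?_))
  field_simp

lemma q_half {r s t : ℝ} (hr : 0 < r) (h : |s| ≤ 2 * |t|) : q r t ≤ 4 * q r s := by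
  rw [q, q, ← ENNReal.ofReal_ofNat, ← ENNReal.ofReal_mul (by norm_num)]
  refine ENNReal.ofReal_le_ofReal ?_
  have : |s| / r ≤ 2 * (|t| / r) := by rw [← mul_div_assoc]; gcongr
  have h0 : 0 ≤ |s| / r := by positivity
  calc _ ≤ r⁻¹ * (((1 + |s| / r) / 2) ^ 2)⁻¹ := by gcongr; linarith
    _ = _ := by field_simp; norm_num

lemma q_conv {r s : ℝ} (hr : 0 < r) (hs : 0 < s) (x z : ℝ) : ∫⁻ y, q r (x - y) * q s (z - y) ≤ 16 * (q r (x - z) + q s (x - z)) := by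
  calc _ ≤ ∫⁻ y, (4 * q r (x - z) * q s (z - y) + 4 * q s (x - z) * q r (x - y)) := by
        refine lintegral_mono fun y => ?_
        have : |x - z| ≤ |x - y| + |z - y| := by rw [abs_sub_comm z]; exact abs_sub_le x y z
        rcases le_total |x - y| |z - y| with h | h
        · exact le_add_left (by rw [mul_comm]; exact mul_le_mul_left (q_half hs (by linarith)) _)
        · exact le_add_right (mul_le_mul_left (q_half hr (by linarith)) _)
    _ ≤ 4 * q r (x - z) * 4 + 4 * q s (x - z) * 4 := by
        rw [lintegral_add_left (by unfold q; fun_prop), lintegral_const_mul' _ _ (by unfold q; finiteness), lintegral_const_mul' _ _ (by unfold q; finiteness)]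
        gcongr <;> exact q_int ‹_› _
    _ = _ := by ring

section
variable {r : ℝ → ℝ} (hr : Measurable r) (r0 : ∀ x, 0 < r x)
include hr
lemma meas_q : Measurable (Function.uncurry fun x y => q (r x) (x - y)) := by
  simp only [q, Function.uncurry_def]; fun_prop
include r0
lemma HL1 {h : ℝ → ℝ≥0∞} (hh : Measurable h) :
    ∫⁻ y, (∫⁻ x, q (r x) (x - y) * h x) ^ 2 ≤ 32 * ∫⁻ x, ∫⁻ z, h x * (h z * q (r x) (x - z)) := by
  have mq := meas_q hr
  have m1 : Measurable fun p : ℝ × ℝ × ℝ => q (r p.2.1) (p.2.1 - p.1) * h p.2.1 * (q (r p.2.2) (p.2.2 - p.1) * h p.2.2) :=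
    ((mq.comp (by fun_prop : Measurable fun p : ℝ × ℝ × ℝ => (p.2.1, p.1))).mul (by fun_prop)).mul ((mq.comp (by fun_prop : Measurable fun p : ℝ × ℝ × ℝ => (p.2.2, p.1))).mul (by fun_prop))
  have m2 : Measurable fun p : ℝ × ℝ => h p.1 * (h p.2 * q (r p.1) (p.1 - p.2)) := (hh.comp measurable_fst).mul ((hh.comp measurable_snd).mul mq)
  have m3 := m2.comp measurable_swap
  calc _ = ∫⁻ y, ∫⁻ x, ∫⁻ z, q (r x) (x - y) * h x * (q (r z) (z - y) * h z) := by
        refine lintegral_congr fun y => ?_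
        have : Measurable fun x => q (r x) (x - y) * h x := (mq.comp (by fun_prop : Measurable fun x => (x, y))).mul hh
        simp_rw [lintegral_const_mul _ this, lintegral_mul_const _ this, sq]
    _ = ∫⁻ x, ∫⁻ z, ∫⁻ y, q (r x) (x - y) * h x * (q (r z) (z - y) * h z) := by
        rw [lintegral_lintegral_swap]
        · refine lintegral_congr fun x => ?_
          rw [lintegral_lintegral_swap]
          exact (m1.comp (by fun_prop : Measurable fun p : ℝ × ℝ => (p.1, x, p.2))).aemeasurable
        · exact (Measurable.lintegral_prod_right' (f := fun p : (ℝ × ℝ) × ℝ => q (r p.1.2) (p.1.2 - p.1.1) * h p.1.2 * (q (r p.2) (p.2 - p.1.1) * h p.2)) (m1.comp (by fun_prop : Measurable fun p : (ℝ × ℝ) × ℝ => (p.1.1, p.1.2, p.2)))).aemeasurable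
    _ ≤ ∫⁻ x, ∫⁻ z, (16 * (h x * (h z * q (r x) (x - z))) + 16 * (h z * (h x * q (r z) (z - x)))) := by
        refine lintegral_mono fun x => lintegral_mono fun z => ?_
        calc _ = h x * h z * ∫⁻ y, q (r x) (x - y) * q (r z) (z - y) := by
              rw [← lintegral_const_mul]
              · congr 1; ext y; ring
              · unfold q; fun_prop
          _ ≤ h x * h z * (16 * (q (r x) (x - z) + q (r z) (x - z))) := by gcongr; exact q_conv (r0 x) (r0 z) x z
          _ = _ := by simp only [q, abs_sub_comm x z]; ring
    _ = _ := by
        have e1 : ∀ x, ∫⁻ z, (16 * (h x * (h z * q (r x) (x - z))) + 16 * (h z * (h x * q (r z) (z - x)))) = 16 * (∫⁻ z, h x * (h z * q (r x) (x - z))) + 16 * ∫⁻ z, h z * (h x * q (r z) (z - x)) := by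
          intro x
          rw [lintegral_add_left, lintegral_const_mul' 16 _ (by finiteness), lintegral_const_mul' 16 _ (by finiteness)]
          exact (m2.comp (by fun_prop : Measurable fun z => (x, z))).const_mul 16
        simp_rw [e1]
        rw [lintegral_add_left (Measurable.const_mul (Measurable.lintegral_prod_right' m2) 16), lintegral_const_mul' _ _ (by finiteness), lintegral_const_mul' _ _ (by finiteness), lintegral_lintegral_swap (f := fun x z => h z * (h x * q (r z) (z - x))) m3.aemeasurable]
        ring

lemma HL2 {h : ℝ → ℝ≥0∞} (hh : Measurable h) (hf : ∫⁻ x, ∫⁻ z, h x * (h z * q (r x) (x - z)) ≠ ∞) :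
    ∫⁻ y, (∫⁻ x, q (r x) (x - y) * h x) ^ 2 ≤ 1024 * ∫⁻ x, h x ^ 2 := by
  have h1 := HL1 hr r0 hh
  set D := ∫⁻ y, (∫⁻ x, q (r x) (x - y) * h x) ^ 2
  have mq := meas_q hr
  have Df : D ≠ ∞ := ne_top_of_le_ne_top (by finiteness) h1
  have e : ∫⁻ x, ∫⁻ z, h x * (h z * q (r x) (x - z)) = ∫⁻ z, h z * ∫⁻ x, q (r x) (x - z) * h x := by
    rw [lintegral_lintegral_swap]
    · refine lintegral_congr fun z => ?_
      rw [← lintegral_const_mul]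
      · congr 1; ext x; ring
      · exact (mq.comp (by fun_prop : Measurable fun x => (x, z))).mul hh
    · exact ((hh.comp measurable_fst).mul ((hh.comp measurable_snd).mul mq)).aemeasurable
  have h2 := csq (μ := volume) hh.aemeasurable (g := fun z => ∫⁻ x, q (r x) (x - z) * h x) (Measurable.lintegral_prod_left' (f := fun p : ℝ × ℝ => q (r p.1) (p.1 - p.2) * h p.1) (mq.mul (hh.comp measurable_fst))).aemeasurable
  rw [← e] at h2
  have h3 : D * D ≤ D * (1024 * ∫⁻ x, h x ^ 2) := by
    rw [← sq]
    refine (pow_le_pow_left' h1 2).trans ?_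
    rw [mul_pow]
    refine (mul_le_mul_right h2 _).trans (Eq.le ?_)
    change _ * (_ * D) = _
    ring
  rcases eq_or_ne D 0 with h0 | h0
  · rw [h0]; exact zero_le
  · exact (ENNReal.mul_le_mul_iff_right h0 Df).1 h3

lemma HL {g : ℝ → ℝ≥0∞} (hg : Measurable g) : ∫⁻ x, (∫⁻ y, q (r x) (x - y) * g y) ^ 2 ≤ 1024 * ∫⁻ y, g y ^ 2 := by
  have mq := meas_q hr
  set P := fun x => ∫⁻ y, q (r x) (x - y) * g y with hP
  have mP : Measurable P := Measurable.lintegral_prod_right' (f := fun p : ℝ × ℝ => q (r p.1) (p.1 - p.2) * g p.2) (mq.mul (hg.comp measurable_snd))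
  set A : ℕ → Set ℝ := fun n => {x | |x| ≤ n ∧ (r x)⁻¹ ≤ n} with hA
  have mA : ∀ n, MeasurableSet (A n) := fun n => (measurableSet_le measurable_norm measurable_const).inter (measurableSet_le (f := fun x => (r x)⁻¹) hr.inv measurable_const)
  set h : ℕ → ℝ → ℝ≥0∞ := fun n => (A n).indicator fun x => min (P x) n with hh
  have mh : ∀ n, Measurable (h n) := fun n => (mP.min measurable_const).indicator (mA n)
  have vA : ∀ n, volume (A n) ≠ ∞ := fun n => ne_top_of_le_ne_top (measure_closedBall_lt_top (x := (0:ℝ)) (r := n)).ne (measure_mono fun x hx => by simpa using hx.1)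
  have hn : ∀ n x, h n x ≤ (A n).indicator (fun _ => (n:ℝ≥0∞)) x := fun n x => indicator_le_indicator' fun _ => min_le_right _ _
  have key : ∀ n, ∫⁻ x, h n x ^ 2 ≤ 1024 * ∫⁻ y, g y ^ 2 := by
    intro n
    have f1 : ∫⁻ x, ∫⁻ z, h n x * (h n z * q (r x) (x - z)) ≠ ∞ := by
      refine ne_top_of_le_ne_top (b := n * n * n * volume (A n) * volume (A n)) (by have := vA n; finiteness) ?_
      calc _ ≤ ∫⁻ x, (A n).indicator (fun _ => n * n * n * volume (A n)) x := by
            refine lintegral_mono fun x => ?_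
            by_cases hx : x ∈ A n
            · rw [indicator_of_mem hx]
              calc _ ≤ ∫⁻ z, (A n).indicator (fun _ => (n * n * n : ℝ≥0∞)) z := by
                    refine lintegral_mono fun z => ?_
                    by_cases hz : z ∈ A n
                    · rw [indicator_of_mem hz, mul_assoc]
                      have := hn n x; have h2 := hn n z
                      rw [indicator_of_mem hx] at this; rw [indicator_of_mem hz] at h2
                      refine mul_le_mul' this (mul_le_mul' h2 ?_)
                      rw [← ENNReal.ofReal_natCast]
                      have := r0 x
                      exact ENNReal.ofReal_le_ofReal ((mul_le_of_le_one_right (by positivity) (inv_le_one_of_one_le₀ (one_le_pow₀ (by linarith [show 0 ≤ |x - z| / r x by positivity])))).trans hx.2)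
                    · simp [hh, hz]
                _ = _ := by rw [lintegral_indicator_const (mA n)]
            · simp [hh, hx]
        _ = _ := by rw [lintegral_indicator_const (mA n)]
    have h2 := HL2 hr r0 (mh n) f1
    have h3 : ∫⁻ x, h n x ^ 2 ≠ ∞ := by
      refine ne_top_of_le_ne_top (b := n ^ 2 * volume (A n)) (by have := vA n; finiteness) ?_
      rw [← lintegral_indicator_const (mA n)]
      refine lintegral_mono fun x => ?_
      by_cases hx : x ∈ A n
      · have := hn n x; rw [indicator_of_mem hx] at this ⊢; gcongr
      · simp [hh, hx]
    have h4 : ∫⁻ x, h n x ^ 2 ≤ ∫⁻ y, (∫⁻ x, q (r x) (x - y) * h n x) * g y := by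
      calc _ ≤ ∫⁻ x, h n x * P x := by
            refine lintegral_mono fun x => ?_
            simp only [sq]; gcongr
            exact (indicator_le_self' fun _ _ => zero_le) x |>.trans (min_le_left _ _)
        _ = ∫⁻ x, ∫⁻ y, q (r x) (x - y) * h n x * g y := by
            refine lintegral_congr fun x => ?_
            rw [hP, ← lintegral_const_mul]
            · congr 1; ext y; ring
            · exact (mq.comp (by fun_prop : Measurable fun y => (x, y))).mul hg
        _ = _ := by
            rw [lintegral_lintegral_swap]
            · refine lintegral_congr fun y => ?_
              rw [lintegral_mul_const]
              exact (mq.comp (by fun_prop : Measurable fun x => (x, y))).mul (mh n)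
            · exact ((mq.mul ((mh n).comp measurable_fst)).mul (hg.comp measurable_snd)).aemeasurable
    have h5 := csq (μ := volume) (f := fun y => ∫⁻ x, q (r x) (x - y) * h n x) (Measurable.lintegral_prod_left' (f := fun p : ℝ × ℝ => q (r p.1) (p.1 - p.2) * h n p.1) (mq.mul ((mh n).comp measurable_fst))).aemeasurable hg.aemeasurable
    rcases eq_or_ne (∫⁻ x, h n x ^ 2) 0 with h0 | h0
    · rw [h0]; exact zero_le
    · refine (ENNReal.mul_le_mul_iff_right h0 h3).1 ?_
      rw [← sq]
      refine ((pow_le_pow_left' h4 2).trans h5).trans ((mul_le_mul_left h2 _).trans (Eq.le (by ring)))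
  have lim : ∀ x, Tendsto (fun n => h n x) atTop (𝓝 (P x)) := by
    intro x
    have h1 : Tendsto (fun n : ℕ => min (P x) n) atTop (𝓝 (min (P x) ∞)) := tendsto_const_nhds.min ENNReal.tendsto_nat_nhds_top
    rw [min_eq_left le_top] at h1
    refine h1.congr' ?_
    filter_upwards [eventually_ge_atTop (⌈|x|⌉₊ + ⌈(r x)⁻¹⌉₊)] with n hn
    refine (indicator_of_mem (s := A n) ?_ fun x => min (P x) n).symm
    have : ((⌈|x|⌉₊ + ⌈(r x)⁻¹⌉₊ : ℕ) : ℝ) ≤ n := by exact_mod_cast hn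
    push_cast at this
    exact ⟨by linarith [Nat.le_ceil |x|, Nat.cast_nonneg (α := ℝ) ⌈(r x)⁻¹⌉₊], by linarith [Nat.le_ceil (r x)⁻¹, Nat.cast_nonneg (α := ℝ) ⌈|x|⌉₊]⟩
  calc _ = ∫⁻ x, liminf (fun n => h n x ^ 2) atTop := lintegral_congr fun x => (((ENNReal.continuous_pow 2).tendsto _).comp (lim x)).liminf_eq.symm
    _ ≤ liminf (fun n => ∫⁻ x, h n x ^ 2) atTop := lintegral_liminf_le fun n => (mh n).pow_const 2
    _ ≤ _ := liminf_le_of_le (by isBoundedDefault) fun b hb => by obtain ⟨n, hn⟩ := hb.exists; exact hn.trans (key n)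

lemma avg {v : ℝ → ℂ} (hv : Measurable v) {k : ℝ → ℝ → ℂ} {D : ℝ≥0∞} (hD : D ≠ ∞) (hk : ∀ x t, ‖k x t‖ₑ ≤ D * q (r x) t) :
    ∫⁻ x, ‖∫ t, v (x - t) * k x t‖ₑ ^ 2 ≤ D ^ 2 * 1024 * ∫⁻ x, ‖v x‖ₑ ^ 2 := by
  rw [mul_assoc, ← lintegral_const_mul' _ _ (by finiteness)]
  have := HL hr r0 (g := fun y => D * ‖v y‖ₑ) (hv.enorm.const_mul D)
  simp_rw [mul_pow] at this
  rw [lintegral_const_mul' _ _ (by finiteness), mul_left_comm, ← lintegral_const_mul' (1024) _ (by finiteness)] at this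
  refine le_trans (lintegral_mono fun x => pow_le_pow_left' ?_ 2) this
  refine (enorm_integral_le_lintegral_enorm _).trans ?_
  rw [← lintegral_sub_left_eq_self _ x]
  refine lintegral_mono fun y => ?_
  rw [enorm_mul, sub_sub_cancel, mul_comm, mul_left_comm, ← mul_assoc]
  gcongr
  exact hk x _
end
end

section
open MeasureTheory Filter Set
open scoped ENNReal Topology

noncomputable def op (v : ℝ → ℂ) (k : ℝ → ℝ → ℂ) (x : ℝ) : ℂ := ∫ t, v (x - t) * k x t
def Bd (k : ℝ → ℝ → ℂ) (C : ℝ≥0∞) : Prop := ∀ v, Nice v → eLpNorm (op v k) 2 volume ≤ C * eLpNorm v 2 volume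
structure KM (k : ℝ → ℝ → ℂ) : Prop where
  m : Measurable (Function.uncurry k)
  b : ∃ B : ℝ, ∀ x t, ‖k x t‖ ≤ B

lemma l2sq {X : Type*} [MeasurableSpace X] {μ : Measure X} (f : X → ℂ) : eLpNorm f 2 μ ^ 2 = ∫⁻ x, ‖f x‖ₑ ^ 2 ∂μ := by
  simpa using eLpNorm_nnreal_pow_eq_lintegral (f := f) (μ := μ) (p := 2) two_ne_zero

lemma l2iff {X Y : Type*} [MeasurableSpace X] [MeasurableSpace Y] {μ : Measure X} {ν : Measure Y} (f : X → ℂ) (g : Y → ℂ) (C : ℝ≥0∞) : 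
    eLpNorm f 2 μ ≤ C * eLpNorm g 2 ν ↔ ∫⁻ x, ‖f x‖ₑ ^ 2 ∂μ ≤ C ^ 2 * ∫⁻ x, ‖g x‖ₑ ^ 2 ∂ν := by
  rw [← l2sq, ← l2sq, ← mul_pow, ENNReal.pow_le_pow_left_iff two_ne_zero]

lemma KM.int {k : ℝ → ℝ → ℂ} (h : KM k) {v : ℝ → ℂ} (hv : Nice v) (x : ℝ) : Integrable fun t => v (x - t) * k x t := by
  obtain ⟨B, hB⟩ := h.b
  exact (hv.int.comp_sub_left x).mul_bdd (c := B) (h.m.comp measurable_prodMk_left).aestronglyMeasurable (ae_of_all _ (hB x))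
lemma KM.op {k : ℝ → ℝ → ℂ} (h : KM k) {v : ℝ → ℂ} (hv : Nice v) : Measurable (op v k) :=
  (StronglyMeasurable.integral_prod_right' (f := fun p : ℝ × ℝ => v (p.1 - p.2) * k p.1 p.2) ((hv.meas.comp (by fun_prop)).mul h.m).stronglyMeasurable).measurable
lemma KM.sum {ι : Type*} {k : ι → ℝ → ℝ → ℂ} {s : Finset ι} (h : ∀ i ∈ s, KM (k i)) : KM fun x t => ∑ i ∈ s, k i x t := by
  refine ⟨Finset.measurable_fun_sum _ fun i hi => (h i hi).m, ?_⟩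
  choose! B hB using fun i hi => (h i hi).b
  exact ⟨∑ i ∈ s, B i, fun x t => (norm_sum_le _ _).trans (Finset.sum_le_sum fun i hi => hB i hi x t)⟩
lemma Bd.sum {ι : Type*} {k : ι → ℝ → ℝ → ℂ} {C : ι → ℝ≥0∞} {s : Finset ι} (h : ∀ i ∈ s, KM (k i)) (h' : ∀ i ∈ s, Bd (k i) (C i)) :
    Bd (fun x t => ∑ i ∈ s, k i x t) (∑ i ∈ s, C i) := by
  intro v hv
  have : op v (fun x t => ∑ i ∈ s, k i x t) = ∑ i ∈ s, op v (k i) := by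
    ext x; simp only [_root_.op, Finset.mul_sum, Finset.sum_apply]
    exact integral_finsetSum _ fun i hi => (h i hi).int hv x
  rw [this, Finset.sum_mul]
  exact (eLpNorm_sum_le (fun i hi => ((h i hi).op hv).aestronglyMeasurable) (by norm_num)).trans (Finset.sum_le_sum fun i hi => h' i hi v hv)
lemma KM.add {k l : ℝ → ℝ → ℂ} (h : KM k) (h' : KM l) : KM fun x t => k x t + l x t := by
  simpa using KM.sum (k := ![k, l]) (s := .univ) (by simp [Fin.forall_fin_two, h, h'])
lemma Bd.add {k l : ℝ → ℝ → ℂ} {C D : ℝ≥0∞} (h : KM k) (h' : KM l) (hk : Bd k C) (hl : Bd l D) : Bd (fun x t => k x t + l x t) (C + D) := by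
  simpa using Bd.sum (k := ![k, l]) (C := ![C, D]) (s := .univ) (by simp [Fin.forall_fin_two, h, h']) (by simp [Fin.forall_fin_two, hk, hl])
lemma Bd.q {k : ℝ → ℝ → ℂ} {r : ℝ → ℝ} (hr : Measurable r) (r0 : ∀ x, 0 < r x) {D : ℝ≥0∞} (hD : D ≠ ∞) (hk : ∀ x t, ‖k x t‖ₑ ≤ D * q (r x) t) : Bd k (D * 32) := by
  intro v hv
  rw [l2iff, mul_pow]
  exact (avg hr r0 hv.meas hD hk).trans_eq (by norm_num)

open Classical in
lemma hilb : ∃ C : ℝ≥0∞, C ≠ ∞ ∧ ∀ (n : ℕ) (N ρ : ℝ → ℝ) (A : ℝ → Set ℝ), Measurable N → Measurable ρ → (∀ x, ((2:ℝ) ^ (6 * n))⁻¹ ≤ ρ x ∧ ρ x ≤ 2 ^ (6 * n)) →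
    MeasurableSet {p : ℝ × ℝ | p.2 ∈ A p.1} → (∀ x, ∀ t ∈ A x, ρ x ≤ |t| ∧ |t| < 2 ^ (6 * n)) → (∀ x, ∀ t ∉ A x, |t| ≤ ρ x ∨ 2 ^ (6 * n) ≤ |t|) →
    Bd (fun x t => if t ∈ A x then ee (N x * t) / t else 0) C := by
  obtain ⟨E, A0, c, hA0, c0, cE, -, dE, lE, hE⟩ := carl
  refine ⟨ENNReal.ofReal √A0 + (ENNReal.ofReal (9 * c) * 32 + ENNReal.ofReal (9 * c) * 32), by finiteness, fun n N ρ A hN hρ bρ mA h1 h2 => ?_⟩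
  set b : ℝ := 2 ^ (6 * n) with hb
  have b0 : 0 < b := by positivity
  have ρ0 : ∀ x, 0 < ρ x := fun x => lt_of_lt_of_le (by positivity) (bρ x).1
  set κ : ℝ → ℤ := fun x => ⌊Real.logb 2 (ρ x)⌋ with hκ
  have mκ : Measurable κ := Int.measurable_floor.comp ((Real.measurable_log.comp hρ).div_const _)
  have mκ2 : Measurable fun x => (2:ℝ) ^ κ x := (measurable_of_countable fun z : ℤ => (2:ℝ) ^ z).comp mκ
  have κ1 : ∀ x, (2:ℝ) ^ κ x ≤ ρ x := fun x => by
    rw [← Real.rpow_intCast, ← Real.le_logb_iff_rpow_le (by norm_num) (ρ0 x)]; exact Int.floor_le _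
  have κ2 : ∀ x, ρ x ≤ 2 * (2:ℝ) ^ κ x := fun x => by
    rw [mul_comm, ← zpow_add_one₀ two_ne_zero, ← Real.rpow_intCast, ← Real.logb_le_iff_le_rpow (by norm_num) (ρ0 x)]; push_cast; exact (Int.lt_floor_add_one _).le
  have κ3 : ∀ x, -(6 * n) ≤ κ x ∧ κ x ≤ 6 * n := fun x => by
    constructor
    · rw [hκ, Int.le_floor, Real.le_logb_iff_rpow_le (by norm_num) (ρ0 x), Real.rpow_intCast, zpow_neg]; exact (bρ x).1
    · have := (κ1 x).trans (bρ x).2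
      rw [hb, ← zpow_natCast, zpow_le_zpow_iff_right₀ (by norm_num)] at this
      exact_mod_cast this
  have me := continuous_ee.measurable; have mE := cE.measurable
  have bq : ∀ {R t : ℝ} {P : Prop} [Decidable P] (x : ℝ), 0 < R → (P → |t| ≤ 2 * R) → (¬ P → R ≤ |t|) → ‖((if P then 1 else 0) - E (t / R)) * ee x / t‖ ≤ 9 * c * (R⁻¹ * ((1 + |t| / R) ^ 2)⁻¹) := by
    intro R t P _ x hR h1 h2
    rw [norm_div, norm_mul, norm_ee, mul_one, Complex.norm_real]
    refine div_le_of_le_mul₀ (norm_nonneg _) (by positivity) ?_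
    have et : |t / R| = |t| / R := by rw [abs_div, abs_of_pos hR]
    by_cases h : P
    · rw [if_pos h, norm_sub_rev]
      refine (lE _).trans ?_
      have : |t| / R ≤ 2 := (div_le_iff₀ hR).2 (h1 h)
      have h3 : (1 + |t| / R) ^ 2 ≤ 9 := by nlinarith [show 0 ≤ |t| / R by positivity]
      rw [et, Real.norm_eq_abs]
      have : c * (|t| / R) * 1 ≤ c * (|t| / R) * (9 * ((1 + |t| / R) ^ 2)⁻¹) := by gcongr; rw [← div_eq_mul_inv, le_div_iff₀ (by positivity)]; linarith
      refine (mul_one _).symm.le.trans (this.trans (Eq.le ?_)); ring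
    · rw [if_neg h, zero_sub, norm_neg]
      refine (dE _).trans ?_
      have : 1 ≤ |t| / R := (one_le_div hR).2 (h2 h)
      rw [et, Real.norm_eq_abs]
      calc _ ≤ c * ((1 + |t| / R) ^ 2)⁻¹ := by gcongr ?_ * ?_; exact pow_inv_mono (by positivity) (by norm_num)
        _ ≤ c * ((1 + |t| / R) ^ 2)⁻¹ * (9 * (|t| / R)) := le_mul_of_one_le_right (by positivity) (by linarith)
        _ = _ := by ring
  have bq' : ∀ {R t : ℝ} {P : Prop} [Decidable P] (x : ℝ), 0 < R → (P → |t| ≤ 2 * R) → (¬ P → R ≤ |t|) → ‖((if P then 1 else 0) - E (t / R)) * ee x / t‖ₑ ≤ ENNReal.ofReal (9 * c) * q R t := by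
    intro R t P _ x hR h1 h2
    rw [q, ← ENNReal.ofReal_mul (by positivity)]; exact enorm_le_ofReal (bq x hR h1 h2)
  have bq3 : ∀ {R t : ℝ} {P : Prop} [Decidable P] (x : ℝ), b⁻¹ ≤ 2 * R → 0 < R → (P → |t| ≤ 2 * R) → (¬ P → R ≤ |t|) → ‖((if P then 1 else 0) - E (t / R)) * ee x / t‖ ≤ 9 * c * (2 * b) := by
    intro R t P _ x h hR h1 h2
    refine (bq x hR h1 h2).trans ?_
    refine mul_le_mul_of_nonneg_left ?_ (by positivity)
    refine (mul_le_of_le_one_right (by positivity) (inv_le_one_of_one_le₀ (one_le_pow₀ (le_add_of_nonneg_right (by positivity : 0 ≤ |t| / R))))).trans ?_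
    rw [inv_le_comm₀ hR (by positivity), mul_inv]; linarith
  have b1 : (1:ℝ) ≤ b := by rw [hb]; exact one_le_pow₀ (by norm_num)
  have bb : b⁻¹ ≤ 2 * b := by linarith [inv_le_one_of_one_le₀ b1]
  clear_value b κ
  set k1 : ℝ → ℝ → ℂ := fun x t => ((if |t| < b then 1 else 0) - E (t / b)) * ee (N x * t) / t with hk1
  set k2 : ℝ → ℝ → ℂ := fun x t => -(((if |t| < b ∧ t ∉ A x then 1 else 0) - E (t / 2 ^ κ x)) * ee (N x * t) / t) with hk2
  set k3 : ℝ → ℝ → ℂ := fun x t => ee (N x * t) * ((E (t / b) - E (t / (2:ℝ) ^ κ x)) / t) with hk3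
  have i1 : ∀ x t, |t| < b ∧ t ∉ A x → |t| ≤ 2 * 2 ^ κ x := fun x t h => ((h2 x t h.2).resolve_right (by linarith [h.1])).trans (κ2 x)
  have i2 : ∀ x t, ¬ (|t| < b ∧ t ∉ A x) → 2 ^ κ x ≤ |t| := fun x t h => (κ1 x).trans (by
    by_cases ht : t ∈ A x
    · exact (h1 x t ht).1
    · exact (bρ x).2.trans (not_lt.1 fun h' => h ⟨h', ht⟩))
  have j1 : ∀ t, |t| < b → |t| ≤ 2 * b := fun t _ => by linarith
  have p0 : ∀ x, (0:ℝ) < 2 ^ κ x := fun x => by positivity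
  have mt : MeasurableSet {p : ℝ × ℝ | |p.2| < b} := measurableSet_lt (by fun_prop) measurable_const
  have e : ∀ x t, (if t ∈ A x then ee (N x * t) / t else 0) = k1 x t + (k2 x t + k3 x t) := fun x t => by
    simp only [hk1, hk2, hk3]
    by_cases h : t ∈ A x
    · simp [h, (h1 x t h).2]; ring
    · by_cases h' : |t| < b <;> simp [h, h'] <;> ring
  have K1 : KM k1 := ⟨by
    simp only [hk1, Function.uncurry_def]
    exact (((Measurable.ite mt measurable_const measurable_const).sub (by fun_prop)).mul (by fun_prop)).div (by fun_prop), 9 * c * (2 * b), fun x t => bq3 _ bb b0 (j1 t) not_lt.1⟩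
  have K2 : KM k2 := ⟨by
    simp only [hk2, Function.uncurry_def]
    exact ((((Measurable.ite (mt.inter mA.compl) measurable_const measurable_const).sub (by fun_prop)).mul (by fun_prop)).div (by fun_prop)).neg, 9 * c * (2 * b), fun x t => by
      simp only [hk2, norm_neg]; exact bq3 _ ((bρ x).1.trans (κ2 x)) (p0 x) (i1 x t) (i2 x t)⟩
  have K3 : KM k3 := ⟨by simp only [hk3, Function.uncurry_def]; fun_prop, b + 9 * c * (2 * b) + 9 * c * (2 * b), fun x t => by
    obtain ⟨B1, hB1⟩ := K1.b
    rw [show k3 x t = (if t ∈ A x then ee (N x * t) / t else 0) - k1 x t - k2 x t by rw [e]; ring]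
    refine (norm_sub_le _ _).trans (add_le_add ((norm_sub_le _ _).trans (add_le_add ?_ (bq3 _ bb b0 (j1 t) not_lt.1))) (by
      simp only [hk2, norm_neg]; exact bq3 _ ((bρ x).1.trans (κ2 x)) (p0 x) (i1 x t) (i2 x t)))
    split_ifs with h
    · have := (bρ x).1.trans (h1 x t h).1
      rw [norm_div, norm_ee, Complex.norm_real, one_div, Real.norm_eq_abs]
      exact inv_le_of_inv_le₀ b0 this
    · simpa using b0.le⟩
  simp_rw [e]
  rw [add_left_comm, add_comm (ENNReal.ofReal √A0)]
  refine Bd.add K1 (K2.add K3) (Bd.q measurable_const (fun _ => b0) (by finiteness) fun x t => bq' _ b0 (j1 t) not_lt.1) (Bd.add K2 K3 (Bd.q mκ2 p0 (by finiteness) fun x t => ?_) fun v hv => ?_)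
  · simp only [hk2, enorm_neg]; exact bq' _ (p0 x) (i1 x t) (i2 x t)
  · rw [l2iff, ← ENNReal.ofReal_pow (Real.sqrt_nonneg _), Real.sq_sqrt hA0.le]
    have := hE v N κ n hv hN mκ κ3
    rw [← hb] at this; exact this
end

section
open MeasureTheory Filter Set
open scoped ENNReal Topology ComplexConjugate

structure Band (K : ℝ → ℝ → ℂ) : Prop where
  m : Measurable (Function.uncurry K)
  b : ∃ B b : ℝ, 0 ≤ B ∧ ∀ x y, ‖K x y‖ ≤ B ∧ (b < |x - y| → K x y = 0)

lemma Band.int {K : ℝ → ℝ → ℂ} (h : Band K) {f w : ℝ → ℂ} (hf : Integrable f) (mf : Measurable f) (hw : Measurable w) {W : ℝ} (bw : ∀ y, ‖w y‖ ≤ W) :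
    Integrable (fun p : ℝ × ℝ => f p.2 * (K p.2 p.1 * w p.1)) (volume.prod volume) := by
  obtain ⟨B, b, B0, hb⟩ := h.b
  have W0 := (norm_nonneg _).trans (bw 0)
  have i : Integrable ((Icc (-b) b).indicator fun _ => B * W) := (integrable_indicator_iff measurableSet_Icc).2 (integrableOn_const (by simp))
  refine (Integrable.convolution_integrand (ContinuousLinearMap.mul ℝ ℝ) hf.norm i).mono' ((mf.comp measurable_snd).mul ((h.m.comp measurable_swap).mul (hw.comp measurable_fst))).aestronglyMeasurable (ae_of_all _ fun p => ?_)
  rw [norm_mul, norm_mul, ContinuousLinearMap.mul_apply']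
  refine mul_le_mul_of_nonneg_left ?_ (norm_nonneg _)
  by_cases hp : p.1 - p.2 ∈ Icc (-b) b
  · rw [indicator_of_mem hp]; exact mul_le_mul (hb _ _).1 (bw _) (norm_nonneg _) B0
  · rw [(hb p.2 p.1).2 (by rw [abs_sub_comm]; by_contra h; exact hp (abs_le.1 (not_lt.1 h))), indicator_of_notMem hp]; simp

lemma Band.fub {K : ℝ → ℝ → ℂ} (h : Band K) {f w : ℝ → ℂ} (hf : Nice f) (hw : Measurable w) {W : ℝ} (bw : ∀ y, ‖w y‖ ≤ W) :
    ∫ y, (∫ x, f x * K x y) * w y = ∫ x, f x * ∫ y, K x y * w y := by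
  simp_rw [← integral_mul_const, ← integral_const_mul, mul_assoc]
  exact integral_integral_swap (f := fun y x => f x * (K x y * w y)) (h.int hf.int hf.meas hw bw)

lemma Band.nice {K : ℝ → ℝ → ℂ} (h : Band K) {f : ℝ → ℂ} (hf : Nice f) : Nice fun y => ∫ x, f x * K x y := by
  have i := h.int hf.int hf.meas (w := 1) measurable_const (W := 1) (by simp)
  simp only [Pi.one_apply, mul_one] at i
  obtain ⟨B, b, B0, hb⟩ := h.b
  refine ⟨(StronglyMeasurable.integral_prod_right' (f := fun p : ℝ × ℝ => f p.2 * K p.2 p.1) ((hf.meas.comp measurable_snd).mul (h.m.comp measurable_swap)).stronglyMeasurable).measurable,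
    ⟨(∫ x, ‖f x‖) * B, mul_nonneg (integral_nonneg fun _ => norm_nonneg _) B0, fun y => ?_⟩, i.integral_prod_left⟩
  rw [← integral_mul_const]
  refine norm_integral_le_of_norm_le (hf.int.norm.mul_const _) (ae_of_all _ fun x => ?_)
  rw [norm_mul]; exact mul_le_mul_of_nonneg_left (hb x y).1 (norm_nonneg _)

lemma Nice.conj {f : ℝ → ℂ} (hf : Nice f) : Nice fun x => conj (f x) :=
  ⟨Complex.continuous_conj.measurable.comp hf.meas, by simpa only [RCLike.norm_conj] using hf.bdd, Complex.conjLIE.toContinuousLinearEquiv.integrable_comp_iff.2 hf.int⟩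

lemma Nice.nsq {f : ℝ → ℂ} (hf : Nice f) : ‖∫ x, conj (f x) * f x‖ₑ = ∫⁻ x, ‖f x‖ₑ ^ 2 := by
  simp_rw [Complex.conj_mul', ← Complex.ofReal_pow]
  rw [integral_complex_ofReal, ← ofReal_norm, Complex.norm_real, Real.norm_of_nonneg (integral_nonneg fun _ => by positivity), ofReal_integral_eq_lintegral_ofReal hf.sq (ae_of_all _ fun _ => by positivity)]
  simp_rw [ENNReal.ofReal_pow (norm_nonneg _), ofReal_norm]

lemma tts {k : ℝ → ℝ → ℂ} (hk : KM k) {b : ℝ} (hb : ∀ x t, b < |t| → k x t = 0) {s : ℝ → ℝ} (hs : Measurable s) (s0 : ∀ x, 0 < s x) {a : ℝ≥0∞} (ha : a ≠ ∞)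
    (h : ∀ x z, ‖∫ y, k x (x - y) * conj (k z (z - y))‖ₑ ≤ a * (q (s x) (x - z) + q (s z) (x - z))) {v : ℝ → ℂ} (hv : Nice v) :
    ∫⁻ x, ‖op v k x‖ₑ ^ 2 ≤ 64 * a * ∫⁻ x, ‖v x‖ₑ ^ 2 := by
  obtain ⟨B, hB⟩ := hk.b
  have B0 := (norm_nonneg _).trans (hB 0 0)
  have mc := Complex.continuous_conj.measurable
  have mk : Measurable fun p : ℝ × ℝ => k p.1 (p.1 - p.2) := hk.m.comp (by fun_prop : Measurable fun p : ℝ × ℝ => (p.1, p.1 - p.2))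
  have b1 : Band fun x y => k x (x - y) := ⟨mk, B, b, B0, fun x y => ⟨hB _ _, hb _ _⟩⟩
  have b2 : Band fun y x => k x (x - y) := ⟨mk.comp measurable_swap, B, b, B0, fun x y => ⟨hB _ _, fun h => hb _ _ (by rwa [abs_sub_comm])⟩⟩
  have b3 : Band fun x y => conj (k x (x - y)) := ⟨mc.comp mk, B, b, B0, fun x y => ⟨by rw [RCLike.norm_conj]; exact hB _ _, fun h => by rw [hb _ _ h, map_zero]⟩⟩
  have eg : op v k = fun x => ∫ y, v y * k x (x - y) := by
    ext x; rw [op, ← integral_sub_left_eq_self _ _ x]; simp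
  have ng := b2.nice hv
  rw [← eg] at ng
  set g := op v k
  have nG := b1.nice ng.conj
  set G := fun y => ∫ x, conj (g x) * k x (x - y) with hG
  obtain ⟨W, W0, hW⟩ := nG.bdd
  obtain ⟨V, V0, hV⟩ := hv.bdd
  have e1 : ∫⁻ x, ‖g x‖ₑ ^ 2 = ‖∫ y, G y * v y‖ₑ := by
    rw [← ng.nsq, b1.fub ng.conj hv.meas hV, eg]; simp_rw [mul_comm (v _)]
  have cG : ∀ y, conj (G y) = ∫ z, g z * conj (k z (z - y)) := fun y => by
    rw [hG, ← integral_conj]; simp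
  have e2 : ∫⁻ x, ‖G x‖ₑ ^ 2 = ‖∫ x, conj (g x) * ∫ z, g z * ∫ y, k x (x - y) * conj (k z (z - y))‖ₑ := by
    rw [← nG.nsq]; simp_rw [mul_comm (conj (G _))]
    rw [b1.fub ng.conj (w := fun y => conj (G y)) (mc.comp nG.meas) (W := W) fun y => by rw [RCLike.norm_conj]; exact hW y]
    congr 2; ext x; congr 1; simp_rw [cG, mul_comm (k x _)]
    exact b3.fub ng (mk.comp measurable_prodMk_left) fun y => hB x _
  have mq := meas_q hs
  have mg : Measurable fun x => ‖g x‖ₑ := ng.meas.enorm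
  set D := ∫⁻ x, ‖g x‖ₑ ^ 2
  have Df : D ≠ ∞ := by rw [e1]; finiteness
  have m2 : Measurable fun p : ℝ × ℝ => q (s p.1) (p.1 - p.2) * ‖g p.2‖ₑ := mq.mul (mg.comp measurable_snd)
  set P := fun x => ∫⁻ z, q (s x) (x - z) * ‖g z‖ₑ with hP
  have mP : Measurable P := Measurable.lintegral_prod_right' m2
  have e3 : ∫⁻ x, ‖G x‖ₑ ^ 2 ≤ 2 * a * ∫⁻ x, ‖g x‖ₑ * P x := by
    have m3 : Measurable fun p : ℝ × ℝ => ‖g p.1‖ₑ * (q (s p.1) (p.1 - p.2) * ‖g p.2‖ₑ) := (mg.comp measurable_fst).mul m2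
    have e4 : ∫⁻ x, ‖g x‖ₑ * P x = ∫⁻ x, ∫⁻ z, ‖g x‖ₑ * (q (s x) (x - z) * ‖g z‖ₑ) :=
      lintegral_congr fun x => (lintegral_const_mul _ (m2.comp measurable_prodMk_left)).symm
    have e5 := e4.trans (lintegral_lintegral_swap m3.aemeasurable)
    rw [e2]
    calc _ ≤ ∫⁻ x, ∫⁻ z, (a * (‖g x‖ₑ * (q (s x) (x - z) * ‖g z‖ₑ)) + a * (‖g z‖ₑ * (q (s z) (z - x) * ‖g x‖ₑ))) := by
          refine (enorm_integral_le_lintegral_enorm _).trans (lintegral_mono fun x => ?_)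
          rw [enorm_mul, ← ofReal_norm, RCLike.norm_conj, ofReal_norm]
          refine (mul_le_mul_right (enorm_integral_le_lintegral_enorm _) _).trans ?_
          rw [← lintegral_const_mul' _ _ (by finiteness)]
          refine lintegral_mono fun z => ?_
          rw [enorm_mul]
          refine (mul_le_mul_right (mul_le_mul_right (h x z) _) _).trans_eq ?_
          simp only [q, abs_sub_comm z]; ring
      _ = _ := by
          have e6 : ∀ x, ∫⁻ z, (a * (‖g x‖ₑ * (q (s x) (x - z) * ‖g z‖ₑ)) + a * (‖g z‖ₑ * (q (s z) (z - x) * ‖g x‖ₑ))) = a * (∫⁻ z, ‖g x‖ₑ * (q (s x) (x - z) * ‖g z‖ₑ)) + a * ∫⁻ z, ‖g z‖ₑ * (q (s z) (z - x) * ‖g x‖ₑ) := fun x => by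
            rw [lintegral_add_left, lintegral_const_mul' a _ ha, lintegral_const_mul' a _ ha]
            exact (m3.comp measurable_prodMk_left).const_mul a
          simp_rw [e6]
          rw [lintegral_add_left (Measurable.const_mul (Measurable.lintegral_prod_right' m3) a), lintegral_const_mul' a _ ha, lintegral_const_mul' a _ ha, ← e4, ← e5]; ring
  have c1 : D ^ 2 ≤ (∫⁻ x, ‖G x‖ₑ ^ 2) * ∫⁻ x, ‖v x‖ₑ ^ 2 := by
    refine le_trans ?_ (csq nG.meas.enorm.aemeasurable hv.meas.enorm.aemeasurable)
    rw [e1]; gcongr; simp_rw [← enorm_mul]; exact enorm_integral_le_lintegral_enorm _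
  have c2 : (∫⁻ x, ‖g x‖ₑ * P x) ≤ 32 * D := by
    rw [← ENNReal.pow_le_pow_left_iff two_ne_zero]
    refine (csq mg.aemeasurable mP.aemeasurable).trans ((mul_le_mul_right (HL hs s0 mg) _).trans_eq ?_)
    change D * (1024 * D) = _; ring
  rcases eq_or_ne D 0 with h0 | h0
  · rw [h0]; exact zero_le
  · refine (ENNReal.mul_le_mul_iff_right h0 Df).1 (le_of_eq_of_le (sq D).symm (c1.trans ((mul_le_mul_left (e3.trans (mul_le_mul_right c2 _)) _).trans_eq ?_)))
    ring
end

section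
open MeasureTheory Filter Set
open scoped ENNReal Topology ComplexConjugate

lemma ibp {α β W m : ℝ} (ab : α ≤ β) (m0 : 0 < m) {Φ D D' w w' b b' : ℝ → ℝ} (mΦ : Measurable Φ) (mw : Measurable w)
    (h : ∀ t ∈ Icc α β, HasDerivAt Φ (D t) t ∧ HasDerivAt D (D' t) t ∧ HasDerivAt w (w' t) t ∧ HasDerivAt b (b' t) t ∧ |w t| ≤ W ∧ W * (m ^ 2 / (D t ^ 2 + m ^ 2)) + |w' t| / m + W * |D' t| / m ^ 2 ≤ b' t) :
    ‖∫ t in α..β, w t * ee (Φ t)‖ ≤ 2 * W / m + (b β - b α) := by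
  set G : ℝ → ℝ := fun t => D t / (D t ^ 2 + m ^ 2) with hG
  set F : ℝ → ℂ := fun t => ((w t * G t : ℝ) : ℂ) * (ee (Φ t) / (2 * Real.pi * Complex.I)) with hF
  set G' : ℝ → ℝ := fun t => D' t * (m ^ 2 - D t ^ 2) / (D t ^ 2 + m ^ 2) ^ 2 with hG'
  have pp : ∀ t, 0 < D t ^ 2 + m ^ 2 := fun t => by positivity
  have n2 : ‖(2 * Real.pi * Complex.I : ℂ)‖ = 2 * Real.pi := by simp [Real.pi_pos.le]
  have z2 : (2 * Real.pi * Complex.I : ℂ) ≠ 0 := by simp [Real.pi_ne_zero]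
  have n1 : ∀ x, ‖ee x / (2 * Real.pi * Complex.I)‖ ≤ 1 := fun x => by
    rw [norm_div, norm_ee, n2, div_le_one (by positivity)]; linarith [Real.pi_gt_three]
  have gb : ∀ t, |G t| ≤ 1 / m := fun t => by
    rw [hG, abs_div, abs_of_pos (pp t), div_le_div_iff₀ (pp t) m0]; nlinarith [sq_nonneg (|D t| - m), sq_abs (D t), abs_nonneg (D t)]
  have gb' : ∀ t, |G' t| ≤ |D' t| / m ^ 2 := fun t => by
    rw [hG', abs_div, abs_mul, abs_of_pos (pow_pos (pp t) 2), mul_div_assoc, div_eq_mul_inv |D' t|]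
    refine mul_le_mul_of_nonneg_left ?_ (abs_nonneg _)
    rw [div_le_iff₀ (by have := pp t; positivity), ← div_eq_inv_mul, le_div_iff₀ (by positivity)]
    have : |m ^ 2 - D t ^ 2| ≤ D t ^ 2 + m ^ 2 := abs_le.2 ⟨by nlinarith, by nlinarith⟩
    nlinarith [sq_nonneg (D t), sq_nonneg m]
  have dF : ∀ t ∈ Icc α β, HasDerivAt F (w t * ee (Φ t) * (D t * G t : ℝ) + ((w' t * G t + w t * G' t : ℝ) : ℂ) * (ee (Φ t) / (2 * Real.pi * Complex.I))) t := fun t ht => by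
    obtain ⟨h1, h2, h3, -⟩ := h t ht
    have hg : HasDerivAt G (G' t) t := (h2.div ((h2.pow 2).add_const (m ^ 2)) (pp t).ne').congr_deriv (by simp only [hG']; congr 1; simp only [Pi.pow_apply]; push_cast; ring)
    refine ((h3.mul hg).ofReal_comp.mul (((hasDerivAt_ee (Φ t)).scomp t h1).div_const _)).congr_deriv ?_
    simp only [Complex.real_smul, Function.comp_apply, Pi.mul_apply]; push_cast; field_simp; ring
  have ci : ∀ t ∈ Icc α β, ContinuousAt (fun t => w t * ee (Φ t)) t := fun t ht =>
    (Complex.continuous_ofReal.continuousAt.comp (h t ht).2.2.1.continuousAt).mul (continuous_ee.continuousAt.comp (h t ht).1.continuousAt)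
  have co : ContinuousOn (fun t => w t * ee (Φ t)) (Icc α β) := fun t ht => (ci t ht).continuousWithinAt
  have mi : Measurable fun t => (w t : ℂ) * ee (Φ t) := (Complex.measurable_ofReal.comp mw).mul (continuous_ee.measurable.comp mΦ)
  have ii : IntervalIntegrable (fun t => w t * ee (Φ t)) volume α β := co.intervalIntegrable_of_Icc ab
  have Fb : ∀ t ∈ Icc α β, ‖F t‖ ≤ W / m := fun t ht => by
    rw [hF, norm_mul, Complex.norm_real, Real.norm_eq_abs, abs_mul, div_eq_mul_one_div W]
    have := (h t ht).2.2.2.2.1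
    exact (mul_le_of_le_one_right (by positivity) (n1 _)).trans (mul_le_mul this (gb t) (abs_nonneg _) ((abs_nonneg _).trans this))
  have key := image_norm_le_of_norm_deriv_right_le_deriv_boundary' (f := fun t => (∫ s in α..t, w s * ee (Φ s)) - F t) (a := α) (b := β)
    (f' := fun t => w t * ee (Φ t) - (w t * ee (Φ t) * (D t * G t : ℝ) + ((w' t * G t + w t * G' t : ℝ) : ℂ) * (ee (Φ t) / (2 * Real.pi * Complex.I)))) (B := fun t => W / m + (b t - b α)) (B' := b')
    ((intervalIntegral.continuousOn_primitive_interval' ii left_mem_uIcc |>.mono (by rw [uIcc_of_le ab])).sub fun t ht => (dF t ht).continuousAt.continuousWithinAt)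
    (fun t ht => (intervalIntegral.integral_hasDerivWithinAt_right (t := Ioi t) (ii.mono_set (by rw [uIcc_of_le ab, uIcc_of_le ht.1]; exact Icc_subset_Icc_right ht.2.le))
      mi.stronglyMeasurable.stronglyMeasurableAtFilter (ci t ⟨ht.1, ht.2.le⟩).continuousWithinAt).sub (dF t ⟨ht.1, ht.2.le⟩).hasDerivWithinAt)
    (by simpa using Fb α (left_mem_Icc.2 ab)) (fun t ht => (((h t ht).2.2.2.1.continuousAt.sub continuousAt_const).const_add _).continuousWithinAt)
    (fun t ht => (((h t ⟨ht.1, ht.2.le⟩).2.2.2.1.sub_const _).const_add _).hasDerivWithinAt) (fun t ht => by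
      obtain ⟨-, -, -, -, hw, hb⟩ := h t ⟨ht.1, ht.2.le⟩
      refine le_trans ?_ hb
      rw [show w t * ee (Φ t) - (w t * ee (Φ t) * (D t * G t : ℝ) + ((w' t * G t + w t * G' t : ℝ) : ℂ) * (ee (Φ t) / (2 * Real.pi * Complex.I))) = ((w t * (m ^ 2 / (D t ^ 2 + m ^ 2)) : ℝ) : ℂ) * ee (Φ t) - ((w' t * G t + w t * G' t : ℝ) : ℂ) * (ee (Φ t) / (2 * Real.pi * Complex.I)) by
        have : m ^ 2 / (D t ^ 2 + m ^ 2) = 1 - D t * G t := by rw [hG]; have := (pp t).ne'; field_simp; ring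
        rw [this]; push_cast; ring]
      refine (norm_sub_le _ _).trans ?_
      rw [norm_mul, norm_ee, mul_one, norm_mul, Complex.norm_real, Complex.norm_real, Real.norm_eq_abs, Real.norm_eq_abs, add_assoc]
      refine add_le_add ?_ ((mul_le_of_le_one_right (abs_nonneg _) (n1 _)).trans ((abs_add_le _ _).trans ?_))
      · rw [abs_mul, abs_of_pos (by have := pp t; positivity : 0 < m ^ 2 / (D t ^ 2 + m ^ 2))]
        gcongr
      · rw [abs_mul, abs_mul, div_eq_mul_one_div |w' t|, mul_div_assoc]
        exact add_le_add (mul_le_mul_of_nonneg_left (gb t) (abs_nonneg _)) (mul_le_mul hw (gb' t) (abs_nonneg _) ((abs_nonneg _).trans hw)))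
  have := key (right_mem_Icc.2 ab)
  have h3 := norm_sub_norm_le (∫ s in α..β, w s * ee (Φ s)) (F β)
  have h4 := Fb β (right_mem_Icc.2 ab)
  rw [two_mul, add_div]; linarith
end

section
open MeasureTheory Filter Set
open scoped ENNReal Topology ComplexConjugate

set_option maxHeartbeats 1000000 in
lemma osc {ε Γ : ℝ} (e0 : ε ≠ 0) (e1 : ε ≠ 1) (hΓ : 1 ≤ Γ) : ∃ C : ℝ, 0 < C ∧ ∀ (r r' lam δ h α β ς : ℝ) (Φ A B : ℝ → ℝ), 0 < r' → r' ≤ r → 0 < δ → δ ≤ 1 → lam * δ ^ 4 = 1 → h ≠ 0 → α ≤ β → Measurable Φ → |ς| = 1 →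
    (∀ t ∈ Icc α β, r' ≤ t ∧ t ≤ 2 * r' ∧ r ≤ t + h ∧ t + h ≤ 2 * r ∧ HasDerivAt Φ (ε * (A t - B t)) t ∧ HasDerivAt A ((ε - 1) * A t / (t + h)) t ∧ HasDerivAt B ((ε - 1) * B t / t) t ∧ 
      |A t| ≤ Γ * lam / r ∧ lam / (2 * Γ * r') ≤ |B t| ∧ |B t| ≤ Γ * lam / r' ∧ 0 ≤ ς * (A t / B t)) →
    ‖∫ t in α..β, ((((t + h) * t)⁻¹ : ℝ) : ℂ) * ee (Φ t)‖ ≤ C * (δ ^ 2 / r + δ / |h|) := by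
  set e := |ε| with he
  set f := |ε - 1| with hf
  have e0' : 0 < e := abs_pos.2 e0
  have f0 : 0 < f := abs_pos.2 (sub_ne_zero.2 e1)
  set c := e / (2 * Γ) with hc
  have c0 : 0 < c := by positivity
  set K := 4 / c ^ 2 + 2 + 2 * e * f * Γ with hK
  have K0 : 0 < K := by positivity
  refine ⟨2 + K + 8 / (c * f) * Real.pi, by positivity, fun r r' lam δ h α β ς Φ A B r0' rr d0 d1 hl h0 ab mΦ hς H => ?_⟩
  have r0 : 0 < r := r0'.trans_le rr
  have l0 : 0 < lam := pos_of_mul_pos_left (hl ▸ one_pos) (by positivity)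
  have h0' : 0 < |h| := abs_pos.2 h0
  set m := lam * δ / r' with hm
  have m0 : 0 < m := by positivity
  have hl' : lam⁻¹ = δ ^ 4 := (eq_inv_of_mul_eq_one_right hl).symm
  have im : m⁻¹ = r' * δ ^ 3 := by rw [hm, inv_div, div_eq_mul_inv, mul_inv, hl']; field_simp
  set κ := 8 * δ / (c * f * |h|) with hκ
  have κ0 : 0 < κ := by positivity
  set sg := ς * SignType.sign (-((ε - 1) * h)) with hsg
  set R := fun t => A t / B t with hR
  set u := fun t => c * (R t - 1) / δ with hu
  set W := (r * r')⁻¹ with hW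
  have W0 : 0 < W := by positivity
  clear_value c K m κ sg W e f
  have key := ibp (α := α) (β := β) (W := W) (m := m) ab m0 (Φ := Φ) (D := fun t => ε * (A t - B t)) (D' := fun t => ε * ((ε - 1) * A t / (t + h) - (ε - 1) * B t / t))
    (w := fun t => ((t + h) * t)⁻¹) (w' := fun t => -(t + (t + h)) / ((t + h) * t) ^ 2) (b := fun t => K * δ ^ 2 * W * t + κ * sg * Real.arctan (u t))
    (b' := fun t => K * δ ^ 2 * W + κ * sg * (1 / (1 + u t ^ 2) * (c * (R t * (-((ε - 1) * h)) / (t * (t + h))) / δ))) mΦ (by fun_prop) (fun t ht => by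
      obtain ⟨h1, h2, h3, h4, h5, h6, h7, h8, h9, h10, h11⟩ := H t ht
      have t0 : 0 < t := r0'.trans_le h1
      have th0 : 0 < t + h := r0.trans_le h3
      have B0 : B t ≠ 0 := fun hh => by rw [hh, abs_zero] at h9; exact absurd h9 (not_le.2 (by positivity))
      have hut : u t = c * (R t - 1) / δ := rfl
      refine ⟨h5, (h6.sub h7).const_mul _, ?_, ?_, ?_, ?_⟩
      · exact ((((hasDerivAt_id t).add_const h).mul (hasDerivAt_id t)).inv (mul_pos th0 t0).ne').congr_deriv (by simp)
      · refine (((hasDerivAt_id t).const_mul _).add ((((((h6.div h7 B0).sub_const 1).const_mul c).div_const δ).arctan).const_mul _)).congr_deriv ?_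
        simp only [hu, hR, Pi.div_apply]; field_simp; ring
      · rw [abs_of_pos (by positivity), hW]; gcongr
      · have s1 : |-(t + (t + h)) / ((t + h) * t) ^ 2| / m ≤ 2 * δ ^ 2 * W := by
          rw [neg_div, abs_neg, abs_of_pos (by positivity), div_eq_mul_inv, im, show (t + (t + h)) / ((t + h) * t) ^ 2 = ((t + h)⁻¹ + t⁻¹) * ((t + h) * t)⁻¹ by field_simp]
          have : (t + h)⁻¹ ≤ r'⁻¹ := inv_anti₀ r0' (rr.trans h3)
          calc _ ≤ (r'⁻¹ + r'⁻¹) * W * (r' * δ ^ 2) := by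
                rw [hW]; gcongr ?_ * ?_ * (_ * ?_)
                · exact add_le_add this (inv_anti₀ r0' h1)
                · gcongr
                · exact pow_le_pow_of_le_one d0.le d1 (by norm_num)
            _ = _ := by field_simp; ring
        have s2 : |ε * ((ε - 1) * A t / (t + h) - (ε - 1) * B t / t)| / m ^ 2 ≤ 2 * e * f * Γ * δ ^ 2 := by
          rw [show ε * ((ε - 1) * A t / (t + h) - (ε - 1) * B t / t) = ε * (ε - 1) * (A t / (t + h) - B t / t) by ring, abs_mul, abs_mul, div_eq_mul_inv, ← inv_pow, im, ← he, ← hf]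
          have a1 : |A t / (t + h)| ≤ Γ * lam / r' / r' := by rw [abs_div, abs_of_pos th0]; exact div_le_div₀ (by positivity) (h8.trans (by gcongr)) r0' (rr.trans h3)
          have a2 : |B t / t| ≤ Γ * lam / r' / r' := by rw [abs_div, abs_of_pos t0]; gcongr
          calc _ ≤ e * f * (Γ * lam / r' / r' + Γ * lam / r' / r') * (r' * δ ^ 3) ^ 2 := by gcongr; exact (abs_sub _ _).trans (add_le_add a1 a2)
            _ = 2 * e * f * Γ * δ ^ 2 * (lam * δ ^ 4) := by field_simp; ring
            _ = _ := by rw [hl, mul_one]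
        have s3 : m ^ 2 / ((ε * (A t - B t)) ^ 2 + m ^ 2) ≤ 1 / (1 + u t ^ 2) := by
          have : |m * u t| ≤ |ε * (A t - B t)| := by
            rw [show A t - B t = B t * (R t - 1) by simp only [hR]; field_simp, ← mul_assoc, abs_mul, abs_mul _ (R t - 1), abs_mul ε, ← he, abs_of_pos m0, hut, abs_div, abs_mul c, abs_of_pos c0, abs_of_pos d0]
            calc _ = e * (lam / (2 * Γ * r')) * |R t - 1| := by rw [hm, hc]; field_simp
              _ ≤ _ := by gcongr
          have := sq_le_sq.2 this
          rw [mul_pow] at this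
          rw [div_le_div_iff₀ (by positivity) (by positivity)]; linarith
        have s4 : W * (1 / (1 + u t ^ 2)) ≤ 4 / c ^ 2 * δ ^ 2 * W + κ * sg * (1 / (1 + u t ^ 2) * (c * (R t * (-((ε - 1) * h)) / (t * (t + h))) / δ)) := by
          have a1 : sg * (R t * (-((ε - 1) * h))) = |R t| * (f * |h|) := by
            have h12 : |R t| = ς * R t := by rw [← abs_of_nonneg h11, abs_mul, hς, one_mul]
            have := sign_mul_self (-((ε - 1) * h))
            rw [abs_neg, abs_mul] at this
            rw [hsg, h12, hf, ← this]; ring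
          rw [show κ * sg * (1 / (1 + u t ^ 2) * (c * (R t * (-((ε - 1) * h)) / (t * (t + h))) / δ)) = (1 / (1 + u t ^ 2)) * (8 * |R t| * ((t + h) * t)⁻¹) by
            rw [show κ * sg * (1 / (1 + u t ^ 2) * (c * (R t * (-((ε - 1) * h)) / (t * (t + h))) / δ)) = κ * (1 / (1 + u t ^ 2) * (c * (sg * (R t * (-((ε - 1) * h))) / (t * (t + h))) / δ)) by ring, a1, hκ]; field_simp]
          rcases le_or_gt (1 / 2) |R t - 1| with hh | hh
          · refine le_add_of_le_of_nonneg ?_ (by positivity)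
            rw [mul_comm]; refine mul_le_mul_of_nonneg_right ?_ W0.le
            have : 1 / 4 ≤ (R t - 1) ^ 2 := by have := pow_le_pow_left₀ (by norm_num) hh 2; rw [sq_abs] at this; linarith
            have : c ^ 2 / (4 * δ ^ 2) ≤ u t ^ 2 := by rw [hut, div_pow, mul_pow, div_le_div_iff₀ (by positivity) (by positivity)]; linarith [mul_le_mul_of_nonneg_left this (by positivity : 0 ≤ c ^ 2 * δ ^ 2 * 4)]
            calc _ ≤ 1 / (c ^ 2 / (4 * δ ^ 2)) := by gcongr; linarith
              _ = _ := by field_simp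
          · refine le_add_of_nonneg_of_le (by positivity) ?_
            rw [mul_comm]; refine mul_le_mul_of_nonneg_left ?_ (by positivity)
            have : 1 / 2 ≤ |R t| := by rw [abs_lt] at hh; exact (by linarith : 1 / 2 ≤ R t).trans (le_abs_self _)
            have i : (4 * (r * r'))⁻¹ ≤ ((t + h) * t)⁻¹ := inv_anti₀ (by positivity) (by linarith [mul_le_mul h4 h2 t0.le (by positivity)])
            calc W = 8 * (1 / 2) * (4 * (r * r'))⁻¹ := by rw [hW]; field_simp; norm_num
              _ ≤ _ := by gcongr
        have s5 := mul_le_mul_of_nonneg_left s3 W0.le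
        have s6 := mul_le_mul_of_nonneg_left s2 W0.le
        rw [← mul_div_assoc] at s6
        rw [hK]; linarith)
  refine key.trans ?_
  have a1 : κ * sg * Real.arctan (u β) - κ * sg * Real.arctan (u α) ≤ κ * Real.pi := by
    rw [← mul_sub, mul_assoc]
    refine mul_le_mul_of_nonneg_left ((le_abs_self _).trans ?_) (by positivity)
    have s1 : |sg| ≤ 1 := by rw [hsg, abs_mul, hς, one_mul]; rcases SignType.trichotomy (SignType.sign (-((ε - 1) * h))) with h | h | h <;> simp [h]
    rw [abs_mul]
    refine (mul_le_of_le_one_left (abs_nonneg _) s1).trans (abs_le.2 ⟨?_, ?_⟩) <;> linarith [Real.arctan_lt_pi_div_two (u β), Real.arctan_lt_pi_div_two (u α), Real.neg_pi_div_two_lt_arctan (u β), Real.neg_pi_div_two_lt_arctan (u α)]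
  have a2 : β - α ≤ r' := by linarith [(H α (left_mem_Icc.2 ab)).1, (H β (right_mem_Icc.2 ab)).2.1]
  have a3 : K * δ ^ 2 * W * (β - α) ≤ K * δ ^ 2 * W * r' := mul_le_mul_of_nonneg_left a2 (by positivity)
  have a4 : 2 * W / m ≤ 2 * (δ ^ 2 / r) := by
    rw [div_eq_mul_inv, im, hW]
    calc _ = 2 * (δ ^ 3 / r) := by field_simp
      _ ≤ _ := by gcongr 2 * (?_ / _); exact pow_le_pow_of_le_one d0.le d1 (by norm_num)
  have a5 : K * δ ^ 2 * W * r' = K * (δ ^ 2 / r) := by rw [hW]; field_simp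
  have a6 : κ * Real.pi = 8 / (c * f) * Real.pi * (δ / |h|) := by rw [hκ]; field_simp
  have := Real.pi_pos
  have p1 : 0 ≤ 8 / (c * f) * Real.pi * (δ ^ 2 / r) := by positivity
  have p2 : 0 ≤ (2 + K) * (δ / |h|) := by positivity
  linarith
end

section
open MeasureTheory Filter Set
open scoped ENNReal Topology ComplexConjugate

lemma rp2 {u : ℝ} (ε : ℝ) (h1 : 1 ≤ u) (h2 : u ≤ 2) : u ^ ε ≤ 2 ^ |ε| ∧ (2 ^ |ε|)⁻¹ ≤ u ^ ε := by
  have : ∀ e : ℝ, |e| = |ε| → u ^ e ≤ 2 ^ |ε| := fun e he => (Real.rpow_le_rpow_of_exponent_le h1 (he ▸ le_abs_self e)).trans (Real.rpow_le_rpow (by linarith) h2 (abs_nonneg _))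
  refine ⟨this ε rfl, ?_⟩
  rw [inv_le_comm₀ (by positivity) (by positivity), ← Real.rpow_neg (by linarith)]; exact this _ (abs_neg _)

lemma rp3 {ε N r lam t : ℝ} (r0 : 0 < r) (h : |N| * r ^ ε = lam) (h1 : r ≤ t) (h2 : t ≤ 2 * r) : |N * t ^ (ε - 1)| ≤ 2 ^ |ε| * lam / r ∧ lam / (2 * 2 ^ |ε| * r) ≤ |N * t ^ (ε - 1)| := by
  have t0 := r0.trans_le h1
  have l0 : 0 ≤ lam := h ▸ by positivity
  obtain ⟨a, b⟩ := rp2 ε ((one_le_div r0).2 h1) ((div_le_iff₀ r0).2 h2)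
  have : |N * t ^ (ε - 1)| = lam * (t / r) ^ ε / t := by
    rw [abs_mul, abs_of_pos (by positivity : 0 < t ^ (ε - 1)), Real.rpow_sub_one t0.ne', Real.div_rpow t0.le r0.le, ← h]; field_simp
  rw [this, mul_comm _ lam]
  constructor
  · gcongr
  · calc _ = lam * (2 ^ |ε|)⁻¹ / (2 * r) := by field_simp
      _ ≤ _ := by gcongr

lemma core {ε : ℝ} (e0 : ε ≠ 0) (e1 : ε ≠ 1) : ∃ C : ℝ, 0 < C ∧ ∀ (r r' lam θ h p q p' q' N N' : ℝ), 0 < r' → r' ≤ r → 0 < θ → θ ≤ 1 → lam * θ ^ 8 = 1 → 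
    (p < q → |N| * r ^ ε = lam ∧ r ≤ p ∧ q ≤ 2 * r) → (p' < q' → |N'| * r' ^ ε = lam ∧ r' ≤ p' ∧ q' ≤ 2 * r') →
    ‖∫ t : ℝ, (if t + h ∈ Ico p q then ee (N * (t + h) ^ ε) / ((t + h : ℝ) : ℂ) else 0) * conj (if t ∈ Ico p' q' then ee (N' * t ^ ε) / (t : ℂ) else 0)‖ ≤ C * (r⁻¹ * ((1 + |h| / (θ * r)) ^ 2)⁻¹) := by
  obtain ⟨C, C0, H⟩ := osc e0 e1 (Real.one_le_rpow one_le_two (abs_nonneg ε))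
  refine ⟨24 * C + 4, by positivity, fun r r' lam θ h p q p' q' N N' r0' rr θ0 θ1 hl h1 h2 => ?_⟩
  have r0 := r0'.trans_le rr
  set α := max (p - h) p'
  set β := min (q - h) q'
  set Φ : ℝ → ℝ := fun t => N * (t + h) ^ ε - N' * t ^ ε with hΦ
  have e : ∀ t : ℝ, (if t + h ∈ Ico p q then ee (N * (t + h) ^ ε) / ((t + h : ℝ) : ℂ) else 0) * conj (if t ∈ Ico p' q' then ee (N' * t ^ ε) / (t : ℂ) else 0) = (Ico α β).indicator (fun t => ((((t + h) * t)⁻¹ : ℝ) : ℂ) * ee (Φ t)) t := fun t => by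
    have : t ∈ Ico α β ↔ t + h ∈ Ico p q ∧ t ∈ Ico p' q' := by
      simp only [mem_Ico, α, β, max_le_iff, lt_min_iff, sub_le_iff_le_add, lt_sub_iff_add_lt]; tauto
    by_cases a : t + h ∈ Ico p q <;> by_cases b : t ∈ Ico p' q'
    · rw [if_pos a, if_pos b, indicator_of_mem (this.2 ⟨a, b⟩), map_div₀, ← ee_neg, show Φ t = N * (t + h) ^ ε + -(N' * t ^ ε) from sub_eq_add_neg _ _, ee_add, Complex.conj_ofReal]; push_cast; field_simp
    all_goals rw [indicator_of_notMem (by tauto)]; simp [a, b]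
  simp_rw [e]
  rw [integral_indicator measurableSet_Ico]
  rcases le_or_gt β α with ab | ab
  · rw [Ico_eq_empty (not_lt.2 ab)]; simp; positivity
  have b1 : β + h ≤ q := by linarith [min_le_left (q - h) q']
  have b2 : p ≤ α + h := by linarith [le_max_left (p - h) p']
  obtain ⟨n1, l1, u1⟩ := h1 (by linarith)
  obtain ⟨n2, l2, u2⟩ := h2 ((le_max_right _ _).trans_lt (ab.trans_le (min_le_right _ _)))
  have l0 : 0 < lam := pos_of_mul_pos_left (hl ▸ one_pos) (by positivity)
  have J : ∀ t ∈ Icc α β, r' ≤ t ∧ t ≤ 2 * r' ∧ r ≤ t + h ∧ t + h ≤ 2 * r := fun t ht =>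
    ⟨l2.trans ((le_max_right _ _).trans ht.1), (ht.2.trans (min_le_right _ _)).trans u2, by linarith [ht.1], by linarith [ht.2]⟩
  obtain ⟨g1, g2, g3, g4⟩ := J α (left_mem_Icc.2 ab.le)
  rw [integral_Ico_eq_integral_Ioo, ← integral_Ioc_eq_integral_Ioo, ← intervalIntegral.integral_of_le ab.le]
  have hh : |h| ≤ 2 * r := abs_le.2 ⟨by linarith, by linarith⟩
  rcases le_or_gt |h| (θ * r) with c | c
  · calc _ ≤ (r * r')⁻¹ * |β - α| := by
          refine intervalIntegral.norm_integral_le_of_norm_le_const fun t ht => ?_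
          rw [uIoc_of_le ab.le] at ht
          obtain ⟨a1, a2, a3, a4⟩ := J t ⟨ht.1.le, ht.2⟩
          rw [norm_mul, norm_ee, mul_one, Complex.norm_real, Real.norm_of_nonneg (inv_nonneg.2 (mul_nonneg (by linarith) (by linarith)))]
          have : 0 ≤ t + h := by linarith
          gcongr
      _ ≤ (r * r')⁻¹ * r' := by
          gcongr; rw [abs_of_pos (by linarith)]; linarith [(J β (right_mem_Icc.2 ab.le)).2.1]
      _ = 4 * (r⁻¹ * ((1 + 1) ^ 2)⁻¹) := by field_simp; norm_num
      _ ≤ _ := by gcongr; · linarith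
                  · exact (div_le_one (by positivity)).2 c
  · have h0 : 0 < |h| := lt_trans (by positivity) c
    have N0 : N ≠ 0 := fun hh => by rw [hh, abs_zero, zero_mul] at n1; linarith
    have N0' : N' ≠ 0 := fun hh => by rw [hh, abs_zero, zero_mul] at n2; linarith
    obtain ⟨ς, hς, hs⟩ : ∃ ς : ℝ, |ς| = 1 ∧ 0 ≤ ς * (N / N') := by
      rcases le_total 0 (N / N') with a | a
      · exact ⟨1, by simp, by linarith⟩
      · exact ⟨-1, by simp, by linarith⟩
    have := H r r' lam (θ ^ 2) h α β ς Φ (fun t => N * (t + h) ^ (ε - 1)) (fun t => N' * t ^ (ε - 1)) r0' rr (by positivity) (pow_le_one₀ θ0.le θ1) (by rw [← pow_mul]; exact hl) (abs_pos.1 h0) ab.le (by fun_prop) hς fun t ht => by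
      obtain ⟨a1, a2, a3, a4⟩ := J t ht
      have t0 : 0 < t := r0'.trans_le a1
      have t0' : 0 < t + h := r0.trans_le a3
      obtain ⟨k1, k2⟩ := rp3 r0 n1 a3 a4
      obtain ⟨k3, k4⟩ := rp3 r0' n2 a1 a2
      have d : ∀ M s p : ℝ, 0 < t + s → HasDerivAt (fun t => M * (t + s) ^ p) (p * (M * (t + s) ^ (p - 1))) t := fun M s p hp =>
        ((((hasDerivAt_id t).add_const s).rpow_const (Or.inl hp.ne')).const_mul M).congr_deriv (by simp; ring)
      have d0 : ∀ M p : ℝ, HasDerivAt (fun t => M * t ^ p) (p * (M * t ^ (p - 1))) t := fun M p => by simpa using d M 0 p (by simpa)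
      refine ⟨a1, a2, a3, a4, ((d _ _ _ t0').sub (d0 _ _)).congr_deriv (by ring), (d _ _ _ t0').congr_deriv ?_, (d0 _ _).congr_deriv ?_, k1, k4, k3, ?_⟩
      · rw [Real.rpow_sub_one t0'.ne']; ring
      · rw [Real.rpow_sub_one t0.ne' (ε - 1)]; ring
      · rw [mul_div_mul_comm, ← mul_assoc]; positivity
    refine this.trans ?_
    calc _ ≤ C * (6 * θ ^ 2 * r / |h| ^ 2) := by
          gcongr
          have q1 : (θ ^ 2) ^ 2 / r ≤ 4 * θ ^ 2 * r / |h| ^ 2 := by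
            rw [div_le_div_iff₀ r0 (by positivity)]
            calc _ ≤ θ ^ 2 * 1 * (2 * r) ^ 2 := by rw [sq (θ ^ 2)]; gcongr; exact pow_le_one₀ θ0.le θ1
              _ = _ := by ring
          have q2 : θ ^ 2 / |h| ≤ 2 * θ ^ 2 * r / |h| ^ 2 := by
            rw [div_le_div_iff₀ h0 (by positivity)]
            calc _ = θ ^ 2 * |h| * |h| := by ring
              _ ≤ θ ^ 2 * (2 * r) * |h| := by gcongr
              _ = _ := by ring
          refine (add_le_add q1 q2).trans_eq (by ring)
      _ = 24 * C * (r⁻¹ * ((|h| / (θ * r) + |h| / (θ * r)) ^ 2)⁻¹) := by field_simp; norm_num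
      _ ≤ _ := by gcongr; · linarith
                  · exact (one_le_div (by positivity)).2 c.le
end

section
open MeasureTheory Filter Set
open scoped ENNReal Topology ComplexConjugate

noncomputable def sh (ε : ℝ) (N p q : ℝ → ℝ) (x t : ℝ) : ℂ := if t ∈ Ico (p x) (q x) then (ee (N x * t ^ ε) - if |N x| * t ^ ε < 1 then 1 else 0) / t else 0

variable {ε a b : ℝ} {N p q : ℝ → ℝ} (hN : Measurable N) (hp : Measurable p) (hq : Measurable q) (a0 : 0 < a) (ap : ∀ x, a ≤ p x)
include ap a0 in
lemma shb (x t : ℝ) : ‖sh ε N p q x t‖ ≤ 2 / a := by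
  unfold sh
  split_ifs with h h'
  · rw [norm_div, Complex.norm_real]
    refine div_le_div₀ zero_le_two ((norm_sub_le _ _).trans ?_) a0 (((ap x).trans h.1).trans (le_abs_self t))
    rw [norm_ee, norm_one]; norm_num
  · rw [norm_div, Complex.norm_real, sub_zero, norm_ee]
    exact div_le_div₀ zero_le_two one_le_two a0 (((ap x).trans h.1).trans (le_abs_self t))
  · simp; positivity
include hN hp hq a0 ap in
lemma shm : KM (sh ε N p q) := by
  refine ⟨?_, _, shb a0 ap⟩
  have := continuous_ee.measurable
  unfold sh Function.uncurry
  refine Measurable.ite ((measurableSet_le (hp.comp measurable_fst) measurable_snd).inter (measurableSet_lt measurable_snd (hq.comp measurable_fst)))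
    (Measurable.div (Measurable.sub (by fun_prop) (Measurable.ite (measurableSet_lt (by fun_prop) (by fun_prop)) (by fun_prop) (by fun_prop))) (by fun_prop)) (by fun_prop)

lemma shell (e0 : ε ≠ 0) (e1 : ε ≠ 1) : ∃ C : ℝ, 0 < C ∧ ∀ (N p q r : ℝ → ℝ) (a b lam τ : ℝ), Measurable N → Measurable p → Measurable q → Measurable r → 0 < a → (∀ x, a ≤ p x) → (∀ x, q x ≤ b) → (∀ x, 0 < r x) →
    0 < τ → τ ≤ 1 → lam * τ ^ 16 = 1 → (∀ x, p x < q x → |N x| * r x ^ ε = lam ∧ r x ≤ p x ∧ q x ≤ 2 * r x) → (∀ x, ∀ t ∈ Ico (p x) (q x), 1 ≤ |N x| * t ^ ε) → Bd (sh ε N p q) (ENNReal.ofReal (C * τ)) := by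
  obtain ⟨C, C0, H⟩ := core e0 e1
  refine ⟨8 * (C + 1), by positivity, fun N p q r a b lam τ hN hp hq hr a0 ap qb r0 τ0 τ1 hl h h1 v hv => ?_⟩
  have e : ∀ x t, sh ε N p q x t = if t ∈ Ico (p x) (q x) then ee (N x * t ^ ε) / t else 0 := fun x t => by
    unfold sh; split_ifs with i j
    · exact absurd j (not_lt.2 (h1 x t i))
    · rw [sub_zero]
    · rfl
  have P : ∀ x z, r z ≤ r x → ‖∫ y, sh ε N p q x (x - y) * conj (sh ε N p q z (z - y))‖ₑ ≤ ENNReal.ofReal (C * τ ^ 2) * _root_.q (τ ^ 2 * r x) (x - z) := fun x z hxz => by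
    have := H (r x) (r z) lam (τ ^ 2) (x - z) (p x) (q x) (p z) (q z) (N x) (N z) (r0 z) hxz (by positivity) (pow_le_one₀ τ0.le τ1) (by rw [← pow_mul]; exact hl) (h x) (h z)
    simp_rw [← e] at this
    rw [← integral_sub_left_eq_self _ volume z] at this
    simp_rw [show ∀ y, z - y + (x - z) = x - y from fun y => by ring] at this
    rw [_root_.q, ← ENNReal.ofReal_mul (by positivity)]
    refine enorm_le_ofReal (this.trans (Eq.le ?_))
    have := r0 x
    field_simp
  rw [l2iff]
  refine (tts (shm hN hp hq a0 ap) (b := b) (fun x t ht => if_neg fun hh => ?_) (hr.const_mul (τ ^ 2)) (fun x => mul_pos (by positivity) (r0 x)) (a := ENNReal.ofReal (C * τ ^ 2)) (by finiteness) (fun x z => ?_) hv).trans ?_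
  · rw [abs_of_pos (a0.trans_le ((ap x).trans hh.1))] at ht
    linarith [hh.2, qb x]
  · rcases le_total (r z) (r x) with i | i
    · exact (P x z i).trans (mul_le_mul_right le_self_add _)
    · rw [← RCLike.enorm_conj, ← integral_conj]
      simp only [map_mul, Complex.conj_conj, mul_comm (conj _)]
      refine (P z x i).trans (mul_le_mul_right ?_ _)
      rw [_root_.q, abs_sub_comm, ← _root_.q]; exact le_add_self
  · gcongr
    rw [← ENNReal.ofReal_pow (by positivity), ← ENNReal.ofReal_ofNat, ← ENNReal.ofReal_mul (by positivity)]
    refine ENNReal.ofReal_le_ofReal ?_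
    calc 64 * (C * τ ^ 2) ≤ 64 * ((C + 1) ^ 2 * τ ^ 2) := by gcongr; nlinarith
      _ = _ := by ring
end

section
open MeasureTheory Filter Set
open scoped ENNReal Topology ComplexConjugate

lemma half {ε : ℝ} (e0 : ε ≠ 0) (e1 : ε ≠ 1) : ∃ C : ℝ≥0∞, C ≠ ∞ ∧ ∀ (N : ℝ → ℝ) (a b : ℝ), Measurable N → 0 < a → Bd (sh ε N (fun _ => a) fun _ => b) C := by
  obtain ⟨C, C0, H⟩ := shell e0 e1
  set κ : ℝ := 2 ^ (-|ε| / 16) with hκ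
  have κ0 : 0 < κ := by positivity
  have κ1 : κ < 1 := Real.rpow_lt_one_of_one_lt_of_neg one_lt_two (by have := abs_pos.2 e0; linarith)
  set D : ℝ := C + 8 * 2 ^ |ε| * 9 * 32
  have D0 : 0 < D := by positivity
  have κj : ∀ j : ℤ, κ ^ j.natAbs = 2 ^ (-|j * ε| / 16) := fun j => by
    rw [← Real.rpow_natCast, ← Real.rpow_mul zero_le_two, Nat.cast_natAbs, abs_mul, Int.cast_abs]; congr 1; ring
  refine ⟨∑' j : ℤ, ENNReal.ofReal (D * κ ^ j.natAbs), ((summable_natAbs κ0 κ1).mul_left D).tsum_ofReal_ne_top, fun N a b hN a0 => ?_⟩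
  set ρ : ℝ → ℝ := fun x => (if N x = 0 then 1 else |N x|) ^ (-1 / ε) with hρ
  have mN : MeasurableSet {x | N x = 0} := hN (measurableSet_singleton 0)
  have mρ : Measurable ρ := (Measurable.ite mN measurable_const (by fun_prop)).pow_const _
  have ρ0 : ∀ x, 0 < ρ x := fun x => Real.rpow_pos_of_pos (by split_ifs <;> positivity) _
  set r : ℤ → ℝ → ℝ := fun j x => 2 ^ j * ρ x with hr
  have r0 : ∀ j x, 0 < r j x := fun j x => mul_pos (by positivity) (ρ0 x)
  set p : ℤ → ℝ → ℝ := fun j x => max (r j x) a with hp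
  set q : ℤ → ℝ → ℝ := fun j x => if N x = 0 then 0 else min (2 * r j x) b with hq
  have mr : ∀ j, Measurable (r j) := fun j => mρ.const_mul _
  have mp : ∀ j, Measurable (p j) := fun j => (mr j).max measurable_const
  have mq : ∀ j, Measurable (q j) := fun j => Measurable.ite mN measurable_const (((mr j).const_mul 2).min measurable_const)
  have pa : ∀ j x, a ≤ p j x := fun j x => le_max_right _ _
  have key : ∀ j x, p j x < q j x → |N x| * r j x ^ ε = 2 ^ (j * ε) ∧ r j x ≤ p j x ∧ q j x ≤ 2 * r j x := fun j x h => by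
    by_cases hx : N x = 0
    · simp only [hq, if_pos hx] at h; linarith [pa j x]
    · refine ⟨?_, le_max_left _ _, by simp only [hq, if_neg hx]; exact min_le_left _ _⟩
      have := abs_pos.2 hx
      rw [hr, Real.mul_rpow (by positivity) (ρ0 x).le]
      simp only [hρ, if_neg hx]
      rw [← Real.rpow_mul this.le, div_mul_cancel₀ _ e0, Real.rpow_neg_one, ← Real.rpow_intCast, ← Real.rpow_mul zero_le_two]; field_simp
  clear_value ρ
  have km : ∀ j, KM (sh ε N (p j) (q j)) := fun j => shm hN (mp j) (mq j) a0 (pa j)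
  have B : ∀ j, Bd (sh ε N (p j) (q j)) (ENNReal.ofReal (D * κ ^ j.natAbs)) := fun j => by
    rcases lt_or_ge 0 ((j:ℝ) * ε) with hj | hj
    · refine fun v hv => (H N (p j) (q j) (r j) a |b| (2 ^ (j * ε)) (κ ^ j.natAbs) hN (mp j) (mq j) (mr j) a0 (pa j) (fun x => ?_) (r0 j) (by positivity) (pow_le_one₀ κ0.le κ1.le) ?_ (key j) (fun x t ht => ?_) v hv).trans ?_
      · simp only [hq]; split_ifs
        · positivity
        · exact (min_le_right _ _).trans (le_abs_self b)
      · rw [κj, ← Real.rpow_natCast, ← Real.rpow_mul zero_le_two, ← Real.rpow_add two_pos, abs_of_pos hj]; norm_num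
      · obtain ⟨k1, k2, k3⟩ := key j x (ht.1.trans_lt ht.2)
        have s1 := (one_le_div (r0 j x)).2 (k2.trans ht.1)
        have : |N x| * t ^ ε = 2 ^ (j * ε) * (t / r j x) ^ ε := by
          rw [← k1, Real.div_rpow (a0.le.trans ((pa j x).trans ht.1)) (r0 j x).le]
          have := Real.rpow_pos_of_pos (r0 j x) ε
          field_simp
        rw [this]
        rcases e0.lt_or_gt with e | e
        · have : j ≤ -1 := Int.le_sub_one_of_lt (by exact_mod_cast (neg_iff_neg_of_mul_pos hj).2 e : j < 0)
          have : (j:ℝ) ≤ -1 := by exact_mod_cast this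
          calc (1:ℝ) ≤ 2 ^ ((j + 1) * ε) := Real.one_le_rpow one_le_two (mul_nonneg_of_nonpos_of_nonpos (by linarith) e.le)
            _ = 2 ^ (j * ε) * 2 ^ ε := by rw [← Real.rpow_add two_pos]; ring_nf
            _ ≤ _ := by
              gcongr ?_ * ?_
              exact Real.rpow_le_rpow_of_nonpos (by linarith) ((div_le_iff₀ (r0 j x)).2 (ht.2.le.trans k3)) e.le
        · exact one_le_mul_of_one_le_of_one_le (Real.one_le_rpow one_le_two hj.le) (Real.one_le_rpow s1 e.le)
      · gcongr
        exact le_add_of_nonneg_right (by positivity)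
    · refine fun v hv => (Bd.q (mr j) (r0 j) (D := ENNReal.ofReal (8 * 2 ^ |ε| * 9 * 2 ^ (j * ε))) (by finiteness) (fun x t => ?_) v hv).trans ?_
      · have R := r0 j x
        rw [_root_.q, ← ENNReal.ofReal_mul (by positivity)]
        refine enorm_le_ofReal ?_
        unfold sh
        by_cases h : t ∈ Ico (p j x) (q j x)
        · rw [if_pos h]
          obtain ⟨k1, k2, k3⟩ := key j x (h.1.trans_lt h.2)
          have t0 : 0 < t := a0.trans_le ((pa j x).trans h.1)
          have n : ‖ee (N x * t ^ ε) - (if |N x| * t ^ ε < 1 then 1 else 0)‖ ≤ 8 * (|N x| * t ^ ε) := by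
            split_ifs with i
            · have := norm_ee_sub_le (N x * t ^ ε) 0
              rwa [ee_zero, sub_zero, abs_mul, abs_of_pos (a := t ^ ε) (by positivity)] at this
            · rw [sub_zero, norm_ee]; linarith
          rw [norm_div, Complex.norm_real, Real.norm_of_nonneg t0.le]
          calc _ ≤ 8 * (|N x| * t ^ ε) / t := by gcongr
            _ = 8 * |N x * t ^ (ε - 1)| := by rw [abs_mul, Real.rpow_sub_one t0.ne', abs_of_pos (a := t ^ ε / t) (by positivity)]; ring
            _ ≤ 8 * (2 ^ |ε| * 2 ^ (j * ε) / r j x) := by gcongr; exact (rp3 R k1 (k2.trans h.1) (h.2.le.trans k3)).1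
            _ = 8 * 2 ^ |ε| * 9 * 2 ^ (j * ε) * ((r j x)⁻¹ * ((1 + 2) ^ 2)⁻¹) := by field_simp; norm_num
            _ ≤ _ := by
              gcongr
              rw [abs_of_pos t0]; exact (div_le_iff₀ R).2 (h.2.le.trans k3)
        · rw [if_neg h, norm_zero]; positivity
      · gcongr
        rw [← ENNReal.ofReal_ofNat, ← ENNReal.ofReal_mul (by positivity), κj]
        refine ENNReal.ofReal_le_ofReal ?_
        calc _ = (8 * 2 ^ |ε| * 9 * 32) * (2:ℝ) ^ (j * ε) := by ring
          _ ≤ _ := by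
            gcongr
            · exact le_add_of_nonneg_left C0.le
            · exact one_le_two
            · rw [abs_of_nonpos hj]; linarith
  have E : ∀ x t, ∃ j, ∀ i, sh ε N (p i) (q i) x t = if i = j then sh ε N (fun _ => a) (fun _ => b) x t else 0 := fun x t => by
    by_cases hx : N x = 0
    · exact ⟨0, fun i => by simp [sh, hx, ee_zero]⟩
    by_cases ht : t ∈ Ico a b
    · obtain ⟨j, j1, j2⟩ := exists_mem_Ico_zpow (div_pos (a0.trans_le ht.1) (ρ0 x)) one_lt_two
      have : ∀ i, t ∈ Ico (p i x) (q i x) ↔ t / ρ x ∈ Ico ((2:ℝ) ^ i) (2 ^ (i + 1)) := fun i => by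
        simp only [hp, hq, hr, if_neg hx, mem_Ico, max_le_iff, lt_min_iff, le_div_iff₀ (ρ0 x), div_lt_iff₀ (ρ0 x), ht.1, ht.2, and_true, zpow_add_one₀ (two_ne_zero' ℝ), mul_comm _ (2:ℝ), mul_assoc]
      refine ⟨j, fun i => ?_⟩
      split_ifs with hi
      · simp only [sh]; rw [if_pos ((this i).2 (hi ▸ ⟨j1, j2⟩)), if_pos ht]
      · refine if_neg fun h => ?_
        obtain ⟨i1, i2⟩ := (this i).1 h
        have a1 := (zpow_lt_zpow_iff_right₀ (one_lt_two (α := ℝ))).1 (i1.trans_lt j2)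
        have a2 := (zpow_lt_zpow_iff_right₀ (one_lt_two (α := ℝ))).1 (j1.trans_lt i2)
        omega
    · refine ⟨0, fun i => ?_⟩
      simp only [sh, if_neg ht, ite_self]
      refine if_neg fun h => ht ⟨(pa i x).trans h.1, h.2.trans_le ?_⟩
      simp only [hq, if_neg hx]; exact min_le_right _ _
  intro v hv
  rw [l2iff]
  refine fatou2 (h := fun M : ℕ => op v fun x t => ∑ i ∈ Finset.Ico (-M : ℤ) M, sh ε N (p i) (q i) x t) (fun M => ((KM.sum fun i _ => km i).op hv).aemeasurable) (ae_of_all _ fun x => ?_) fun M => ?_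
  · have bo : ∀ t, ‖sh ε N (fun _ => a) (fun _ => b) x t‖ ≤ 2 / a := shb a0 (fun _ => le_rfl) x
    refine tendsto_integral_of_dominated_convergence (fun t => ‖v (x - t)‖ * (2 / a)) (fun M => ((KM.sum fun i _ => km i).int hv x).1) ((hv.int.comp_sub_left x).norm.mul_const _) (fun M => ae_of_all _ fun t => ?_) (ae_of_all _ fun t => ?_)
    · obtain ⟨j, hj⟩ := E x t
      simp_rw [hj]
      rw [norm_mul, Finset.sum_ite_eq']
      gcongr
      split_ifs
      · exact bo t
      · simp; positivity
    · obtain ⟨j, hj⟩ := E x t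
      simp_rw [hj]
      refine tendsto_const_nhds.congr' ?_
      filter_upwards [eventually_gt_atTop j.natAbs] with M hM
      rw [Finset.sum_ite_eq', if_pos (Finset.mem_Ico.2 (by omega))]
  · exact (l2iff _ _ _).1 ((Bd.sum (fun i _ => km i) (fun i _ => B i) v hv).trans (mul_le_mul_left (ENNReal.sum_le_tsum _) _))
end

section
open MeasureTheory Filter Set
open scoped ENNReal Topology ComplexConjugate

lemma Bd.neg {k : ℝ → ℝ → ℂ} {C : ℝ≥0∞} (h : Bd k C) : Bd (fun x t => -k x t) C := fun v hv => by
  have : op v (fun x t => -k x t) = -op v k := by ext x; simp [op, integral_neg]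
  rw [this, eLpNorm_neg]; exact h v hv

lemma Bd.refl {k : ℝ → ℝ → ℂ} {C : ℝ≥0∞} (h : Bd k C) : Bd (fun x t => k (-x) (-t)) C := fun v hv => by
  have e : ∀ x, op v (fun x t => k (-x) (-t)) x = op (fun y => v (-1 * y)) k (-x) := fun x => by
    simp only [op]; rw [← integral_neg_eq_self]; simp only [neg_neg]; congr! 3; ring
  have := (l2iff _ _ _).1 (h _ (hv.dil (d := -1) (by norm_num)))
  rw [ldil (fun y => ‖v y‖ₑ ^ 2) (by norm_num)] at this
  rw [l2iff]
  simp_rw [e]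
  rw [lintegral_neg_eq_self (fun x => ‖op (fun y => v (-1 * y)) k x‖ₑ ^ 2)]
  simpa using this

lemma KM.neg {k : ℝ → ℝ → ℂ} (h : KM k) : KM fun x t => -k x t := ⟨h.m.neg, by simpa only [norm_neg] using h.b⟩

lemma rpi {ε s N : ℝ} (e0 : ε ≠ 0) (hs : 0 < s) (hN : N ≠ 0) : |N| * s ^ ε = (s / |N| ^ (-1 / ε)) ^ ε := by
  have := abs_pos.2 hN
  rw [Real.div_rpow hs.le (by positivity), ← Real.rpow_mul this.le, div_mul_cancel₀ _ e0, Real.rpow_neg_one]; field_simp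

open Classical in
lemma lowk {ε : ℝ} (e0 : ε ≠ 0) : ∃ C : ℝ≥0∞, C ≠ ∞ ∧ ∀ (n : ℕ) (N : ℝ → ℝ), Measurable N →
    KM (fun x t => if (2 ^ (6 * n))⁻¹ ≤ |t| ∧ |t| < 2 ^ (6 * n) ∧ |N x| * |t| ^ ε < 1 then (t:ℂ)⁻¹ else 0) ∧ Bd (fun x t => if (2 ^ (6 * n))⁻¹ ≤ |t| ∧ |t| < 2 ^ (6 * n) ∧ |N x| * |t| ^ ε < 1 then (t:ℂ)⁻¹ else 0) C := by
  obtain ⟨C, hC, H⟩ := hilb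
  refine ⟨C + C, by finiteness, fun n N hN => ?_⟩
  set b : ℝ := 2 ^ (6 * n) with hb
  have b1 : 1 ≤ b := one_le_pow₀ one_le_two
  have ab : b⁻¹ ≤ b := (inv_le_one_of_one_le₀ b1).trans b1
  have b0 : 0 < b⁻¹ := by positivity
  have M : ∀ P : ℝ → ℝ → Prop, MeasurableSet {p : ℝ × ℝ | P p.1 p.2} → MeasurableSet {p : ℝ × ℝ | b⁻¹ ≤ |p.2| ∧ |p.2| < b ∧ P p.1 p.2} := fun P hP =>
    (measurableSet_le measurable_const measurable_snd.abs).inter ((measurableSet_lt measurable_snd.abs measurable_const).inter hP)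
  have K : ∀ P : ℝ → ℝ → Prop, MeasurableSet {p : ℝ × ℝ | P p.1 p.2} → KM fun x t => if b⁻¹ ≤ |t| ∧ |t| < b ∧ P x t then (t:ℂ)⁻¹ else 0 := fun P hP => by
    refine ⟨Measurable.ite (M P hP) (by fun_prop) (by fun_prop), b, fun x t => ?_⟩
    split_ifs with h
    · rw [norm_inv, Complex.norm_real]; exact inv_le_of_inv_le₀ (by positivity) h.1
    · simp; positivity
  have T : ∀ (P : ℝ → ℝ → Prop) (σ : ℝ → ℝ), Measurable σ → MeasurableSet {p : ℝ × ℝ | P p.1 p.2} → (∀ x t, b⁻¹ ≤ |t| → P x t → σ x ≤ |t|) → (∀ x t, b⁻¹ ≤ |t| → |t| < b → ¬P x t → |t| ≤ σ x) → Bd (fun x t => if b⁻¹ ≤ |t| ∧ |t| < b ∧ P x t then (t:ℂ)⁻¹ else 0) C := fun P σ hσ hP h1 h2 => by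
    have := H n (fun _ => 0) (fun x => max b⁻¹ (min (σ x) b)) (fun x => {t | b⁻¹ ≤ |t| ∧ |t| < b ∧ P x t}) measurable_const (measurable_const.max (hσ.min measurable_const)) (fun x => ⟨le_max_left _ _, max_le ab (min_le_right _ _)⟩) (M P hP)
      (fun x t ht => ⟨max_le ht.1 ((min_le_left _ _).trans (h1 x t ht.1 ht.2.2)), ht.2.1⟩) (fun x t ht => by
        by_contra! hh
        obtain ⟨i, j⟩ := hh
        obtain ⟨i1, i2⟩ := max_lt_iff.1 i
        exact ht ⟨i1.le, j, by_contra fun hP => i2.not_ge (le_min (h2 x t i1.le j hP) j.le)⟩)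
    simpa [ee_zero] using this
  have mP : MeasurableSet {p : ℝ × ℝ | |N p.1| * |p.2| ^ ε < 1} := measurableSet_lt (by fun_prop) (by fun_prop)
  refine ⟨K _ mP, ?_⟩
  rcases e0.lt_or_gt with e | e
  · have pos : 0 < -1 / ε := div_pos_of_neg_of_neg (by norm_num) e
    refine fun v hv => (T (fun x t => |N x| * |t| ^ ε < 1) (fun x => |N x| ^ (-1 / ε)) (by fun_prop) mP (fun x t ht h => ?_) (fun x t ht _ h => ?_) v hv).trans (mul_le_mul_left le_self_add _)
    all_goals
      have t0 := b0.trans_le ht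
      by_cases hx : N x = 0
    · simp only [hx, abs_zero, Real.zero_rpow pos.ne']; exact abs_nonneg t
    · have s0 : 0 < |N x| ^ (-1 / ε) := Real.rpow_pos_of_pos (abs_pos.2 hx) _
      rw [rpi e0 t0 hx, Real.rpow_lt_one_iff_of_pos (by positivity), one_lt_div s0] at h
      rcases h with h | h <;> linarith
    · simp [hx] at h
    · have s0 : 0 < |N x| ^ (-1 / ε) := Real.rpow_pos_of_pos (abs_pos.2 hx) _
      rw [rpi e0 t0 hx, Real.rpow_lt_one_iff_of_pos (by positivity), one_lt_div s0] at h
      by_contra! i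
      exact h (Or.inl ⟨i, e⟩)
  · have mP' : MeasurableSet {p : ℝ × ℝ | ¬|N p.1| * |p.2| ^ ε < 1} := mP.compl
    have B1 := T (fun x t => True) (fun _ => b⁻¹) (by fun_prop) (by simp) (fun x t ht h => ht) (by simp)
    have B2 := T (fun x t => ¬|N x| * |t| ^ ε < 1) (fun x => if N x = 0 then b else |N x| ^ (-1 / ε)) (Measurable.ite (hN (measurableSet_singleton 0)) measurable_const (by fun_prop)) mP' (fun x t ht h => ?_) (fun x t ht tb h => ?_)
    · have := B1.add (K (fun x t => True) (by simp)) (K (fun x t => ¬|N x| * |t| ^ ε < 1) mP').neg B2.neg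
      convert this using 3 with x t
      split_ifs <;> first | (exfalso; tauto) | simp
    all_goals
      have t0 := b0.trans_le ht
      by_cases hx : N x = 0
    · simp [hx] at h
    · have s0 : 0 < |N x| ^ (-1 / ε) := Real.rpow_pos_of_pos (abs_pos.2 hx) _
      rw [rpi e0 t0 hx, Real.rpow_lt_one_iff_of_pos (by positivity), div_lt_one s0] at h
      rw [if_neg hx]
      by_contra! i
      exact h (Or.inr ⟨i, e⟩)
    · rw [if_pos hx]; exact tb.le
    · have s0 : 0 < |N x| ^ (-1 / ε) := Real.rpow_pos_of_pos (abs_pos.2 hx) _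
      rw [rpi e0 t0 hx, not_not, Real.rpow_lt_one_iff_of_pos (by positivity), div_lt_one s0] at h
      rw [if_neg hx]
      rcases h with h | h <;> linarith

lemma main1 {ε : ℝ} (e0 : ε ≠ 0) : ∃ C : ℝ≥0∞, C ≠ ∞ ∧ ∀ (n : ℕ) (N : ℝ → ℝ), Measurable N →
    Bd (fun x t => if (2 ^ (6 * n))⁻¹ ≤ |t| ∧ |t| < 2 ^ (6 * n) then ee (N x * (Real.sign t * |t| ^ ε)) / t else 0) C := by
  by_cases e1 : ε = 1
  · obtain ⟨C, hC, H⟩ := hilb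
    refine ⟨C, hC, fun n N hN => ?_⟩
    have b1 : (1:ℝ) ≤ 2 ^ (6 * n) := one_le_pow₀ one_le_two
    have := H n N (fun _ => (2 ^ (6 * n))⁻¹) (fun _ => {t | (2 ^ (6 * n))⁻¹ ≤ |t| ∧ |t| < 2 ^ (6 * n)}) hN measurable_const (fun _ => ⟨le_rfl, (inv_le_one_of_one_le₀ b1).trans b1⟩)
      (by simp only [mem_setOf_eq]; exact (measurableSet_le measurable_const measurable_snd.abs).inter (measurableSet_lt measurable_snd.abs measurable_const)) (fun x t h => h) fun x t h => by
        by_contra! hh; exact h ⟨hh.1.le, hh.2⟩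
    convert this using 5 with x t
    · rfl
    · rw [e1, Real.rpow_one]; congr 2
      rcases lt_trichotomy t 0 with i | i | i
      · rw [Real.sign_of_neg i, abs_of_neg i]; ring
      · simp [i]
      · rw [Real.sign_of_pos i, abs_of_pos i]; ring
  · obtain ⟨C, hC, H⟩ := lowk e0
    obtain ⟨D, hD, H'⟩ := half e0 e1
    refine ⟨C + (D + D), by finiteness, fun n N hN => ?_⟩
    set b : ℝ := 2 ^ (6 * n) with hb
    have b0 : 0 < b⁻¹ := by positivity
    have hN' : Measurable fun x => -N (-x) := (hN.comp measurable_neg).neg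
    have k1 := shm (ε := ε) hN measurable_const (measurable_const (a := b)) b0 fun _ => le_rfl
    have k2 := shm (ε := ε) hN' measurable_const (measurable_const (a := b)) b0 fun _ => le_rfl
    have k3 : KM fun x t => sh ε (fun x => -N (-x)) (fun _ => b⁻¹) (fun _ => b) (-x) (-t) :=
      ⟨k2.m.comp (measurable_fst.neg.prodMk measurable_snd.neg), k2.b.imp fun B h x t => h _ _⟩
    have := (H n N hN).2.add (H n N hN).1 (k1.add k3.neg) ((H' N b⁻¹ b hN b0).add k1 k3.neg (H' _ b⁻¹ b hN' b0).refl.neg)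
    convert this using 3 with x t
    simp only [sh, ← hb, neg_neg, mem_Ico]
    rcases lt_trichotomy t 0 with i | i | i
    · rw [Real.sign_of_neg i, abs_of_neg i]
      have : ¬b⁻¹ ≤ t := by linarith
      simp only [this, false_and, if_false, abs_neg]
      split_ifs <;> first | (exfalso; tauto) | (simp; done) | skip
      all_goals simp only [neg_one_mul, mul_neg, neg_mul, Complex.ofReal_neg, div_neg]; ring
    · simp [i, b0.not_ge]
    · have : ¬b⁻¹ ≤ -t := by linarith
      rw [Real.sign_of_pos i, abs_of_pos i]
      simp only [this, false_and, if_false, one_mul]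
      split_ifs <;> first | (exfalso; tauto) | (simp; done) | skip
      all_goals ring
end

section
open MeasureTheory Filter Set
open scoped ENNReal Topology ComplexConjugate SchwartzMap FourierTransform ContDiff

lemma planch {f : ℝ → ℂ} (hf : Nice f) : ∫⁻ η, ‖∫ y, ee (-(y * η)) * f y‖ₑ ^ 2 = ∫⁻ y, ‖f y‖ₑ ^ 2 := by
  have m : MemLp f 2 := (memLp_two_iff_integrable_sq_norm hf.meas.aestronglyMeasurable).2 hf.sq
  set F := m.toLp f
  have e : ∀ η, ∫ y, ee (-(y * η)) * f y = 𝓕 f η := fun η => by rw [Real.fourier_real_eq]; rfl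
  have key : ∀ᵐ x : ℝ, 𝓕 f x = (𝓕 F : Lp (α := ℝ) ℂ 2 volume) x := by
    refine ae_eq_of_integral_contDiff_smul_eq (VectorFourier.fourierIntegral_continuous Real.continuous_fourierChar (L := innerₗ ℝ) continuous_inner hf.int).locallyIntegrable ((Lp.memLp _).locallyIntegrable one_le_two) fun g g1 g2 => ?_
    have c1 : HasCompactSupport fun x => (g x : ℂ) := g2.comp_left Complex.ofReal_zero
    have c2 : ContDiff ℝ ∞ fun x => (g x : ℂ) := Complex.ofRealCLM.contDiff.comp g1
    set G := c1.toSchwartzMap c2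
    have := DFunLike.congr_fun (Lp.fourier_toTemperedDistribution_eq F) G
    rw [TemperedDistribution.fourier_apply, Lp.toTemperedDistribution_apply, Lp.toTemperedDistribution_apply] at this
    have h2 := VectorFourier.integral_fourierIntegral_smul_eq_flip (μ := volume) (ν := volume) (L := innerₗ ℝ) Real.continuous_fourierChar continuous_inner G.integrable hf.int
    rw [flip_innerₗ] at h2
    refine (h2.symm.trans (Eq.trans ?_ this)).trans ?_
    · exact integral_congr_ae (m.coeFn_toLp.mono fun x hx => by
        show _ = _ * F x
        rw [show F x = f x from hx]; rfl)
    · rfl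
  simp_rw [e]
  rw [← l2sq, ← l2sq, eLpNorm_congr_ae key, ← eLpNorm_congr_ae m.coeFn_toLp, ← Lp.enorm_def, ← Lp.enorm_def, ← ofReal_norm, Lp.norm_fourier_eq, ofReal_norm]
end

section
open MeasureTheory Filter Set
open scoped ENNReal Topology ComplexConjugate SchwartzMap

lemma mi {X : Type*} [MeasurableSpace X] {g : X × ℝ → ℂ} (h : Measurable g) : Measurable fun x => ∫ t, g (x, t) :=
  h.stronglyMeasurable.integral_prod_right'.measurable

lemma decay (f : 𝓢(ℝ × ℝ, ℂ)) : ∃ B : ℝ, 0 ≤ B ∧ ∀ x y, ‖f (x, y)‖ ≤ B * (1 + y ^ 2)⁻¹ := by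
  have h := f.one_add_le_sup_seminorm_apply (𝕜 := ℝ) (m := (2, 0)) le_rfl le_rfl
  refine ⟨_, le_trans (by positivity) (h 0), fun x y => ?_⟩
  rw [← div_eq_mul_inv, le_div_iff₀ (by positivity)]
  refine le_trans ?_ (h (x, y))
  rw [norm_iteratedFDeriv_zero, mul_comm]
  gcongr
  have : |y| ≤ ‖(x, y)‖ := le_max_right _ _
  dsimp only; rw [← sq_abs]; nlinarith [abs_nonneg y]


lemma red {b : ℝ} (b0 : 0 < b) {s : ℝ → ℝ} (hs : Measurable s) {C : ℝ≥0∞} 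
    (H : ∀ N, Measurable N → Bd (fun x t => if b⁻¹ ≤ |t| ∧ |t| < b then ee (N x * s t) / t else 0) C) {u : ℝ → ℝ} (hu : Measurable u) (f : 𝓢(ℝ × ℝ, ℂ)) :
    Measurable (fun x : ℝ × ℝ => ∫ t, f (x.1 - t, x.2 - u x.1 * s t) * if b⁻¹ ≤ |t| ∧ |t| < b then (t:ℂ)⁻¹ else 0) ∧
    ∫⁻ x : ℝ × ℝ, ‖∫ t, f (x.1 - t, x.2 - u x.1 * s t) * if b⁻¹ ≤ |t| ∧ |t| < b then (t:ℂ)⁻¹ else 0‖ₑ ^ 2 ≤ C ^ 2 * ∫⁻ x, ‖f x‖ₑ ^ 2 := by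
  obtain ⟨B, B0, hB⟩ := decay f
  have hB' : ∀ x y, ‖f (x, y)‖ ≤ B := fun x y => (hB x y).trans (mul_le_of_le_one_right B0 (inv_le_one_of_one_le₀ (by nlinarith)))
  have ce := continuous_ee
  have me := continuous_ee.measurable
  have mf : Measurable f := f.continuous.measurable
  set K : ℝ → ℂ := fun t => if b⁻¹ ≤ |t| ∧ |t| < b then (t:ℂ)⁻¹ else 0 with hK
  have mK : Measurable K := Measurable.ite ((measurableSet_le measurable_const measurable_id.abs).inter (measurableSet_lt measurable_id.abs measurable_const)) (by fun_prop) (by fun_prop)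
  have bK : ∀ t, ‖K t‖ ≤ b := fun t => by
    simp only [hK]; split_ifs with h
    · rw [norm_inv, Complex.norm_real]; exact inv_le_of_inv_le₀ b0 h.1
    · simpa using b0.le
  have iK : Integrable K := by
    refine IntegrableOn.integrable_of_forall_notMem_eq_zero (s := Icc (-b) b) (Measure.integrableOn_of_bounded (M := b) (by simp) mK.aestronglyMeasurable (ae_of_all _ bK)) fun t ht => if_neg fun h => ht (abs_le.1 h.2.le)
  set F : ℝ → ℝ → ℂ := fun η x => ∫ y, ee (-(y * η)) * f (x, y) with hF
  set h : ℝ × ℝ → ℂ := fun x => ∫ t, f (x.1 - t, x.2 - u x.1 * s t) * K t with hh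
  suffices Q : Measurable h ∧ ∫⁻ x, ‖h x‖ₑ ^ 2 ≤ C ^ 2 * ∫⁻ x, ‖f x‖ₑ ^ 2 from Q
  have mF : Measurable fun p : ℝ × ℝ => F p.2 p.1 := mi (g := fun p : (ℝ × ℝ) × ℝ => ee (-(p.2 * p.1.2)) * f (p.1.1, p.2)) (by fun_prop)
  have mh : Measurable h := mi (g := fun p : (ℝ × ℝ) × ℝ => f (p.1.1 - p.2, p.1.2 - u p.1.1 * s p.2) * K p.2) (by fun_prop)
  clear_value K F h
  have nf : ∀ x, Nice fun y => f (x, y) := fun x => ⟨by fun_prop, ⟨B, B0, fun y => hB' x y⟩,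
    (integrable_inv_one_add_sq.const_mul B).mono' (by fun_prop) (ae_of_all _ (hB x))⟩
  have fi : Integrable f (volume.prod volume) := f.integrable
  have nF : ∀ η, Nice (F η) := fun η => by
    have m : Measurable fun p : ℝ × ℝ => ee (-(p.2 * η)) := by fun_prop
    have i := (fi.bdd_mul (c := 1) m.aestronglyMeasurable (ae_of_all _ fun p => (norm_ee (-(p.2 * η))).le)).integral_prod_left
    refine ⟨?_, ⟨∫ y, B * (1 + y ^ 2)⁻¹, integral_nonneg fun y => by positivity, fun x => ?_⟩, by rw [hF]; exact i⟩
    · exact mF.comp (measurable_id.prodMk (measurable_const (a := η)))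
    · rw [hF]
      exact norm_integral_le_of_norm_le (integrable_inv_one_add_sq.const_mul B) (ae_of_all _ fun y => by rw [norm_mul, norm_ee, one_mul]; exact hB x y)
  have ih : ∀ x, Integrable (fun p : ℝ × ℝ => f (x - p.2, p.1 - u x * s p.2) * K p.2) (volume.prod volume) := fun x => by
    refine (integrable_prod_iff' (by fun_prop)).2 ⟨ae_of_all _ fun t => ?_, ?_⟩
    · have := ((nf (x - t)).int.comp_sub_right (u x * s t)).mul_const (K t)
      exact this
    simp only [norm_mul, integral_mul_const]
    have e : ∀ t, ∫ y, ‖f (x - t, y - u x * s t)‖ = ∫ y, ‖f (x - t, y)‖ := fun t => integral_sub_right_eq_self (fun y => ‖f (x - t, y)‖) (u x * s t)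
    simp only [e]
    exact (fi.norm.integral_prod_left.comp_sub_left x).mul_bdd (c := b) (by fun_prop) (ae_of_all _ fun t => by simpa using bK t)
  have nh : ∀ x, Nice fun y => h (x, y) := fun x => by
    refine ⟨by fun_prop, ⟨∫ t, B * ‖K t‖, integral_nonneg fun t => by positivity, fun y => by
      rw [hh]; exact norm_integral_le_of_norm_le (iK.norm.const_mul B) (ae_of_all _ fun t => by rw [norm_mul]; gcongr; exact hB' _ _)⟩,
    by rw [hh]; exact (ih x).integral_prod_left⟩
  have key : ∀ x η, ∫ y, ee (-(y * η)) * h (x, y) = op (F η) (fun x t => if b⁻¹ ≤ |t| ∧ |t| < b then ee (-(η * u x) * s t) / t else 0) x := fun x η => by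
    simp only [hh, ← integral_const_mul]
    rw [integral_integral_swap ((ih x).bdd_mul (c := 1) (f := fun p : ℝ × ℝ => ee (-(p.1 * η))) (by fun_prop) (ae_of_all _ fun p => (norm_ee _).le))]
    refine integral_congr_ae (ae_of_all _ fun t => ?_)
    beta_reduce
    rw [← integral_add_right_eq_self _ (u x * s t)]
    have : ∀ y, ee (-((y + u x * s t) * η)) * (f (x - t, y + u x * s t - u x * s t) * K t) = ee (-(y * η)) * f (x - t, y) * (ee (-(η * u x) * s t) * K t) := fun y => by
      rw [show -((y + u x * s t) * η) = -(y * η) + -(η * u x) * s t by ring, ee_add, add_sub_cancel_right]; ring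
    simp_rw [this]
    rw [integral_mul_const]
    simp only [hF, hK, mul_ite, mul_zero, div_eq_mul_inv]
  refine ⟨mh, ?_⟩
  calc ∫⁻ x, ‖h x‖ₑ ^ 2 = ∫⁻ x, ∫⁻ y, ‖h (x, y)‖ₑ ^ 2 := lintegral_prod _ (by fun_prop)
    _ = ∫⁻ x, ∫⁻ η, ‖∫ y, ee (-(y * η)) * h (x, y)‖ₑ ^ 2 := by simp_rw [fun x => planch (nh x)]
    _ = ∫⁻ η, ∫⁻ x, ‖∫ y, ee (-(y * η)) * h (x, y)‖ₑ ^ 2 := lintegral_lintegral_swap (by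
        have := mi (g := fun p : (ℝ × ℝ) × ℝ => ee (-(p.2 * p.1.2)) * h (p.1.1, p.2)) (by fun_prop)
        exact (this.enorm.pow_const 2).aemeasurable)
    _ ≤ ∫⁻ η, C ^ 2 * ∫⁻ x, ‖F η x‖ₑ ^ 2 := by
        refine lintegral_mono fun η => ?_
        simp_rw [key]
        exact (l2iff _ _ _).1 (H _ (by fun_prop) _ (nF η))
    _ = C ^ 2 * ∫⁻ η, ∫⁻ x, ‖F η x‖ₑ ^ 2 := lintegral_const_mul'' _ ((mF.comp measurable_swap).enorm.pow_const 2).lintegral_prod_right'.aemeasurable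
    _ = C ^ 2 * ∫⁻ x, ∫⁻ η, ‖F η x‖ₑ ^ 2 := by rw [lintegral_lintegral_swap ((mF.comp measurable_swap).enorm.pow_const 2).aemeasurable]
    _ = C ^ 2 * ∫⁻ x, ∫⁻ y, ‖f (x, y)‖ₑ ^ 2 := by simp_rw [hF, fun x => planch (nf x)]
    _ = C ^ 2 * ∫⁻ x, ‖f x‖ₑ ^ 2 := by rw [show ∫⁻ x, ‖f x‖ₑ ^ 2 = ∫⁻ x, ∫⁻ y, ‖f (x, y)‖ₑ ^ 2 from lintegral_prod _ (by fun_prop)]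
end

section
open MeasureTheory Filter Set
open scoped ENNReal Topology

theorem stmt_6 (ε : ℝ) (hε : ε ≠ 0) :
    ∃ C : ℝ, 0 < C ∧ ∀ u : ℝ → ℝ, Measurable u → ∀ f : SchwartzMap (ℝ × ℝ) ℂ,
      ∀ g : ℝ × ℝ → ℂ,
        (∀ᵐ x : ℝ × ℝ ∂volume,
          Filter.Tendsto
            (fun p : ℝ × ℝ => ∫ t in {t : ℝ | p.1 ≤ |t| ∧ |t| ≤ p.2},
              f (x.1 - t, x.2 - u x.1 * (Real.sign t * |t| ^ ε)) / (t : ℂ))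
            ((nhdsWithin (0 : ℝ) (Set.Ioi 0)) ×ˢ Filter.atTop) (nhds (g x))) →
        eLpNorm g 2 volume ≤ ENNReal.ofReal C * eLpNorm (fun x => f x) 2 volume := by
  obtain ⟨C, hC, H⟩ := main1 hε
  refine ⟨C.toReal + 1, by positivity, fun u hu f g hg => ?_⟩
  have ms : Measurable Real.sign :=
    Measurable.ite measurableSet_Iio measurable_const (Measurable.ite measurableSet_Ioi measurable_const measurable_const)
  have ht : Tendsto (fun n : ℕ => (2:ℝ) ^ (6 * n)) atTop atTop := by
    simp_rw [pow_mul]; exact tendsto_pow_atTop_atTop_of_one_lt (by norm_num)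
  have tp : Tendsto (fun n : ℕ => (((2:ℝ) ^ (6 * n))⁻¹, (2:ℝ) ^ (6 * n))) atTop (nhdsWithin (0 : ℝ) (Set.Ioi 0) ×ˢ atTop) :=
    (tendsto_inv_atTop_nhdsGT_zero.comp ht).prodMk ht
  have R := fun n => red (b := 2 ^ (6 * n)) (by positivity) (s := fun t => Real.sign t * |t| ^ ε) (by fun_prop) (H n) hu f
  refine ((l2iff _ _ _).2 (fatou2 (fun n => (R n).1.aemeasurable) ?_ fun n => (R n).2)).trans (mul_le_mul_left ?_ _)
  · filter_upwards [hg] with x hx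
    refine (hx.comp tp).congr fun n => ?_
    have m : MeasurableSet {t : ℝ | ((2:ℝ) ^ (6 * n))⁻¹ ≤ |t| ∧ |t| ≤ 2 ^ (6 * n)} :=
      (measurableSet_le measurable_const measurable_id.abs).inter (measurableSet_le measurable_id.abs measurable_const)
    dsimp only [Function.comp]
    rw [← integral_indicator m]
    refine integral_congr_ae ?_
    filter_upwards [compl_mem_ae_iff.2 (measure_singleton ((2:ℝ) ^ (6 * n))), compl_mem_ae_iff.2 (measure_singleton (-(2:ℝ) ^ (6 * n)))] with t h1 h2
    have h3 : |t| ≠ 2 ^ (6 * n) := fun h => by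
      rcases (abs_eq (by positivity)).1 h with h | h
      exacts [h1 h, h2 h]
    simp only [indicator_apply, mem_setOf_eq, le_iff_lt_or_eq (b := (2:ℝ) ^ (6 * n)), h3, or_false, mul_ite, mul_zero, div_eq_mul_inv]
  · rw [ENNReal.le_ofReal_iff_toReal_le hC (by positivity)]; linarith
end
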